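/- Let f(X) = aX² + bX + c be a quadratic polynomial with integer coefficients, a ≠ 0, and negative discriminant b² − 4ac < 0 (so f has no real roots), and let h be a nonzero integer. Then ∑_{p ≤ x, p prime} ∑_{0 ≤ ν < p, p ∣ f(ν)} e(hν/p) = o(π(x)) as x → ∞; that is, for every ε > 0 there is x₀ such that for all x ≥ x₀, |∑_{p ≤ x} ∑_{0 ≤ ν < p, p ∣ f(ν)} e(hν/p)| ≤ ε · π(x). -/

import Mathlib

namespace QuadRoots

open Polynomial Finset

section Stepanov

lemma exists_linear_relation {K : Type*} [Field K] {N D : ℕ} (h : Fin N → K[X])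
    (hdeg : ∀ e, (h e).natDegree < D) (hD : D < N) :
    ∃ d : Fin N → K, d ≠ 0 ∧ ∑ e, C (d e) * h e = 0 := by
  let L : (Fin N → K) →ₗ[K] (Fin D → K) :=
    { toFun := fun d t => (∑ e, C (d e) * h e).coeff t
      map_add' := by
        intro x y; ext t
        simp [add_mul, Finset.sum_add_distrib, finsetSum_coeff]
      map_smul' := by
        intro c x; ext t
        simp [finsetSum_coeff, Finset.mul_sum, mul_assoc] }
  have hk : L.ker ≠ ⊥ := LinearMap.ker_ne_bot_of_finrank_lt (by simpa using hD)
  obtain ⟨d, hd, hd0⟩ := Submodule.exists_mem_ne_zero_of_ne_bot hk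
  refine ⟨d, hd0, ?_⟩
  ext t
  by_cases ht : t < D
  · have := congrFun (LinearMap.mem_ker.1 hd) ⟨t, ht⟩
    simpa [L] using this
  · rw [finsetSum_coeff, coeff_zero]
    refine Finset.sum_eq_zero fun e _ => ?_
    rw [coeff_C_mul, coeff_eq_zero_of_natDegree_lt, mul_zero]
    exact (hdeg e).trans_le (not_lt.1 ht)

lemma sum_ne_zero_of_natDegree {K : Type*} [Field K] {N D : ℕ} (g : Fin N → K[X])
    (hg : ∀ e, g e ≠ 0) (hdeg : ∀ e, (g e).natDegree = e + D) (c : Fin N → K) (hc : c ≠ 0) :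
    ∑ e, C (c e) * g e ≠ 0 := by
  intro h0
  have hd := degree_sum_eq_of_disjoint (fun e => C (c e) * g e) Finset.univ (by
    rintro e ⟨-, he⟩ e' ⟨-, he'⟩ hne h
    have h1 : c e ≠ 0 := fun h => he (by simp [h])
    have h2 : c e' ≠ 0 := fun h => he' (by simp [h])
    simp only [Function.comp, degree_mul, degree_C h1, degree_C h2, zero_add] at h
    have := natDegree_eq_of_degree_eq h
    rw [hdeg, hdeg] at this
    exact hne (Fin.ext (by omega)))
  rw [h0, degree_zero] at hd
  apply hc
  ext e
  by_contra hce
  have : (C (c e) * g e).degree ≤ ⊥ := by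
    rw [hd]; exact Finset.le_sup (f := fun e => (C (c e) * g e).degree) (Finset.mem_univ e)
  rw [le_bot_iff, degree_eq_bot] at this
  exact (mul_ne_zero (C_ne_zero.2 hce) (hg e)) this

/-- The Laurent polynomial `∑ (α x ^ p ^ i + β x⁻¹ ^ p ^ i)`. -/
def halfTrace {K : Type*} [Field K] (p n : ℕ) (α β x : K) : K :=
  ∑ i ∈ range (n + 1), (α * x ^ p ^ i + β * x⁻¹ ^ p ^ i)

/-- `halfTrace` with denominators cleared. -/
noncomputable def halfTracePoly {K : Type*} [Field K] (p n : ℕ) (α β : K) : K[X] :=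
  ∑ i ∈ range (n + 1), (C α * X ^ (p ^ n + p ^ i) + C β * X ^ (p ^ n - p ^ i))

lemma eval_halfTracePoly {K : Type*} [Field K] {p n : ℕ} (hp : 0 < p) (α β x : K) (hx : x ≠ 0) :
    (halfTracePoly p n α β).eval x = x ^ p ^ n * halfTrace p n α β x := by
  simp only [halfTracePoly, halfTrace, eval_finsetSum, Finset.mul_sum]
  refine Finset.sum_congr rfl fun i hi => ?_
  have hi' : p ^ i ≤ p ^ n := Nat.pow_le_pow_right hp (by simpa [Nat.lt_succ_iff] using hi)
  simp only [eval_add, eval_mul, eval_C, eval_pow, eval_X, pow_add, pow_sub₀ x hx hi', inv_pow]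
  ring

lemma natDegree_halfTracePoly {K : Type*} [Field K] {p n : ℕ} (hp : 1 < p) (α β : K)
    (hα : α ≠ 0) : (halfTracePoly p n α β).natDegree = 2 * p ^ n := by
  rw [halfTracePoly, Finset.sum_range_succ, Nat.sub_self, pow_zero, mul_one, ← add_assoc]
  have hpos : 0 < p ^ n := by positivity
  rw [natDegree_add_C, natDegree_add_eq_right_of_natDegree_lt]
  · rw [natDegree_C_mul_X_pow _ _ hα]; ring
  · rw [natDegree_C_mul_X_pow _ _ hα]
    refine lt_of_le_of_lt (natDegree_sum_le_of_forall_le (n := p ^ n + p ^ n - 1) _ _ ?_) (by omega)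
    intro i hi
    have hi' : p ^ i < p ^ n := Nat.pow_lt_pow_right hp (by simpa using hi)
    refine (natDegree_add_le _ _).trans (max_le ?_ ?_)
    · exact (natDegree_C_mul_X_pow_le _ _).trans (by omega)
    · exact (natDegree_C_mul_X_pow_le _ _).trans (by omega)

lemma card_halfTrace_le {K : Type*} [Field K] [Finite K] (p n : ℕ) [Fact p.Prime] [CharP K p]
    (hK : Nat.card K = (p ^ (n + 1)) ^ 2) (α β s : K) (hα : α ≠ 0) (T : Finset K)
    (hT : ∀ x ∈ T, x ≠ 0 ∧
      halfTrace p n α β x + (halfTrace p n α β x) ^ p ^ (n + 1) = s) :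
    T.card ≤ p ^ (n + 1) * (p ^ n + 4) := by
  have hp : p.Prime := Fact.out
  have hp1 := hp.one_lt
  obtain ⟨M, hM⟩ : ∃ M, M = p ^ n := ⟨_, rfl⟩
  obtain ⟨Q, hQ⟩ : ∃ Q, Q = p ^ (n + 1) := ⟨_, rfl⟩
  have hQM : Q = M * p := by rw [hQ, hM, pow_succ]
  have hM0 : 0 < M := by rw [hM]; positivity
  have hQ2 : 2 ≤ Q := by rw [hQM]; nlinarith
  set R := halfTracePoly p n α β with hR
  have hRdeg : R.natDegree = 2 * M := by rw [hM]; exact natDegree_halfTracePoly hp1 α β hα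
  have hR0 : R ≠ 0 := by intro h; rw [h, natDegree_zero] at hRdeg; omega
  let N := Q * (M + 3)
  let I : Fin N → ℕ := fun e => (e : ℕ) % M
  let J : Fin N → ℕ := fun e => ((e : ℕ) / M) % p
  let k : Fin N → ℕ := fun e => (e : ℕ) / M / p
  have hJ : ∀ e, J e + 1 ≤ p := fun e => Nat.mod_lt _ hp.pos
  have hI : ∀ e, I e + 1 ≤ M := fun e => Nat.mod_lt _ hM0
  have hk : ∀ e, k e + 1 ≤ M + 3 := fun e => by
    change (e : ℕ) / M / p < M + 3
    rw [Nat.div_div_eq_div_mul, ← hQM]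
    exact Nat.div_lt_of_lt_mul e.2
  have hIJk : ∀ e : Fin N, (e : ℕ) = I e + M * J e + Q * k e := fun e => by
    have h1 := Nat.mod_add_div (e : ℕ) M
    have h2 := Nat.mod_add_div ((e : ℕ) / M) p
    change (e : ℕ) = (e : ℕ) % M + M * (((e : ℕ) / M) % p) + Q * ((e : ℕ) / M / p)
    rw [hQM]
    conv_lhs => rw [← h1, ← h2]
    ring
  let g : Fin N → K[X] := fun e => X ^ (I e + Q * k e + M * (p - 1 - J e)) * R ^ J e
  let h : Fin N → K[X] := fun e =>
    X ^ (Q * I e + k e + M * (p - 1 - J e)) * (C s * X ^ M - R) ^ J e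
  have hg0 : ∀ e, g e ≠ 0 := fun e => mul_ne_zero (pow_ne_zero _ X_ne_zero) (pow_ne_zero _ hR0)
  have hgdeg : ∀ e, (g e).natDegree = e + M * (p - 1) := fun e => by
    change (X ^ (I e + Q * k e + M * (p - 1 - J e)) * R ^ J e).natDegree = e + M * (p - 1)
    rw [natDegree_mul (pow_ne_zero _ X_ne_zero) (pow_ne_zero _ hR0), natDegree_X_pow,
      natDegree_pow, hRdeg, hIJk e]
    have : p - 1 = (p - 1 - J e) + J e := by have := hJ e; omega
    conv_rhs => rw [this]
    ring
  have hhdeg : ∀ e, (h e).natDegree < Q * M + Q + 3 := fun e => by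
    have hd : (C s * X ^ M - R).natDegree ≤ 2 * M := by
      refine (natDegree_sub_le _ _).trans (max_le ?_ hRdeg.le)
      exact (natDegree_C_mul_X_pow_le _ _).trans (by omega)
    have h1 : (h e).natDegree ≤ (Q * I e + k e + M * (p - 1 - J e)) + J e * (2 * M) := by
      refine natDegree_mul_le.trans (add_le_add (natDegree_X_pow _).le ?_)
      exact natDegree_pow_le.trans (Nat.mul_le_mul_left _ hd)
    obtain ⟨j', hj'⟩ : ∃ j', p = J e + 1 + j' := ⟨p - (J e + 1), by have := hJ e; omega⟩
    have hj2 : p - 1 - J e = j' := by omega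
    rw [hj2] at h1
    obtain ⟨i', hi'⟩ : ∃ i', M = I e + 1 + i' := ⟨M - (I e + 1), by have := hI e; omega⟩
    have h3 := hk e
    have : Q * M = Q * I e + Q + Q * i' := by conv_lhs => rw [hi']
                                              ring
    have h4 : Q = M * J e + M + M * j' := by conv_lhs => rw [hQM, hj']
                                             ring
    have h5 : J e * (2 * M) = 2 * (M * J e) := by ring
    nlinarith [Nat.zero_le (Q * i'), Nat.zero_le (M * j')]
  have hDN : Q * M + Q + 3 < N := by
    change Q * M + Q + 3 < Q * (M + 3)
    nlinarith
  obtain ⟨d, hd0, hd⟩ := exists_linear_relation h hhdeg hDN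
  have : Fintype K := Fintype.ofFinite K
  have hfrob : ∀ y : K, y ^ (Q ^ 2) = y := fun y => by
    have := FiniteField.pow_card y
    rw [← Nat.card_eq_fintype_card, hK, ← hQ] at this
    exact this
  let c : Fin N → K := fun e => d e ^ Q
  have hcQ : ∀ e, c e ^ Q = d e := fun e => by
    change (d e ^ Q) ^ Q = d e
    rw [← pow_mul, ← sq, hfrob]
  have hc0 : c ≠ 0 := by
    intro hc
    apply hd0
    ext e
    have : c e = 0 := congrFun hc e
    rw [← hcQ e, this]
    simp; omega
  have hG := sum_ne_zero_of_natDegree g hg0 hgdeg c hc0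
  set G := ∑ e, C (c e) * g e with hGdef
  have hGdeg : G.natDegree ≤ Q * (M + 4) := by
    refine natDegree_sum_le_of_forall_le _ _ fun e _ => ?_
    refine (natDegree_C_mul_le _ _).trans ?_
    rw [hgdeg]
    have h1 : (e : ℕ) ≤ Q * (M + 3) := e.2.le
    have h2 : M * (p - 1) ≤ Q := by rw [hQM]; exact Nat.mul_le_mul_left _ (Nat.sub_le _ _)
    nlinarith
  have hroot : ∀ x ∈ T, G.IsRoot x := by
    intro x hxT
    obtain ⟨hx, hxs⟩ := hT x hxT
    rw [← hQ] at hxs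
    set r := halfTrace p n α β x with hr
    have hRx : R.eval x = x ^ M * r := by rw [hR, hM]; exact eval_halfTracePoly hp.pos α β x hx
    have hGx : G.eval x = x ^ (M * (p - 1)) * ∑ e, c e * x ^ (I e + Q * k e) * r ^ J e := by
      rw [hGdef, eval_finsetSum, Finset.mul_sum]
      refine Finset.sum_congr rfl fun e _ => ?_
      change eval x (C (c e) * (X ^ (I e + Q * k e + M * (p - 1 - J e)) * R ^ J e)) = _
      have : p - 1 = (p - 1 - J e) + J e := by have := hJ e; omega
      conv_rhs => rw [this]
      simp only [eval_mul, eval_C, eval_pow, eval_X, hRx, pow_add, mul_add, mul_pow, ← pow_mul]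
      ring
    have hsum : (∑ e, c e * x ^ (I e + Q * k e) * r ^ J e) ^ Q = 0 := by
      have hxM : x ^ (M * (p - 1)) ≠ 0 := pow_ne_zero _ hx
      rw [hQ, sum_pow_char_pow, ← hQ]
      refine (mul_eq_zero.1 ?_).resolve_left hxM
      have h0 : eval x (∑ e, C (d e) * h e) = 0 := by rw [hd, eval_zero]
      rw [← h0, eval_finsetSum, Finset.mul_sum]
      refine Finset.sum_congr rfl fun e _ => ?_
      change _ = eval x (C (d e) *
        (X ^ (Q * I e + k e + M * (p - 1 - J e)) * (C s * X ^ M - R) ^ J e))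
      have hrs : r ^ Q = s - r := by rw [← hxs]; ring
      have : p - 1 = (p - 1 - J e) + J e := by have := hJ e; omega
      conv_lhs => rw [this]
      simp only [eval_mul, eval_C, eval_pow, eval_X, eval_sub, hRx]
      rw [mul_pow, mul_pow, hcQ, ← pow_mul r, mul_comm (J e) Q, pow_mul r, hrs, ← pow_mul x,
        show (I e + Q * k e) * Q = Q * I e + Q ^ 2 * k e by ring, pow_add x (Q * I e),
        pow_mul x (Q ^ 2), hfrob, show s * x ^ M - x ^ M * r = x ^ M * (s - r) by ring, mul_pow,
        ← pow_mul x M, mul_add, pow_add, pow_add, pow_add]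
      ring
    rw [IsRoot, hGx, pow_eq_zero_iff (by omega) |>.1 hsum, mul_zero]
  have := Polynomial.card_le_degree_of_subset_roots (p := G) (Z := T) (by
    intro x hx
    rw [mem_roots hG]
    exact hroot x hx)
  rw [← hQ, ← hM]
  exact this.trans hGdeg

end Stepanov

end QuadRoots

namespace QuadRoots

open Polynomial Finset

section KloostermanField

variable {p : ℕ} [Fact p.Prime]

/-- The Kloosterman sum over a finite extension `K` of `ZMod p`. -/
noncomputable def fieldSum (K : Type*) [Field K] [Fintype K] [DecidableEq K] [Algebra (ZMod p) K]
    (ψ : AddChar (ZMod p) ℂ) (α β : ZMod p) : ℂ :=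
  ∑ x ∈ (univ : Finset K).filter (· ≠ 0), ψ (Algebra.trace (ZMod p) K (α • x + β • x⁻¹))

lemma norm_addChar_zmod (ψ : AddChar (ZMod p) ℂ) (s : ZMod p) : ‖ψ s‖ = 1 := by
  exact AddChar.norm_apply ψ s

lemma algebraMap_trace_eq_halfTrace {K : Type*} [Field K] [Finite K] [Algebra (ZMod p) K] {n : ℕ}
    (hK : Nat.card K = (p ^ (n + 1)) ^ 2) (α β : ZMod p) (x : K) :
    algebraMap (ZMod p) K (Algebra.trace (ZMod p) K (α • x + β • x⁻¹)) =
      halfTrace p n (algebraMap _ K α) (algebraMap _ K β) x +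
        (halfTrace p n (algebraMap _ K α) (algebraMap _ K β) x) ^ p ^ (n + 1) := by
  have hp : p.Prime := Fact.out
  have : CharP K p := charP_of_injective_algebraMap (algebraMap (ZMod p) K).injective p
  have hrank : Module.finrank (ZMod p) K = (n + 1) + (n + 1) := by
    have := Module.natCard_eq_pow_finrank (K := ZMod p) (V := K)
    rw [hK, Nat.card_eq_fintype_card, ZMod.card, ← pow_mul] at this
    have := Nat.pow_right_injective hp.two_le this
    omega
  have hfix : ∀ (a : ZMod p) i, (algebraMap (ZMod p) K a) ^ p ^ i = algebraMap (ZMod p) K a := by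
    intro a i
    rw [← map_pow, ZMod.pow_card_pow]
  have key : ∀ i, (α • x + β • x⁻¹) ^ p ^ i =
      algebraMap (ZMod p) K α * x ^ p ^ i + algebraMap (ZMod p) K β * x⁻¹ ^ p ^ i := by
    intro i
    rw [add_pow_char_pow, Algebra.smul_def, Algebra.smul_def, mul_pow, mul_pow, hfix, hfix]
  rw [FiniteField.algebraMap_trace_eq_sum_pow, hrank, Nat.card_eq_fintype_card, ZMod.card,
    Finset.sum_range_add, halfTrace, sum_pow_char_pow]
  congr 1
  · exact Finset.sum_congr rfl fun i _ => key i
  · refine Finset.sum_congr rfl fun i _ => ?_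
    rw [key, add_pow_char_pow, mul_pow, mul_pow, hfix, hfix, ← pow_mul, ← pow_mul, ← pow_add,
      add_comm i]

lemma norm_fieldSum_le {K : Type*} [Field K] [Fintype K] [DecidableEq K] [Algebra (ZMod p) K]
    {n : ℕ} (hK : Nat.card K = (p ^ (n + 1)) ^ 2) (ψ : AddChar (ZMod p) ℂ) (hψ : ψ ≠ 1)
    (α β : ZMod p) (hα : α ≠ 0) : ‖fieldSum K ψ α β‖ ≤ 5 * p * p ^ (n + 1) := by
  have hp : p.Prime := Fact.out
  have : CharP K p := charP_of_injective_algebraMap (algebraMap (ZMod p) K).injective p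
  let f : K → ZMod p := fun x => Algebra.trace (ZMod p) K (α • x + β • x⁻¹)
  let S := (univ : Finset K).filter (· ≠ 0)
  let B : ℕ := p ^ (n + 1) * (p ^ n + 4)
  let T : ZMod p → Finset K := fun s => S.filter (f · = s)
  have hT : ∀ s, (T s).card ≤ B := fun s => by
    refine card_halfTrace_le p n hK (algebraMap _ K α) (algebraMap _ K β) (algebraMap _ K s)
      (by simpa using hα) _ fun x hx => ?_
    simp only [T, S, mem_filter, mem_univ, true_and] at hx
    exact ⟨hx.1, by rw [← algebraMap_trace_eq_halfTrace hK]; exact congrArg _ hx.2⟩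
  have hsum : fieldSum K ψ α β = ∑ s, ((T s).card : ℂ) * ψ s := by
    rw [fieldSum, ← Finset.sum_fiberwise (s := S) (g := f)]
    refine Finset.sum_congr rfl fun s _ => ?_
    rw [Finset.sum_congr rfl (g := fun _ => ψ s), Finset.sum_const, nsmul_eq_mul]
    intro x hx
    rw [← (mem_filter.1 hx).2]
  have hzero : ∑ s, ψ s = 0 := AddChar.sum_eq_zero_of_ne_one hψ
  have hcard : ∑ s, (T s).card = p * p ^ (n + 1) * p ^ n - 1 := by
    rw [← Finset.card_eq_sum_card_fiberwise (f := f) (s := S) (t := univ) (fun _ _ => by simp)]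
    have : S = univ.erase 0 := by ext; simp [S]
    rw [this, Finset.card_erase_of_mem (mem_univ _), Finset.card_univ, ← Nat.card_eq_fintype_card, hK]
    ring_nf
  have hneg : fieldSum K ψ α β = - ∑ s, (((B : ℝ) - (T s).card : ℝ) : ℂ) * ψ s := by
    rw [hsum]
    push_cast
    simp only [sub_mul, Finset.sum_sub_distrib, ← Finset.mul_sum, hzero]
    ring
  rw [hneg, norm_neg]
  refine (norm_sum_le _ _).trans ?_
  have : ∀ s, ‖(((B : ℝ) - (T s).card : ℝ) : ℂ) * ψ s‖ = (B : ℝ) - (T s).card := fun s => by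
    rw [norm_mul, norm_addChar_zmod, mul_one, Complex.norm_real, Real.norm_of_nonneg]
    have := hT s
    rw [sub_nonneg]; exact_mod_cast this
  simp only [this, Finset.sum_sub_distrib]
  rw [← Nat.cast_sum univ fun s => (T s).card, hcard, Nat.cast_sub (Nat.one_le_iff_ne_zero.2 (by have := hp.pos; positivity))]
  simp only [Finset.sum_const, Finset.card_univ, ZMod.card, nsmul_eq_mul, B]
  push_cast
  have h1 : (1 : ℝ) ≤ p * p ^ (n + 1) := by
    have : 1 ≤ p * p ^ (n + 1) := Nat.one_le_iff_ne_zero.2 (by have := hp.pos; positivity)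
    exact_mod_cast this
  nlinarith

end KloostermanField

end QuadRoots

namespace QuadRoots

open Polynomial Finset

section LFunction

variable {p : ℕ} [Fact p.Prime]

/-- Monic polynomials of degree `n` with nonzero constant term. -/
noncomputable def monics (p : ℕ) [Fact p.Prime] (n : ℕ) : Finset (ZMod p)[X] :=
  ((univ : Finset (Fin n → ZMod p)).image
    (fun c => X ^ n + ∑ i : Fin n, C (c i) * X ^ (i : ℕ))).filter (fun g => g.coeff 0 ≠ 0)

lemma mem_monics {n : ℕ} {g : (ZMod p)[X]} :
    g ∈ monics p n ↔ g.Monic ∧ g.natDegree = n ∧ g.coeff 0 ≠ 0 := by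
  simp only [monics, mem_filter, mem_image, mem_univ, true_and]
  constructor
  · rintro ⟨⟨c, rfl⟩, h0⟩
    have hlt : (∑ i : Fin n, C (c i) * X ^ (i : ℕ)).degree < (n : WithBot ℕ) := degree_sum_fin_lt c
    have hm := monic_X_pow_add hlt
    refine ⟨hm, ?_, h0⟩
    rw [natDegree_eq_of_degree_eq (degree_add_eq_left_of_degree_lt
      (by rw [degree_X_pow]; exact hlt)), natDegree_X_pow]
  · rintro ⟨hm, hd, h0⟩
    refine ⟨⟨fun i => g.coeff i, ?_⟩, h0⟩
    conv_rhs => rw [hm.as_sum, hd]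
    rw [Finset.sum_range]

/-- The weight of a monic polynomial whose zeta function is the Kloosterman `L`-function. -/
noncomputable def wt (ψ : AddChar (ZMod p) ℂ) (α β : ZMod p) (g : (ZMod p)[X]) : ℂ :=
  ψ (-(α * g.nextCoeff + β * (g.coeff 1 / g.coeff 0)))

lemma wt_mul (ψ : AddChar (ZMod p) ℂ) (α β : ZMod p) {g h : (ZMod p)[X]} (hg : g.Monic)
    (hh : h.Monic) (hg0 : g.coeff 0 ≠ 0) (hh0 : h.coeff 0 ≠ 0) :
    wt ψ α β (g * h) = wt ψ α β g * wt ψ α β h := by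
  rw [wt, wt, wt, ← AddChar.map_add_eq_mul, hg.nextCoeff_mul hh, mul_coeff_one, mul_coeff_zero]
  congr 1
  field_simp
  ring

lemma wt_one (ψ : AddChar (ZMod p) ℂ) (α β : ZMod p) : wt ψ α β 1 = 1 := by
  simp [wt, coeff_one, nextCoeff]

lemma wt_pow (ψ : AddChar (ZMod p) ℂ) (α β : ZMod p) {g : (ZMod p)[X]} (hg : g.Monic)
    (hg0 : g.coeff 0 ≠ 0) (j : ℕ) :
    wt ψ α β (g ^ j) = wt ψ α β g ^ j := by
  induction j with
  | zero => simp [wt_one]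
  | succ j ih =>
    rw [pow_succ, wt_mul ψ α β (hg.pow j) hg _ hg0, ih, pow_succ]
    rw [coeff_zero_eq_eval_zero, eval_pow, ← coeff_zero_eq_eval_zero]
    exact pow_ne_zero _ hg0

/-- The coefficients of the `L`-function. -/
noncomputable def wtSum (ψ : AddChar (ZMod p) ℂ) (α β : ZMod p) (n : ℕ) : ℂ :=
  ∑ g ∈ monics p n, wt ψ α β g

lemma wtSum_zero (ψ : AddChar (ZMod p) ℂ) (α β : ZMod p) : wtSum ψ α β 0 = 1 := by
  have : monics p 0 = {1} := by
    ext g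
    rw [mem_monics, mem_singleton]
    constructor
    · rintro ⟨h1, h2, -⟩
      exact h1.natDegree_eq_zero.1 h2
    · rintro rfl
      simp
  rw [wtSum, this, sum_singleton, wt_one]

lemma wtSum_of_three_le (ψ : AddChar (ZMod p) ℂ) (hψ : ψ ≠ 1) (α β : ZMod p) (hα : α ≠ 0) {n : ℕ}
    (hn : 3 ≤ n) : wtSum ψ α β n = 0 := by
  obtain ⟨u, hu⟩ : ∃ u, ψ (-(α * u)) ≠ 1 := by
    by_contra! H
    apply hψ
    ext y
    have := H (-(α⁻¹ * y))
    rw [← mul_neg, neg_neg, mul_inv_cancel_left₀ hα] at this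
    simpa using this
  have hmem : ∀ (v : ZMod p) (g : (ZMod p)[X]), g ∈ monics p n →
      g + C v * X ^ (n - 1) ∈ monics p n := by
    intro v g hg
    rw [mem_monics] at hg ⊢
    obtain ⟨h1, h2, h3⟩ := hg
    have hlt : (C v * X ^ (n - 1)).degree < g.degree := by
      rw [degree_eq_natDegree h1.ne_zero, h2]
      exact (degree_C_mul_X_pow_le _ _).trans_lt (by exact_mod_cast (by omega))
    refine ⟨h1.add_of_left hlt, ?_, ?_⟩
    · rw [natDegree_eq_of_degree_eq (degree_add_eq_left_of_degree_lt hlt), h2]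
    · simpa [coeff_X_pow, show (0 : ℕ) ≠ n - 1 by omega] using h3
  have hval : ∀ g ∈ monics p n,
      wt ψ α β (g + C u * X ^ (n - 1)) = ψ (-(α * u)) * wt ψ α β g := by
    intro g hg
    have hg' := mem_monics.1 (hmem u g hg)
    rw [mem_monics] at hg
    rw [wt, wt, ← AddChar.map_add_eq_mul, nextCoeff_of_natDegree_pos (by omega),
      nextCoeff_of_natDegree_pos (by omega), hg.2.1, hg'.2.1]
    simp only [coeff_add, coeff_C_mul, coeff_X_pow, show (0 : ℕ) ≠ n - 1 by omega,
      show (1 : ℕ) ≠ n - 1 by omega, if_true, if_false]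
    congr 1
    ring
  have hS : wtSum ψ α β n = ψ (-(α * u)) * wtSum ψ α β n := by
    conv_rhs => rw [wtSum, Finset.mul_sum, ← Finset.sum_congr rfl hval]
    rw [wtSum]
    symm
    refine Finset.sum_bij' (fun g _ => g + C u * X ^ (n - 1)) (fun g _ => g + C (-u) * X ^ (n - 1))
      (fun g hg => hmem u g hg) (fun g hg => hmem (-u) g hg) ?_ ?_ (fun _ _ => rfl)
    · intro g _; simp
    · intro g _; simp
  have : (1 - ψ (-(α * u))) * wtSum ψ α β n = 0 := by linear_combination hS
  exact (mul_eq_zero.1 this).resolve_left (sub_ne_zero.2 hu.symm)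

lemma wtSum_two (ψ : AddChar (ZMod p) ℂ) (hψ : ψ ≠ 1) (α β : ZMod p) (hα : α ≠ 0) (hβ : β ≠ 0) :
    wtSum ψ α β 2 = p := by
  have hdeg : ∀ u v : ZMod p, (X ^ 2 + C u * X + C v : (ZMod p)[X]).Monic ∧
      (X ^ 2 + C u * X + C v : (ZMod p)[X]).natDegree = 2 := fun u v => by
    have : (X ^ 2 + C u * X + C v : (ZMod p)[X]) = C 1 * X ^ 2 + C u * X + C v := by simp
    rw [this]
    exact ⟨leadingCoeff_quadratic one_ne_zero, natDegree_quadratic one_ne_zero⟩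
  have h1 : wtSum ψ α β 2 = ∑ x ∈ (univ : Finset (ZMod p)).filter (· ≠ 0) ×ˢ
      (univ : Finset (ZMod p)), ψ (x.2 * (-(α + β / x.1))) := by
    rw [wtSum]
    refine Finset.sum_bij' (fun g _ => (g.coeff 0, g.coeff 1))
      (fun x _ => X ^ 2 + C x.2 * X + C x.1) ?_ ?_ ?_ ?_ ?_
    · intro g hg
      have := (mem_monics.1 hg).2.2
      simpa using this
    · intro x hx
      rw [mem_monics]
      refine ⟨(hdeg _ _).1, (hdeg _ _).2, ?_⟩
      simpa using hx
    · intro g hg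
      obtain ⟨h1, h2, -⟩ := mem_monics.1 hg
      conv_rhs => rw [h1.as_sum, h2]
      simp [Finset.sum_range_succ]; ring
    · intro x hx
      ext <;> simp [coeff_X]
    · intro g hg
      obtain ⟨h1, h2, h3⟩ := mem_monics.1 hg
      rw [wt, nextCoeff_of_natDegree_pos (by omega), h2]
      congr 1
      simp only [show 2 - 1 = 1 from rfl]
      field_simp
  have h2 : ∀ w : ZMod p, ∑ u : ZMod p, ψ (u * w) = if w = 0 then (p : ℂ) else 0 := by
    intro w
    split_ifs with hw
    · simp [hw, ZMod.card]
    · have hbij : Function.Bijective (fun u : ZMod p => u * w) := mulRight_bijective₀ w hw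
      rw [hbij.sum_comp (fun u => ψ u)]
      exact AddChar.sum_eq_zero_of_ne_one hψ
  rw [h1, Finset.sum_product]
  simp only [h2]
  rw [Finset.sum_eq_single (-β / α)]
  · rw [if_pos]
    field_simp
    ring
  · intro v hv hne
    rw [mem_filter] at hv
    rw [if_neg]
    intro h
    apply hne
    have := hv.2
    field_simp at h
    field_simp
    linear_combination -h
  · intro h
    exfalso
    apply h
    simp [hα, hβ]

end LFunction

end QuadRoots

namespace QuadRoots

open Polynomial Finset

section Trace

variable {p : ℕ} [Fact p.Prime]

lemma minpoly_inv_eq {F K : Type*} [Field F] [Field K] [Algebra F K] [FiniteDimensional F K] {x : K}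
    (hx : x ≠ 0) :
    minpoly F x⁻¹ = (minpoly F x).reverse * C ((minpoly F x).coeff 0)⁻¹ := by
  have hInt : IsIntegral F x := .of_finite F x
  have hInt' : IsIntegral F x⁻¹ := .of_finite F _
  set P := minpoly F x with hP
  have hP0 : P.coeff 0 ≠ 0 := minpoly.coeff_zero_ne_zero hInt hx
  have htr : P.natTrailingDegree = 0 := natTrailingDegree_eq_zero.2 (Or.inr hP0)
  have hlead : P.reverse.leadingCoeff = P.coeff 0 := by
    rw [reverse_leadingCoeff, trailingCoeff, htr]
  have hm : (P.reverse * C (P.coeff 0)⁻¹).Monic := by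
    rw [Monic, leadingCoeff_mul, leadingCoeff_C, hlead, mul_inv_cancel₀ hP0]
  have heq : IntermediateField.adjoin F {x⁻¹} = IntermediateField.adjoin F {x} := by
    apply le_antisymm
    · rw [IntermediateField.adjoin_simple_le_iff]
      exact inv_mem (IntermediateField.mem_adjoin_simple_self F x)
    · rw [IntermediateField.adjoin_simple_le_iff]
      have := inv_mem (IntermediateField.mem_adjoin_simple_self F x⁻¹)
      rwa [inv_inv] at this
  symm
  refine minpoly.unique_of_degree_le_degree_minpoly F _ hm ?_ ?_
  · have : Invertible x := invertibleOfNonzero hx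
    have h1 := (eval₂_reverse_eq_zero_iff (algebraMap F K) x P).2 (minpoly.aeval F x)
    rw [invOf_eq_inv] at h1
    rw [map_mul, aeval_def, h1, zero_mul]
  · rw [degree_eq_natDegree hm.ne_zero, degree_eq_natDegree (minpoly.ne_zero hInt')]
    rw [← IntermediateField.adjoin.finrank hInt', heq, IntermediateField.adjoin.finrank hInt,
      natDegree_mul_C (inv_ne_zero hP0), reverse_natDegree, ← hP]
    exact_mod_cast Nat.sub_le _ _

lemma trace_smul_add_smul_inv {K : Type*} [Field K] [Algebra (ZMod p) K]
    [FiniteDimensional (ZMod p) K] {x : K} (hx : x ≠ 0) (α β : ZMod p) :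
    Algebra.trace (ZMod p) K (α • x + β • x⁻¹) =
      (Module.finrank (ZMod p) K / (minpoly (ZMod p) x).natDegree) •
        (-(α * (minpoly (ZMod p) x).nextCoeff +
          β * ((minpoly (ZMod p) x).coeff 1 / (minpoly (ZMod p) x).coeff 0))) := by
  have hInt : IsIntegral (ZMod p) x := .of_finite (ZMod p) x
  have hInt' : IsIntegral (ZMod p) x⁻¹ := .of_finite (ZMod p) _
  have key : ∀ y : K, Algebra.trace (ZMod p) K y =
      ((Module.finrank (ZMod p) K / (minpoly (ZMod p) y).natDegree : ℕ) : ZMod p) *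
        -(minpoly (ZMod p) y).nextCoeff := fun y => by
    have hy : IsIntegral (ZMod p) y := .of_finite (ZMod p) y
    rw [trace_eq_finrank_mul_minpoly_nextCoeff, ← IntermediateField.adjoin.finrank hy]
    congr 2
    rw [← Module.finrank_mul_finrank (ZMod p) (IntermediateField.adjoin (ZMod p) {y}) K,
      Nat.mul_div_cancel_left _ Module.finrank_pos]
  set P := minpoly (ZMod p) x with hP
  have hP0 : P.coeff 0 ≠ 0 := minpoly.coeff_zero_ne_zero hInt hx
  have hpos : 0 < P.natDegree := minpoly.natDegree_pos hInt
  have htr : P.natTrailingDegree = 0 := natTrailingDegree_eq_zero.2 (Or.inr hP0)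
  have hdeg : (minpoly (ZMod p) x⁻¹).natDegree = P.natDegree := by
    rw [minpoly_inv_eq hx, natDegree_mul_C (inv_ne_zero hP0), reverse_natDegree, ← hP, htr,
      Nat.sub_zero]
  have hnext : (minpoly (ZMod p) x⁻¹).nextCoeff = P.coeff 1 / P.coeff 0 := by
    rw [nextCoeff_of_natDegree_pos (by omega), hdeg, minpoly_inv_eq hx, coeff_mul_C, ← hP,
      coeff_reverse, revAt_le (Nat.sub_le _ _), div_eq_mul_inv]
    congr 2
    omega
  rw [map_add, map_smul, map_smul, key x, key x⁻¹, hdeg, hnext, ← hP, nsmul_eq_mul, smul_eq_mul,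
    smul_eq_mul]
  ring

/-- Monic irreducible polynomials of degree `d` other than `X`. -/
noncomputable def irreds (p : ℕ) [Fact p.Prime] (d : ℕ) : Finset (ZMod p)[X] :=
  open Classical in (monics p d).filter Irreducible

lemma mem_irreds {d : ℕ} {g : (ZMod p)[X]} : g ∈ irreds p d ↔ g ∈ monics p d ∧ Irreducible g := by
  simp [irreds]

lemma card_roots_irred {K : Type*} [Field K] [Fintype K] [DecidableEq K] [Algebra (ZMod p) K]
    {d k : ℕ} (hk0 : k ≠ 0)
    (hk : Module.finrank (ZMod p) K = k) (hd : d ∣ k) {P : (ZMod p)[X]} (hP : P ∈ irreds p d) :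
    (((univ : Finset K).filter (· ≠ 0)).filter (fun x => minpoly (ZMod p) x = P)).card = d := by
  classical
  obtain ⟨hP1, hirr⟩ := mem_irreds.1 hP
  obtain ⟨hm, hdeg, h0⟩ := mem_monics.1 hP1
  have hcard : Fintype.card K = p ^ k := by
    have := Module.natCard_eq_pow_finrank (K := ZMod p) (V := K)
    rwa [Nat.card_eq_fintype_card, Nat.card_eq_fintype_card, ZMod.card, hk] at this
  have hdvd : P ∣ X ^ Fintype.card K - X := by
    have := (hirr.natDegree_dvd_iff_dvd_X_pow_card_pow_sub_X (n := k)).1 (by rwa [hdeg])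
    rwa [Nat.card_eq_fintype_card, ZMod.card, ← hcard] at this
  have hsplit : (P.map (algebraMap (ZMod p) K)).Splits := by
    refine Splits.of_dvd (IsSplittingField.splits K (X ^ Fintype.card K - X : (ZMod p)[X])) ?_
      (map_dvd (mapRingHom (algebraMap (ZMod p) K)) hdvd)
    exact Polynomial.map_ne_zero (FiniteField.X_pow_card_sub_X_ne_zero _ (by
      rw [hcard]; exact Nat.one_lt_pow hk0 (Fact.out : p.Prime).one_lt))
  have hsep : P.Separable := PerfectField.separable_of_irreducible hirr
  rw [← hdeg, ← card_rootSet_eq_natDegree hsep hsplit, ← Set.toFinset_card]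
  congr 1
  ext x
  simp only [mem_filter, mem_univ, true_and, Set.mem_toFinset, mem_rootSet, ne_eq, hm.ne_zero,
    not_false_eq_true]
  constructor
  · rintro ⟨-, rfl⟩
    exact minpoly.aeval _ _
  · intro h
    refine ⟨?_, (minpoly.eq_of_irreducible_of_monic hirr h hm).symm⟩
    rintro rfl
    apply h0
    rw [aeval_def, eval₂_at_zero] at h
    simpa using h

lemma fieldSum_eq_sum_irreds {K : Type*} [Field K] [Fintype K] [DecidableEq K] [Algebra (ZMod p) K]
    {k : ℕ} (hk0 : k ≠ 0) (hk : Module.finrank (ZMod p) K = k) (ψ : AddChar (ZMod p) ℂ)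
    (α β : ZMod p) :
    fieldSum K ψ α β = ∑ d ∈ k.divisors, ∑ P ∈ irreds p d, (d : ℂ) * wt ψ α β P ^ (k / d) := by
  classical
  have hmaps : ∀ x ∈ (univ : Finset K).filter (· ≠ 0),
      minpoly (ZMod p) x ∈ k.divisors.biUnion (irreds p) := by
    intro x hx
    have hx0 : x ≠ 0 := by simpa using hx
    have hInt : IsIntegral (ZMod p) x := .of_finite (ZMod p) x
    rw [mem_biUnion]
    refine ⟨(minpoly (ZMod p) x).natDegree, ?_, ?_⟩
    · rw [Nat.mem_divisors, ← hk]
      exact ⟨minpoly.degree_dvd hInt, by omega⟩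
    · rw [mem_irreds, mem_monics]
      exact ⟨⟨minpoly.monic hInt, rfl, minpoly.coeff_zero_ne_zero hInt hx0⟩,
        minpoly.irreducible hInt⟩
  rw [fieldSum, ← Finset.sum_fiberwise_of_maps_to hmaps, Finset.sum_biUnion]
  · refine Finset.sum_congr rfl fun d hd => Finset.sum_congr rfl fun P hP => ?_
    rw [Finset.sum_congr rfl (g := fun _ => wt ψ α β P ^ (k / d)), Finset.sum_const,
      card_roots_irred hk0 hk (Nat.dvd_of_mem_divisors hd) hP, nsmul_eq_mul]
    intro x hx
    simp only [mem_filter, mem_univ, true_and] at hx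
    have hdeg : (minpoly (ZMod p) x).natDegree = d := by
      rw [hx.2]
      exact (mem_monics.1 (mem_irreds.1 hP).1).2.1
    rw [trace_smul_add_smul_inv hx.1, AddChar.map_nsmul_eq_pow, hk, hdeg, hx.2, wt]
  · intro d _ d' _ hne
    rw [Function.onFun, Finset.disjoint_left]
    intro P hP hP'
    exact hne ((mem_monics.1 (mem_irreds.1 hP).1).2.1.symm.trans
      (mem_monics.1 (mem_irreds.1 hP').1).2.1)

end Trace

end QuadRoots

namespace QuadRoots

open Polynomial Finset UniqueFactorizationMonoid

section Recursion

variable {p : ℕ} [Fact p.Prime]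

open Classical in
lemma natDegree_eq_sum_irreds {n : ℕ} {g : (ZMod p)[X]} (hg : g ∈ monics p n) :
    n = ∑ d ∈ Icc 1 n, ∑ P ∈ irreds p d, ∑ j ∈ Icc 1 n, if P ^ j ∣ g then d else 0 := by
  classical
  obtain ⟨hm, hdeg, h0⟩ := mem_monics.1 hg
  have hg0 := hm.ne_zero
  have hprod : (normalizedFactors g).prod = g := by
    rw [prod_normalizedFactors_eq hg0, hm.normalize_eq_self]
  have hmem : ∀ P ∈ normalizedFactors g, P ∈ (Icc 1 n).biUnion (irreds p) := by
    intro P hP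
    have hirr := irreducible_of_normalized_factor P hP
    have hdvd := dvd_of_mem_normalizedFactors hP
    have hmP : P.Monic := by
      rw [← normalize_normalized_factor P hP]
      exact monic_normalize hirr.ne_zero
    rw [mem_biUnion]
    refine ⟨P.natDegree, ?_, ?_⟩
    · rw [mem_Icc]
      exact ⟨hirr.natDegree_pos, hdeg ▸ natDegree_le_of_dvd hdvd hg0⟩
    · rw [mem_irreds, mem_monics]
      refine ⟨⟨hmP, rfl, fun h => h0 ?_⟩, hirr⟩
      obtain ⟨r, rfl⟩ := hdvd
      rw [mul_coeff_zero, h, zero_mul]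
  have hcount : ∀ d, ∀ P ∈ irreds p d, ∑ j ∈ Icc 1 n, (if P ^ j ∣ g then d else 0) =
      (normalizedFactors g).count P * P.natDegree := by
    intro d P hP
    obtain ⟨hP1, hirr⟩ := mem_irreds.1 hP
    obtain ⟨hmP, hPd, -⟩ := mem_monics.1 hP1
    have hiff : ∀ j, P ^ j ∣ g ↔ j ≤ (normalizedFactors g).count P := fun j => by
      rw [pow_dvd_iff_le_emultiplicity,
        le_emultiplicity_iff_replicate_le_normalizedFactors hirr hg0, hmP.normalize_eq_self,
        Multiset.le_count_iff_replicate_le]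
    have hle : (normalizedFactors g).count P ≤ n := by
      have h1 : P ^ (normalizedFactors g).count P ∣ g := (hiff _).2 le_rfl
      have h2 := natDegree_le_of_dvd h1 hg0
      rw [natDegree_pow, hdeg] at h2
      exact (Nat.le_mul_of_pos_right _ hirr.natDegree_pos).trans h2
    rw [← Finset.sum_filter, Finset.sum_const, smul_eq_mul, ← hPd]
    congr 1
    have : (Icc 1 n).filter (fun j => P ^ j ∣ g) = Icc 1 ((normalizedFactors g).count P) := by
      ext j
      rw [mem_filter, hiff, mem_Icc, mem_Icc]
      omega
    rw [this]; simp
  have hdisj : Set.PairwiseDisjoint (↑(Icc 1 n) : Set ℕ) (irreds p) := by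
    intro d _ d' _ hne
    rw [Function.onFun, Finset.disjoint_left]
    intro P hP hP'
    exact hne ((mem_monics.1 (mem_irreds.1 hP).1).2.1.symm.trans
      (mem_monics.1 (mem_irreds.1 hP').1).2.1)
  rw [Finset.sum_congr rfl fun d _ => Finset.sum_congr rfl fun P hP => hcount d P hP,
    ← Finset.sum_biUnion hdisj]
  conv_lhs => rw [← hdeg, ← hprod]
  rw [natDegree_multiset_prod _ (fun h => not_irreducible_zero (irreducible_of_normalized_factor 0 h)),
    Finset.sum_multiset_map_count]
  simp only [smul_eq_mul]
  refine Finset.sum_subset (fun P hP => hmem P (Multiset.mem_toFinset.1 hP)) fun P _ hP => ?_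
  rw [Multiset.count_eq_zero.2 (fun h => hP (Multiset.mem_toFinset.2 h)), zero_mul]

lemma wtSum_mul_pow (ψ : AddChar (ZMod p) ℂ) (α β : ZMod p) {n d j : ℕ} {P : (ZMod p)[X]}
    (hP : P ∈ monics p d) (hdj : d * j ≤ n) :
    wt ψ α β P ^ j * wtSum ψ α β (n - d * j) =
      open Classical in ∑ g ∈ monics p n, if P ^ j ∣ g then wt ψ α β g else 0 := by
  classical
  obtain ⟨hm, hdeg, h0⟩ := mem_monics.1 hP
  have hmj : (P ^ j).Monic := hm.pow j
  have h0j : (P ^ j).coeff 0 ≠ 0 := by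
    rw [coeff_zero_eq_eval_zero, eval_pow, ← coeff_zero_eq_eval_zero]
    exact pow_ne_zero _ h0
  have hdj' : (P ^ j).natDegree = d * j := by rw [natDegree_pow, hdeg, mul_comm]
  rw [← Finset.sum_filter, wtSum, Finset.mul_sum]
  refine Finset.sum_bij (fun g _ => P ^ j * g) ?_ ?_ ?_ ?_
  · intro g hg
    obtain ⟨h1, h2, h3⟩ := mem_monics.1 hg
    rw [mem_filter, mem_monics]
    refine ⟨⟨hmj.mul h1, ?_, ?_⟩, dvd_mul_right _ _⟩
    · rw [hmj.natDegree_mul h1, hdj', h2]; omega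
    · rw [mul_coeff_zero]; exact mul_ne_zero h0j h3
  · intro g _ g' _ h
    exact mul_left_cancel₀ hmj.ne_zero h
  · intro g hg
    rw [mem_filter, mem_monics] at hg
    obtain ⟨⟨h1, h2, h3⟩, r, rfl⟩ := hg
    have hr := hmj.of_mul_monic_left h1
    refine ⟨r, ?_, rfl⟩
    rw [mem_monics]
    refine ⟨hr, ?_, ?_⟩
    · rw [hmj.natDegree_mul hr, hdj'] at h2; omega
    · rw [mul_coeff_zero] at h3; exact right_ne_zero_of_mul h3
  · intro g hg
    obtain ⟨h1, h2, h3⟩ := mem_monics.1 hg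
    rw [wt_mul ψ α β hmj h1 h0j h3, wt_pow ψ α β hm h0]

/-- Newton's identity for the Kloosterman `L`-function. -/
lemma newton_wtSum (ψ : AddChar (ZMod p) ℂ) (α β : ZMod p) (S : ℕ → ℂ)
    (hS : ∀ k, k ≠ 0 → S k = ∑ d ∈ k.divisors, ∑ P ∈ irreds p d, (d : ℂ) * wt ψ α β P ^ (k / d))
    (n : ℕ) : (n : ℂ) * wtSum ψ α β n = ∑ k ∈ Icc 1 n, S k * wtSum ψ α β (n - k) := by
  classical
  have hleft : (n : ℂ) * wtSum ψ α β n = ∑ d ∈ Icc 1 n, ∑ P ∈ irreds p d, ∑ j ∈ Icc 1 n,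
      ∑ g ∈ monics p n, if P ^ j ∣ g then (d : ℂ) * wt ψ α β g else 0 := by
    rw [wtSum, Finset.mul_sum]
    have : ∀ g ∈ monics p n, (n : ℂ) * wt ψ α β g = ∑ d ∈ Icc 1 n, ∑ P ∈ irreds p d,
        ∑ j ∈ Icc 1 n, if P ^ j ∣ g then (d : ℂ) * wt ψ α β g else 0 := by
      intro g hg
      have h := congrArg (fun m : ℕ => (m : ℂ) * wt ψ α β g) (natDegree_eq_sum_irreds hg)
      simp only [Nat.cast_sum, Finset.sum_mul] at h
      rw [h]
      refine Finset.sum_congr rfl fun d _ => Finset.sum_congr rfl fun P _ =>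
        Finset.sum_congr rfl fun j _ => ?_
      split_ifs <;> simp
    rw [Finset.sum_congr rfl this, Finset.sum_comm]
    refine Finset.sum_congr rfl fun d _ => ?_
    rw [Finset.sum_comm]
    refine Finset.sum_congr rfl fun P _ => ?_
    rw [Finset.sum_comm]
  have hinner : ∀ d ∈ Icc 1 n, ∀ P ∈ irreds p d, ∀ j ∈ Icc 1 n,
      (∑ g ∈ monics p n, if P ^ j ∣ g then (d : ℂ) * wt ψ α β g else 0) =
        ∑ k ∈ Icc 1 n, if d * j = k then (d : ℂ) * wt ψ α β P ^ j * wtSum ψ α β (n - k) else 0 := by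
    intro d hd P hP j hj
    rw [Finset.sum_ite_eq]
    have hPm := (mem_irreds.1 hP).1
    split_ifs with h
    · rw [mul_assoc, wtSum_mul_pow ψ α β hPm (mem_Icc.1 h).2, Finset.mul_sum]
      refine Finset.sum_congr rfl fun g _ => ?_
      split_ifs <;> simp
    · refine Finset.sum_eq_zero fun g hg => ?_
      rw [if_neg]
      intro hdvd
      apply h
      obtain ⟨hm, hdeg, h0⟩ := mem_monics.1 hPm
      have := natDegree_le_of_dvd hdvd (mem_monics.1 hg).1.ne_zero
      rw [natDegree_pow, hdeg, (mem_monics.1 hg).2.1, mul_comm] at this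
      rw [mem_Icc] at hd hj ⊢
      exact ⟨Nat.mul_pos hd.1 hj.1, this⟩
  rw [hleft, Finset.sum_congr rfl fun d hd => Finset.sum_congr rfl fun P hP =>
    Finset.sum_congr rfl fun j hj => hinner d hd P hP j hj]
  have hright : ∀ k ∈ Icc 1 n, S k * wtSum ψ α β (n - k) = ∑ d ∈ Icc 1 n, ∑ P ∈ irreds p d,
      ∑ j ∈ Icc 1 n,
        if d * j = k then (d : ℂ) * wt ψ α β P ^ j * wtSum ψ α β (n - k) else 0 := by
    intro k hk
    rw [mem_Icc] at hk
    rw [hS k (by omega), Finset.sum_mul]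
    have hsub : k.divisors ⊆ Icc 1 n := by
      intro d hd
      have := Nat.pos_of_mem_divisors hd
      have := Nat.divisor_le hd
      rw [mem_Icc]; omega
    rw [← Finset.sum_subset hsub]
    · refine Finset.sum_congr rfl fun d hd => ?_
      rw [Finset.sum_mul]
      refine Finset.sum_congr rfl fun P _ => ?_
      obtain ⟨e, rfl⟩ := Nat.dvd_of_mem_divisors hd
      have hd0 := Nat.pos_of_mem_divisors hd
      have he0 : 0 < e := Nat.pos_of_ne_zero (by rintro rfl; simp at hk)
      rw [Nat.mul_div_cancel_left _ hd0, Finset.sum_eq_single e]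
      · simp
      · intro j _ hj
        rw [if_neg]
        intro h
        exact hj (Nat.eq_of_mul_eq_mul_left hd0 h)
      · intro h
        exfalso
        apply h
        rw [mem_Icc]
        exact ⟨he0, (Nat.le_mul_of_pos_left _ hd0).trans hk.2⟩
    · intro d _ hd
      refine Finset.sum_eq_zero fun P _ => Finset.sum_eq_zero fun j _ => ?_
      rw [if_neg]
      rintro rfl
      apply hd
      rw [Nat.mem_divisors]
      exact ⟨dvd_mul_right _ _, by omega⟩
  rw [Finset.sum_congr rfl hright]
  conv_rhs => rw [Finset.sum_comm]
  refine Finset.sum_congr rfl fun d _ => ?_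
  conv_rhs => rw [Finset.sum_comm]
  refine Finset.sum_congr rfl fun P _ => ?_
  conv_rhs => rw [Finset.sum_comm]

end Recursion

end QuadRoots

namespace QuadRoots

open Polynomial Finset

section Weil

lemma sq_norm_le_of_pow_bound {A B : ℂ} {P C : ℝ} (hP : 0 < P)
    (hAB : ‖A‖ * ‖B‖ = P) (hbd : ∀ m : ℕ, ‖A ^ (2 * (m + 1)) + B ^ (2 * (m + 1))‖ ≤ C * P ^ (m + 1)) :
    ‖A‖ ^ 2 ≤ P := by
  by_contra! h
  set t := ‖A‖ ^ 2 / P with ht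
  have ht1 : 1 < t := by rw [ht, one_lt_div hP]; exact h
  have hA : ‖A‖ ^ 2 = t * P := by rw [ht]; field_simp
  have hB : ‖B‖ ^ 2 ≤ P := by
    have : ‖A‖ ^ 2 * ‖B‖ ^ 2 = P ^ 2 := by rw [← mul_pow, hAB]
    rw [hA] at this
    by_contra! hB
    nlinarith [mul_pos hP hP, mul_lt_mul_of_pos_left hB (mul_pos (one_pos.trans ht1) hP)]
  have hmain : ∀ m : ℕ, t ^ (m + 1) ≤ C + 1 := by
    intro m
    have h1 : ‖A‖ ^ (2 * (m + 1)) = t ^ (m + 1) * P ^ (m + 1) := by rw [pow_mul, hA, mul_pow]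
    have h2 : ‖B‖ ^ (2 * (m + 1)) ≤ P ^ (m + 1) := by
      rw [pow_mul]; exact pow_le_pow_left₀ (by positivity) hB _
    have h3 : ‖A ^ (2 * (m + 1))‖ ≤
        ‖A ^ (2 * (m + 1)) + B ^ (2 * (m + 1))‖ + ‖B ^ (2 * (m + 1))‖ := by
      simpa using norm_sub_le (A ^ (2 * (m + 1)) + B ^ (2 * (m + 1))) (B ^ (2 * (m + 1)))
    rw [norm_pow, norm_pow, h1] at h3
    have h4 := hbd m
    have h5 : 0 < P ^ (m + 1) := by positivity
    have : t ^ (m + 1) * P ^ (m + 1) ≤ (C + 1) * P ^ (m + 1) := by linarith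
    exact le_of_mul_le_mul_right this h5
  obtain ⟨m, hm⟩ := pow_unbounded_of_one_lt (C + 1) ht1
  have := hmain m
  have h6 : t ^ m ≤ t ^ (m + 1) := pow_le_pow_right₀ ht1.le (Nat.le_succ m)
  linarith

variable {p : ℕ} [Fact p.Prime]

open Classical in
/-- The Kloosterman sum over the extension of degree `k`. -/
noncomputable def galoisSum (ψ : AddChar (ZMod p) ℂ) (α β : ZMod p) (k : ℕ) : ℂ :=
  letI := Fintype.ofFinite (GaloisField p k)
  fieldSum (GaloisField p k) ψ α β

lemma galoisSum_recursion (ψ : AddChar (ZMod p) ℂ) (hψ : ψ ≠ 1) (α β : ZMod p) (hα : α ≠ 0)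
    (hβ : β ≠ 0) : galoisSum ψ α β 2 = 2 * p - galoisSum ψ α β 1 ^ 2 ∧
    ∀ n, galoisSum ψ α β (n + 3) =
      -galoisSum ψ α β 1 * galoisSum ψ α β (n + 2) - p * galoisSum ψ α β (n + 1) := by
  classical
  have hN := newton_wtSum ψ α β (galoisSum ψ α β) (fun k hk => by
    let _ := Fintype.ofFinite (GaloisField p k)
    exact fieldSum_eq_sum_irreds hk (GaloisField.finrank p hk) ψ α β)
  have h0 := wtSum_zero ψ α β
  have h2 := wtSum_two ψ hψ α β hα hβ
  have h1 : wtSum ψ α β 1 = galoisSum ψ α β 1 := by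
    have := hN 1
    simpa [h0] using this
  constructor
  · have := hN 2
    rw [show Icc 1 2 = {1, 2} from rfl, Finset.sum_pair (by norm_num)] at this
    simp only [h2, h0, h1, show 2 - 1 = 1 from rfl, show 2 - 2 = 0 from rfl] at this
    push_cast at this
    linear_combination -this
  · intro n
    have := hN (n + 3)
    rw [wtSum_of_three_le ψ hψ α β hα (by omega), Finset.sum_Icc_succ_top (by omega),
      Finset.sum_Icc_succ_top (by omega), Finset.sum_Icc_succ_top (by omega),
      Finset.sum_eq_zero] at this
    · simp only [show n + 3 - (n + 2 + 1) = 0 by omega, show n + 3 - (n + 1 + 1) = 1 by omega,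
        show n + 3 - (n + 1) = 2 by omega, h0, h1, h2] at this
      linear_combination -this
    · intro k hk
      rw [mem_Icc] at hk
      rw [wtSum_of_three_le ψ hψ α β hα (by omega), mul_zero]

/-- Weil's bound for Kloosterman sums to prime moduli. -/
theorem norm_kloosterman_prime_le (ψ : AddChar (ZMod p) ℂ) (hψ : ψ ≠ 1) (α β : ZMod p)
    (hα : α ≠ 0) (hβ : β ≠ 0) :
    ‖∑ x ∈ (univ : Finset (ZMod p)).filter (· ≠ 0), ψ (α * x + β * x⁻¹)‖ ≤ 2 * √p := by
  classical
  have hp : p.Prime := Fact.out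
  have hS1 : ∑ x ∈ (univ : Finset (ZMod p)).filter (· ≠ 0), ψ (α * x + β * x⁻¹) =
      galoisSum ψ α β 1 := by
    let _ := Fintype.ofFinite (GaloisField p 1)
    have h1 := fieldSum_eq_sum_irreds (K := ZMod p) one_ne_zero (Module.finrank_self _) ψ α β
    have h2 := fieldSum_eq_sum_irreds (K := GaloisField p 1) one_ne_zero
      (GaloisField.finrank p one_ne_zero) ψ α β
    rw [galoisSum, h2, ← h1, fieldSum]
    refine Finset.sum_congr rfl fun x _ => ?_
    rw [Algebra.trace_self_apply, smul_eq_mul, smul_eq_mul]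
  rw [hS1]
  obtain ⟨hr2, hr⟩ := galoisSum_recursion ψ hψ α β hα hβ
  set S := galoisSum ψ α β with hS
  obtain ⟨w, hw⟩ := IsAlgClosed.exists_pow_nat_eq (S 1 ^ 2 - 4 * p) (n := 2) (by norm_num)
  set A := (-S 1 + w) / 2 with hA
  set B := (-S 1 - w) / 2 with hB
  have hsum : A + B = -S 1 := by rw [hA, hB]; ring
  have hprod : A * B = p := by rw [hA, hB]; linear_combination -hw / 4
  have hform : ∀ n, S (n + 1) = -(A ^ (n + 1) + B ^ (n + 1)) ∧
      S (n + 2) = -(A ^ (n + 2) + B ^ (n + 2)) := by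
    intro n
    induction n with
    | zero =>
      refine ⟨by simp [hsum], ?_⟩
      rw [zero_add, hr2, ← hprod, show S 1 = -(A + B) by rw [hsum, neg_neg]]; ring
    | succ n ih =>
      refine ⟨ih.2, ?_⟩
      rw [hr n, ih.1, ih.2, ← hprod, show S 1 = -(A + B) by rw [hsum, neg_neg]]; ring
  have hbd : ∀ m : ℕ, ‖A ^ (2 * (m + 1)) + B ^ (2 * (m + 1))‖ ≤ (5 * p) * (p : ℝ) ^ (m + 1) := by
    intro m
    have h1 : A ^ (2 * (m + 1)) + B ^ (2 * (m + 1)) = -S (2 * (m + 1)) := by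
      have := (hform (2 * m)).2
      rw [show 2 * (m + 1) = 2 * m + 2 by ring, this, neg_neg]
    rw [h1, norm_neg, hS, galoisSum]
    let _ := Fintype.ofFinite (GaloisField p (2 * (m + 1)))
    refine norm_fieldSum_le ?_ ψ hψ α β hα
    rw [GaloisField.card p _ (by omega), ← pow_mul]
    ring_nf
  have hp0 : (0 : ℝ) < p := by exact_mod_cast hp.pos
  have hAB : ‖A‖ * ‖B‖ = p := by rw [← norm_mul, hprod]; simp
  have hA2 := sq_norm_le_of_pow_bound hp0 hAB hbd
  have hB2 := sq_norm_le_of_pow_bound (A := B) (B := A) hp0 (by rw [mul_comm]; exact hAB)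
    (fun m => by rw [add_comm]; exact hbd m)
  have hA3 : ‖A‖ ≤ √p := Real.le_sqrt_of_sq_le hA2
  have hB3 : ‖B‖ ≤ √p := Real.le_sqrt_of_sq_le hB2
  rw [show S 1 = -(A + B) by rw [hsum, neg_neg], norm_neg]
  linarith [norm_add_le A B]

end Weil

end QuadRoots

namespace QuadRoots

open Finset

section Composite

/-- The Kloosterman sum `K(c, c; k)`. -/
noncomputable def kl (c : ℤ) (k : ℕ) [NeZero k] : ℂ :=
  ∑ u : (ZMod k)ˣ, ZMod.stdAddChar ((c : ZMod k) * ((u : ZMod k) + ((u⁻¹ : (ZMod k)ˣ) : ZMod k)))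

lemma norm_kl_le (c : ℤ) (k : ℕ) [NeZero k] : ‖kl c k‖ ≤ k := by
  refine (norm_sum_le _ _).trans ?_
  simp only [AddChar.norm_apply, sum_const, card_univ, ZMod.card_units_eq_totient, nsmul_eq_mul,
    mul_one]
  exact_mod_cast Nat.totient_le k

lemma stdAddChar_mul_eq {m n : ℕ} [NeZero m] [NeZero n] (h : m.Coprime n) {m' n' : ℤ}
    (hmn : (m : ℤ) * m' + n * n' = 1) (x : ZMod (m * n)) :
    ZMod.stdAddChar x = ZMod.stdAddChar ((n' : ZMod m) * (ZMod.chineseRemainder h x).1) *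
      ZMod.stdAddChar ((m' : ZMod n) * (ZMod.chineseRemainder h x).2) := by
  obtain ⟨j, rfl⟩ := ZMod.intCast_surjective x
  have hm : (m : ℂ) ≠ 0 := by exact_mod_cast NeZero.ne m
  have hn : (n : ℂ) ≠ 0 := by exact_mod_cast NeZero.ne n
  have h1 : ZMod.chineseRemainder h (j : ZMod (m * n)) = ((j : ZMod m), (j : ZMod n)) := by
    rw [map_intCast]; rfl
  rw [h1, ← Int.cast_mul, ← Int.cast_mul, ZMod.stdAddChar_coe, ZMod.stdAddChar_coe,
    ZMod.stdAddChar_coe, ← Complex.exp_add]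
  congr 1
  push_cast
  have : (m : ℂ) * m' + n * n' = 1 := by exact_mod_cast hmn
  field_simp
  linear_combination (-(j : ℂ)) * this

lemma kl_mul {m n : ℕ} [NeZero m] [NeZero n] (h : m.Coprime n) {m' n' : ℤ}
    (hmn : (m : ℤ) * m' + n * n' = 1) (c : ℤ) :
    kl c (m * n) = kl (n' * c) m * kl (m' * c) n := by
  let e : (ZMod (m * n))ˣ ≃* (ZMod m)ˣ × (ZMod n)ˣ :=
    (Units.mapEquiv (ZMod.chineseRemainder h).toMulEquiv).trans MulEquiv.prodUnits
  have he1 : ∀ u, (((e u).1 : (ZMod m)ˣ) : ZMod m) = (ZMod.chineseRemainder h (u : ZMod (m * n))).1 :=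
    fun u => rfl
  have he2 : ∀ u, (((e u).2 : (ZMod n)ˣ) : ZMod n) = (ZMod.chineseRemainder h (u : ZMod (m * n))).2 :=
    fun u => rfl
  simp only [kl]
  rw [Finset.sum_mul_sum, ← Finset.sum_product', ← univ_product_univ.symm, ← e.toEquiv.sum_comp]
  refine Finset.sum_congr rfl fun u _ => ?_
  rw [stdAddChar_mul_eq h hmn]
  simp only [MulEquiv.toEquiv_eq_coe, EquivLike.coe_coe]
  have h1 : ((e u).1⁻¹ : (ZMod m)ˣ) = (e u⁻¹).1 := by rw [map_inv]; rfl
  have h2 : ((e u).2⁻¹ : (ZMod n)ˣ) = (e u⁻¹).2 := by rw [map_inv]; rfl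
  rw [h1, h2, he1, he2, he1, he2]
  congr 2
  · simp only [map_mul, map_add, map_intCast, Prod.fst_mul, Prod.fst_add, Prod.fst_intCast]
    push_cast; ring
  · simp only [map_mul, map_add, map_intCast, Prod.snd_mul, Prod.snd_add, Prod.snd_intCast]
    push_cast; ring

/-- A bound for Kloosterman sums which is sharp at the primes dividing the modulus exactly once. -/
lemma exists_norm_kl_le (k : ℕ) (hk : k ≠ 0) : ∀ c : ℤ, ∃ b u v : ℕ,
    b * (u ^ 2 * v ^ 3) ∣ k ∧ (b : ℤ) ∣ c ∧
      ∀ [NeZero k], ‖kl c k‖ ≤ k.divisors.card * √k * √(b * (u ^ 2 * v ^ 3) : ℕ) := by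
  induction k using Nat.recOnPosPrimePosCoprime with
  | zero => exact absurd rfl hk
  | one =>
    intro c
    refine ⟨1, 1, 1, by simp, by simp, ?_⟩
    intro _
    simpa using norm_kl_le c 1
  | prime_pow p n hp hn =>
    intro c
    have : Fact p.Prime := ⟨hp⟩
    rcases Nat.lt_or_ge 1 n with hn1 | hn1
    · obtain ⟨i, j, hij⟩ : ∃ i j, n = 2 * i + 3 * j := by
        rcases Nat.even_or_odd' n with ⟨t, ht | ht⟩
        · exact ⟨t, 0, by omega⟩
        · exact ⟨t - 1, 1, by omega⟩
      have hpow : 1 * ((p ^ i) ^ 2 * (p ^ j) ^ 3) = p ^ n := by rw [hij]; ring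
      refine ⟨1, p ^ i, p ^ j, hpow.dvd, by simp, ?_⟩
      intro _
      rw [hpow, mul_assoc, Real.mul_self_sqrt (by positivity)]
      refine (norm_kl_le c _).trans ?_
      have : (1 : ℝ) ≤ (p ^ n).divisors.card := by
        exact_mod_cast Finset.card_pos.2 ⟨1, by simp [hp.ne_zero]⟩
      nlinarith [show (0 : ℝ) ≤ (p ^ n : ℕ) by positivity]
    · obtain rfl : n = 1 := by omega
      rw [pow_one]
      have hcard : p.divisors.card = 2 := by
        rw [hp.divisors, Finset.card_pair hp.one_lt.ne]
      by_cases hpc : (p : ℤ) ∣ c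
      · refine ⟨p, 1, 1, by simp, hpc, ?_⟩
        intro _
        rw [hcard, show p * (1 ^ 2 * 1 ^ 3) = p by ring, mul_assoc, Real.mul_self_sqrt (by positivity)]
        refine (norm_kl_le c _).trans ?_
        push_cast
        linarith [show (0 : ℝ) ≤ p by positivity]
      · refine ⟨1, 1, 1, by simp, by simp, ?_⟩
        intro inst
        rw [hcard]
        have hc : (c : ZMod p) ≠ 0 := by rwa [Ne, ZMod.intCast_zmod_eq_zero_iff_dvd]
        have hψ : (ZMod.stdAddChar : AddChar (ZMod p) ℂ) ≠ 1 := by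
          intro h
          have h1 : (1 : ZMod p) = 0 := ZMod.injective_stdAddChar (by rw [h]; rfl)
          exact one_ne_zero h1
        have hW := norm_kloosterman_prime_le ZMod.stdAddChar hψ (c : ZMod p) (c : ZMod p) hc hc
        have : kl c p = ∑ x ∈ (univ : Finset (ZMod p)).filter (· ≠ 0),
            ZMod.stdAddChar ((c : ZMod p) * x + (c : ZMod p) * x⁻¹) := by
          rw [kl]
          refine Finset.sum_bij (fun u _ => (u : ZMod p)) ?_ ?_ ?_ ?_
          · intro u _; simp
          · intro u _ v _ h; exact Units.ext h
          · intro x hx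
            exact ⟨Units.mk0 x (by simpa using hx), mem_univ _, rfl⟩
          · intro u _
            rw [mul_add, Units.val_inv_eq_inv_val]
        rw [this]
        simpa using hW
  | coprime a b ha hb hab iha ihb =>
    intro c
    have : NeZero a := ⟨by omega⟩
    have : NeZero b := ⟨by omega⟩
    have hab' : IsCoprime (a : ℤ) b := Nat.isCoprime_iff_coprime.2 hab
    obtain ⟨x, y, hxy⟩ := hab'
    have hxy' : (a : ℤ) * x + b * y = 1 := by linarith
    obtain ⟨b1, u1, v1, h1, h2, h3⟩ := iha (by omega) (y * c)
    obtain ⟨b2, u2, v2, k1, k2, k3⟩ := ihb (by omega) (x * c)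
    have e1 : (b1 : ℤ) ∣ c := by
      refine IsCoprime.dvd_of_dvd_mul_left ?_ h2
      have : (b1 : ℤ) ∣ a := by exact_mod_cast (dvd_mul_right _ _).trans h1
      exact IsCoprime.of_isCoprime_of_dvd_left ⟨x, b, by linarith⟩ this
    have e2 : (b2 : ℤ) ∣ c := by
      refine IsCoprime.dvd_of_dvd_mul_left ?_ k2
      have : (b2 : ℤ) ∣ b := by exact_mod_cast (dvd_mul_right _ _).trans k1
      exact IsCoprime.of_isCoprime_of_dvd_left ⟨y, a, by linarith⟩ this
    have e3 : IsCoprime (b1 : ℤ) b2 := by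
      refine IsCoprime.of_isCoprime_of_dvd_left (IsCoprime.of_isCoprime_of_dvd_right
        (Nat.isCoprime_iff_coprime.2 hab) ?_) ?_
      · exact_mod_cast (dvd_mul_right _ _).trans k1
      · exact_mod_cast (dvd_mul_right _ _).trans h1
    have hfac : b1 * b2 * ((u1 * u2) ^ 2 * (v1 * v2) ^ 3) =
        (b1 * (u1 ^ 2 * v1 ^ 3)) * (b2 * (u2 ^ 2 * v2 ^ 3)) := by ring
    refine ⟨b1 * b2, u1 * u2, v1 * v2, ?_, ?_, ?_⟩
    · rw [hfac]; exact mul_dvd_mul h1 k1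
    · push_cast; exact e3.mul_dvd e1 e2
    · intro inst
      have hk := kl_mul hab hxy' c
      have : kl c (a * b) = kl (y * c) a * kl (x * c) b := by rw [← hk]
      rw [this, norm_mul, hab.card_divisors_mul, hfac]
      refine (mul_le_mul (h3) (k3) (norm_nonneg _) (by positivity)).trans_eq ?_
      rw [Nat.cast_mul a b, Real.sqrt_mul (by positivity), Nat.cast_mul (b1 * _),
        Real.sqrt_mul (by positivity)]
      push_cast
      ring

end Composite

end QuadRoots

namespace QuadRoots

open Finset

section Average

/-- `‖K(c, c; k)‖`, with value `0` at `k = 0`. -/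
noncomputable def klNorm (c : ℤ) (k : ℕ) : ℝ :=
  if h : k = 0 then 0 else haveI : NeZero k := ⟨h⟩; ‖kl c k‖

lemma sum_inv_sqrt_le (J : ℕ) : ∑ j ∈ Icc 1 J, 1 / √(j : ℝ) ≤ 2 * √J := by
  induction J with
  | zero => simp
  | succ J ih =>
    rw [Finset.sum_Icc_succ_top (by omega)]
    have h1 : (0 : ℝ) < √((J + 1 : ℕ) : ℝ) := Real.sqrt_pos.2 (by positivity)
    have h2 : √((J + 1 : ℕ) : ℝ) ^ 2 = J + 1 := by rw [Real.sq_sqrt (by positivity)]; push_cast; ring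
    have h3 : √(J : ℝ) ^ 2 = J := Real.sq_sqrt (by positivity)
    have h4 : 1 / √((J + 1 : ℕ) : ℝ) ≤ 2 * √((J + 1 : ℕ) : ℝ) - 2 * √(J : ℝ) := by
      rw [div_le_iff₀ h1]
      nlinarith [sq_nonneg (√((J + 1 : ℕ) : ℝ) - √(J : ℝ))]
    linarith

lemma sum_multiples_eq (X L : ℕ) (hL : 0 < L) (f : ℕ → ℝ) :
    ∑ k ∈ (Icc 1 X).filter (L ∣ ·), f k = ∑ j ∈ Icc 1 (X / L), f (L * j) := by
  symm
  refine Finset.sum_bij (fun j _ => L * j) ?_ ?_ ?_ (fun _ _ => rfl)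
  · intro j hj
    rw [mem_Icc] at hj
    rw [mem_filter, mem_Icc]
    refine ⟨⟨Nat.mul_pos hL hj.1, ?_⟩, dvd_mul_right _ _⟩
    exact (Nat.mul_le_mul_left _ hj.2).trans (Nat.mul_div_le X L)
  · intro i _ j _ h
    exact Nat.eq_of_mul_eq_mul_left hL h
  · intro k hk
    rw [mem_filter, mem_Icc] at hk
    obtain ⟨⟨h1, h2⟩, j, rfl⟩ := hk
    refine ⟨j, ?_, rfl⟩
    rw [mem_Icc]
    refine ⟨Nat.pos_of_ne_zero (by rintro rfl; simp at h1), ?_⟩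
    rw [Nat.le_div_iff_mul_le hL]
    linarith [mul_comm j L]

lemma sum_multiples_inv_sqrt_le (X L : ℕ) (hL : 0 < L) :
    ∑ k ∈ (Icc 1 X).filter (L ∣ ·), 1 / √(k : ℝ) ≤ 2 * √X / L := by
  rw [sum_multiples_eq X L hL]
  have hL' : (0 : ℝ) < L := by exact_mod_cast hL
  have h1 : ∀ j ∈ Icc 1 (X / L), 1 / √((L * j : ℕ) : ℝ) = 1 / √(L : ℝ) * (1 / √(j : ℝ)) := by
    intro j _
    rw [Nat.cast_mul, Real.sqrt_mul hL'.le, one_div_mul_one_div]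
  rw [Finset.sum_congr rfl h1, ← Finset.mul_sum]
  have h2 : √((X / L : ℕ) : ℝ) ≤ √X / √L := by
    rw [← Real.sqrt_div (by positivity)]
    exact Real.sqrt_le_sqrt Nat.cast_div_le
  calc _ ≤ 1 / √(L : ℝ) * (2 * (√X / √L)) := by
        refine mul_le_mul_of_nonneg_left ((sum_inv_sqrt_le _).trans ?_) (by positivity)
        linarith
    _ = 2 * √X / (√L * √L) := by field_simp
    _ = _ := by rw [Real.mul_self_sqrt hL'.le]

lemma sum_Icc_inv_le (X : ℕ) : ∑ u ∈ Icc 1 X, (1 : ℝ) / u ≤ 1 + Real.log X := by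
  have := harmonic_le_one_add_log X
  rw [harmonic_eq_sum_Icc] at this
  simpa using this

lemma sum_multiples_inv_le (X L : ℕ) (hL : 0 < L) :
    ∑ k ∈ (Icc 1 X).filter (L ∣ ·), 1 / (k : ℝ) ≤ (1 + Real.log X) / L := by
  rw [sum_multiples_eq X L hL]
  have hL' : (0 : ℝ) < L := by exact_mod_cast hL
  have h1 : ∀ j ∈ Icc 1 (X / L), 1 / ((L * j : ℕ) : ℝ) = 1 / (L : ℝ) * (1 / (j : ℝ)) := by
    intro j _
    rw [Nat.cast_mul, one_div_mul_one_div]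
  rw [Finset.sum_congr rfl h1, ← Finset.mul_sum, div_eq_mul_one_div (1 + Real.log X) (L : ℝ),
    mul_comm (1 + Real.log X) (1 / (L : ℝ))]
  refine mul_le_mul_of_nonneg_left ?_ (by positivity)
  refine le_trans ?_ (sum_Icc_inv_le X)
  exact Finset.sum_le_sum_of_subset_of_nonneg (Finset.Icc_subset_Icc_right (Nat.div_le_self _ _))
    (fun _ _ _ => by positivity)

lemma sum_gcd_div_le (q X : ℕ) (hq : q ≠ 0) :
    ∑ u ∈ Icc 1 X, (q.gcd u : ℝ) / u ≤ q.divisors.card * (1 + Real.log X) := by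
  have h1 : ∀ u ∈ Icc 1 X, (q.gcd u : ℝ) / u ≤
      ∑ d ∈ q.divisors, if d ∣ u then (d : ℝ) * (1 / u) else 0 := by
    intro u _
    have : q.gcd u ∈ q.divisors := Nat.mem_divisors.2 ⟨Nat.gcd_dvd_left _ _, hq⟩
    refine le_trans ?_ (Finset.single_le_sum (fun d _ => ?_) this)
    · rw [if_pos (Nat.gcd_dvd_right _ _), mul_one_div]
    · split_ifs <;> positivity
  refine (Finset.sum_le_sum h1).trans ?_
  rw [Finset.sum_comm, ← nsmul_eq_mul, ← Finset.sum_const]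
  refine Finset.sum_le_sum fun d hd => ?_
  have hd0 := Nat.pos_of_mem_divisors hd
  rw [← Finset.sum_filter, ← Finset.mul_sum]
  refine (mul_le_mul_of_nonneg_left (sum_multiples_inv_le X d hd0) (by positivity)).trans_eq ?_
  have : (d : ℝ) ≠ 0 := by positivity
  field_simp

lemma gcd_mul_pow_le {q : ℕ} (hq : Squarefree q) {b u v : ℕ} (hb : 0 < b) (hu : 0 < u) (hv : 0 < v) :
    q.gcd (b * (u ^ 2 * v ^ 3)) ≤ q.gcd b * (q.gcd u * q.gcd v) := by
  have hq0 : q ≠ 0 := hq.ne_zero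
  have h1 : q.gcd (u ^ 2 * v ^ 3) ∣ q.gcd u * q.gcd v := by
    have hs : Squarefree (q.gcd (u ^ 2 * v ^ 3)) := hq.squarefree_of_dvd (Nat.gcd_dvd_left _ _)
    have h2 : q.gcd (u ^ 2 * v ^ 3) ∣ (u * v) ^ 3 :=
      (Nat.gcd_dvd_right _ _).trans ⟨u, by ring⟩
    have h3 : q.gcd (u ^ 2 * v ^ 3) ∣ u * v := (hs.dvd_pow_iff_dvd (by norm_num)).1 h2
    exact (Nat.dvd_gcd (Nat.gcd_dvd_left _ _) h3).trans (Nat.gcd_mul_right_dvd_mul_gcd q u v)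
  have h0 : 0 < q.gcd b * (q.gcd u * q.gcd v) :=
    Nat.mul_pos (Nat.gcd_pos_of_pos_right _ hb)
      (Nat.mul_pos (Nat.gcd_pos_of_pos_right _ hu) (Nat.gcd_pos_of_pos_right _ hv))
  exact Nat.le_of_dvd h0 ((Nat.gcd_mul_right_dvd_mul_gcd q b _).trans (mul_dvd_mul_left _ h1))

/-- Kloosterman sums on average over multiples of `a * q`. -/
theorem sum_klNorm_div_le {a q X T : ℕ} (ha : 0 < a) (hq : Squarefree q) {c : ℤ} (hc : c ≠ 0)
    (hT : ∀ k, 0 < k → k ≤ X → k.divisors.card ≤ T) :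
    ∑ k ∈ (Icc 1 X).filter (a * q ∣ ·), klNorm c k / k ≤
      2 * T * √X / q * (q.gcd c.natAbs) * c.natAbs.divisors.card *
        (q.divisors.card * (1 + Real.log X)) ^ 2 := by
  have hq0 : 0 < q := Nat.pos_of_ne_zero hq.ne_zero
  have hq' : (0 : ℝ) < q := by exact_mod_cast hq0
  have ha' : (0 : ℝ) < a := by exact_mod_cast ha
  have hc0 : c.natAbs ≠ 0 := by simpa using hc
  set I := c.natAbs.divisors ×ˢ (Icc 1 X ×ˢ Icc 1 X) with hI
  let B : ℕ × ℕ × ℕ → ℕ := fun w => w.1 * (w.2.1 ^ 2 * w.2.2 ^ 3)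
  have hpos : ∀ w ∈ I, 0 < w.1 ∧ 0 < w.2.1 ∧ 0 < w.2.2 := by
    intro w hw
    simp only [hI, mem_product, mem_Icc] at hw
    exact ⟨Nat.pos_of_mem_divisors hw.1, hw.2.1.1, hw.2.2.1⟩
  have hBpos : ∀ w ∈ I, 0 < B w := by
    intro w hw
    obtain ⟨h1, h2, h3⟩ := hpos w hw
    simp only [B]; positivity
  have hpt : ∀ k ∈ (Icc 1 X).filter (a * q ∣ ·), klNorm c k / k ≤
      ∑ w ∈ I, if B w ∣ k then T * √(B w) * (1 / √(k : ℝ)) else 0 := by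
    intro k hk
    rw [mem_filter, mem_Icc] at hk
    obtain ⟨⟨hk1, hkX⟩, -⟩ := hk
    have hk0 : k ≠ 0 := by omega
    have : NeZero k := ⟨hk0⟩
    obtain ⟨b, u, v, h1, h2, h3⟩ := exists_norm_kl_le k hk0 c
    have hmem : (b, u, v) ∈ I := by
      have hle := Nat.le_of_dvd hk1 h1
      have hne : b * (u ^ 2 * v ^ 3) ≠ 0 := fun h => hk0 (by simpa [h] using h1)
      have hb0 : 0 < b := Nat.pos_of_ne_zero (left_ne_zero_of_mul hne)
      have hu0 : 0 < u := Nat.pos_of_ne_zero (by rintro rfl; simp at hne)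
      have hv0 : 0 < v := Nat.pos_of_ne_zero (by rintro rfl; simp at hne)
      have hu1 : u ∣ k := ((Dvd.intro (b * u * v ^ 3) (by ring)).trans h1)
      have hv1 : v ∣ k := ((Dvd.intro (b * u ^ 2 * v ^ 2) (by ring)).trans h1)
      simp only [hI, mem_product, mem_Icc, Nat.mem_divisors]
      exact ⟨⟨Int.natCast_dvd.1 h2, hc0⟩, ⟨hu0, (Nat.le_of_dvd hk1 hu1).trans hkX⟩,
        ⟨hv0, (Nat.le_of_dvd hk1 hv1).trans hkX⟩⟩
    refine le_trans ?_ (Finset.single_le_sum (f := fun w => if B w ∣ k then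
      (T : ℝ) * √(B w) * (1 / √(k : ℝ)) else 0) (fun w _ => ?_) hmem)
    · rw [if_pos (show B (b, u, v) ∣ k from h1), klNorm, dif_neg hk0]
      have hks : (0 : ℝ) < √k := Real.sqrt_pos.2 (by exact_mod_cast hk1)
      have hkk : (k : ℝ) = √k * √k := (Real.mul_self_sqrt (by positivity)).symm
      have h4 : ‖kl c k‖ ≤ T * √k * √(B (b, u, v) : ℝ) := by
        refine h3.trans ?_
        have := hT k hk1 hkX
        have : (k.divisors.card : ℝ) ≤ T := by exact_mod_cast this
        gcongr
      calc ‖kl c k‖ / k ≤ T * √k * √(B (b, u, v) : ℝ) / k := by gcongr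
        _ = _ := by
          conv_lhs => rw [show T * √(k : ℝ) * √(B (b, u, v) : ℝ) / k =
            T * √(k : ℝ) * √(B (b, u, v) : ℝ) / (√k * √k) by rw [← hkk]]
          field_simp
    · split_ifs <;> positivity
  have hinner : ∀ w ∈ I, ∑ k ∈ (Icc 1 X).filter (a * q ∣ ·),
      (if B w ∣ k then (T : ℝ) * √(B w) * (1 / √(k : ℝ)) else 0) ≤
        2 * T * √X / q * (q.gcd c.natAbs) *
          (((q.gcd w.2.1 : ℝ) / w.2.1) * ((q.gcd w.2.2 : ℝ) / w.2.2)) := by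
    intro w hw
    obtain ⟨h1, h2, h3⟩ := hpos w hw
    have hB := hBpos w hw
    have hB' : (0 : ℝ) < B w := by exact_mod_cast hB
    rw [← Finset.sum_filter, Finset.filter_filter, ← Finset.mul_sum]
    have hfil : (Icc 1 X).filter (fun k => a * q ∣ k ∧ B w ∣ k) =
        (Icc 1 X).filter ((a * q).lcm (B w) ∣ ·) := by
      ext k; simp only [mem_filter, Nat.lcm_dvd_iff]
    have hlpos : 0 < (a * q).lcm (B w) := Nat.lcm_pos (Nat.mul_pos ha hq0) hB
    rw [hfil]
    refine (mul_le_mul_of_nonneg_left (sum_multiples_inv_sqrt_le X _ hlpos) (by positivity)).trans ?_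
    have hgl : ((a * q).gcd (B w) : ℝ) * ((a * q).lcm (B w)) = a * q * B w := by
      exact_mod_cast Nat.gcd_mul_lcm (a * q) (B w)
    have hlpos' : (0 : ℝ) < (a * q).lcm (B w) := by exact_mod_cast hlpos
    have hgcd : ((a * q).gcd (B w) : ℝ) ≤
        a * ((q.gcd c.natAbs) * ((q.gcd w.2.1) * (q.gcd w.2.2))) := by
      have e1 : (a * q).gcd (B w) ≤ a * q.gcd (B w) := by
        refine Nat.le_of_dvd (Nat.mul_pos ha (Nat.gcd_pos_of_pos_left _ hq0)) ?_
        rw [Nat.gcd_comm, Nat.gcd_comm q]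
        exact (Nat.gcd_mul_right_dvd_mul_gcd _ _ _).trans
          (mul_dvd_mul_right (Nat.gcd_dvd_right _ _) _)
      have e2 := gcd_mul_pow_le hq h1 h2 h3
      have e3 : q.gcd w.1 ≤ q.gcd c.natAbs := by
        refine Nat.le_of_dvd (Nat.gcd_pos_of_pos_left _ hq0) (Nat.gcd_dvd_gcd_of_dvd_right _ ?_)
        simp only [hI, mem_product] at hw
        exact Nat.dvd_of_mem_divisors hw.1
      have : (a * q).gcd (B w) ≤ a * ((q.gcd c.natAbs) * ((q.gcd w.2.1) * (q.gcd w.2.2))) :=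
        e1.trans (Nat.mul_le_mul_left _ (e2.trans (Nat.mul_le_mul_right _ e3)))
      exact_mod_cast this
    have hsq : √(B w : ℝ) ≥ w.2.1 * w.2.2 := by
      apply Real.le_sqrt_of_sq_le
      have : (w.2.1 * w.2.2) ^ 2 ≤ B w := by
        simp only [B, mul_pow]
        refine (Nat.mul_le_mul_left _ (Nat.pow_le_pow_right h3 (by norm_num : 2 ≤ 3))).trans ?_
        exact Nat.le_mul_of_pos_left _ h1
      exact_mod_cast this
    have hu' : (0 : ℝ) < w.2.1 := by exact_mod_cast h2
    have hv' : (0 : ℝ) < w.2.2 := by exact_mod_cast h3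
    have hBs : 0 < √(B w : ℝ) := Real.sqrt_pos.2 hB'
    have hBB : (B w : ℝ) = √(B w : ℝ) * √(B w : ℝ) := (Real.mul_self_sqrt hB'.le).symm
    have hlcm : 1 / ((a * q).lcm (B w) : ℝ) = (a * q).gcd (B w) / (a * q * B w) := by
      rw [← hgl]
      have : ((a * q).gcd (B w) : ℝ) ≠ 0 := by
        have : (a * q).gcd (B w) ≠ 0 := (Nat.gcd_pos_of_pos_right _ hB).ne'
        exact_mod_cast this
      field_simp
    calc T * √(B w : ℝ) * (2 * √X / ((a * q).lcm (B w) : ℝ))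
        = 2 * T * √X * √(B w : ℝ) * (1 / ((a * q).lcm (B w) : ℝ)) := by ring
      _ = 2 * T * √X * ((a * q).gcd (B w)) / (a * q * √(B w : ℝ)) := by
          rw [hlcm]
          conv_lhs => rw [show (a * q * B w : ℝ) = a * q * (√(B w : ℝ) * √(B w : ℝ)) by rw [← hBB]]
          field_simp
      _ ≤ 2 * T * √X * (a * ((q.gcd c.natAbs) * ((q.gcd w.2.1) * (q.gcd w.2.2)))) /
            (a * q * (w.2.1 * w.2.2)) := by
          gcongr
      _ = _ := by field_simp
  calc _ ≤ ∑ k ∈ (Icc 1 X).filter (a * q ∣ ·),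
      ∑ w ∈ I, (if B w ∣ k then (T : ℝ) * √(B w) * (1 / √(k : ℝ)) else 0) := Finset.sum_le_sum hpt
    _ ≤ ∑ w ∈ I, 2 * T * √X / q * (q.gcd c.natAbs) *
          (((q.gcd w.2.1 : ℝ) / w.2.1) * ((q.gcd w.2.2 : ℝ) / w.2.2)) := by
        rw [Finset.sum_comm]; exact Finset.sum_le_sum hinner
    _ = 2 * T * √X / q * (q.gcd c.natAbs) * c.natAbs.divisors.card *
          ((∑ u ∈ Icc 1 X, (q.gcd u : ℝ) / u) * (∑ u ∈ Icc 1 X, (q.gcd u : ℝ) / u)) := by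
        rw [← Finset.mul_sum, hI, Finset.sum_product]
        simp only [Finset.sum_const, nsmul_eq_mul]
        rw [Finset.sum_mul_sum, Finset.sum_product]
        ring
    _ ≤ _ := by
        have h0 : 0 ≤ ∑ u ∈ Icc 1 X, (q.gcd u : ℝ) / u :=
          Finset.sum_nonneg fun _ _ => by positivity
        have := sum_gcd_div_le q X hq0.ne'
        rw [sq]
        gcongr

end Average

end QuadRoots

namespace QuadRoots

section Unfolding
open MeasureTheory UpperHalfPlane ModularGroup Filter
open scoped MatrixGroups

/-- A Siegel-type set meeting every orbit of the modular group. -/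
def siegel : Set ℍ := {z | |z.re| ≤ 1 ∧ 1 / 2 ≤ z.im}

lemma exists_smul_mem_siegel (z : ℍ) : ∃ γ : SL(2, ℤ), γ • z ∈ siegel := by
  obtain ⟨γ, hγ⟩ := exists_smul_mem_fd z
  refine ⟨γ, hγ.2.trans (by norm_num), ?_⟩
  have h := three_le_four_mul_im_sq_of_mem_fd hγ
  have := (γ • z).im_pos
  nlinarith

lemma siegel_bottom_row {z : ℍ} {γ : SL(2, ℤ)} (hz : z ∈ siegel) (hγ : γ • z ∈ siegel) :
    (|γ 1 0| ≤ 2 ∧ |γ 1 1| ≤ 4) ∧ (γ 1 0 = 0 → |γ 0 1| ≤ 2) := by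
  obtain ⟨hx, hy⟩ := hz
  obtain ⟨hx', hy'⟩ := hγ
  have him := ModularGroup.im_smul_eq_div_normSq γ z
  have hpos : 0 < Complex.normSq (denom γ z) := normSq_denom_pos γ z.im_ne_zero
  have hle : Complex.normSq (denom γ z) ≤ 2 * z.im := by
    rw [him, le_div_iff₀ hpos] at hy'
    linarith
  have hden : Complex.normSq (denom γ z) =
      ((γ 1 0 : ℝ) * z.re + γ 1 1) ^ 2 + ((γ 1 0 : ℝ) * z.im) ^ 2 := by
    rw [ModularGroup.denom_apply, Complex.normSq_apply]
    simp
    ring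
  rw [hden] at hle
  have hdet : γ 0 0 * γ 1 1 - γ 0 1 * γ 1 0 = 1 := by
    rw [← Matrix.det_fin_two]; exact γ.det_coe
  have hc2 : (γ 1 0 : ℝ) ^ 2 * z.im ≤ 2 := by
    have : (γ 1 0 : ℝ) ^ 2 * z.im * z.im ≤ 2 * z.im := by nlinarith [sq_nonneg ((γ 1 0 : ℝ) * z.re + γ 1 1)]
    exact le_of_mul_le_mul_right this z.im_pos
  have hc : |γ 1 0| ≤ 2 := by
    have : (γ 1 0 : ℝ) ^ 2 ≤ 2 ^ 2 := by nlinarith [sq_nonneg (γ 1 0 : ℝ)]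
    have h2 := abs_le_of_sq_le_sq this (by norm_num)
    exact_mod_cast h2
  by_cases h0 : γ 1 0 = 0
  · rw [h0] at hdet
    simp only [mul_zero, sub_zero] at hdet
    refine ⟨⟨hc, ?_⟩, fun _ => ?_⟩
    · rcases Int.eq_one_or_neg_one_of_mul_eq_one' hdet with h | h <;> simp [h.2]
    · have hre : (γ • z).re = z.re + (γ 0 1 : ℝ) / γ 1 1 := by
        have h1 := coe_specialLinearGroup_apply γ z
        have h2 := congrArg Complex.re h1
        rw [coe_re] at h2
        rw [h2, h0]
        rcases Int.eq_one_or_neg_one_of_mul_eq_one' hdet with h | h 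
        · simp [h.1, h.2]
        · simp only [h.1, h.2, map_neg, map_one, eq_intCast, Int.cast_zero, Complex.ofReal_zero]
          simp [Complex.div_re]
          ring
      rw [hre] at hx'
      have : |(γ 0 1 : ℝ) / γ 1 1| ≤ 2 := by
        rw [abs_le] at *
        constructor <;> linarith [hx.1, hx.2, hx'.1, hx'.2]
      rcases Int.eq_one_or_neg_one_of_mul_eq_one' hdet with h | h
      · rw [h.2, Int.cast_one, div_one] at this
        exact_mod_cast this
      · rw [h.2, Int.cast_neg, Int.cast_one, div_neg, div_one, abs_neg] at this
        exact_mod_cast this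
  · refine ⟨⟨hc, ?_⟩, fun h => absurd h h0⟩
    have h1 : (1 : ℝ) ≤ (γ 1 0 : ℝ) ^ 2 := by
      have : (1 : ℤ) ≤ (γ 1 0) ^ 2 := by
        have := sq_pos_of_ne_zero h0
        omega
      exact_mod_cast this
    have h2 : z.im ≤ 2 := by nlinarith [z.im_pos]
    have h3 : ((γ 1 0 : ℝ) * z.re + γ 1 1) ^ 2 ≤ 2 ^ 2 := by nlinarith [sq_nonneg ((γ 1 0 : ℝ) * z.im)]
    have h4 := abs_le.1 (abs_le_of_sq_le_sq h3 (by norm_num))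
    have h5 : |(γ 1 0 : ℝ) * z.re| ≤ 2 := by
      rw [abs_mul]
      have : |(γ 1 0 : ℝ)| ≤ 2 := by exact_mod_cast hc
      nlinarith [abs_nonneg (γ 1 0 : ℝ), abs_nonneg z.re]
    rw [abs_le] at h5
    rw [abs_le]
    constructor
    · have : (-4 : ℝ) ≤ γ 1 1 := by linarith [h4.1, h5.2]
      exact_mod_cast this
    · have : (γ 1 1 : ℝ) ≤ 4 := by linarith [h4.2, h5.1]
      exact_mod_cast this

/-- Elements of the modular group with bounded entries. -/
def boundedGroupElts : Set SL(2, ℤ) := {γ | ∀ i j, |γ i j| ≤ 17}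

lemma boundedGroupElts_finite : boundedGroupElts.Finite := by
  have h : Set.Finite {f : Fin 2 → Fin 2 → ℤ | ∀ i j, f i j ∈ Set.Icc (-17 : ℤ) 17} := by
    have := Set.Finite.pi' (ι := Fin 2) (t := fun _ => {g : Fin 2 → ℤ | ∀ j, g j ∈ Set.Icc (-17 : ℤ) 17})
      (fun _ => Set.Finite.pi' (fun _ => Set.finite_Icc _ _))
    exact this
  refine Set.Finite.of_finite_image (f := fun γ : SL(2, ℤ) => (fun i j => γ i j : Fin 2 → Fin 2 → ℤ))
    (h.subset ?_) ?_
  · rintro _ ⟨γ, hγ, rfl⟩ i j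
    exact abs_le.1 (hγ i j)
  · intro γ _ γ' _ h
    ext i j
    exact congrFun (congrFun h i) j

noncomputable def nearElts : Finset SL(2, ℤ) := boundedGroupElts_finite.toFinset

lemma mem_nearElts {z : ℍ} {γ : SL(2, ℤ)} (hz : z ∈ siegel) (hγ : γ • z ∈ siegel) :
    γ ∈ nearElts := by
  rw [nearElts, Set.Finite.mem_toFinset]
  obtain ⟨⟨h10, h11⟩, h0⟩ := siegel_bottom_row hz hγ
  have hinv : γ⁻¹ • (γ • z) ∈ siegel := by rwa [inv_smul_smul]
  obtain ⟨⟨_, h00⟩, _⟩ := siegel_bottom_row hγ hinv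
  rw [Matrix.SpecialLinearGroup.SL2_inv_expl] at h00
  simp at h00
  have hdet : γ 0 0 * γ 1 1 - γ 0 1 * γ 1 0 = 1 := by
    rw [← Matrix.det_fin_two]; exact γ.det_coe
  have h01 : |γ 0 1| ≤ 17 := by
    by_cases hc : γ 1 0 = 0
    · exact (h0 hc).trans (by norm_num)
    · have h1 : 1 ≤ |γ 1 0| := Int.one_le_abs hc
      have h2 : |γ 0 1 * γ 1 0| ≤ 17 := by
        rw [show γ 0 1 * γ 1 0 = γ 0 0 * γ 1 1 - 1 by linarith]
        refine (abs_sub _ _).trans ?_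
        rw [abs_mul]
        simp only [abs_one]
        nlinarith [abs_nonneg (γ 0 0), abs_nonneg (γ 1 1)]
      rw [abs_mul] at h2
      nlinarith [abs_nonneg (γ 0 1)]
  intro i j
  fin_cases i <;> fin_cases j
  · exact h00.trans (by norm_num)
  · exact h01
  · exact h10.trans (by norm_num)
  · exact h11.trans (by norm_num)

end Unfolding
end QuadRoots

namespace QuadRoots

section Unfolding
open MeasureTheory UpperHalfPlane ModularGroup Filter
open scoped MatrixGroups

instance : MeasurableConstSMul SL(2, ℤ) ℍ :=
  ⟨fun γ => measurable_const_smul (γ : GL (Fin 2) ℝ)⟩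

instance : Countable SL(2, ℤ) :=
  Function.Injective.countable (f := fun γ : SL(2, ℤ) => (fun i j => γ i j : Fin 2 → Fin 2 → ℤ))
    fun γ γ' h => by
      ext i j
      exact congrFun (congrFun h i) j

instance : SMulInvariantMeasure SL(2, ℤ) ℍ volume :=
  ⟨fun γ _ hs => measure_preimage_smul_of_nullMeasurableSet
    (G := GL (Fin 2) ℝ) hs.nullMeasurableSet (γ : GL (Fin 2) ℝ)⟩

lemma isClosed_siegel : IsClosed siegel :=
  (isClosed_le (continuous_abs.comp continuous_re) continuous_const).inter
    (isClosed_le continuous_const continuous_im)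

lemma measurableSet_siegel : MeasurableSet siegel := isClosed_siegel.measurableSet

open Classical in
/-- A weight whose translates by the modular group form a partition of unity. -/
noncomputable def weight (z : ℍ) : ℝ :=
  if z ∈ siegel then 1 / ((nearElts.filter (fun γ => γ • z ∈ siegel)).card : ℝ) else 0

lemma weight_nonneg (z : ℍ) : 0 ≤ weight z := by
  unfold weight; split_ifs <;> positivity

open Classical in
lemma card_near_pos {z : ℍ} (hz : z ∈ siegel) :
    0 < (nearElts.filter (fun γ => γ • z ∈ siegel)).card := by
  refine Finset.card_pos.2 ⟨1, Finset.mem_filter.2 ⟨mem_nearElts hz ?_, ?_⟩⟩ <;> rwa [one_smul]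

lemma weight_le_one (z : ℍ) : weight z ≤ 1 := by
  classical
  unfold weight
  split_ifs with h
  · have := card_near_pos h
    rw [div_le_one (by exact_mod_cast this)]
    exact_mod_cast this
  · norm_num

lemma le_weight {z : ℍ} (hz : z ∈ siegel) : 1 / (nearElts.card : ℝ) ≤ weight z := by
  classical
  rw [weight, if_pos hz]
  have := card_near_pos hz
  refine one_div_le_one_div_of_le (by exact_mod_cast this) ?_
  exact_mod_cast Finset.card_filter_le _ _

lemma weight_eq_zero {z : ℍ} (hz : z ∉ siegel) : weight z = 0 := if_neg hz

lemma measurable_weight : Measurable weight := by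
  classical
  have h : weight = siegel.indicator
      (fun z => 1 / ∑ γ ∈ nearElts, {z | γ • z ∈ siegel}.indicator (fun _ => (1 : ℝ)) z) := by
    funext z
    rw [weight, Set.indicator_apply]
    congr 2
    simp only [Set.indicator_apply, Set.mem_ofPred_eq, Finset.sum_boole]
  rw [h]
  refine Measurable.indicator ?_ measurableSet_siegel
  refine measurable_const.div (Finset.measurable_sum _ fun γ _ => ?_)
  exact measurable_const.indicator (measurableSet_siegel.preimage (measurable_const_smul γ))

lemma hasSum_weight_smul (z : ℍ) : HasSum (fun γ : SL(2, ℤ) => weight (γ • z)) 1 := by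
  classical
  have key : ∀ z ∈ siegel, HasSum (fun γ : SL(2, ℤ) => weight (γ • z)) 1 := by
    intro z hz
    have h0 : ∀ γ ∉ nearElts.filter (fun γ => γ • z ∈ siegel), weight (γ • z) = 0 := by
      intro γ hγ
      refine weight_eq_zero fun h => hγ (Finset.mem_filter.2 ⟨mem_nearElts hz h, h⟩)
    have h1 := hasSum_sum_of_ne_finset_zero (L := .unconditional _) (f := fun γ : SL(2, ℤ) => weight (γ • z)) h0
    convert h1 using 1
    have h2 : ∀ γ ∈ nearElts.filter (fun γ => γ • z ∈ siegel), weight (γ • z) =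
        1 / ((nearElts.filter (fun γ => γ • z ∈ siegel)).card : ℝ) := by
      intro γ hγ
      have hγ' := (Finset.mem_filter.1 hγ).2
      rw [weight, if_pos hγ']
      congr 2
      refine Finset.card_bij' (fun σ _ => σ * γ) (fun σ _ => σ * γ⁻¹) ?_ ?_ ?_ ?_
      · intro σ hσ
        have := (Finset.mem_filter.1 hσ).2
        rw [← mul_smul] at this
        exact Finset.mem_filter.2 ⟨mem_nearElts hz this, this⟩
      · intro σ hσ
        have := (Finset.mem_filter.1 hσ).2
        have h3 : (σ * γ⁻¹) • (γ • z) ∈ siegel := by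
          rwa [← mul_smul, inv_mul_cancel_right]
        exact Finset.mem_filter.2 ⟨mem_nearElts hγ' h3, h3⟩
      · intro σ _; simp
      · intro σ _; simp
    rw [Finset.sum_congr rfl h2, Finset.sum_const, nsmul_eq_mul, mul_one_div_cancel]
    exact_mod_cast (card_near_pos hz).ne'
  obtain ⟨σ, hσ⟩ := exists_smul_mem_siegel z
  have := key _ hσ
  rw [← (Equiv.mulRight σ).hasSum_iff]
  convert this using 2 with γ
  simp [mul_smul]

lemma integrable_and_integral_of_hasSum {α ι : Type*} [MeasurableSpace α] {μ : Measure α}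
    [Countable ι] {F : ι → α → ℂ} {f : α → ℂ} (hF : ∀ i, Integrable (F i) μ)
    (hs : Summable fun i => ∫ a, ‖F i a‖ ∂μ) (hf : ∀ a, HasSum (fun i => F i a) (f a)) :
    Integrable f μ ∧ HasSum (fun i => ∫ a, F i a ∂μ) (∫ a, f a ∂μ) := by
  have hf' : f = fun a => ∑' i, F i a := funext fun a => (hf a).tsum_eq.symm
  constructor
  · refine ⟨aestronglyMeasurable_of_tendsto_ae (u := atTop)
      (f := fun (s : Finset ι) a => ∑ i ∈ s, F i a) ?_ (ae_of_all _ fun a => hf a), ?_⟩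
    · intro s
      exact Finset.aestronglyMeasurable_fun_sum s fun i _ => (hF i).1
    · rw [hasFiniteIntegral_iff_enorm]
      calc ∫⁻ a, ‖f a‖ₑ ∂μ ≤ ∫⁻ a, ∑' i, ‖F i a‖ₑ ∂μ := by
            refine lintegral_mono fun a => ?_
            rw [hf']
            exact enorm_tsum_le_tsum_enorm
        _ = ∑' i, ∫⁻ a, ‖F i a‖ₑ ∂μ := lintegral_tsum fun i => (hF i).1.enorm
        _ = ∑' i, ENNReal.ofReal (∫ a, ‖F i a‖ ∂μ) := by
            congr 1
            funext i
            exact (ofReal_integral_norm_eq_lintegral_enorm (hF i)).symm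
        _ < ⊤ := by
            exact hs.tsum_ofReal_lt_top
  · rw [hf']
    exact hasSum_integral_of_summable_integral_norm hF hs

/-- Unfolding against the partition of unity. -/
theorem unfold_integral {Θ : ℍ → ℂ} {S : ℍ → ℂ} (hΘ : Integrable Θ)
    (hS : ∀ z, HasSum (fun γ : SL(2, ℤ) => Θ (γ • z)) (S z)) :
    Integrable (fun z => (weight z : ℂ) * S z) ∧ ∫ z, (weight z : ℂ) * S z = ∫ z, Θ z := by
  have hInt : ∀ γ : SL(2, ℤ), Integrable fun w : ℍ => (weight (γ⁻¹ • w) : ℂ) * Θ w := by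
    intro γ
    refine hΘ.bdd_mul (c := 1) ?_ ?_
    · exact (Complex.measurable_ofReal.comp
        (measurable_weight.comp (measurable_const_smul γ⁻¹))).aestronglyMeasurable
    · refine ae_of_all _ fun w => ?_
      rw [Complex.norm_real, Real.norm_of_nonneg (weight_nonneg _)]
      exact weight_le_one _
  have hnorm : ∀ (γ : SL(2, ℤ)) (w : ℍ), ‖(weight (γ⁻¹ • w) : ℂ) * Θ w‖ = weight (γ⁻¹ • w) * ‖Θ w‖ := by
    intro γ w
    rw [norm_mul, Complex.norm_real, Real.norm_of_nonneg (weight_nonneg _)]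
  have hw : ∀ w : ℍ, HasSum (fun γ : SL(2, ℤ) => weight (γ⁻¹ • w)) 1 := fun w =>
    (Equiv.inv SL(2, ℤ)).hasSum_iff.2 (hasSum_weight_smul w)
  have hsum : Summable fun γ : SL(2, ℤ) => ∫ w : ℍ, ‖(weight (γ⁻¹ • w) : ℂ) * Θ w‖ := by
    refine summable_of_sum_le (c := ∫ w, ‖Θ w‖) (fun γ => integral_nonneg fun _ => norm_nonneg _)
      fun s => ?_
    rw [← integral_finsetSum _ fun γ _ => (hInt γ).norm]
    refine integral_mono (integrable_finsetSum _ fun γ _ => (hInt γ).norm) hΘ.norm fun w => ?_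
    simp only [hnorm]
    rw [← Finset.sum_mul]
    exact mul_le_of_le_one_left (norm_nonneg _)
      (sum_le_hasSum s (fun γ _ => weight_nonneg _) (hw w))
  have h1 := integrable_and_integral_of_hasSum hInt hsum (f := Θ) (by
    intro w
    have := ((Complex.hasSum_ofReal.2 (hw w)).mul_right (Θ w))
    simpa using this)
  have hmp : ∀ γ : SL(2, ℤ), MeasurePreserving (fun z : ℍ => γ • z) :=
    fun γ => measurePreserving_smul γ _
  have hInt' : ∀ γ : SL(2, ℤ), Integrable fun z : ℍ => (weight z : ℂ) * Θ (γ • z) := by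
    intro γ
    have := (hmp γ).integrable_comp_of_integrable (hInt γ)
    simpa [Function.comp_def] using this
  have hsum' : Summable fun γ : SL(2, ℤ) => ∫ z : ℍ, ‖(weight z : ℂ) * Θ (γ • z)‖ := by
    convert hsum using 2 with γ
    rw [← integral_smul_eq_self (μ := (volume : Measure ℍ))
      (fun w => ‖(weight (γ⁻¹ • w) : ℂ) * Θ w‖) (g := γ)]
    simp
  have h2 := integrable_and_integral_of_hasSum hInt' hsum'
    (f := fun z => (weight z : ℂ) * S z) (fun z => (hS z).mul_left _)
  refine ⟨h2.1, h2.2.unique ?_⟩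
  convert h1.2 using 2 with γ
  rw [← integral_smul_eq_self (μ := (volume : Measure ℍ))
      (fun w => (weight (γ⁻¹ • w) : ℂ) * Θ w) (g := γ)]
  simp

end Unfolding
end QuadRoots

namespace QuadRoots

section Rows
open UpperHalfPlane ModularGroup
open scoped MatrixGroups

/-- Primitive integer vectors. -/
abbrev Prim := {v : ℤ × ℤ // IsCoprime v.1 v.2}

/-- The bottom row of an element of the modular group. -/
def row (γ : SL(2, ℤ)) : Prim := ⟨(γ 1 0, γ 1 1), bottom_row_coprime γ⟩

lemma SL_det (γ : SL(2, ℤ)) : γ 0 0 * γ 1 1 - γ 0 1 * γ 1 0 = 1 := by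
  rw [← Matrix.det_fin_two]; exact γ.det_coe

lemma SL_mul_10 (σ γ : SL(2, ℤ)) : (σ * γ) 1 0 = σ 1 0 * γ 0 0 + σ 1 1 * γ 1 0 := by
  simp [Matrix.mul_apply, Fin.sum_univ_two]

lemma SL_mul_11 (σ γ : SL(2, ℤ)) : (σ * γ) 1 1 = σ 1 0 * γ 0 1 + σ 1 1 * γ 1 1 := by
  simp [Matrix.mul_apply, Fin.sum_univ_two]

lemma row_surjective : Function.Surjective row := by
  intro v
  obtain ⟨γ, -, hγ⟩ := bottom_row_surj (R := ℤ) (show (![v.1.1, v.1.2] : Fin 2 → ℤ) ∈ _ from v.2)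
  refine ⟨γ, Subtype.ext (Prod.ext ?_ ?_)⟩
  · exact congrFun hγ 0
  · exact congrFun hγ 1

noncomputable def sec (v : Prim) : SL(2, ℤ) := Function.surjInv row_surjective v

lemma row_sec (v : Prim) : row (sec v) = v := Function.surjInv_eq row_surjective v

lemma exists_zpow_of_row_eq {γ γ' : SL(2, ℤ)} (h : row γ = row γ') : ∃ n : ℤ, γ' = T ^ n * γ := by
  have h0 : γ 1 0 = γ' 1 0 := congrArg (fun v : Prim => v.1.1) h
  have h1 : γ 1 1 = γ' 1 1 := congrArg (fun v : Prim => v.1.2) h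
  refine ⟨γ' 0 0 * γ 0 1 * (-1) + γ' 0 1 * γ 0 0, ?_⟩
  have d := SL_det γ
  have d' := SL_det γ'
  rw [← h0, ← h1] at d'
  ext i j
  rw [Matrix.SpecialLinearGroup.coe_mul, coe_T_zpow, Matrix.mul_apply, Fin.sum_univ_two]
  fin_cases i <;> fin_cases j
  · simp
    linear_combination (-γ' 0 0) * d + γ 0 0 * d'
  · simp
    linear_combination (-γ' 0 1) * d + γ 0 1 * d'
  · simp [h0]
  · simp [h1]

lemma row_zpow_mul (n : ℤ) (γ : SL(2, ℤ)) : row (T ^ n * γ) = row γ := by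
  refine Subtype.ext (Prod.ext ?_ ?_)
  · change (T ^ n * γ) 1 0 = γ 1 0
    rw [SL_mul_10, coe_T_zpow]; simp
  · change (T ^ n * γ) 1 1 = γ 1 1
    rw [SL_mul_11, coe_T_zpow]; simp

/-- Invariance under integral translations. -/
def Periodic (F : ℍ → ℂ) : Prop := ∀ (n : ℤ) (z : ℍ), F (T ^ n • z) = F z

lemma Periodic.sec_row {F : ℍ → ℂ} (hF : Periodic F) (γ : SL(2, ℤ)) (z : ℍ) :
    F (sec (row γ) • z) = F (γ • z) := by
  obtain ⟨n, hn⟩ := exists_zpow_of_row_eq (row_sec (row γ)).symm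
  rw [hn, mul_smul, hF]

def Prim.det (v w : Prim) : ℤ := v.1.1 * w.1.2 - v.1.2 * w.1.1

lemma im_smul_row (γ : SL(2, ℤ)) (z : ℍ) : (γ • z).im =
    z.im / (((γ 1 0 : ℝ) * z.re + γ 1 1) ^ 2 + ((γ 1 0 : ℝ) * z.im) ^ 2) := by
  rw [ModularGroup.im_smul_eq_div_normSq]
  congr 1
  rw [ModularGroup.denom_apply, Complex.normSq_apply]
  simp
  ring

lemma im_sec (v : Prim) (z : ℍ) : (sec v • z).im =
    z.im / (((v.1.1 : ℝ) * z.re + v.1.2) ^ 2 + ((v.1.1 : ℝ) * z.im) ^ 2) := by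
  rw [im_smul_row]
  have h := row_sec v
  have h0 : (sec v) 1 0 = v.1.1 := congrArg (fun v : Prim => v.1.1) h
  have h1 : (sec v) 1 1 = v.1.2 := congrArg (fun v : Prim => v.1.2) h
  rw [h0, h1]

lemma sec_denom_pos (v : Prim) (z : ℍ) :
    0 < ((v.1.1 : ℝ) * z.re + v.1.2) ^ 2 + ((v.1.1 : ℝ) * z.im) ^ 2 := by
  by_contra h
  have h1 : (sec v • z).im ≤ 0 := by
    rw [im_sec]
    exact div_nonpos_of_nonneg_of_nonpos z.im_pos.le (not_lt.1 h)
  exact absurd (sec v • z).im_pos (not_lt.2 h1)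

lemma le_im_sec_iff {Y : ℝ} (hY : 0 < Y) (v : Prim) (z : ℍ) : 1 / Y ≤ (sec v • z).im ↔
    ((v.1.1 : ℝ) * z.re + v.1.2) ^ 2 + ((v.1.1 : ℝ) * z.im) ^ 2 ≤ Y * z.im := by
  rw [im_sec, div_le_div_iff₀ hY (sec_denom_pos v z)]
  constructor <;> intro h <;> linarith

/-- A box of integer vectors containing all those of bounded height. -/
noncomputable def heightBox (Y : ℝ) (z : ℍ) : Finset (ℤ × ℤ) :=
  {((0 : ℤ), (1 : ℤ)), (0, -1)} ∪
    ((Finset.Icc (-(⌊√(Y / z.im)⌋₊ : ℤ)) ⌊√(Y / z.im)⌋₊).erase 0).biUnion fun c =>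
      (Finset.Icc ⌈-(c * z.re) - √(Y * z.im)⌉ ⌊-(c * z.re) + √(Y * z.im)⌋).image fun d => (c, d)

lemma mem_heightBox {Y : ℝ} {z : ℍ} {v : Prim}
    (h : ((v.1.1 : ℝ) * z.re + v.1.2) ^ 2 + ((v.1.1 : ℝ) * z.im) ^ 2 ≤ Y * z.im) :
    v.1 ∈ heightBox Y z := by
  obtain ⟨⟨c, d⟩, hcop⟩ := v
  simp only at h hcop
  have hy := z.im_pos
  by_cases hc : c = 0
  · subst hc
    rw [isCoprime_zero_left, Int.isUnit_iff] at hcop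
    rcases hcop with rfl | rfl <;> simp [heightBox]
  · refine Finset.mem_union_right _ (Finset.mem_biUnion.2 ⟨c, ?_, Finset.mem_image.2 ⟨d, ?_, rfl⟩⟩)
    · have h1 : (c : ℝ) ^ 2 ≤ Y / z.im := by
        rw [le_div_iff₀ hy]
        have : (c : ℝ) ^ 2 * z.im * z.im ≤ Y * z.im := by
          nlinarith [sq_nonneg ((c : ℝ) * z.re + d)]
        exact le_of_mul_le_mul_right this hy
      have h2 : |(c : ℝ)| ≤ √(Y / z.im) := Real.abs_le_sqrt h1
      have h3 : c.natAbs ≤ ⌊√(Y / z.im)⌋₊ := Nat.le_floor (by rwa [Nat.cast_natAbs, Int.cast_abs])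
      rw [Finset.mem_erase, Finset.mem_Icc]
      exact ⟨hc, by omega, by omega⟩
    · have h1 := abs_le.1 (Real.abs_le_sqrt (show ((c : ℝ) * z.re + d) ^ 2 ≤ Y * z.im by
        nlinarith [sq_nonneg ((c : ℝ) * z.im)]))
      rw [Finset.mem_Icc, Int.ceil_le, Int.le_floor]
      constructor <;> linarith [h1.1, h1.2]

lemma card_heightBox_le {Y : ℝ} (hY : 1 ≤ Y) {z : ℍ} (hz : 1 / 2 ≤ z.im) :
    ((heightBox Y z).card : ℝ) ≤ 10 * Y := by
  have hy := z.im_pos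
  set C := ⌊√(Y / z.im)⌋₊ with hC
  have hCle : (C : ℝ) ≤ √(Y / z.im) := Nat.floor_le (Real.sqrt_nonneg _)
  have h1 : ∀ c ∈ (Finset.Icc (-(C : ℤ)) C).erase 0,
      (((Finset.Icc ⌈-(c * z.re) - √(Y * z.im)⌉ ⌊-(c * z.re) + √(Y * z.im)⌋).image
        fun d => (c, d)).card : ℝ) ≤ 2 * √(Y * z.im) + 1 := by
    intro c _
    refine (Nat.cast_le.2 Finset.card_image_le).trans ?_
    rw [Int.card_Icc]
    have hs := Real.sqrt_nonneg (Y * z.im)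
    have h2 := Int.floor_le (-(c * z.re) + √(Y * z.im))
    have h3 := Int.le_ceil (-(c * z.re) - √(Y * z.im))
    have h4 : ((⌊-(c * z.re) + √(Y * z.im)⌋ + 1 - ⌈-(c * z.re) - √(Y * z.im)⌉ : ℤ) : ℝ) ≤
        2 * √(Y * z.im) + 1 := by push_cast; linarith
    have h5 : (((⌊-(c * z.re) + √(Y * z.im)⌋ + 1 - ⌈-(c * z.re) - √(Y * z.im)⌉).toNat : ℤ) : ℝ) ≤
        2 * √(Y * z.im) + 1 := by
      rw [Int.toNat_eq_max]
      push_cast at h4 ⊢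
      exact max_le h4 (by positivity)
    exact_mod_cast h5
  have hcard : (((Finset.Icc (-(C : ℤ)) C).erase 0).card : ℝ) = 2 * C := by
    rw [Finset.card_erase_of_mem (by simp), Int.card_Icc]
    have : ((C : ℤ) + 1 - -(C : ℤ)).toNat - 1 = 2 * C := by omega
    rw [this]; push_cast; ring
  have h2 : ((heightBox Y z).card : ℝ) ≤ 2 + 2 * C * (2 * √(Y * z.im) + 1) := by
    have h3 := Finset.card_union_le ({((0 : ℤ), (1 : ℤ)), (0, -1)} : Finset (ℤ × ℤ))
      (((Finset.Icc (-(C : ℤ)) C).erase 0).biUnion fun c =>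
      (Finset.Icc ⌈-(c * z.re) - √(Y * z.im)⌉ ⌊-(c * z.re) + √(Y * z.im)⌋).image fun d => (c, d))
    have h4 := Finset.card_le_two (a := ((0 : ℤ), (1 : ℤ))) (b := (0, -1))
    have h5 := Finset.card_biUnion_le (s := (Finset.Icc (-(C : ℤ)) C).erase 0) (t := fun c =>
      (Finset.Icc ⌈-(c * z.re) - √(Y * z.im)⌉ ⌊-(c * z.re) + √(Y * z.im)⌋).image fun d => (c, d))
    have h6 : ((heightBox Y z).card : ℝ) ≤ 2 + ∑ c ∈ (Finset.Icc (-(C : ℤ)) C).erase 0,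
        (((Finset.Icc ⌈-(c * z.re) - √(Y * z.im)⌉ ⌊-(c * z.re) + √(Y * z.im)⌋).image
        fun d => (c, d)).card : ℝ) := by
      exact_mod_cast h3.trans (add_le_add h4 h5)
    refine h6.trans ?_
    have h7 := Finset.sum_le_sum h1
    rw [Finset.sum_const, nsmul_eq_mul, hcard] at h7
    linarith
  have h3 : √(Y / z.im) * √(Y * z.im) = Y := by
    rw [← Real.sqrt_mul (by positivity), show Y / z.im * (Y * z.im) = Y * Y by field_simp]
    exact Real.sqrt_mul_self (by linarith)
  have h4 : √(Y / z.im) ≤ 2 * Y := by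
    rw [Real.sqrt_le_left (by linarith)]
    rw [div_le_iff₀ hy]
    nlinarith
  have hs := Real.sqrt_nonneg (Y * z.im)
  have h5 : (C : ℝ) * √(Y * z.im) ≤ Y := by
    exact (mul_le_mul_of_nonneg_right hCle hs).trans h3.le
  nlinarith

lemma finite_height (Y : ℝ) (z : ℍ) : {v : Prim |
    ((v.1.1 : ℝ) * z.re + v.1.2) ^ 2 + ((v.1.1 : ℝ) * z.im) ^ 2 ≤ Y * z.im}.Finite :=
  Set.Finite.of_finite_image (f := Subtype.val)
    ((heightBox Y z).finite_toSet.subset (by rintro _ ⟨v, hv, rfl⟩; exact mem_heightBox hv))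
    Subtype.val_injective.injOn

/-- Primitive vectors of bounded height with respect to `z`. -/
noncomputable def lowVecs (Y : ℝ) (z : ℍ) : Finset Prim := (finite_height Y z).toFinset

lemma mem_lowVecs {Y : ℝ} (hY : 0 < Y) {z : ℍ} {v : Prim} :
    v ∈ lowVecs Y z ↔ 1 / Y ≤ (sec v • z).im := by
  rw [lowVecs, Set.Finite.mem_toFinset, Set.mem_ofPred_eq, le_im_sec_iff hY]

lemma card_lowVecs_le {Y : ℝ} (hY : 1 ≤ Y) {z : ℍ} (hz : 1 / 2 ≤ z.im) :
    ((lowVecs Y z).card : ℝ) ≤ 10 * Y := by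
  refine le_trans ?_ (card_heightBox_le hY hz)
  have : (lowVecs Y z).card ≤ (heightBox Y z).card := by
    refine Finset.card_le_card_of_injOn Subtype.val ?_ Subtype.val_injective.injOn
    intro v hv
    exact mem_heightBox ((finite_height Y z).mem_toFinset.1 hv)
  exact_mod_cast this

end Rows
end QuadRoots

namespace QuadRoots

section CuspMeasure
open MeasureTheory UpperHalfPlane ModularGroup
open scoped MatrixGroups ENNReal

lemma lintegral_cusp {y₀ C α : ℝ} (hy : 0 < y₀) (hC : 0 ≤ C) (hα : α < 1) :
    ∫⁻ w : ℂ in {w : ℂ | y₀ < w.im ∧ |w.re| ≤ C * w.im ^ α},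
      ↑((1 / ‖w.im‖₊) ^ 2 : NNReal) ≤ ENNReal.ofReal (2 * C * (y₀ ^ (α - 1) / (1 - α))) := by
  have hm : MeasurableSet {w : ℂ | y₀ < w.im ∧ |w.re| ≤ C * w.im ^ α} := by
    have h1 : MeasurableSet {w : ℂ | |w.re| ≤ C * w.im ^ α} :=
      measurableSet_le Complex.measurable_re.abs ((Complex.measurable_im.pow_const α).const_mul C)
    exact (measurableSet_lt measurable_const Complex.measurable_im).inter h1
  rw [← lintegral_indicator hm,
    ← (Complex.volume_preserving_equiv_real_prod.symm).lintegral_comp_emb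
      Complex.measurableEquivRealProd.symm.measurableEmbedding]
  rw [show (volume : Measure (ℝ × ℝ)) = (volume : Measure ℝ).prod volume from rfl]
  rw [lintegral_prod_symm']
  swap
  · have h1 : Measurable ({w : ℂ | y₀ < w.im ∧ |w.re| ≤ C * w.im ^ α}.indicator
        (fun w : ℂ => (((1 / ‖w.im‖₊) ^ 2 : NNReal) : ℝ≥0∞))) :=
      Measurable.indicator (by fun_prop) hm
    exact h1.comp Complex.measurableEquivRealProd.symm.measurable
  have h1 : ∀ y : ℝ, ∫⁻ x : ℝ, ({w : ℂ | y₀ < w.im ∧ |w.re| ≤ C * w.im ^ α}.indicator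
      (fun w : ℂ => (((1 / ‖w.im‖₊) ^ 2 : NNReal) : ℝ≥0∞))
        (Complex.measurableEquivRealProd.symm (x, y))) =
      (Set.Ioi y₀).indicator (fun y => ENNReal.ofReal (2 * C * y ^ (α - 2))) y := by
    intro y
    by_cases h : y₀ < y
    · rw [Set.indicator_of_mem (by exact h)]
      have hy' : 0 < y := hy.trans h
      have h2 : ∀ x : ℝ, ({w : ℂ | y₀ < w.im ∧ |w.re| ≤ C * w.im ^ α}.indicator
        (fun w : ℂ => (((1 / ‖w.im‖₊) ^ 2 : NNReal) : ℝ≥0∞))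
        (Complex.measurableEquivRealProd.symm (x, y))) =
        (Set.Icc (-(C * y ^ α)) (C * y ^ α)).indicator
          (fun _ => (((1 / ‖y‖₊) ^ 2 : NNReal) : ℝ≥0∞)) x := by
        intro x
        simp only [Set.indicator, Set.mem_ofPred_eq, Set.mem_Icc, abs_le,
          Complex.measurableEquivRealProd_symm_apply]
        simp [h]
      rw [lintegral_congr h2, lintegral_indicator measurableSet_Icc, setLIntegral_const,
        Real.volume_Icc]
      have h3 : (((1 / ‖y‖₊) ^ 2 : NNReal) : ℝ≥0∞) = ENNReal.ofReal ((1 / y) ^ 2) := by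
        rw [ENNReal.ofReal, ENNReal.coe_inj]
        ext
        rw [Real.coe_toNNReal _ (by positivity)]
        simp [abs_of_pos hy']
      rw [h3, ← ENNReal.ofReal_mul (by positivity)]
      congr 1
      rw [Real.rpow_sub hy', Real.rpow_two]
      field_simp
      ring
    · rw [Set.indicator_of_notMem (by exact h)]
      simp [Set.indicator, h]
  rw [lintegral_congr h1, lintegral_indicator measurableSet_Ioi,
    ← ofReal_integral_eq_lintegral_ofReal]
  · rw [integral_const_mul, integral_Ioi_rpow_of_lt (by linarith) hy]
    refine ENNReal.ofReal_le_ofReal (le_of_eq ?_)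
    rw [show α - 2 + 1 = α - 1 by ring, ← neg_div_neg_eq, neg_neg, neg_sub]
  · exact (integrableOn_Ioi_rpow_of_lt (by linarith) hy).const_mul _
  · filter_upwards [ae_restrict_mem measurableSet_Ioi] with y h
    have : 0 < y := hy.trans h
    change 0 ≤ _
    positivity

lemma volume_cusp_le {y₀ C α : ℝ} (hy : 0 < y₀) (hC : 0 ≤ C) (hα : α < 1) :
    volume {z : ℍ | y₀ < z.im ∧ |z.re| ≤ C * z.im ^ α} ≤
      ENNReal.ofReal (2 * C * (y₀ ^ (α - 1) / (1 - α))) := by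
  rw [volume_eq_lintegral]
  refine le_trans (lintegral_mono_set ?_) (lintegral_cusp hy hC hα)
  rintro _ ⟨z, hz, rfl⟩
  exact hz

lemma volume_siegel_lt_top : volume siegel < ∞ := by
  refine lt_of_le_of_lt (le_trans (measure_mono ?_)
    (volume_cusp_le (y₀ := 1 / 4) (C := 1) (α := 0) (by norm_num) (by norm_num) (by norm_num)))
    ENNReal.ofReal_lt_top
  intro z hz
  refine ⟨lt_of_lt_of_le (by norm_num) hz.2, ?_⟩
  simpa using hz.1

/-- The points of height at least `1 / Y` whose image under `z ↦ -1 / (k ^ 2 z)` also has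
height at least `1 / Y`. -/
def overlapRegion (Y k : ℝ) : Set ℍ :=
  {z | 1 / Y ≤ z.im ∧ k ^ 2 * (z.re ^ 2 + z.im ^ 2) ≤ Y * z.im}

lemma volume_overlapRegion_le {Y k : ℝ} (hY : 0 < Y) (hk : 0 < k) :
    volume (overlapRegion Y k) ≤ ENNReal.ofReal (8 * Y / k) := by
  refine le_trans (le_trans (measure_mono ?_)
    (volume_cusp_le (y₀ := 1 / (4 * Y)) (C := √Y / k) (α := 1 / 2) (by positivity)
      (by positivity) (by norm_num))) (ENNReal.ofReal_le_ofReal (le_of_eq ?_))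
  · rintro z ⟨h1, h2⟩
    refine ⟨lt_of_lt_of_le ?_ h1, ?_⟩
    · gcongr; linarith
    · rw [← Real.sqrt_eq_rpow, div_mul_eq_mul_div, le_div_iff₀ hk, ← Real.sqrt_mul hY.le]
      refine Real.le_sqrt_of_sq_le ?_
      rw [mul_pow, sq_abs]
      nlinarith [mul_nonneg (sq_nonneg k) (sq_nonneg z.im)]
  · rw [show (1 / 2 - 1 : ℝ) = -(1 / 2) by norm_num, Real.rpow_neg (by positivity),
      ← Real.sqrt_eq_rpow, one_div (4 * Y), Real.sqrt_inv, inv_inv, Real.sqrt_mul (by norm_num),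
      show √(4 : ℝ) = 2 by rw [show (4 : ℝ) = 2 ^ 2 by norm_num]; simp]
    have := Real.mul_self_sqrt hY.le
    field_simp
    nlinarith

lemma measurableSet_overlapRegion (Y k : ℝ) : MeasurableSet (overlapRegion Y k) := by
  have h1 : Measurable (UpperHalfPlane.re) := continuous_re.measurable
  have h2 : Measurable (UpperHalfPlane.im) := continuous_im.measurable
  have h3 : MeasurableSet {z : ℍ | k ^ 2 * (z.re ^ 2 + z.im ^ 2) ≤ Y * z.im} :=
    measurableSet_le (by fun_prop) (by fun_prop)
  exact (measurableSet_le measurable_const h2).inter h3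

noncomputable def translationMatrix (t : ℝ) : GL (Fin 2) ℝ :=
  Matrix.GeneralLinearGroup.mkOfDetNeZero !![1, t; 0, 1] (by simp)

lemma translationMatrix_smul (t : ℝ) (z : ℍ) : translationMatrix t • z = t +ᵥ z := by
  have hd : 0 < (translationMatrix t).val.det := by
    simp [translationMatrix, Matrix.GeneralLinearGroup.mkOfDetNeZero]
  apply UpperHalfPlane.ext
  rw [UpperHalfPlane.coe_smul_of_det_pos hd, coe_vadd]
  simp [num, denom, translationMatrix, Matrix.GeneralLinearGroup.mkOfDetNeZero, add_comm]

instance : VAddInvariantMeasure ℝ ℍ volume :=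
  ⟨fun t s hs => by
    have := measure_preimage_smul_of_nullMeasurableSet
      (μ := (volume : Measure ℍ)) hs.nullMeasurableSet (translationMatrix t)
    simpa only [translationMatrix_smul] using this⟩

instance : MeasurableConstVAdd ℝ ℍ :=
  ⟨fun t => (isometry_real_vadd t).continuous.measurable⟩

end CuspMeasure
end QuadRoots

namespace QuadRoots

section Pairs
open MeasureTheory UpperHalfPlane ModularGroup ComplexConjugate
open scoped MatrixGroups

lemma T_zpow_mul_00 (n : ℤ) (γ : SL(2, ℤ)) : (T ^ n * γ) 0 0 = γ 0 0 + n * γ 1 0 := by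
  rw [Matrix.SpecialLinearGroup.coe_mul, coe_T_zpow, Matrix.mul_apply, Fin.sum_univ_two]; simp

lemma T_zpow_mul_01 (n : ℤ) (γ : SL(2, ℤ)) : (T ^ n * γ) 0 1 = γ 0 1 + n * γ 1 1 := by
  rw [Matrix.SpecialLinearGroup.coe_mul, coe_T_zpow, Matrix.mul_apply, Fin.sum_univ_two]; simp

lemma T_zpow_mul_10 (n : ℤ) (γ : SL(2, ℤ)) : (T ^ n * γ) 1 0 = γ 1 0 := by
  rw [SL_mul_10, coe_T_zpow]; simp

lemma T_zpow_mul_11 (n : ℤ) (γ : SL(2, ℤ)) : (T ^ n * γ) 1 1 = γ 1 1 := by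
  rw [SL_mul_11, coe_T_zpow]; simp

/-- An element of the modular group with bottom row `(k, u)`. -/
noncomputable def tau (k : ℕ) [NeZero k] (u : (ZMod k)ˣ) : SL(2, ℤ) :=
  sec ⟨((k : ℤ), ((u : ZMod k).val : ℤ)),
    (Nat.isCoprime_iff_coprime.2 (ZMod.val_coe_unit_coprime u)).symm⟩

lemma tau_10 (k : ℕ) [NeZero k] (u : (ZMod k)ˣ) : (tau k u) 1 0 = k :=
  congrArg (fun v : Prim => v.1.1) (row_sec _)

lemma tau_11 (k : ℕ) [NeZero k] (u : (ZMod k)ˣ) : (tau k u) 1 1 = ((u : ZMod k).val : ℤ) :=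
  congrArg (fun v : Prim => v.1.2) (row_sec _)

noncomputable def pairMap (k : ℕ) [NeZero k] (p : (ZMod k)ˣ × SL(2, ℤ)) : Prim × Prim :=
  (row (tau k p.1 * p.2), row p.2)

lemma det_pairMap (k : ℕ) [NeZero k] (p : (ZMod k)ˣ × SL(2, ℤ)) :
    (pairMap k p).1.det (pairMap k p).2 = k := by
  simp only [pairMap, row, Prim.det, SL_mul_10, SL_mul_11, tau_10]
  linear_combination (k : ℤ) * SL_det p.2

lemma pairMap_injective (k : ℕ) [NeZero k] : Function.Injective (pairMap k) := by
  rintro ⟨u, γ⟩ ⟨u', γ'⟩ h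
  have h2 : row γ = row γ' := congrArg Prod.snd h
  obtain ⟨n, rfl⟩ := exists_zpow_of_row_eq h2
  have h1 : row (tau k u * γ) = row (tau k u' * (T ^ n * γ)) := congrArg Prod.fst h
  have e0 : (tau k u * γ) 1 0 = (tau k u' * (T ^ n * γ)) 1 0 :=
    congrArg (fun v : Prim => v.1.1) h1
  have e1 : (tau k u * γ) 1 1 = (tau k u' * (T ^ n * γ)) 1 1 :=
    congrArg (fun v : Prim => v.1.2) h1
  rw [SL_mul_10, SL_mul_10, tau_10, tau_10, tau_11, tau_11, T_zpow_mul_00, T_zpow_mul_10] at e0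
  rw [SL_mul_11, SL_mul_11, tau_10, tau_10, tau_11, tau_11, T_zpow_mul_01, T_zpow_mul_11] at e1
  have d := SL_det γ
  have key : ((u : ZMod k).val : ℤ) = k * n + (u' : ZMod k).val := by
    linear_combination (γ 0 0) * e1 - γ 0 1 * e0 + (-((u : ZMod k).val : ℤ) +
      (k * n + ((u' : ZMod k).val : ℤ))) * d
  have hu := ZMod.val_lt (u : ZMod k)
  have hu' := ZMod.val_lt (u' : ZMod k)
  have hn : n = 0 := by
    have h1 : (k : ℤ) * n < k * 1 := by lia
    have h2 : (k : ℤ) * (-1) < k * n := by lia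
    have hk : (0 : ℤ) < k := by exact_mod_cast NeZero.pos k
    have := lt_of_mul_lt_mul_left h1 hk.le
    have := lt_of_mul_lt_mul_left h2 hk.le
    omega
  subst hn
  have huu : u = u' := by
    apply Units.ext
    apply ZMod.val_injective
    simp only [mul_zero, zero_add] at key
    exact_mod_cast key
  simp [huu]

lemma mem_range_pairMap (k : ℕ) [NeZero k] {p : Prim × Prim} (hp : p.1.det p.2 = k) :
    p ∈ Set.range (pairMap k) := by
  obtain ⟨v, w⟩ := p
  simp only at hp
  set γ := sec w with hγ
  have hw : row γ = w := row_sec w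
  have g0 : γ 1 0 = w.1.1 := congrArg (fun v : Prim => v.1.1) hw
  have g1 : γ 1 1 = w.1.2 := congrArg (fun v : Prim => v.1.2) hw
  have d := SL_det γ
  rw [g0, g1] at d
  set δ : ℤ := -v.1.1 * γ 0 1 + v.1.2 * γ 0 0 with hδ
  rw [Prim.det] at hp
  have hv0 : v.1.1 = k * γ 0 0 + δ * w.1.1 := by rw [← hp]; linear_combination (-v.1.1) * d
  have hv1 : v.1.2 = k * γ 0 1 + δ * w.1.2 := by rw [← hp]; linear_combination (-v.1.2) * d
  have hcop : IsCoprime δ (k : ℤ) := by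
    obtain ⟨x, y, hxy⟩ := v.2
    refine ⟨x * w.1.1 + y * w.1.2, x * γ 0 0 + y * γ 0 1, ?_⟩
    linear_combination (-x) * hv0 - y * hv1 + hxy
  have hunit : IsUnit (δ : ZMod k) := by
    obtain ⟨x, y, hxy⟩ := hcop
    refine IsUnit.of_mul_eq_one (x : ZMod k) ?_
    have := congrArg (Int.cast : ℤ → ZMod k) hxy
    push_cast at this
    simpa [mul_comm] using this
  obtain ⟨u, hu⟩ := hunit
  have : (k : ℤ) ∣ δ - ((u : ZMod k).val : ℤ) := by
    rw [← ZMod.intCast_zmod_eq_zero_iff_dvd]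
    push_cast
    rw [ZMod.natCast_zmod_val, hu, sub_self]
  obtain ⟨n, hn⟩ := this
  refine ⟨(u, T ^ n * γ), ?_⟩
  refine Prod.ext (Subtype.ext (Prod.ext ?_ ?_)) ?_
  · change (tau k u * (T ^ n * γ)) 1 0 = v.1.1
    rw [SL_mul_10, tau_10, tau_11, T_zpow_mul_00, T_zpow_mul_10, g0, hv0]
    linear_combination (-w.1.1) * hn
  · change (tau k u * (T ^ n * γ)) 1 1 = v.1.2
    rw [SL_mul_11, tau_10, tau_11, T_zpow_mul_01, T_zpow_mul_11, g1, hv1]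
    linear_combination (-w.1.2) * hn
  · change row (T ^ n * γ) = w
    rw [row_zpow_mul, hw]

/-- The sum of `F ⊗ conj F` over pairs of low vectors of given determinant. -/
noncomputable def pairSum (F : ℍ → ℂ) (Y : ℝ) (k : ℤ) (z : ℍ) : ℂ :=
  ∑ p ∈ (lowVecs Y z ×ˢ lowVecs Y z).filter (fun p => p.1.det p.2 = k),
    F (sec p.1 • z) * conj (F (sec p.2 • z))

lemma hasSum_pairs {F : ℍ → ℂ} (hF : Periodic F) {Y : ℝ} (hY : 0 < Y)
    (hF0 : ∀ w : ℍ, w.im < 1 / Y → F w = 0) (k : ℕ) [NeZero k] (z : ℍ) :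
    HasSum (fun p : (ZMod k)ˣ × SL(2, ℤ) => F (tau k p.1 • p.2 • z) * conj (F (p.2 • z)))
      (pairSum F Y k z) := by
  classical
  set f : Prim × Prim → ℂ := fun p =>
    if p.1.det p.2 = k then F (sec p.1 • z) * conj (F (sec p.2 • z)) else 0 with hf
  have h1 : HasSum f (pairSum F Y k z) := by
    rw [pairSum, Finset.sum_filter]
    refine hasSum_sum_of_ne_finset_zero (L := .unconditional _) ?_
    intro p hp
    rw [Finset.mem_product, mem_lowVecs hY, mem_lowVecs hY, not_and_or, not_le, not_le] at hp
    simp only [hf]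
    rcases hp with hp | hp <;> rw [hF0 _ hp] <;> simp
  rw [← (pairMap_injective k).hasSum_iff] at h1
  · convert h1 using 2 with p
    simp only [Function.comp, hf, det_pairMap, if_true]
    simp only [pairMap, hF.sec_row, mul_smul]
  · intro p hp
    simp only [hf]
    rw [if_neg]
    exact fun h => hp (mem_range_pairMap k h)

lemma unfold_pairSum {F : ℍ → ℂ} (hF : Periodic F) {Y : ℝ} (hY : 0 < Y)
    (hF0 : ∀ w : ℍ, w.im < 1 / Y → F w = 0) (k : ℕ) [NeZero k]
    (hInt : ∀ u : (ZMod k)ˣ, Integrable fun w : ℍ => F (tau k u • w) * conj (F w)) :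
    Integrable (fun z => (weight z : ℂ) * pairSum F Y k z) ∧
      ∫ z, (weight z : ℂ) * pairSum F Y k z =
        ∑ u : (ZMod k)ˣ, ∫ w : ℍ, F (tau k u • w) * conj (F w) := by
  have h0 := fun z => hasSum_pairs hF hY hF0 k z
  set S : (ZMod k)ˣ → ℍ → ℂ := fun u z =>
    ∑' γ : SL(2, ℤ), F (tau k u • γ • z) * conj (F (γ • z))
  have h1 : ∀ u z, HasSum (fun γ : SL(2, ℤ) => F (tau k u • γ • z) * conj (F (γ • z))) (S u z) :=
    fun u z => ((h0 z).summable.prod_factor u).hasSum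
  have h2 : ∀ z, pairSum F Y k z = ∑ u, S u z := fun z =>
    ((h0 z).prod_fiberwise fun u => h1 u z).unique (hasSum_fintype _)
  have h3 := fun u => unfold_integral (hInt u) (h1 u)
  simp_rw [h2, Finset.mul_sum]
  refine ⟨integrable_finsetSum _ fun u _ => (h3 u).1, ?_⟩
  rw [integral_finsetSum _ fun u _ => (h3 u).1]
  exact Finset.sum_congr rfl fun u _ => (h3 u).2

end Pairs
end QuadRoots

namespace QuadRoots

section CuspPhase
open MeasureTheory UpperHalfPlane ModularGroup ComplexConjugate
open scoped MatrixGroups Real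

/-- The additive character `t ↦ e^{2πit}` of the real line. -/
noncomputable def ft (t : ℝ) : ℂ := Complex.exp (2 * π * Complex.I * t)

lemma norm_ft (t : ℝ) : ‖ft t‖ = 1 := by
  rw [ft, show 2 * (π : ℂ) * Complex.I * t = ((2 * π * t : ℝ) : ℂ) * Complex.I by push_cast; ring]
  exact Complex.norm_exp_ofReal_mul_I _

lemma ft_add (s t : ℝ) : ft (s + t) = ft s * ft t := by
  rw [ft, ft, ft, ← Complex.exp_add]; push_cast; ring_nf

lemma conj_ft (t : ℝ) : conj (ft t) = ft (-t) := by
  rw [ft, ft, ← Complex.exp_conj]; simp [map_ofNat]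

lemma ft_int (n : ℤ) : ft n = 1 := by
  rw [ft, ← Complex.exp_int_mul_two_pi_mul_I n]; push_cast; ring_nf

lemma continuous_ft : Continuous ft := by unfold ft; fun_prop

lemma ft_eq_stdAddChar (k : ℕ) [NeZero k] (n : ℤ) : ft ((n : ℝ) / k) = ZMod.stdAddChar (n : ZMod k) := by
  rw [ZMod.stdAddChar_coe, ft]; push_cast; ring_nf

open Classical in
/-- The function `e(-h (x + κ y))` cut off at height `1 / Y`. -/
noncomputable def cuspPhase (h : ℤ) (κ Y : ℝ) (w : ℍ) : ℂ :=
  if 1 / Y ≤ w.im then ft (-(h * (w.re + κ * w.im))) else 0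

lemma norm_cuspPhase_le (h : ℤ) (κ Y : ℝ) (w : ℍ) : ‖cuspPhase h κ Y w‖ ≤ 1 := by
  rw [cuspPhase]; split_ifs <;> simp [norm_ft]

lemma cuspPhase_eq_zero {h : ℤ} {κ Y : ℝ} {w : ℍ} (hw : w.im < 1 / Y) : cuspPhase h κ Y w = 0 :=
  if_neg (not_le.2 hw)

lemma periodic_cuspPhase (h : ℤ) (κ Y : ℝ) : Periodic (cuspPhase h κ Y) := by
  intro n z
  rw [cuspPhase, cuspPhase, im_T_zpow_smul, re_T_zpow_smul]
  congr 1
  rw [show -((h : ℝ) * (z.re + n + κ * z.im)) = -(h * (z.re + κ * z.im)) + ((-(h * n) : ℤ) : ℝ) by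
    push_cast; ring, ft_add, ft_int, mul_one]

lemma re_smul_mul (γ : SL(2, ℤ)) (z : ℍ) :
    (γ 1 0 : ℝ) * (γ • z).re * (((γ 1 0 : ℝ) * z.re + γ 1 1) ^ 2 + ((γ 1 0 : ℝ) * z.im) ^ 2) =
      γ 0 0 * (((γ 1 0 : ℝ) * z.re + γ 1 1) ^ 2 + ((γ 1 0 : ℝ) * z.im) ^ 2) -
        ((γ 1 0 : ℝ) * z.re + γ 1 1) := by
  have hden : ((γ 1 0 : ℝ) : ℂ) * z + ((γ 1 1 : ℝ) : ℂ) ≠ 0 := by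
    have := sec_denom_pos (row γ) z
    intro h0
    have hre := congrArg Complex.re h0
    have him := congrArg Complex.im h0
    simp only [Complex.add_re, Complex.mul_re, Complex.ofReal_re, Complex.ofReal_im,
      Complex.add_im, Complex.mul_im, coe_re, coe_im, Complex.zero_re, Complex.zero_im] at hre him
    simp only [row] at this
    nlinarith
  have h1 : ((γ • z : ℍ) : ℂ) * (((γ 1 0 : ℝ) : ℂ) * z + ((γ 1 1 : ℝ) : ℂ)) =
      ((γ 0 0 : ℝ) : ℂ) * z + ((γ 0 1 : ℝ) : ℂ) := by
    rw [coe_specialLinearGroup_apply]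
    simp only [algebraMap_int_eq, eq_intCast]
    exact div_mul_cancel₀ _ hden
  have hre := congrArg Complex.re h1
  have him := congrArg Complex.im h1
  simp only [Complex.add_re, Complex.mul_re, Complex.ofReal_re, Complex.ofReal_im,
      Complex.add_im, Complex.mul_im, coe_re, coe_im] at hre him
  have d : (γ 0 0 : ℝ) * γ 1 1 - γ 0 1 * γ 1 0 = 1 := by exact_mod_cast SL_det γ
  linear_combination (γ 1 0 : ℝ) * (γ 1 0 * z.re + γ 1 1) * hre +
    (γ 1 0 : ℝ) * (γ 1 0 * z.im) * him - ((γ 1 0 : ℝ) * z.re + γ 1 1) * d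

open Classical in
noncomputable def overlapPhase (h : ℤ) (κ Y k : ℝ) (w : ℍ) : ℂ :=
  if w ∈ overlapRegion Y k then
    ft (-(h * (-(w.re / (k ^ 2 * (w.re ^ 2 + w.im ^ 2))) +
      κ * (w.im / (k ^ 2 * (w.re ^ 2 + w.im ^ 2)))))) * ft (h * (w.re + κ * w.im)) else 0

lemma norm_overlapPhase_le (h : ℤ) (κ Y k : ℝ) (w : ℍ) :
    ‖overlapPhase h κ Y k w‖ ≤ (overlapRegion Y k).indicator 1 w := by
  rw [overlapPhase, Set.indicator]; split_ifs <;> simp [norm_ft]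

lemma measurable_overlapPhase (h : ℤ) (κ Y k : ℝ) : Measurable (overlapPhase h κ Y k) := by
  have h1 : Measurable (UpperHalfPlane.re) := continuous_re.measurable
  have h2 : Measurable (UpperHalfPlane.im) := continuous_im.measurable
  have h3 := continuous_ft.measurable
  refine Measurable.ite (measurableSet_overlapRegion Y k) ?_ measurable_const
  exact (h3.comp (by fun_prop)).mul (h3.comp (by fun_prop))

lemma integrable_indicator_overlapRegion {Y k : ℝ} (hY : 0 < Y) (hk : 0 < k) :
    Integrable ((overlapRegion Y k).indicator (1 : ℍ → ℝ)) := by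
  rw [integrable_indicator_iff (measurableSet_overlapRegion Y k)]
  have := (volume_overlapRegion_le hY hk).trans_lt ENNReal.ofReal_lt_top
  exact integrableOn_const (C := (1 : ℝ)) this.ne

lemma integrable_overlapPhase (h : ℤ) (κ : ℝ) {Y k : ℝ} (hY : 0 < Y) (hk : 0 < k) :
    Integrable (overlapPhase h κ Y k) :=
  (integrable_indicator_overlapRegion hY hk).mono'
    (measurable_overlapPhase h κ Y k).aestronglyMeasurable
    (Filter.Eventually.of_forall (norm_overlapPhase_le h κ Y k))

lemma norm_integral_overlapPhase_le (h : ℤ) (κ : ℝ) {Y k : ℝ} (hY : 0 < Y) (hk : 0 < k) :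
    ‖∫ w, overlapPhase h κ Y k w‖ ≤ 8 * Y / k := by
  refine (norm_integral_le_of_norm_le (integrable_indicator_overlapRegion hY hk)
    (Filter.Eventually.of_forall (norm_overlapPhase_le h κ Y k))).trans ?_
  rw [integral_indicator_one (measurableSet_overlapRegion Y k)]
  exact ENNReal.toReal_le_of_le_ofReal (by positivity) (volume_overlapRegion_le hY hk)

lemma cuspPhase_tau (h : ℤ) (κ : ℝ) {Y : ℝ} (hY : 0 < Y) (k : ℕ) [NeZero k] (u : (ZMod k)ˣ)
    (w : ℍ) : cuspPhase h κ Y (tau k u • w) * conj (cuspPhase h κ Y w) =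
      ZMod.stdAddChar (((-h : ℤ) : ZMod k) * ((u : ZMod k) + ((u⁻¹ : (ZMod k)ˣ) : ZMod k))) *
        overlapPhase h κ Y k (((((u : ZMod k).val : ℝ)) / k) +ᵥ w) := by
  have hk : (0 : ℝ) < k := by exact_mod_cast NeZero.pos k
  set d : ℝ := ((u : ZMod k).val : ℝ) with hd
  set a : ℤ := (tau k u) 0 0 with ha
  have t0 : (((tau k u) 1 0 : ℤ) : ℝ) = k := by rw [tau_10]; simp
  have t1 : (((tau k u) 1 1 : ℤ) : ℝ) = d := by rw [tau_11]; simp only [hd, Int.cast_natCast]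
  set z : ℍ := (d / k) +ᵥ w with hz
  have zre : z.re = d / k + w.re := vadd_re _ _
  have zim : z.im = w.im := vadd_im _ _
  have hN : ((k : ℝ) * w.re + d) ^ 2 + (k * w.im) ^ 2 = k ^ 2 * (z.re ^ 2 + z.im ^ 2) := by
    rw [zre, zim]; field_simp; ring
  have hNpos : 0 < (k : ℝ) ^ 2 * (z.re ^ 2 + z.im ^ 2) := by
    have := z.im_pos; positivity
  have him : (tau k u • w).im = z.im / (k ^ 2 * (z.re ^ 2 + z.im ^ 2)) := by
    rw [im_smul_row, t0, t1, hN, zim]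
  have hre : (tau k u • w).re = a / k - z.re / (k ^ 2 * (z.re ^ 2 + z.im ^ 2)) := by
    have := re_smul_mul (tau k u) w
    rw [t0, t1, hN] at this
    have h2 : (k : ℝ) * w.re + d = k * z.re := by rw [zre]; field_simp; ring
    rw [h2] at this
    field_simp
    refine mul_left_cancel₀ hk.ne' ?_
    linear_combination this
  have hmem : (1 / Y ≤ (tau k u • w).im ∧ 1 / Y ≤ w.im) ↔ z ∈ overlapRegion Y k := by
    rw [him, overlapRegion, Set.mem_ofPred_eq, ← zim, and_comm, div_le_div_iff₀ hY hNpos]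
    constructor <;> rintro ⟨h1, h2⟩ <;> exact ⟨h1, by linarith⟩
  by_cases hin : z ∈ overlapRegion Y k
  · obtain ⟨h1, h2⟩ := hmem.2 hin
    rw [cuspPhase, cuspPhase, overlapPhase, if_pos h1, if_pos h2, if_pos hin, conj_ft]
    have hchar : ZMod.stdAddChar (((-h : ℤ) : ZMod k) *
        ((u : ZMod k) + ((u⁻¹ : (ZMod k)ˣ) : ZMod k))) = ft (-(h * (a / k)) - h * (d / k)) := by
      have hinv : ((u⁻¹ : (ZMod k)ˣ) : ZMod k) = (a : ZMod k) := by
        apply Units.inv_eq_of_mul_eq_one_right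
        have := congrArg (Int.cast : ℤ → ZMod k) (SL_det (tau k u))
        rw [tau_10, tau_11] at this
        push_cast at this
        rw [ZMod.natCast_self, mul_zero, sub_zero, ZMod.natCast_zmod_val] at this
        rw [mul_comm]; exact this
      have hu : (u : ZMod k) = (((u : ZMod k).val : ℤ) : ZMod k) := by
        push_cast; rw [ZMod.natCast_zmod_val]
      rw [hinv]
      nth_rewrite 1 [hu]
      rw [← Int.cast_add, ← Int.cast_mul, ← ft_eq_stdAddChar]
      congr 1
      push_cast
      rw [← hd]
      ring
    rw [hchar, ← ft_add, ← ft_add, ← ft_add, hre, him]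
    congr 1
    rw [zre, zim]
    ring
  · rw [overlapPhase, if_neg hin, mul_zero]
    rcases not_and_or.1 (fun h => hin (hmem.1 h)) with h1 | h1
    · rw [cuspPhase, if_neg h1, zero_mul]
    · rw [cuspPhase_eq_zero (not_le.1 h1), map_zero, mul_zero]

lemma integrable_vadd {g : ℍ → ℂ} (hg : Integrable g) (t : ℝ) :
    Integrable (fun w : ℍ => g (t +ᵥ w)) := by
  have mp : MeasurePreserving (fun w : ℍ => t +ᵥ w) volume volume := measurePreserving_vadd t volume
  exact mp.integrable_comp_of_integrable (g := g) hg

lemma weighted_pairSum (h : ℤ) (κ : ℝ) {Y : ℝ} (hY : 0 < Y) (k : ℕ) [NeZero k] :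
    Integrable (fun z => (weight z : ℂ) * pairSum (cuspPhase h κ Y) Y k z) ∧
      ‖∫ z, (weight z : ℂ) * pairSum (cuspPhase h κ Y) Y k z‖ ≤ klNorm (-h) k * (8 * Y / k) := by
  have hk : (0 : ℝ) < k := by exact_mod_cast NeZero.pos k
  have hInt : ∀ u : (ZMod k)ˣ, Integrable fun w : ℍ =>
      cuspPhase h κ Y (tau k u • w) * conj (cuspPhase h κ Y w) := by
    intro u
    rw [funext (cuspPhase_tau h κ hY k u)]
    exact (integrable_vadd (integrable_overlapPhase h κ hY hk) _).const_mul _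
  obtain ⟨h1, h2⟩ := unfold_pairSum (periodic_cuspPhase h κ Y) hY
    (fun w hw => cuspPhase_eq_zero hw) k hInt
  refine ⟨h1, ?_⟩
  have h3 : ∀ u : (ZMod k)ˣ, ∫ w : ℍ, cuspPhase h κ Y (tau k u • w) * conj (cuspPhase h κ Y w) =
      ZMod.stdAddChar (((-h : ℤ) : ZMod k) * ((u : ZMod k) + ((u⁻¹ : (ZMod k)ˣ) : ZMod k))) *
        ∫ w, overlapPhase h κ Y k w := by
    intro u
    rw [funext (cuspPhase_tau h κ hY k u)]
    rw [integral_const_mul, integral_vadd_eq_self (μ := (volume : Measure ℍ))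
      (overlapPhase h κ Y k)]
  rw [h2, Finset.sum_congr rfl fun u _ => h3 u, ← Finset.sum_mul, norm_mul]
  have : klNorm (-h) k = ‖∑ u : (ZMod k)ˣ, ZMod.stdAddChar (((-h : ℤ) : ZMod k) *
      ((u : ZMod k) + ((u⁻¹ : (ZMod k)ˣ) : ZMod k)))‖ := by
    rw [klNorm, dif_neg (NeZero.ne k), kl]
  rw [this]
  exact mul_le_mul_of_nonneg_left (norm_integral_overlapPhase_le h κ hY hk) (norm_nonneg _)

end CuspPhase
end QuadRoots

namespace QuadRoots

section Majorant
open MeasureTheory UpperHalfPlane ModularGroup ComplexConjugate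
open scoped MatrixGroups Real

lemma Prim.det_swap (v w : Prim) : w.det v = -v.det w := by
  simp only [Prim.det]; ring

lemma Prim.exists_eq_mul_of_det_eq_zero {v w : Prim} (h : v.det w = 0) :
    ∃ t : ℤ, (t = 1 ∨ t = -1) ∧ w.1 = (t * v.1.1, t * v.1.2) := by
  obtain ⟨x, y, hxy⟩ := v.2
  obtain ⟨x', y', hxy'⟩ := w.2
  rw [Prim.det] at h
  have h1 : w.1.1 = (x * w.1.1 + y * w.1.2) * v.1.1 := by
    linear_combination (-w.1.1) * hxy - y * h
  have h2 : w.1.2 = (x * w.1.1 + y * w.1.2) * v.1.2 := by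
    linear_combination (-w.1.2) * hxy + x * h
  refine ⟨x * w.1.1 + y * w.1.2, ?_, Prod.ext h1 h2⟩
  refine Int.isUnit_iff.1 (IsUnit.of_mul_eq_one (x' * v.1.1 + y' * v.1.2) ?_)
  linear_combination hxy' - x' * h1 - y' * h2

lemma abs_det_le {Y : ℝ} (hY : 0 < Y) {z : ℍ} {v w : Prim} (hv : v ∈ lowVecs Y z)
    (hw : w ∈ lowVecs Y z) : |(v.det w : ℝ)| ≤ Y := by
  rw [mem_lowVecs hY, le_im_sec_iff hY] at hv hw
  have hy := z.im_pos
  set p := (v.1.1 : ℝ) * z.re + v.1.2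
  set q := (v.1.1 : ℝ) * z.im
  set p' := (w.1.1 : ℝ) * z.re + w.1.2
  set q' := (w.1.1 : ℝ) * z.im
  have hd : (v.det w : ℝ) * z.im = q * p' - p * q' := by
    simp only [Prim.det, p, q, p', q']; push_cast; ring
  have h1 : (q * p' - p * q') ^ 2 ≤ (Y * z.im) ^ 2 :=
    calc (q * p' - p * q') ^ 2 ≤ (p ^ 2 + q ^ 2) * (p' ^ 2 + q' ^ 2) := by
          nlinarith [sq_nonneg (p * p' + q * q')]
      _ ≤ (Y * z.im) * (Y * z.im) := by gcongr
      _ = _ := by ring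
  have h2 := abs_le_of_sq_le_sq h1 (by positivity)
  rw [← hd, abs_mul, abs_of_pos hy] at h2
  exact le_of_mul_le_mul_right h2 hy

lemma pairSum_neg (F : ℍ → ℂ) (Y : ℝ) (k : ℤ) (z : ℍ) :
    pairSum F Y (-k) z = conj (pairSum F Y k z) := by
  rw [pairSum, pairSum, map_sum]
  refine Finset.sum_nbij' Prod.swap Prod.swap ?_ ?_ (fun _ _ => rfl) (fun _ _ => rfl) ?_
  · rintro ⟨v, w⟩ h
    simp only [Finset.mem_filter, Finset.mem_product, Prod.swap] at h ⊢
    exact ⟨⟨h.1.2, h.1.1⟩, by rw [Prim.det_swap, h.2, neg_neg]⟩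
  · rintro ⟨v, w⟩ h
    simp only [Finset.mem_filter, Finset.mem_product, Prod.swap] at h ⊢
    exact ⟨⟨h.1.2, h.1.1⟩, by rw [Prim.det_swap, h.2]⟩
  · rintro ⟨v, w⟩ _
    simp [mul_comm]

/-- The sum of `F ⊗ conj F` over pairs of low vectors with determinant divisible by `Q`. -/
noncomputable def pairSumDvd (F : ℍ → ℂ) (Y : ℝ) (Q : ℕ) (z : ℍ) : ℂ :=
  ∑ p ∈ (lowVecs Y z ×ˢ lowVecs Y z).filter (fun p => (Q : ℤ) ∣ p.1.det p.2),
    F (sec p.1 • z) * conj (F (sec p.2 • z))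

lemma norm_pairSum_zero_le {F : ℍ → ℂ} (hF : ∀ w, ‖F w‖ ≤ 1) (Y : ℝ) (z : ℍ) :
    ‖pairSum F Y 0 z‖ ≤ 2 * (lowVecs Y z).card := by
  have h1 : ‖pairSum F Y 0 z‖ ≤
      ((lowVecs Y z ×ˢ lowVecs Y z).filter (fun p => p.1.det p.2 = 0)).card := by
    refine (norm_sum_le _ _).trans ?_
    rw [Finset.card_eq_sum_ones, Nat.cast_sum]
    refine Finset.sum_le_sum fun p _ => ?_
    rw [norm_mul, RCLike.norm_conj]
    simpa using mul_le_mul (hF (sec p.1 • z)) (hF (sec p.2 • z)) (norm_nonneg _) zero_le_one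
  have h2 : ((lowVecs Y z ×ˢ lowVecs Y z).filter (fun p => p.1.det p.2 = 0)).card ≤
      ((lowVecs Y z) ×ˢ ({1, -1} : Finset ℤ)).card := by
    have hmem : ∀ p ∈ (lowVecs Y z ×ˢ lowVecs Y z).filter (fun p => p.1.det p.2 = 0),
        ∃ t : ℤ, (t = 1 ∨ t = -1) ∧ p.2.1 = (t * p.1.1.1, t * p.1.1.2) := fun p hp =>
      Prim.exists_eq_mul_of_det_eq_zero (Finset.mem_filter.1 hp).2
    choose! t ht ht' using hmem
    refine Finset.card_le_card_of_injOn (fun p => (p.1, t p)) ?_ ?_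
    · intro p hp
      have h3 := Finset.mem_filter.1 hp
      simp only [Finset.coe_product, Set.mem_prod, Finset.mem_coe]
      exact ⟨(Finset.mem_product.1 h3.1).1, by simpa using ht p hp⟩
    · intro p hp p' hp' h
      simp only [Prod.mk.injEq] at h
      refine Prod.ext h.1 (Subtype.ext ?_)
      rw [ht' p hp, ht' p' hp', h.1, h.2]
  refine h1.trans ?_
  rw [Finset.card_product, Finset.card_pair (by norm_num)] at h2
  rw [mul_comm]
  exact_mod_cast h2

lemma pairSumDvd_eq {F : ℍ → ℂ} {Y : ℝ} (hY : 0 < Y) (Q : ℕ) (z : ℍ) :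
    (pairSumDvd F Y Q z).re = (pairSum F Y 0 z).re +
      2 * ∑ k ∈ (Finset.Icc 1 ⌊Y⌋₊).filter (Q ∣ ·), (pairSum F Y k z).re := by
  set P := (lowVecs Y z ×ˢ lowVecs Y z).filter (fun p => (Q : ℤ) ∣ p.1.det p.2) with hP
  set K := (Finset.Icc 1 ⌊Y⌋₊).filter (Q ∣ ·) with hK
  have hmaps : ∀ p ∈ P, (p.1.det p.2).natAbs ∈ insert 0 K := by
    intro p hp
    rw [hP, Finset.mem_filter, Finset.mem_product] at hp
    rw [Finset.mem_insert, hK, Finset.mem_filter, Finset.mem_Icc]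
    by_cases h0 : (p.1.det p.2).natAbs = 0
    · exact Or.inl h0
    · refine Or.inr ⟨⟨by omega, Nat.le_floor ?_⟩, Int.natCast_dvd.1 hp.2⟩
      rw [Nat.cast_natAbs, Int.cast_abs]
      exact abs_det_le hY hp.1.1 hp.1.2
  rw [pairSumDvd, ← Finset.sum_fiberwise_of_maps_to hmaps, Finset.sum_insert (by simp [hK]),
    Complex.add_re]
  congr 1
  · congr 1
    refine Finset.sum_congr ?_ fun _ _ => rfl
    ext p
    simp only [hP, Finset.mem_filter, Int.natAbs_eq_zero]
    constructor
    · rintro ⟨⟨h1, -⟩, h2⟩; exact ⟨h1, h2⟩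
    · rintro ⟨h1, h2⟩; exact ⟨⟨h1, by rw [h2]; exact dvd_zero _⟩, h2⟩
  · rw [Complex.re_sum, Finset.mul_sum]
    refine Finset.sum_congr rfl fun k hk => ?_
    rw [hK, Finset.mem_filter, Finset.mem_Icc] at hk
    have h1 : P.filter (fun p => (p.1.det p.2).natAbs = k) =
        (lowVecs Y z ×ˢ lowVecs Y z).filter (fun p => p.1.det p.2 = (k : ℤ)) ∪
        (lowVecs Y z ×ˢ lowVecs Y z).filter (fun p => p.1.det p.2 = -(k : ℤ)) := by
      ext p
      simp only [hP, Finset.mem_filter, Finset.mem_union, Int.natAbs_eq_iff]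
      constructor
      · rintro ⟨⟨h1, -⟩, h2 | h2⟩
        · exact Or.inl ⟨h1, h2⟩
        · exact Or.inr ⟨h1, h2⟩
      · rintro (⟨h1, h2⟩ | ⟨h1, h2⟩)
        · exact ⟨⟨h1, by rw [h2]; exact_mod_cast hk.2⟩, Or.inl h2⟩
        · exact ⟨⟨h1, by rw [h2]; exact (dvd_neg.2 (by exact_mod_cast hk.2))⟩, Or.inr h2⟩
    rw [h1, Finset.sum_union, Complex.add_re]
    · change (pairSum F Y k z).re + (pairSum F Y (-k) z).re = _
      rw [pairSum_neg, Complex.conj_re]; ring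
    · rw [Finset.disjoint_filter]
      intro p _ h2 h3
      omega

theorem exists_majorant (h : ℤ) (κ : ℝ) {Y : ℝ} (hY : 1 ≤ Y) (Q : ℕ) :
    ∃ R : ℍ → ℝ, Integrable R ∧
      (∀ z, weight z * (pairSumDvd (cuspPhase h κ Y) Y Q z).re ≤ R z) ∧
      ∫ z, R z ≤ 20 * Y * volume.real siegel +
        16 * Y * ∑ k ∈ (Finset.Icc 1 ⌊Y⌋₊).filter (Q ∣ ·), klNorm (-h) k / k := by
  have hY0 : 0 < Y := by linarith
  set F := cuspPhase h κ Y with hF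
  set K := (Finset.Icc 1 ⌊Y⌋₊).filter (Q ∣ ·) with hK
  have hk0 : ∀ k ∈ K, k ≠ 0 := by
    intro k hk
    rw [hK, Finset.mem_filter, Finset.mem_Icc] at hk
    omega
  have hwk : ∀ k ∈ K, Integrable (fun z => (weight z : ℂ) * pairSum F Y k z) ∧
      ‖∫ z, (weight z : ℂ) * pairSum F Y k z‖ ≤ klNorm (-h) k * (8 * Y / k) := by
    intro k hk
    have : NeZero k := ⟨hk0 k hk⟩
    exact weighted_pairSum h κ hY0 k
  have hre : ∀ k : ℕ, ∀ z, ((weight z : ℂ) * pairSum F Y k z).re = weight z * (pairSum F Y k z).re :=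
    fun k z => Complex.re_ofReal_mul _ _
  have hInt : ∀ k ∈ K, Integrable (fun z => weight z * (pairSum F Y k z).re) := by
    intro k hk
    simp_rw [← hre]
    exact (hwk k hk).1.re
  have hintw : Integrable (siegel.indicator (fun _ : ℍ => 20 * Y)) := by
    rw [integrable_indicator_iff measurableSet_siegel]
    exact integrableOn_const volume_siegel_lt_top.ne
  refine ⟨fun z => siegel.indicator (fun _ : ℍ => 20 * Y) z +
    2 * ∑ k ∈ K, weight z * (pairSum F Y k z).re, ?_, ?_, ?_⟩
  · exact hintw.add ((integrable_finsetSum _ hInt).const_mul 2)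
  · intro z
    change _ ≤ siegel.indicator (fun _ : ℍ => 20 * Y) z +
      2 * ∑ k ∈ K, weight z * (pairSum F Y k z).re
    rw [pairSumDvd_eq hY0, mul_add, mul_left_comm (weight z), Finset.mul_sum]
    by_cases hz : z ∈ siegel
    · rw [Set.indicator_of_mem hz]
      have h1 : (pairSum F Y 0 z).re ≤ 20 * Y := by
        refine (Complex.re_le_norm _).trans
          ((norm_pairSum_zero_le (norm_cuspPhase_le h κ Y) Y z).trans ?_)
        linarith [card_lowVecs_le hY hz.2]
      have h2 : weight z * (pairSum F Y 0 z).re ≤ 20 * Y := by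
        nlinarith [weight_nonneg z, weight_le_one z]
      linarith
    · rw [weight_eq_zero hz, Set.indicator_of_notMem hz]; simp
  · rw [integral_add hintw ((integrable_finsetSum _ hInt).const_mul 2), integral_const_mul,
      integral_finsetSum _ hInt, integral_indicator measurableSet_siegel, setIntegral_const,
      smul_eq_mul, mul_comm (volume.real siegel)]
    have h1 : ∑ k ∈ K, ∫ z, weight z * (pairSum F Y k z).re ≤
        ∑ k ∈ K, klNorm (-h) k * (8 * Y / k) := by
      refine Finset.sum_le_sum fun k hk => ?_
      simp_rw [← hre]
      have := integral_re (𝕜 := ℂ) (hwk k hk).1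
      rw [show (∫ z, ((weight z : ℂ) * pairSum F Y k z).re) =
        (∫ z, (weight z : ℂ) * pairSum F Y k z).re from this]
      exact (Complex.re_le_norm _).trans (hwk k hk).2
    have h2 : ∑ k ∈ K, klNorm (-h) k * (8 * Y / k) = 8 * Y * ∑ k ∈ K, klNorm (-h) k / k := by
      rw [Finset.mul_sum]
      exact Finset.sum_congr rfl fun k _ => by ring
    rw [h2] at h1
    linarith

end Majorant
end QuadRoots

namespace QuadRoots

section Forms
open UpperHalfPlane ModularGroup
open scoped MatrixGroups Real

/-- Positive definite integral binary quadratic forms `A X² + B XY + C Y²` of discriminant `D`. -/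
@[ext] structure QForm (D : ℤ) where
  A : ℤ
  B : ℤ
  C : ℤ
  pos : 0 < A
  neg : D < 0
  disc : B ^ 2 - 4 * A * C = D

namespace QForm
variable {D : ℤ}

/-- The square root of the absolute value of the discriminant. -/
noncomputable def rt (D : ℤ) : ℝ := √(-(D : ℝ))

lemma rt_pos (hD : D < 0) : 0 < rt D := Real.sqrt_pos.2 (by
  have : (D : ℝ) < 0 := by exact_mod_cast hD
  linarith)

lemma rt_sq (hD : D < 0) : rt D ^ 2 = -D := Real.sq_sqrt (by
  have : (D : ℝ) < 0 := by exact_mod_cast hD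
  linarith)

lemma A_pos (Q : QForm D) : (0 : ℝ) < Q.A := by exact_mod_cast Q.pos

/-- The root of the form in the upper half plane. -/
noncomputable def point (Q : QForm D) : ℍ :=
  ⟨⟨-Q.B / (2 * Q.A), rt D / (2 * Q.A)⟩, div_pos (rt_pos Q.neg) (by linarith [Q.A_pos])⟩

lemma point_re (Q : QForm D) : Q.point.re = -Q.B / (2 * Q.A) := rfl

lemma point_im (Q : QForm D) : Q.point.im = rt D / (2 * Q.A) := rfl

lemma point_injective : Function.Injective (point : QForm D → ℍ) := by
  intro Q Q' h
  have hA := Q.A_pos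
  have hA' := Q'.A_pos
  have hs := rt_pos Q.neg
  have h1 : rt D / (2 * Q.A) = rt D / (2 * Q'.A) := congrArg UpperHalfPlane.im h
  have h2 : -(Q.B : ℝ) / (2 * Q.A) = -Q'.B / (2 * Q'.A) := congrArg UpperHalfPlane.re h
  have e1 : Q.A = Q'.A := by
    rw [div_eq_div_iff (by positivity) (by positivity)] at h1
    have : (Q'.A : ℝ) = Q.A := by
      have := mul_left_cancel₀ hs.ne' h1
      linarith
    exact_mod_cast this.symm
  have e2 : Q.B = Q'.B := by
    rw [e1, div_left_inj' (by positivity)] at h2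
    exact_mod_cast neg_injective h2
  have e3 : Q.C = Q'.C := by
    have h3 := Q.disc.trans Q'.disc.symm
    rw [e1, e2] at h3
    have : Q'.A * Q.C = Q'.A * Q'.C := by linarith
    exact mul_left_cancel₀ Q'.pos.ne' this
  exact QForm.ext e1 e2 e3

/-- The first coefficient of the transform of `Q` by a matrix with bottom row `(c, d)`. -/
def val (Q : QForm D) (c d : ℤ) : ℤ := Q.A * d ^ 2 - Q.B * c * d + Q.C * c ^ 2

/-- The action of the modular group on forms. -/
def act (γ : SL(2, ℤ)) (Q : QForm D) : QForm D where
  A := Q.val (γ 1 0) (γ 1 1)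
  B := -2 * Q.A * γ 1 1 * γ 0 1 + Q.B * (γ 0 0 * γ 1 1 + γ 0 1 * γ 1 0) - 2 * Q.C * γ 0 0 * γ 1 0
  C := Q.A * γ 0 1 ^ 2 - Q.B * γ 0 0 * γ 0 1 + Q.C * γ 0 0 ^ 2
  pos := by
    have h1 : 4 * Q.A * Q.val (γ 1 0) (γ 1 1) =
        (2 * Q.A * γ 1 1 - Q.B * γ 1 0) ^ 2 - D * γ 1 0 ^ 2 := by
      rw [val]; linear_combination (-(γ 1 0 ^ 2)) * Q.disc
    have h2 : 0 < (2 * Q.A * γ 1 1 - Q.B * γ 1 0) ^ 2 - D * γ 1 0 ^ 2 := by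
      have hD := Q.neg
      have hA := Q.pos
      by_cases h0 : γ 1 0 = 0
      · have hd := SL_det γ
        have : γ 1 1 ≠ 0 := by
          rintro h; rw [h0, h] at hd; simp at hd
        rw [h0]
        have : 2 * Q.A * γ 1 1 - Q.B * 0 ≠ 0 := by
          rw [mul_zero, sub_zero]; positivity
        have := pow_pos (abs_pos.2 this) 2
        rw [sq_abs] at this
        linarith
      · have : 0 < γ 1 0 ^ 2 := by positivity
        nlinarith [sq_nonneg (2 * Q.A * γ 1 1 - Q.B * γ 1 0)]
    rw [← h1] at h2
    exact (mul_pos_iff_of_pos_left (by linarith [Q.pos])).1 h2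
  neg := Q.neg
  disc := by
    have hd := SL_det γ
    have h1 : (γ 0 0 * γ 1 1 - γ 0 1 * γ 1 0) ^ 2 = 1 := by rw [hd]; norm_num
    rw [val]
    linear_combination (γ 0 0 * γ 1 1 - γ 0 1 * γ 1 0) ^ 2 * Q.disc + D * h1

lemma act_point (γ : SL(2, ℤ)) (Q : QForm D) : (act γ Q).point = γ • Q.point := by
  have hA := Q.A_pos
  have hA' : (0 : ℝ) < (act γ Q).A := (act γ Q).A_pos
  have hs := rt_sq Q.neg
  have d : (γ 0 0 : ℝ) * γ 1 1 - γ 0 1 * γ 1 0 = 1 := by exact_mod_cast SL_det γ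
  have hdisc : (Q.B : ℝ) ^ 2 - 4 * Q.A * Q.C = D := by exact_mod_cast Q.disc
  have eA : ((act γ Q).A : ℝ) = Q.A * γ 1 1 ^ 2 - Q.B * γ 1 0 * γ 1 1 + Q.C * γ 1 0 ^ 2 := by
    simp only [act, val]; push_cast; ring
  have eB : ((act γ Q).B : ℝ) = -2 * Q.A * γ 1 1 * γ 0 1 +
      Q.B * (γ 0 0 * γ 1 1 + γ 0 1 * γ 1 0) - 2 * Q.C * γ 0 0 * γ 1 0 := by
    simp only [act]; push_cast; ring
  set x := Q.point.re with hx
  set y := Q.point.im with hy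
  have ex : x * (2 * Q.A) = -Q.B := by rw [hx, point_re]; field_simp
  have ey : y * (2 * Q.A) = rt D := by rw [hy, point_im]; field_simp
  have hden := sec_denom_pos (row γ) Q.point
  simp only [row] at hden
  have eN : (((γ 1 0 : ℝ) * x + γ 1 1) ^ 2 + ((γ 1 0 : ℝ) * y) ^ 2) * Q.A = (act γ Q).A := by
    rw [eA]
    have : (4 * Q.A : ℝ) ≠ 0 := by positivity
    refine mul_left_cancel₀ this ?_
    linear_combination (γ 1 0 : ℝ) ^ 2 * ((x * (2 * Q.A) - Q.B) * ex + (y * (2 * Q.A) + rt D) * ey) +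
      (γ 1 0 : ℝ) ^ 2 * hs + (γ 1 0 : ℝ) ^ 2 * hdisc + 4 * (γ 1 0 : ℝ) * γ 1 1 * Q.A * ex
  have him : (γ • Q.point).im = rt D / (2 * (act γ Q).A) := by
    rw [im_smul_row, ← hx, ← hy, ← eN, ← ey]
    field_simp
  have hre : (γ • Q.point).re = -(act γ Q).B / (2 * (act γ Q).A) := by
    have h1 := coe_specialLinearGroup_apply γ Q.point
    have hden' : ((γ 1 0 : ℝ) : ℂ) * Q.point + ((γ 1 1 : ℝ) : ℂ) ≠ 0 := by
      intro h0
      have hre := congrArg Complex.re h0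
      have him := congrArg Complex.im h0
      simp only [Complex.add_re, Complex.mul_re, Complex.ofReal_re, Complex.ofReal_im,
        Complex.add_im, Complex.mul_im, coe_re, coe_im, Complex.zero_re, Complex.zero_im] at hre him
      rw [← hx, ← hy] at *
      nlinarith
    simp only [algebraMap_int_eq, eq_intCast] at h1
    rw [eq_div_iff hden'] at h1
    have hre := congrArg Complex.re h1
    have him' := congrArg Complex.im h1
    simp only [Complex.add_re, Complex.mul_re, Complex.ofReal_re, Complex.ofReal_im,
      Complex.add_im, Complex.mul_im, coe_re, coe_im] at hre him'
    rw [← hx, ← hy] at hre him'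
    rw [eq_div_iff (by positivity), ← eN]
    have hrt : rt D ^ 2 = 4 * Q.A * Q.C - Q.B ^ 2 := by rw [hs, ← hdisc]; ring
    have hxy : (2 * Q.A) * (x ^ 2 + y ^ 2) = 2 * (Q.C : ℝ) := by
      have : (2 * Q.A : ℝ) ≠ 0 := by positivity
      refine mul_left_cancel₀ this ?_
      linear_combination (x * (2 * Q.A) - Q.B) * ex + (y * (2 * Q.A) + rt D) * ey + hrt
    rw [eB]
    linear_combination (2 * Q.A : ℝ) * ((γ 1 0 * x + γ 1 1) * hre + (γ 1 0 * y) * him') +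
      (γ 0 0 : ℝ) * γ 1 0 * hxy + ((γ 0 0 : ℝ) * γ 1 1 + γ 0 1 * γ 1 0) * ex
  refine UpperHalfPlane.ext_re_im ?_ ?_
  · rw [hre, point_re]
  · rw [him, point_im]

lemma act_mul (γ γ' : SL(2, ℤ)) (Q : QForm D) : act (γ * γ') Q = act γ (act γ' Q) :=
  point_injective (by rw [act_point, act_point, act_point, mul_smul])

lemma act_inv_act (γ : SL(2, ℤ)) (Q : QForm D) : act γ⁻¹ (act γ Q) = Q :=
  point_injective (by rw [act_point, act_point, inv_smul_smul])

lemma act_T_zpow_A (n : ℤ) (Q : QForm D) : (act (T ^ n) Q).A = Q.A := by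
  simp [act, val, coe_T_zpow]

lemma act_T_zpow_B (n : ℤ) (Q : QForm D) : (act (T ^ n) Q).B = Q.B - 2 * n * Q.A := by
  simp [act, coe_T_zpow]; ring

/-- The forms whose root lies in the Siegel set. -/
lemma finite_reduced (D : ℤ) : {Q : QForm D | Q.point ∈ siegel}.Finite := by
  refine Set.Finite.of_injOn (f := fun Q : QForm D => (Q.A, Q.B))
    (t := Set.Icc 0 (-D) ×ˢ Set.Icc (2 * D) (-2 * D)) ?_ ?_
    ((Set.finite_Icc _ _).prod (Set.finite_Icc _ _))
  · intro Q hQ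
    obtain ⟨h1, h2⟩ := hQ
    have hA := Q.A_pos
    rw [point_re, abs_le, le_div_iff₀ (by positivity), div_le_iff₀ (by positivity)] at h1
    rw [point_im, le_div_iff₀ (by positivity)] at h2
    have h3 := rt_sq Q.neg
    have hA1 : (1 : ℝ) ≤ Q.A := by exact_mod_cast Q.pos
    have h4 : (Q.A : ℝ) ≤ -D := by nlinarith
    have h4' : Q.A ≤ -D := by exact_mod_cast h4
    have h5 : Q.B ≤ 2 * Q.A := by
      have : (Q.B : ℝ) ≤ 2 * Q.A := by linarith [h1.1]
      exact_mod_cast this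
    have h6 : -(2 * Q.A) ≤ Q.B := by
      have : -(2 * Q.A : ℝ) ≤ Q.B := by linarith [h1.2]
      exact_mod_cast this
    have := Q.pos
    simp only [Set.mem_prod, Set.mem_Icc]
    omega
  · intro Q _ Q' _ h
    simp only [Prod.mk.injEq] at h
    refine QForm.ext h.1 h.2 ?_
    have h3 := Q.disc.trans Q'.disc.symm
    rw [h.1, h.2] at h3
    have : Q'.A * Q.C = Q'.A * Q'.C := by linarith
    exact mul_left_cancel₀ Q'.pos.ne' this

noncomputable def reduced (D : ℤ) : Finset (QForm D) := (finite_reduced D).toFinset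

lemma mem_reduced {Q : QForm D} : Q ∈ reduced D ↔ Q.point ∈ siegel := by
  rw [reduced, Set.Finite.mem_toFinset, Set.mem_ofPred_eq]

/-- The vector `v` is good for `Q` if a translate of `Q` by a matrix with bottom row `v` has
first coefficient divisible by `a q` and second coefficient congruent to `b` modulo `2 a`. -/
def Good (a b q : ℤ) (Q : QForm D) (v : Prim) : Prop :=
  a * q ∣ (act (sec v) Q).A ∧ 2 * a ∣ (act (sec v) Q).B - b

lemma good_row_iff {a b q : ℤ} {Q : QForm D} (γ : SL(2, ℤ)) : Good a b q Q (row γ) ↔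
    a * q ∣ (act γ Q).A ∧ 2 * a ∣ (act γ Q).B - b := by
  obtain ⟨n, hn⟩ := exists_zpow_of_row_eq (row_sec (row γ)).symm
  rw [Good, hn, act_mul, act_T_zpow_A, act_T_zpow_B]
  refine and_congr_right fun h => ?_
  have : 2 * a ∣ 2 * n * (act γ Q).A := by
    obtain ⟨m, hm⟩ := h
    exact ⟨n * q * m, by rw [hm]; ring⟩
  rw [show (act γ Q).B - 2 * n * (act γ Q).A - b = (act γ Q).B - b - 2 * n * (act γ Q).A by ring,
    dvd_sub_left this]

end QForm
end Forms
end QuadRoots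

namespace QuadRoots

section Decomposition
open UpperHalfPlane ModularGroup QForm
open scoped MatrixGroups Real

/-- The roots of `a X² + b X + c` modulo `n`. -/
def roots (a b c : ℤ) (n : ℕ) : Finset ℕ :=
  (Finset.range n).filter fun ν : ℕ => (n : ℤ) ∣ a * (ν : ℤ) ^ 2 + b * (ν : ℤ) + c

/-- Pairs `(n, ν)` with `n ≤ X`, `q ∣ n`, and `ν` a root modulo `n`. -/
def rootPairs (a b c : ℤ) (q X : ℕ) : Finset (Σ _ : ℕ, ℕ) :=
  ((Finset.Icc 1 X).filter (q ∣ ·)).sigma (roots a b c)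

lemma mem_rootPairs {a b c : ℤ} {q X : ℕ} {i : Σ _ : ℕ, ℕ} : i ∈ rootPairs a b c q X ↔
    (0 < i.1 ∧ i.1 ≤ X ∧ q ∣ i.1) ∧ i.2 < i.1 ∧ (i.1 : ℤ) ∣ a * (i.2 : ℤ) ^ 2 + b * i.2 + c := by
  simp only [rootPairs, roots, Finset.mem_sigma, Finset.mem_filter, Finset.mem_Icc,
    Finset.mem_range, and_assoc, Nat.succ_le_iff]

variable {a b c : ℤ} {q : ℕ}

/-- The form attached to a root of a quadratic congruence. -/
def rootForm (ha : 0 < a) (hD : b ^ 2 - 4 * a * c < 0) {X : ℕ} (i : rootPairs a b c q X) :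
    QForm (b ^ 2 - 4 * a * c) where
  A := a * i.1.1
  B := 2 * a * i.1.2 + b
  C := (a * (i.1.2 : ℤ) ^ 2 + b * i.1.2 + c) / i.1.1
  pos := by
    have := (mem_rootPairs.1 i.2).1.1
    positivity
  neg := hD
  disc := by
    have := Int.ediv_mul_cancel (mem_rootPairs.1 i.2).2.2
    linear_combination (-4 * a) * this

lemma rootForm_injective (ha : 0 < a) (hD : b ^ 2 - 4 * a * c < 0) {X : ℕ} :
    Function.Injective (rootForm (q := q) (X := X) ha hD) := by
  rintro ⟨⟨n, ν⟩, hi⟩ ⟨⟨n', ν'⟩, hi'⟩ h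
  have h1 : a * (n : ℤ) = a * n' := congrArg QForm.A h
  have h2 : 2 * a * (ν : ℤ) + b = 2 * a * ν' + b := congrArg QForm.B h
  have e1 : (n : ℤ) = n' := mul_left_cancel₀ ha.ne' h1
  have e2 : (ν : ℤ) = ν' := mul_left_cancel₀ (show 2 * a ≠ 0 by positivity) (by linarith)
  have e1' : n = n' := by exact_mod_cast e1
  have e2' : ν = ν' := by exact_mod_cast e2
  subst e1' e2'
  rfl

lemma rootForm_eq_of_act (ha : 0 < a) (hD : b ^ 2 - 4 * a * c < 0) {X : ℕ}
    {i j : rootPairs a b c q X} {n : ℤ}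
    (h : rootForm ha hD i = act (T ^ n) (rootForm ha hD j)) : i = j := by
  have hA := congrArg QForm.A h
  have hB := congrArg QForm.B h
  rw [act_T_zpow_A] at hA
  rw [act_T_zpow_B] at hB
  refine rootForm_injective ha hD (X := X) ?_
  have hi := mem_rootPairs.1 i.2
  have hj := mem_rootPairs.1 j.2
  simp only [rootForm] at hA hB
  have e1 : (i.1.1 : ℤ) = j.1.1 := mul_left_cancel₀ ha.ne' hA
  have e2 : (i.1.2 : ℤ) = j.1.2 - n * j.1.1 :=
    mul_left_cancel₀ (show 2 * a ≠ 0 by positivity) (by linarith)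
  have e3 : n = 0 := by
    have h1 : (i.1.2 : ℤ) < i.1.1 := by exact_mod_cast hi.2.1
    have h2 : (j.1.2 : ℤ) < j.1.1 := by exact_mod_cast hj.2.1
    have h3 : (0 : ℤ) < j.1.1 := by exact_mod_cast hj.1.1
    have h4 : n * (j.1.1 : ℤ) < 1 * j.1.1 := by lia
    have h5 : (-1) * (j.1.1 : ℤ) < n * j.1.1 := by lia
    have := lt_of_mul_lt_mul_right h4 h3.le
    have := lt_of_mul_lt_mul_right h5 h3.le
    omega
  rw [h, e3, zpow_zero]
  exact point_injective (by rw [act_point, one_smul])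

open Classical in
/-- Grouping the roots of quadratic congruences according to reduced forms. -/
lemma sum_rootPairs_eq (ha : 0 < a) (hD : b ^ 2 - 4 * a * c < 0) {X : ℝ} (hX : 0 < X)
    {G : ℍ → ℂ} (hG : Periodic G)
    (hG0 : ∀ w : ℍ, w.im < 1 / (2 * a * X / rt (b ^ 2 - 4 * a * c)) → G w = 0) :
    ∑ i : rootPairs a b c q ⌊X⌋₊, G (rootForm ha hD i).point =
      ∑ Q ∈ reduced (b ^ 2 - 4 * a * c), (weight Q.point : ℂ) *
        ∑ v ∈ (lowVecs (2 * a * X / rt (b ^ 2 - 4 * a * c)) Q.point).filter (Good a b q Q),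
          G (sec v • Q.point) := by
  set D := b ^ 2 - 4 * a * c with hDdef
  set Y := 2 * a * X / rt D with hYdef
  have haR : (0 : ℝ) < a := by exact_mod_cast ha
  have hrt := rt_pos hD
  have hY : 0 < Y := by positivity
  set f : QForm D × Prim → ℂ := fun p =>
    if Good a b q p.1 p.2 then (weight p.1.point : ℂ) * G (sec p.2 • p.1.point) else 0 with hf
  have hlow : ∀ (Q : QForm D) (v : Prim), v ∉ lowVecs Y Q.point → G (sec v • Q.point) = 0 := by
    intro Q v hv
    rw [mem_lowVecs hY, not_le] at hv
    exact hG0 _ hv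
  set g : rootPairs a b c q ⌊X⌋₊ × SL(2, ℤ) → QForm D × Prim := fun p =>
    (act p.2 (rootForm ha hD p.1), row p.2⁻¹) with hg
  have hginj : Function.Injective g := by
    rintro ⟨i, γ⟩ ⟨j, γ'⟩ h
    have h1 : act γ (rootForm ha hD i) = act γ' (rootForm ha hD j) := congrArg Prod.fst h
    have h2 : row γ⁻¹ = row γ'⁻¹ := congrArg Prod.snd h
    obtain ⟨n, hn⟩ := exists_zpow_of_row_eq h2.symm
    have h3 : rootForm ha hD i = act (T ^ n) (rootForm ha hD j) := by
      rw [← act_inv_act γ (rootForm ha hD i), h1, hn, act_mul, act_inv_act]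
    have hij := rootForm_eq_of_act ha hD h3
    subst hij
    have hB := congrArg QForm.B h3
    rw [act_T_zpow_B] at hB
    have hn0 : n = 0 := by
      have h4 := (rootForm ha hD i).pos
      have h5 : 2 * (rootForm ha hD i).A * n = 0 := by linarith
      rcases mul_eq_zero.1 h5 with h6 | h6
      · lia
      · exact h6
    rw [hn0, zpow_zero, one_mul] at hn
    rw [inv_injective hn]
  have hgood : ∀ p, Good a b q (g p).1 (g p).2 := by
    rintro ⟨i, γ⟩
    simp only [hg]
    rw [good_row_iff, act_inv_act]
    refine ⟨mul_dvd_mul_left a ?_, ⟨i.1.2, by simp [rootForm]⟩⟩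
    exact_mod_cast (mem_rootPairs.1 i.2).1.2.2
  have hfg : ∀ p, f (g p) = (weight (p.2 • (rootForm ha hD p.1).point) : ℂ) *
      G (rootForm ha hD p.1).point := by
    intro p
    simp only [hf]
    rw [if_pos (hgood p)]
    simp only [hg]
    rw [hG.sec_row, act_point, inv_smul_smul]
  have hsupp : ∀ p ∉ Set.range g, f p = 0 := by
    rintro ⟨Q, v⟩ hp
    by_contra h0
    apply hp
    simp only [hf] at h0
    have hgd : Good a b q Q v := by
      by_contra hgd; exact h0 (if_neg hgd)
    rw [if_pos hgd] at h0
    have hGne : G (sec v • Q.point) ≠ 0 := right_ne_zero_of_mul h0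
    have hv : v ∈ lowVecs Y Q.point := by
      by_contra hv; exact hGne (hlow Q v hv)
    rw [mem_lowVecs hY, ← act_point, point_im] at hv
    obtain ⟨⟨m, hm⟩, ⟨ν, hν⟩⟩ := hgd
    have hApos := (act (sec v) Q).pos
    set n : ℤ := q * m with hn
    have hAn : (act (sec v) Q).A = a * n := by rw [hm, hn]; ring
    have hnpos : 0 < n := by
      rw [hAn] at hApos
      exact (mul_pos_iff_of_pos_left ha).1 hApos
    have hdisc := (act (sec v) Q).disc
    have hroot : n ∣ a * ν ^ 2 + b * ν + c := by
      refine ⟨(act (sec v) Q).C, ?_⟩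
      have hBν : (act (sec v) Q).B = 2 * a * ν + b := by linarith
      rw [hAn, hBν] at hdisc
      refine mul_left_cancel₀ (show 4 * a ≠ 0 by positivity) ?_
      linear_combination hdisc + hDdef
    set r := ν % n with hr
    set t := ν / n with ht
    have hνrt : ν = r + n * t := (Int.emod_add_mul_ediv ν n).symm
    have hr0 := Int.emod_nonneg ν hnpos.ne'
    have hrn := Int.emod_lt_of_pos ν hnpos
    have hi : (⟨n.toNat, r.toNat⟩ : Σ _ : ℕ, ℕ) ∈ rootPairs a b c q ⌊X⌋₊ := by
      rw [mem_rootPairs]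
      have e1 : ((n.toNat : ℕ) : ℤ) = n := Int.toNat_of_nonneg hnpos.le
      have e2 : ((r.toNat : ℕ) : ℤ) = r := Int.toNat_of_nonneg hr0
      refine ⟨⟨by simp only; omega, Nat.le_floor ?_, ?_⟩, by simp only; omega, ?_⟩
      · have hA := (act (sec v) Q).A_pos
        have e3 : ((n.toNat : ℕ) : ℝ) = n := by exact_mod_cast congrArg (Int.cast : ℤ → ℝ) e1
        simp only [e3]
        rw [hYdef, one_div_div, hAn] at hv
        push_cast at hv
        have hn' : (0 : ℝ) < n := by exact_mod_cast hnpos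
        rw [div_le_div_iff₀ (by positivity) (by positivity)] at hv
        have : (2 * a * rt D) * n ≤ (2 * a * rt D) * X := by linarith
        exact le_of_mul_le_mul_left this (by positivity)
      · have : (q : ℤ) ∣ (n.toNat : ℤ) := by rw [e1, hn]; exact dvd_mul_right _ _
        exact_mod_cast this
      · simp only [e1, e2]
        have : a * r ^ 2 + b * r + c = a * ν ^ 2 + b * ν + c -
            n * (t * (2 * a * r + a * n * t + b)) := by rw [hνrt]; ring
        rw [this]
        exact dvd_sub hroot (dvd_mul_right _ _)
    have hform : act (T ^ t) (act (sec v) Q) = rootForm ha hD ⟨_, hi⟩ := by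
      have e1 : ((n.toNat : ℕ) : ℤ) = n := Int.toNat_of_nonneg hnpos.le
      have e2 : ((r.toNat : ℕ) : ℤ) = r := Int.toNat_of_nonneg hr0
      have hA' : (act (T ^ t) (act (sec v) Q)).A = (rootForm ha hD ⟨_, hi⟩).A := by
        rw [act_T_zpow_A, hAn]; simp only [rootForm, e1]
      have hB' : (act (T ^ t) (act (sec v) Q)).B = (rootForm ha hD ⟨_, hi⟩).B := by
        rw [act_T_zpow_B, hAn]; simp only [rootForm, e2]
        linear_combination hν + 2 * a * hνrt
      refine QForm.ext hA' hB' ?_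
      have h3 := (act (T ^ t) (act (sec v) Q)).disc.trans (rootForm ha hD ⟨_, hi⟩).disc.symm
      rw [hA', hB'] at h3
      exact mul_left_cancel₀ (rootForm ha hD ⟨_, hi⟩).pos.ne' (by linarith)
    refine ⟨(⟨_, hi⟩, (T ^ t * sec v)⁻¹), ?_⟩
    simp only [hg]
    rw [← hform, ← act_mul (T ^ t) (sec v) Q, act_inv_act, inv_inv, row_zpow_mul, row_sec]
  have hsum : HasSum f (∑ Q ∈ reduced D, (weight Q.point : ℂ) *
        ∑ v ∈ (lowVecs Y Q.point).filter (Good a b q Q), G (sec v • Q.point)) := by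
    have h1 : ∑ Q ∈ reduced D, (weight Q.point : ℂ) *
        ∑ v ∈ (lowVecs Y Q.point).filter (Good a b q Q), G (sec v • Q.point) =
        ∑ p ∈ (reduced D).sigma (fun Q => lowVecs Y Q.point), f (p.1, p.2) := by
      rw [Finset.sum_sigma]
      refine Finset.sum_congr rfl fun Q _ => ?_
      rw [Finset.mul_sum, Finset.sum_filter]
    rw [h1, ← Finset.sum_image (f := f) (g := fun p : Σ _ : QForm D, Prim => (p.1, p.2))]
    · refine hasSum_sum_of_ne_finset_zero (L := .unconditional _) ?_
      rintro ⟨Q, v⟩ hp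
      have : ¬ (Q ∈ reduced D ∧ v ∈ lowVecs Y Q.point) := by
        rintro ⟨h1, h2⟩
        exact hp (Finset.mem_image.2 ⟨⟨Q, v⟩, Finset.mem_sigma.2 ⟨h1, h2⟩, rfl⟩)
      simp only [hf]
      split_ifs
      · by_cases hQ : Q ∈ reduced D
        · rw [hlow Q v fun h => this ⟨hQ, h⟩, mul_zero]
        · rw [mem_reduced] at hQ
          rw [weight_eq_zero hQ]; simp
      · rfl
    · rintro ⟨Q, v⟩ _ ⟨Q', v'⟩ _ h
      simp only [Prod.mk.injEq] at h
      obtain ⟨rfl, rfl⟩ := h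
      rfl
  rw [← hginj.hasSum_iff hsupp] at hsum
  have hfib : ∀ i : rootPairs a b c q ⌊X⌋₊, HasSum (fun γ : SL(2, ℤ) => (f ∘ g) (i, γ))
      (G (rootForm ha hD i).point) := by
    intro i
    have h1 := (Complex.hasSum_ofReal.2 (hasSum_weight_smul (rootForm ha hD i).point)).mul_right
      (G (rootForm ha hD i).point)
    rw [Complex.ofReal_one, one_mul] at h1
    rwa [show (fun γ => (f ∘ g) (i, γ)) = _ from funext fun γ => hfg (i, γ)]
  exact (hasSum_fintype _).unique (hsum.prod_fiberwise hfib)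

end Decomposition
end QuadRoots

namespace QuadRoots

section Classes
open UpperHalfPlane ModularGroup QForm Finset
open scoped MatrixGroups ComplexConjugate

section Abstract
variable {α β : Type*} [DecidableEq β] (L : Finset α) (cls : α → β) (u : α → ℂ)

lemma sum_same_class : (∑ p ∈ (L ×ˢ L).filter (fun p => cls p.1 = cls p.2),
    u p.1 * conj (u p.2)).re = ∑ C ∈ L.image cls, ‖∑ v ∈ L.filter (cls · = C), u v‖ ^ 2 := by
  have h1 : ∀ C, ‖∑ v ∈ L.filter (cls · = C), u v‖ ^ 2 =
      (∑ v ∈ L with cls v = C, ∑ w ∈ L with cls w = C, u v * conj (u w)).re := by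
    intro C
    rw [← Finset.sum_mul_sum, ← map_sum, Complex.mul_conj, Complex.ofReal_re,
      Complex.normSq_eq_norm_sq]
  simp only [h1]
  rw [← Complex.re_sum]
  congr 1
  rw [Finset.sum_filter, Finset.sum_product,
    ← Finset.sum_fiberwise_of_maps_to (t := L.image cls) (g := cls)
      (fun v hv => Finset.mem_image_of_mem _ hv)]
  refine Finset.sum_congr rfl fun C _ => Finset.sum_congr rfl fun v hv => ?_
  rw [Finset.mem_filter] at hv
  rw [Finset.sum_filter]
  refine Finset.sum_congr rfl fun w _ => ?_
  rw [hv.2]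
  exact if_congr eq_comm rfl rfl

lemma norm_sq_sum_saturated_le (good : α → Prop) [DecidablePred good]
    (hsat : ∀ v w, good v → cls v = cls w → good w) {M : ℝ}
    (hM : (((L.filter good).image cls).card : ℝ) ≤ M) :
    ‖∑ v ∈ L.filter good, u v‖ ^ 2 ≤ M * (∑ p ∈ (L ×ˢ L).filter (fun p => cls p.1 = cls p.2),
      u p.1 * conj (u p.2)).re := by
  rw [sum_same_class]
  set I := (L.filter good).image cls with hI
  have h1 : ∑ v ∈ L.filter good, u v = ∑ C ∈ I, ∑ v ∈ L.filter (cls · = C), u v := by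
    rw [← Finset.sum_fiberwise_of_maps_to (t := I) (g := cls)
      (fun v hv => Finset.mem_image_of_mem _ hv)]
    refine Finset.sum_congr rfl fun C hC => Finset.sum_congr ?_ fun _ _ => rfl
    obtain ⟨w, hw, rfl⟩ := Finset.mem_image.1 hC
    rw [Finset.mem_filter] at hw
    ext v
    simp only [Finset.mem_filter]
    constructor
    · rintro ⟨⟨h1, -⟩, h2⟩; exact ⟨h1, h2⟩
    · rintro ⟨h1, h2⟩; exact ⟨⟨h1, hsat w v hw.2 h2.symm⟩, h2⟩
  have hsub : I ⊆ L.image cls := Finset.image_subset_image (Finset.filter_subset _ _)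
  have h0 : 0 ≤ ∑ C ∈ L.image cls, ‖∑ v ∈ L.filter (cls · = C), u v‖ ^ 2 :=
    Finset.sum_nonneg fun _ _ => sq_nonneg _
  calc ‖∑ v ∈ L.filter good, u v‖ ^ 2
      ≤ (∑ C ∈ I, ‖∑ v ∈ L.filter (cls · = C), u v‖) ^ 2 := by
        rw [h1]; gcongr; exact norm_sum_le _ _
    _ ≤ I.card * ∑ C ∈ I, ‖∑ v ∈ L.filter (cls · = C), u v‖ ^ 2 := sq_sum_le_card_mul_sum_sq
    _ ≤ I.card * ∑ C ∈ L.image cls, ‖∑ v ∈ L.filter (cls · = C), u v‖ ^ 2 := by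
        gcongr
    _ ≤ _ := by gcongr

lemma card_image_le_of_label {γ : Type*} [DecidableEq γ] (S : Finset α) (f : α → γ)
    (h : ∀ v ∈ S, ∀ w ∈ S, f v = f w → cls v = cls w) : (S.image cls).card ≤ (S.image f).card := by
  rcases isEmpty_or_nonempty α with h0 | h0
  · simp [Finset.eq_empty_of_isEmpty S]
  choose! g hg using fun (C : β) (hC : C ∈ S.image cls) => Finset.mem_image.1 hC
  refine Finset.card_le_card_of_injOn (fun C => f (g C))
    (fun C hC => Finset.mem_image_of_mem _ (hg C hC).1) ?_
  intro C hC C' hC' he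
  rw [← (hg C hC).2, ← (hg C' hC').2]
  exact h _ (hg C hC).1 _ (hg C' hC').1 he

end Abstract

lemma Prim.det_self (v : Prim) : v.det v = 0 := by rw [Prim.det]; ring

lemma Prim.det_trans {N : ℤ} {u v w : Prim} (h1 : N ∣ u.det v) (h2 : N ∣ v.det w) :
    N ∣ u.det w := by
  obtain ⟨x, y, hxy⟩ := v.2
  have : u.det w = u.det v * (x * w.1.1 + y * w.1.2) + v.det w * (x * u.1.1 + y * u.1.2) := by
    simp only [Prim.det]
    linear_combination (-(u.1.1 * w.1.2 - u.1.2 * w.1.1)) * hxy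
  rw [this]
  exact dvd_add (h1.mul_right _) (h2.mul_right _)

/-- The vectors whose determinant with `v` is divisible by `N`. -/
def detClass (N : ℤ) (v : Prim) : Set Prim := {w | N ∣ v.det w}

lemma detClass_eq_iff {N : ℤ} {v w : Prim} : detClass N v = detClass N w ↔ N ∣ v.det w := by
  constructor
  · intro h
    have : w ∈ detClass N w := by
      change N ∣ w.det w
      rw [Prim.det_self]; exact dvd_zero _
    rw [← h] at this
    exact this
  · intro h
    have h' : N ∣ w.det v := by rw [Prim.det_swap]; exact h.neg_right
    ext x
    exact ⟨fun hx => Prim.det_trans h' hx, fun hx => Prim.det_trans h hx⟩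

variable {D a b q : ℤ}

lemma act_sec_A (Q : QForm D) (v : Prim) : (act (sec v) Q).A = Q.val v.1.1 v.1.2 := by
  have h := row_sec v
  have h0 : (sec v) 1 0 = v.1.1 := congrArg (fun v : Prim => v.1.1) h
  have h1 : (sec v) 1 1 = v.1.2 := congrArg (fun v : Prim => v.1.2) h
  rw [← h0, ← h1]; rfl

lemma Good.of_dvd_det {Q : QForm D} {v w : Prim} (hv : Good a b q Q v) (h : a * q ∣ v.det w) :
    Good a b q Q w := by
  set τ := sec w * (sec v)⁻¹ with hτ
  have h10 : τ 1 0 = -(v.det w) := by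
    have e := row_sec v
    have e0 : (sec v) 1 0 = v.1.1 := congrArg (fun v : Prim => v.1.1) e
    have e1 : (sec v) 1 1 = v.1.2 := congrArg (fun v : Prim => v.1.2) e
    have e' := row_sec w
    have e0' : (sec w) 1 0 = w.1.1 := congrArg (fun v : Prim => v.1.1) e'
    have e1' : (sec w) 1 1 = w.1.2 := congrArg (fun v : Prim => v.1.2) e'
    rw [hτ, SL_mul_10, e0', e1']
    have i0 : (sec v)⁻¹ 0 0 = (sec v) 1 1 := by
      simp [Matrix.SpecialLinearGroup.SL2_inv_expl]
    have i1 : (sec v)⁻¹ 1 0 = -(sec v) 1 0 := by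
      simp [Matrix.SpecialLinearGroup.SL2_inv_expl]
    rw [i0, i1, e0, e1, Prim.det]; ring
  obtain ⟨k, hk⟩ := h
  have hτw : act (sec w) Q = act τ (act (sec v) Q) := by
    rw [← act_mul τ (sec v) Q, hτ, inv_mul_cancel_right]
  obtain ⟨⟨m, hm⟩, n, hn⟩ := hv
  have hdet := SL_det τ
  rw [h10, hk] at hdet
  refine ⟨?_, ?_⟩
  · rw [hτw]
    change a * q ∣ (act (sec v) Q).A * τ 1 1 ^ 2 - (act (sec v) Q).B * τ 1 0 * τ 1 1 +
      (act (sec v) Q).C * τ 1 0 ^ 2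
    rw [h10, hm, hk]
    refine ⟨m * τ 1 1 ^ 2 + (act (sec v) Q).B * k * τ 1 1 +
      (act (sec v) Q).C * a * q * k ^ 2, ?_⟩
    ring
  · rw [hτw]
    change 2 * a ∣ -2 * (act (sec v) Q).A * τ 1 1 * τ 0 1 +
      (act (sec v) Q).B * (τ 0 0 * τ 1 1 + τ 0 1 * τ 1 0) -
      2 * (act (sec v) Q).C * τ 0 0 * τ 1 0 - b
    rw [h10, hm, hk]
    refine ⟨n - q * m * τ 1 1 * τ 0 1 - (act (sec v) Q).B * τ 0 1 * q * k +
      (act (sec v) Q).C * τ 0 0 * q * k, ?_⟩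
    linear_combination hn + (act (sec v) Q).B * hdet

lemma prime_dvd_det {Q : QForm D} {p : ℤ} (hp : Prime p) (hpD : ¬ p ∣ D) {v₀ v₁ v₂ : Prim}
    (h0 : p ∣ Q.val v₀.1.1 v₀.1.2) (h1 : p ∣ Q.val v₁.1.1 v₁.1.2)
    (h2 : p ∣ Q.val v₂.1.1 v₂.1.2) (h : p ∣ v₁.det v₀ ↔ p ∣ v₂.det v₀) : p ∣ v₁.det v₂ := by
  by_cases ht : p ∣ v₁.det v₀
  · refine Prim.det_trans ht ?_
    rw [Prim.det_swap]; exact (h.1 ht).neg_right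
  · have ht2 := fun h' => ht (h.2 h')
    set B := 2 * Q.A * v₀.1.2 * v₁.1.2 - Q.B * (v₀.1.1 * v₁.1.2 + v₀.1.2 * v₁.1.1) +
      2 * Q.C * v₀.1.1 * v₁.1.1 with hB
    have e1 : v₁.det v₂ * v₂.det v₀ * B = v₁.det v₀ ^ 2 * Q.val v₂.1.1 v₂.1.2 -
        v₁.det v₂ ^ 2 * Q.val v₀.1.1 v₀.1.2 - v₂.det v₀ ^ 2 * Q.val v₁.1.1 v₁.1.2 := by
      simp only [Prim.det, QForm.val, hB]; ring
    have e2 : D * v₁.det v₀ ^ 2 = B ^ 2 - 4 * Q.val v₀.1.1 v₀.1.2 * Q.val v₁.1.1 v₁.1.2 := by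
      have := Q.disc
      simp only [Prim.det, QForm.val, hB]
      linear_combination (-(v₁.1.1 * v₀.1.2 - v₁.1.2 * v₀.1.1) ^ 2) * this
    have d1 : p ∣ v₁.det v₂ * v₂.det v₀ * B := by
      rw [e1]
      exact dvd_sub (dvd_sub (h2.mul_left _) (h0.mul_left _)) (h1.mul_left _)
    rcases hp.dvd_or_dvd d1 with d1 | d1
    · exact (hp.dvd_or_dvd d1).resolve_right ht2
    · have d2 : p ∣ D * v₁.det v₀ ^ 2 := by
        rw [e2]
        exact dvd_sub (dvd_pow d1 two_ne_zero) ((h0.mul_left 4).mul_right _)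
      rcases hp.dvd_or_dvd d2 with d2 | d2
      · exact absurd d2 hpD
      · exact absurd (hp.dvd_of_dvd_pow d2) ht

lemma natAbs_dvd_of_prime {m : ℕ} (hm : Squarefree m) {d : ℤ}
    (h : ∀ p : ℕ, p.Prime → p ∣ m → (p : ℤ) ∣ d) : (m : ℤ) ∣ d := by
  rw [Int.natCast_dvd, ← Nat.prod_primeFactors_of_squarefree hm]
  refine Finset.prod_primes_dvd _ (fun p hp => (Nat.prime_of_mem_primeFactors hp).prime) ?_
  intro p hp
  rw [← Int.natCast_dvd]
  exact h p (Nat.prime_of_mem_primeFactors hp) (Nat.dvd_of_mem_primeFactors hp)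

/-- The modulus used to label the classes of good vectors. -/
def labelMod (D a : ℤ) : ℕ := a.natAbs * (D.natAbs * a.natAbs)

lemma dvd_det_of_label (ha : 0 < a) {q : ℕ} (hq : Squarefree q) {Q : QForm D}
    {v₀ v₁ v₂ : Prim} (h0 : Good a b q Q v₀) (h1 : Good a b q Q v₁) (h2 : Good a b q Q v₂)
    (e1 : (v₁.1.1 : ZMod (labelMod D a)) = v₂.1.1) (e2 : (v₁.1.2 : ZMod (labelMod D a)) = v₂.1.2)
    (e : q.gcd (v₁.det v₀).natAbs = q.gcd (v₂.det v₀).natAbs) : a * q ∣ v₁.det v₂ := by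
  set G := D.natAbs * a.natAbs with hG
  have hd : ((a.natAbs * G : ℕ) : ℤ) ∣ v₁.det v₂ := by
    rw [ZMod.intCast_eq_intCast_iff_dvd_sub] at e1 e2
    have : v₁.det v₂ = v₁.1.1 * (v₂.1.2 - v₁.1.2) - v₁.1.2 * (v₂.1.1 - v₁.1.1) := by
      rw [Prim.det]; ring
    rw [this]
    exact dvd_sub (e2.mul_left _) (e1.mul_left _)
  set g := q.gcd G with hg
  obtain ⟨q', hq'⟩ : g ∣ q := Nat.gcd_dvd_left _ _
  have hsq' : Squarefree q' := hq.squarefree_of_dvd ⟨g, by rw [hq']; ring⟩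
  have hnG : ∀ p : ℕ, p.Prime → p ∣ q' → ¬ p ∣ G := by
    intro p hp hpq hpG
    have hpg : p ∣ g := Nat.dvd_gcd (hpq.trans ⟨g, by rw [hq']; ring⟩) hpG
    have : p * p ∣ q := by rw [hq']; exact mul_dvd_mul hpg hpq
    exact hp.one_lt.ne' (Nat.isUnit_iff.1 (hq p this))
  have hq'd : (q' : ℤ) ∣ v₁.det v₂ := by
    refine natAbs_dvd_of_prime hsq' fun p hp hpq => ?_
    have hpq0 : p ∣ q := hpq.trans ⟨g, by rw [hq']; ring⟩
    have hpq' : (p : ℤ) ∣ a * q := (Int.natCast_dvd_natCast.2 hpq0).mul_left _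
    have key : ∀ v, Good a b q Q v → (p : ℤ) ∣ Q.val v.1.1 v.1.2 := fun v hv => by
      rw [← act_sec_A]; exact hpq'.trans hv.1
    refine prime_dvd_det (Nat.prime_iff_prime_int.1 hp) ?_ (key _ h0) (key _ h1) (key _ h2) ?_
    · intro hD
      exact hnG p hp hpq ((Int.natCast_dvd.1 hD).mul_right _)
    · rw [Int.natCast_dvd, Int.natCast_dvd]
      constructor
      · intro h
        exact (Nat.dvd_gcd hpq0 h).trans (e ▸ Nat.gcd_dvd_right _ _)
      · intro h
        exact (Nat.dvd_gcd hpq0 h).trans (e ▸ Nat.gcd_dvd_right _ _)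
  have haq : a * (q : ℤ) = ((a.natAbs * g : ℕ) : ℤ) * q' := by
    rw [hq']
    push_cast
    rw [abs_of_pos ha]; ring
  rw [haq]
  refine IsCoprime.mul_dvd ?_ ?_ hq'd
  · rw [Nat.isCoprime_iff_coprime]
    refine Nat.Coprime.symm (Nat.coprime_of_dvd fun p hp hpq hpa => ?_)
    refine hnG p hp hpq ?_
    rcases hp.dvd_mul.1 hpa with h | h
    · exact h.mul_left _
    · exact h.trans (Nat.gcd_dvd_right _ _)
  · refine dvd_trans ?_ hd
    exact_mod_cast mul_dvd_mul_left _ (Nat.gcd_dvd_right _ _)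

open Classical in
lemma card_good_classes_le (ha : 0 < a) {q : ℕ} (hq : Squarefree q) {Q : QForm D}
    (L : Finset Prim) : ((((L.filter (Good a b q Q)).image (detClass (a * q))).card : ℕ) : ℝ) ≤
      (labelMod D a : ℝ) ^ 2 * q.divisors.card := by
  have hD := Q.neg
  have : NeZero (labelMod D a) := ⟨by
    rw [labelMod]
    have := Int.natAbs_pos.2 ha.ne'
    have := Int.natAbs_pos.2 hD.ne
    positivity⟩
  rcases (L.filter (Good a b q Q)).eq_empty_or_nonempty with h | ⟨v₀, hv₀⟩
  · rw [h]; simp; positivity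
  set f : Prim → (ZMod (labelMod D a) × ZMod (labelMod D a)) × ℕ := fun v =>
    ((v.1.1, v.1.2), q.gcd (v.det v₀).natAbs) with hf
  have hgood : ∀ v ∈ L.filter (Good a b q Q), Good a b q Q v := fun v hv =>
    (Finset.mem_filter.1 hv).2
  have h1 : ((L.filter (Good a b q Q)).image (detClass (a * q))).card ≤
      ((L.filter (Good a b q Q)).image f).card := by
    refine card_image_le_of_label _ _ _ fun v hv w hw hvw => ?_
    simp only [hf, Prod.mk.injEq] at hvw
    rw [detClass_eq_iff]
    exact dvd_det_of_label ha hq (hgood _ hv₀) (hgood _ hv) (hgood _ hw) hvw.1.1 hvw.1.2 hvw.2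
  have h2 : (L.filter (Good a b q Q)).image f ⊆ Finset.univ ×ˢ q.divisors := by
    intro y hy
    obtain ⟨v, -, rfl⟩ := Finset.mem_image.1 hy
    simp only [hf, Finset.mem_product, Finset.mem_univ, true_and, Nat.mem_divisors]
    exact ⟨Nat.gcd_dvd_left _ _, hq.ne_zero⟩
  have h3 := h1.trans (Finset.card_le_card h2)
  rw [Finset.card_product, Finset.card_univ, Fintype.card_prod, ZMod.card] at h3
  calc ((((L.filter (Good a b q Q)).image (detClass (a * q))).card : ℕ) : ℝ)
      ≤ ((labelMod D a * labelMod D a * q.divisors.card : ℕ) : ℝ) := by exact_mod_cast h3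
    _ = _ := by push_cast; ring

open Classical in
lemma pairSumDvd_eq_class (F : ℍ → ℂ) (Y : ℝ) (N : ℕ) (z : ℍ) :
    pairSumDvd F Y N z =
      ∑ p ∈ (lowVecs Y z ×ˢ lowVecs Y z).filter (fun p => detClass N p.1 = detClass N p.2),
        F (sec p.1 • z) * conj (F (sec p.2 • z)) := by
  rw [pairSumDvd]
  refine Finset.sum_congr (Finset.filter_congr fun p _ => ?_) fun _ _ => rfl
  rw [detClass_eq_iff]

lemma pairSumDvd_nonneg (F : ℍ → ℂ) (Y : ℝ) (N : ℕ) (z : ℍ) : 0 ≤ (pairSumDvd F Y N z).re := by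
  classical
  have h := sum_same_class (lowVecs Y z) (detClass N) (fun v => F (sec v • z))
  rw [pairSumDvd_eq_class]
  exact h ▸ Finset.sum_nonneg fun _ _ => sq_nonneg _

open Classical in
lemma norm_sq_sum_good_le {a q : ℕ} (ha : 0 < a) (hq : Squarefree q) (Q : QForm D)
    (F : ℍ → ℂ) (Y : ℝ) (z : ℍ) :
    ‖∑ v ∈ (lowVecs Y z).filter (Good a b q Q), F (sec v • z)‖ ^ 2 ≤
      (labelMod D a : ℝ) ^ 2 * q.divisors.card * (pairSumDvd F Y (a * q) z).re := by
  rw [pairSumDvd_eq_class]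
  have haz : (0 : ℤ) < a := by exact_mod_cast ha
  refine norm_sq_sum_saturated_le (lowVecs Y z) (detClass ((a * q : ℕ) : ℤ))
    (fun v => F (sec v • z)) (Good a b q Q) ?_ ?_
  · intro v w hv h
    rw [detClass_eq_iff] at h
    exact Good.of_dvd_det hv (by exact_mod_cast h)
  · have := card_good_classes_le (b := b) haz hq (Q := Q) (lowVecs Y z)
    exact_mod_cast this

end Classes
end QuadRoots

namespace QuadRoots

section Box
open MeasureTheory UpperHalfPlane ModularGroup
open scoped MatrixGroups Real ENNReal

/-- A small rectangle with a corner or an edge point at `z₀`. -/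
def box (z₀ : ℍ) (η : ℝ) : Set ℍ :=
  {z | (z₀.im ≤ z.im ∧ z.im ≤ z₀.im * (1 + η)) ∧ |z.re - z₀.re| ≤ η * z₀.im ∧ |z.re| ≤ 1}

lemma measurableSet_box (z₀ : ℍ) (η : ℝ) : MeasurableSet (box z₀ η) := by
  have hr := continuous_re
  have hi := continuous_im
  have h1 : IsClosed {z : ℍ | |z.re - z₀.re| ≤ η * z₀.im} :=
    isClosed_le (hr.sub continuous_const).abs continuous_const
  have h2 : IsClosed {z : ℍ | |z.re| ≤ 1} := isClosed_le hr.abs continuous_const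
  exact (((isClosed_le continuous_const hi).inter (isClosed_le hi continuous_const)).inter
    (h1.inter h2)).measurableSet

lemma box_subset_siegel {z₀ : ℍ} (hz : z₀ ∈ siegel) (η : ℝ) : box z₀ η ⊆ siegel :=
  fun _ h => ⟨h.2.2, hz.2.trans h.1.1⟩

lemma dist_le_of_mem_box {z₀ z : ℍ} {η : ℝ} (hz : z ∈ box z₀ η) : dist z z₀ ≤ 2 * η := by
  obtain ⟨⟨h1, h2⟩, h3, -⟩ := hz
  have hy := z₀.im_pos
  refine (dist_le_dist_coe_div_sqrt z z₀).trans ?_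
  have hs : z₀.im ≤ √(z.im * z₀.im) := Real.le_sqrt_of_sq_le (by nlinarith)
  have hd : dist (z : ℂ) z₀ ≤ 2 * η * z₀.im := by
    rw [Complex.dist_eq]
    refine (Complex.norm_le_abs_re_add_abs_im _).trans ?_
    have e1 : ((z : ℂ) - z₀).re = z.re - z₀.re := rfl
    have e2 : ((z : ℂ) - z₀).im = z.im - z₀.im := rfl
    rw [e1, e2, abs_of_nonneg (sub_nonneg.2 h1)]
    nlinarith
  rw [div_le_iff₀ (by positivity)]
  have h0 : 0 ≤ 2 * η := by
    have := abs_nonneg (z.re - z₀.re)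
    have : 0 ≤ η * z₀.im := this.trans h3
    have := nonneg_of_mul_nonneg_left this hy
    linarith
  exact hd.trans (mul_le_mul_of_nonneg_left hs h0)

lemma volume_box_ge {z₀ : ℍ} (hz : z₀ ∈ siegel) {η : ℝ} (hη : 0 < η) (h1 : η ≤ 1)
    (hηy : η * z₀.im ≤ 1) : η ^ 2 / 4 ≤ volume.real (box z₀ η) := by
  have hy := z₀.im_pos
  have hfin : volume (box z₀ η) ≠ ∞ :=
    ((measure_mono (box_subset_siegel hz η)).trans_lt volume_siegel_lt_top).ne
  rw [measureReal_def, ← ENNReal.ofReal_le_iff_le_toReal hfin]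
  obtain ⟨u, hu⟩ : ∃ u : ℝ, ∀ x, u ≤ x → x ≤ u + η * z₀.im →
      |x - z₀.re| ≤ η * z₀.im ∧ |x| ≤ 1 := by
    have hx := abs_le.1 hz.1
    have : 0 < η * z₀.im := by positivity
    rcases le_total 0 z₀.re with h | h
    · refine ⟨z₀.re - η * z₀.im, fun x h2 h3 => ⟨abs_le.2 ⟨?_, ?_⟩, abs_le.2 ⟨?_, ?_⟩⟩⟩ <;> linarith
    · refine ⟨z₀.re, fun x h2 h3 => ⟨abs_le.2 ⟨?_, ?_⟩, abs_le.2 ⟨?_, ?_⟩⟩⟩ <;> linarith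
  set R : Set ℂ := Complex.measurableEquivRealProd ⁻¹'
    (Set.Icc u (u + η * z₀.im) ×ˢ Set.Icc z₀.im (z₀.im * (1 + η))) with hR
  have hRm : MeasurableSet R := Complex.measurableEquivRealProd.measurable
    (measurableSet_Icc.prod measurableSet_Icc)
  have hRvol : volume R = ENNReal.ofReal ((η * z₀.im) ^ 2) := by
    rw [hR, Complex.volume_preserving_equiv_real_prod.measure_preimage_equiv,
      Measure.volume_eq_prod, Measure.prod_prod, Real.volume_Icc, Real.volume_Icc,
      ← ENNReal.ofReal_mul (by linarith [mul_pos hη hy])]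
    congr 1; ring
  have hsub : R ⊆ (↑) '' box z₀ η := by
    intro w hw
    obtain ⟨⟨h2, h3⟩, h4, h5⟩ := hw
    simp only [Complex.measurableEquivRealProd_apply] at h2 h3 h4 h5
    exact ⟨⟨w, hy.trans_le h4⟩, ⟨⟨h4, h5⟩, hu _ h2 h3⟩, rfl⟩
  rw [volume_eq_lintegral]
  calc ENNReal.ofReal (η ^ 2 / 4)
      ≤ ENNReal.ofReal ((1 / (2 * z₀.im)) ^ 2) * volume R := by
        rw [hRvol, ← ENNReal.ofReal_mul (by positivity)]
        refine ENNReal.ofReal_le_ofReal (le_of_eq ?_)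
        field_simp
        norm_num
    _ = ∫⁻ _ in R, ENNReal.ofReal ((1 / (2 * z₀.im)) ^ 2) := by rw [setLIntegral_const]
    _ ≤ ∫⁻ w in R, ↑((1 / ‖w.im‖₊) ^ 2 : NNReal) := by
        refine setLIntegral_mono' hRm fun w hw => ?_
        obtain ⟨-, h4, h5⟩ := hw
        simp only [Complex.measurableEquivRealProd_apply] at h4 h5
        have hw0 : 0 < w.im := hy.trans_le h4
        have h3 : (((1 / ‖w.im‖₊) ^ 2 : NNReal) : ℝ≥0∞) = ENNReal.ofReal ((1 / w.im) ^ 2) := by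
          rw [ENNReal.ofReal, ENNReal.coe_inj]
          ext
          rw [Real.coe_toNNReal _ (by positivity)]
          simp [abs_of_pos hw0]
        rw [h3]
        refine ENNReal.ofReal_le_ofReal ?_
        gcongr
        nlinarith
    _ ≤ _ := lintegral_mono_set hsub

lemma norm_ft_sub_le (s t : ℝ) : ‖ft s - ft t‖ ≤ 2 * π * |s - t| := by
  have h : ft s - ft t = ft t * (Complex.exp (Complex.I * ((2 * π * (s - t) : ℝ) : ℂ)) - 1) := by
    rw [mul_sub, mul_one, ft, ft, ← Complex.exp_add]
    push_cast; ring_nf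
  rw [h, norm_mul, norm_ft, one_mul]
  refine Real.norm_exp_I_mul_ofReal_sub_one_le.trans (le_of_eq ?_)
  rw [Real.norm_eq_abs, abs_mul, abs_of_pos Real.two_pi_pos]

open Classical in
/-- A majorant for the variation of `cuspPhase` on a hyperbolic ball. -/
noncomputable def phaseErr (h : ℤ) (κ Y θ : ℝ) (w : ℍ) : ℝ :=
  if 1 / (Y * (1 + θ)) ≤ w.im then
    (if w.im < (1 + 2 * θ) / Y then 1 else 0) + 2 * π * |(h : ℝ)| * (1 + |κ|) * θ * w.im
  else 0

lemma phaseErr_nonneg {h : ℤ} {κ Y θ : ℝ} (hθ : 0 ≤ θ) (w : ℍ) : 0 ≤ phaseErr h κ Y θ w := by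
  have := w.im_pos
  unfold phaseErr
  split_ifs <;> positivity

lemma im_re_close {w w₀ : ℍ} {η : ℝ} (hη : η ≤ 1 / 8) (hd : dist w w₀ ≤ 2 * η) :
    |w.re - w₀.re| ≤ 4 * η * w₀.im ∧ |w.im - w₀.im| ≤ 4 * η * w₀.im := by
  have hy := w₀.im_pos
  have h1 : dist (w : ℂ) w₀ ≤ 4 * η * w₀.im := by
    refine (dist_coe_le w w₀).trans ?_
    have h0 : 0 ≤ dist w w₀ := dist_nonneg
    have h2 : Real.exp (dist w w₀) - 1 ≤ 2 * dist w w₀ := by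
      have := Real.abs_exp_sub_one_le (x := dist w w₀) (by rw [abs_of_nonneg h0]; linarith)
      rw [abs_of_nonneg h0] at this
      exact (le_abs_self _).trans this
    nlinarith
  rw [Complex.dist_eq] at h1
  exact ⟨(Complex.abs_re_le_norm ((w : ℂ) - w₀)).trans h1,
    (Complex.abs_im_le_norm ((w : ℂ) - w₀)).trans h1⟩

lemma norm_cuspPhase_sub_le (h : ℤ) (κ : ℝ) {Y θ : ℝ} (hY : 0 < Y) (hθ0 : 0 ≤ θ)
    (hθ : θ ≤ 1 / 2) {w w₀ : ℍ} (hre : |w.re - w₀.re| ≤ θ * w₀.im)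
    (him : |w.im - w₀.im| ≤ θ * w₀.im) :
    ‖cuspPhase h κ Y w₀ - cuspPhase h κ Y w‖ ≤ phaseErr h κ Y θ w₀ := by
  have hy := w₀.im_pos
  have him' := abs_le.1 him
  have hlow : 1 / Y ≤ w₀.im * (1 + θ) → 1 / (Y * (1 + θ)) ≤ w₀.im := by
    intro hh
    rw [div_le_iff₀ (by positivity)] at hh ⊢
    linarith
  have hcst : 0 ≤ 2 * π * |(h : ℝ)| * (1 + |κ|) * θ * w₀.im := by positivity
  by_cases h0 : 1 / Y ≤ w₀.im
  · have hl : 1 / (Y * (1 + θ)) ≤ w₀.im := hlow (h0.trans (by nlinarith))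
    rw [phaseErr, if_pos hl]
    by_cases h1 : 1 / Y ≤ w.im
    · rw [cuspPhase, cuspPhase, if_pos h0, if_pos h1]
      refine (norm_ft_sub_le _ _).trans ?_
      have e : |-(h * (w₀.re + κ * w₀.im)) - -(h * (w.re + κ * w.im))| ≤
          |(h : ℝ)| * ((1 + |κ|) * (θ * w₀.im)) := by
        rw [show -(h * (w₀.re + κ * w₀.im)) - -(h * (w.re + κ * w.im)) =
          (h : ℝ) * ((w.re - w₀.re) + κ * (w.im - w₀.im)) by ring, abs_mul]
        gcongr
        refine (abs_add_le _ _).trans ?_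
        rw [abs_mul, add_mul, one_mul]
        gcongr
      have : (0 : ℝ) ≤ if w₀.im < (1 + 2 * θ) / Y then 1 else 0 := by split_ifs <;> norm_num
      calc _ ≤ 2 * π * (|(h : ℝ)| * ((1 + |κ|) * (θ * w₀.im))) := by gcongr
        _ = 2 * π * |(h : ℝ)| * (1 + |κ|) * θ * w₀.im := by ring
        _ ≤ _ := by linarith
    · rw [cuspPhase_eq_zero (not_le.1 h1), sub_zero]
      rw [if_pos]
      · linarith [norm_cuspPhase_le h κ Y w₀]
      · have h2 : w₀.im * (1 - θ) < 1 / Y := by linarith [not_le.1 h1]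
        rw [lt_div_iff₀ hY] at h2 ⊢
        have h3 : 0 < w₀.im * Y := by positivity
        nlinarith
  · rw [cuspPhase_eq_zero (not_le.1 h0), zero_sub, norm_neg]
    by_cases h1 : 1 / Y ≤ w.im
    · have hl : 1 / (Y * (1 + θ)) ≤ w₀.im := hlow (h1.trans (by linarith))
      rw [phaseErr, if_pos hl, if_pos]
      · linarith [norm_cuspPhase_le h κ Y w]
      · refine (not_le.1 h0).trans_le ?_
        gcongr
        linarith
    · rw [cuspPhase_eq_zero (not_le.1 h1), norm_zero]
      exact phaseErr_nonneg hθ0 _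

end Box
end QuadRoots

namespace QuadRoots

section LargeSieve
open MeasureTheory UpperHalfPlane ModularGroup QForm
open scoped MatrixGroups Real

variable {D b : ℤ}

lemma dist_smul_int (g : SL(2, ℤ)) (z w : ℍ) : dist (g • z) (g • w) = dist z w := by
  have h : ∀ z : ℍ, g • z = (Matrix.SpecialLinearGroup.map (Int.castRingHom ℝ) g) • z := fun z => by
    ext
    rw [coe_specialLinearGroup_apply, coe_specialLinearGroup_apply]
    simp
  rw [h, h, dist_smul]

open Classical in
lemma norm_sq_form_sum_le {a q : ℕ} (ha : 0 < a) (hq : Squarefree q) {Q : QForm D}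
    (hQ : Q.point ∈ siegel) (h : ℤ) (κ : ℝ) {Y η : ℝ} (hY : 1 ≤ Y) (hη : 0 < η) (hη8 : η ≤ 1 / 8)
    (hηD : η * rt D ≤ 1) :
    ‖∑ v ∈ (lowVecs Y Q.point).filter (Good a b q Q), cuspPhase h κ Y (sec v • Q.point)‖ ^ 2 ≤
      2 * (∑ v ∈ (lowVecs (Y * (1 + 4 * η)) Q.point).filter (Good a b q Q),
        phaseErr h κ Y (4 * η) (sec v • Q.point)) ^ 2 +
      8 * ((labelMod D a : ℝ) ^ 2 * q.divisors.card) * nearElts.card * (20 * Y * volume.real siegel +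
        16 * Y * ∑ k ∈ (Finset.Icc 1 ⌊Y⌋₊).filter (a * q ∣ ·), klNorm (-h) k / k) / η ^ 2 := by
  have hY0 : 0 < Y := by linarith
  set z₀ := Q.point with hz₀
  set F := cuspPhase h κ Y with hF
  set E := ∑ v ∈ (lowVecs (Y * (1 + 4 * η)) z₀).filter (Good a b q Q),
        phaseErr h κ Y (4 * η) (sec v • z₀) with hE
  set M : ℝ := (labelMod D a : ℝ) ^ 2 * q.divisors.card with hM
  set N : ℝ := (nearElts.card : ℝ) with hN
  set J : ℝ := 20 * Y * volume.real siegel +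
        16 * Y * ∑ k ∈ (Finset.Icc 1 ⌊Y⌋₊).filter (a * q ∣ ·), klNorm (-h) k / k with hJ
  obtain ⟨R, hRint, hRle, hRJ⟩ := exists_majorant h κ hY (a * q)
  have hM0 : 0 ≤ M := by positivity
  have hN0 : 0 < N := by
    have : (1 : SL(2, ℤ)) ∈ nearElts := mem_nearElts hQ (by rwa [one_smul])
    rw [hN]
    exact_mod_cast Finset.card_pos.2 ⟨1, this⟩
  have hR0 : ∀ z, 0 ≤ R z := fun z =>
    (mul_nonneg (weight_nonneg z) (pairSumDvd_nonneg _ _ _ _)).trans (hRle z)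
  set P := fun z : ℍ => ∑ v ∈ (lowVecs Y z).filter (Good a b q Q), F (sec v • z) with hP
  have hPlow : ∀ z : ℍ, lowVecs Y z ⊆ lowVecs (Y * (1 + 4 * η)) z₀ →
      P z = ∑ v ∈ (lowVecs (Y * (1 + 4 * η)) z₀).filter (Good a b q Q), F (sec v • z) := by
    intro z hz
    refine Finset.sum_subset (Finset.filter_subset_filter _ hz) fun v hv hv' => ?_
    rw [Finset.mem_filter] at hv hv'
    have : v ∉ lowVecs Y z := fun h' => hv' ⟨h', hv.2⟩
    rw [mem_lowVecs hY0, not_le] at this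
    exact cuspPhase_eq_zero this
  have hYY : 0 < Y * (1 + 4 * η) := by positivity
  have hsub0 : lowVecs Y z₀ ⊆ lowVecs (Y * (1 + 4 * η)) z₀ := by
    intro v hv
    rw [mem_lowVecs hY0] at hv
    rw [mem_lowVecs hYY]
    refine le_trans ?_ hv
    gcongr
    nlinarith
  have hbox : ∀ z ∈ box z₀ η, ‖P z₀‖ ^ 2 - 2 * E ^ 2 ≤ 2 * M * N * R z := by
    intro z hz
    have hd : ∀ v : Prim, dist (sec v • z) (sec v • z₀) ≤ 2 * η := fun v => by
      rw [dist_smul_int]; exact dist_le_of_mem_box hz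
    have hsub : lowVecs Y z ⊆ lowVecs (Y * (1 + 4 * η)) z₀ := by
      intro v hv
      rw [mem_lowVecs hY0] at hv
      rw [mem_lowVecs hYY]
      have h1 := (abs_le.1 (im_re_close hη8 (hd v)).2).2
      rw [div_le_iff₀ hY0] at hv
      rw [div_le_iff₀ hYY]
      nlinarith
    have h1 : ‖P z₀‖ ≤ E + ‖P z‖ := by
      have : ‖P z₀ - P z‖ ≤ E := by
        rw [hPlow z hsub, hPlow z₀ hsub0, ← Finset.sum_sub_distrib]
        refine (norm_sum_le _ _).trans (Finset.sum_le_sum fun v _ => ?_)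
        have := im_re_close hη8 (hd v)
        exact norm_cuspPhase_sub_le h κ hY0 (by linarith) (by linarith) this.1 this.2
      calc ‖P z₀‖ = ‖(P z₀ - P z) + P z‖ := by rw [sub_add_cancel]
        _ ≤ _ := (norm_add_le _ _).trans (by gcongr)
    have h2 : ‖P z‖ ^ 2 ≤ M * (N * R z) := by
      refine (norm_sq_sum_good_le ha hq Q F Y z).trans ?_
      refine mul_le_mul_of_nonneg_left ?_ hM0
      have hw := le_weight (box_subset_siegel hQ η hz)
      have hp := pairSumDvd_nonneg F Y (a * q) z
      have h3 := hRle z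
      have h4 : 1 / N * (pairSumDvd F Y (a * q) z).re ≤ R z :=
        (mul_le_mul_of_nonneg_right hw hp).trans h3
      rw [div_mul_eq_mul_div, one_mul, div_le_iff₀ hN0] at h4
      linarith
    have h3 : ‖P z₀‖ ^ 2 ≤ (E + ‖P z‖) ^ 2 := by gcongr
    nlinarith [sq_nonneg (E - ‖P z‖)]
  have hInt : (‖P z₀‖ ^ 2 - 2 * E ^ 2) * volume.real (box z₀ η) ≤ 2 * M * N * J := by
    have hfin : volume (box z₀ η) ≠ ⊤ :=
      ((measure_mono (box_subset_siegel hQ η)).trans_lt volume_siegel_lt_top).ne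
    refine (setIntegral_ge_of_const_le_real (measurableSet_box z₀ η) hfin hbox
      (hRint.const_mul _).integrableOn).trans ?_
    rw [integral_const_mul]
    refine mul_le_mul_of_nonneg_left ?_ (by positivity)
    exact (setIntegral_le_integral hRint (Filter.Eventually.of_forall hR0)).trans hRJ
  have hJ0 : 0 ≤ J := le_trans (integral_nonneg hR0) hRJ
  change ‖P z₀‖ ^ 2 ≤ _
  rcases le_total (‖P z₀‖ ^ 2 - 2 * E ^ 2) 0 with hc | hc
  · have : 0 ≤ 8 * M * N * J / η ^ 2 := by positivity
    linarith
  · have hA : (1 : ℝ) ≤ Q.A := by exact_mod_cast Q.pos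
    have hs := rt_pos Q.neg
    have him : η * z₀.im ≤ 1 := by
      refine le_trans ?_ hηD
      rw [hz₀, point_im]
      refine mul_le_mul_of_nonneg_left ?_ hη.le
      rw [div_le_iff₀ (by linarith)]
      nlinarith
    have hv := volume_box_ge hQ hη (by linarith) him
    have h5 := (mul_le_mul_of_nonneg_left hv hc).trans hInt
    have h6 : ‖P z₀‖ ^ 2 - 2 * E ^ 2 ≤ 8 * M * N * J / η ^ 2 := by
      rw [le_div_iff₀ (by positivity)]
      linarith
    linarith

variable {c : ℤ}

/-- The exponential sum over the roots of a quadratic congruence. -/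
noncomputable def rho (a b c h : ℤ) (n : ℕ) : ℂ :=
  ∑ ν ∈ roots a b c n, ft (h * ν / n)

lemma periodic_phaseErr (h : ℤ) (κ Y θ : ℝ) : Periodic fun w => (phaseErr h κ Y θ w : ℂ) := by
  intro n z
  simp only [phaseErr, im_T_zpow_smul]

/-- The error term arising from replacing points by small balls. -/
noncomputable def ballErr (h : ℤ) (κ X θ : ℝ) (a b c : ℤ) (q : ℕ) : ℝ :=
  ∑ n ∈ (Finset.Icc 1 ⌊X * (1 + θ)⌋₊).filter (q ∣ ·), ((roots a b c n).card : ℝ) *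
    ((if X < n * (1 + 2 * θ) then 1 else 0) +
      2 * π * |(h : ℝ)| * (1 + |κ|) * θ * (rt (b ^ 2 - 4 * a * c) / (2 * a * n)))

lemma sum_phaseErr_le {a : ℤ} (ha : 0 < a) (hD : b ^ 2 - 4 * a * c < 0) (q : ℕ) (h : ℤ) (κ : ℝ)
    {X θ : ℝ} (hX : 0 < X) (hθ : 0 ≤ θ) :
    ∑ i : rootPairs a b c q ⌊X * (1 + θ)⌋₊,
      phaseErr h κ (2 * a * X / rt (b ^ 2 - 4 * a * c)) θ (rootForm ha hD i).point ≤
      ballErr h κ X θ a b c q := by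
  set s := rt (b ^ 2 - 4 * a * c) with hs
  have hs0 : 0 < s := rt_pos hD
  have haR : (0 : ℝ) < a := by exact_mod_cast ha
  have h1 : ∀ i : rootPairs a b c q ⌊X * (1 + θ)⌋₊,
      phaseErr h κ (2 * a * X / s) θ (rootForm ha hD i).point ≤
      (fun i : Σ _ : ℕ, ℕ => ((if X < i.1 * (1 + 2 * θ) then 1 else 0) +
      2 * π * |(h : ℝ)| * (1 + |κ|) * θ * (s / (2 * a * i.1)))) i := by
    intro i
    have hi : (0 : ℝ) < i.1.1 := by exact_mod_cast (mem_rootPairs.1 i.2).1.1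
    have him : (rootForm ha hD i).point.im = s / (2 * a * i.1.1) := by
      rw [point_im, ← hs]
      simp only [rootForm]
      push_cast; rw [mul_assoc]
    have hite : (if X < i.1.1 * (1 + 2 * θ) then (1 : ℝ) else 0) =
        if s / (2 * a * i.1.1) < (1 + 2 * θ) / (2 * a * X / s) then 1 else 0 := by
      refine if_congr ?_ rfl rfl
      rw [lt_div_iff₀ (by positivity), div_mul_div_comm, div_lt_iff₀ (by positivity)]
      have : (0 : ℝ) < 2 * a * s := by positivity
      constructor
      · intro h'; nlinarith
      · intro h'
        have : (2 * a * s) * X < (2 * a * s) * (i.1.1 * (1 + 2 * θ)) := by linarith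
        exact lt_of_mul_lt_mul_left this (by positivity)
    simp only
    rw [phaseErr, him, hite]
    split_ifs <;> first | exact le_rfl | positivity
  refine (Finset.sum_le_sum fun i _ => h1 i).trans ?_
  rw [Finset.univ_eq_attach, Finset.sum_attach (rootPairs a b c q ⌊X * (1 + θ)⌋₊)
    (fun i : Σ _ : ℕ, ℕ => ((if X < i.1 * (1 + 2 * θ) then (1 : ℝ) else 0) +
      2 * π * |(h : ℝ)| * (1 + |κ|) * θ * (s / (2 * a * i.1)))), rootPairs, Finset.sum_sigma,
    ballErr]
  refine Finset.sum_le_sum fun n _ => le_of_eq ?_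
  rw [← nsmul_eq_mul, ← Finset.sum_const]

lemma sum_rho_eq {a : ℤ} (ha : 0 < a) (hD : b ^ 2 - 4 * a * c < 0) (q : ℕ) (h : ℤ)
    {X : ℝ} (hX : 0 < X) :
    ∑ n ∈ (Finset.Icc 1 ⌊X⌋₊).filter (q ∣ ·), rho a b c h n =
      ∑ i : rootPairs a b c q ⌊X⌋₊, cuspPhase h (b / rt (b ^ 2 - 4 * a * c))
        (2 * a * X / rt (b ^ 2 - 4 * a * c)) (rootForm ha hD i).point := by
  set s := rt (b ^ 2 - 4 * a * c) with hs
  have hs0 : 0 < s := rt_pos hD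
  have haR : (0 : ℝ) < a := by exact_mod_cast ha
  have h1 : ∀ i : rootPairs a b c q ⌊X⌋₊, cuspPhase h (b / s) (2 * a * X / s)
      (rootForm ha hD i).point = (fun i : Σ _ : ℕ, ℕ => ft (h * i.2 / i.1)) i := by
    intro i
    have hm := mem_rootPairs.1 i.2
    have hi : (0 : ℝ) < i.1.1 := by exact_mod_cast hm.1.1
    have hiX : (i.1.1 : ℝ) ≤ X := (Nat.le_floor_iff hX.le).1 hm.1.2.1
    have him : (rootForm ha hD i).point.im = s / (2 * a * i.1.1) := by
      rw [point_im, ← hs]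
      simp only [rootForm]
      push_cast; rw [mul_assoc]
    have hre : (rootForm ha hD i).point.re = -(2 * a * i.1.2 + b) / (2 * a * i.1.1) := by
      rw [point_re]
      simp only [rootForm]
      push_cast; rw [mul_assoc 2 (a : ℝ)]; ring
    rw [cuspPhase, if_pos, him, hre]
    · simp only
      congr 1
      field_simp
      ring
    · rw [him, one_div_div]
      gcongr
  rw [Finset.sum_congr rfl fun i _ => h1 i, Finset.univ_eq_attach,
    Finset.sum_attach (rootPairs a b c q ⌊X⌋₊) (fun i : Σ _ : ℕ, ℕ => ft (h * i.2 / i.1)),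
    rootPairs, Finset.sum_sigma]
  rfl

/-- The fundamental bound for exponential sums over roots of quadratic congruences with moduli
divisible by a given squarefree number. -/
theorem norm_sq_sum_rho_le {a : ℕ} (ha : 0 < a) (hD : b ^ 2 - 4 * a * c < 0) {q : ℕ}
    (hq : Squarefree q) (h : ℤ) {X η : ℝ} (hX : rt (b ^ 2 - 4 * a * c) ≤ X) (hη : 0 < η)
    (hη8 : η ≤ 1 / 8) (hηD : η * rt (b ^ 2 - 4 * a * c) ≤ 1) :
    ‖∑ n ∈ (Finset.Icc 1 ⌊X⌋₊).filter (q ∣ ·), rho a b c h n‖ ^ 2 ≤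
      ((reduced (b ^ 2 - 4 * a * c)).card : ℝ) ^ 2 *
      (2 * (nearElts.card * ballErr h (b / rt (b ^ 2 - 4 * a * c)) X (4 * η) a b c q) ^ 2 +
        8 * ((labelMod (b ^ 2 - 4 * a * c) a : ℝ) ^ 2 * q.divisors.card) * nearElts.card *
          (20 * (2 * a * X / rt (b ^ 2 - 4 * a * c)) * volume.real siegel +
          16 * (2 * a * X / rt (b ^ 2 - 4 * a * c)) *
            ∑ k ∈ (Finset.Icc 1 ⌊2 * a * X / rt (b ^ 2 - 4 * a * c)⌋₊).filter (a * q ∣ ·),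
              klNorm (-h) k / k) / η ^ 2) := by
  classical
  have hs0 : 0 < rt (b ^ 2 - 4 * a * c) := rt_pos hD
  have haz : (0 : ℤ) < a := by exact_mod_cast ha
  have haR : (1 : ℝ) ≤ a := by exact_mod_cast ha
  have hX0 : 0 < X := hs0.trans_le hX
  set D : ℤ := b ^ 2 - 4 * a * c with hDdef
  set s := rt D with hs
  have hY : 1 ≤ 2 * a * X / s := by
    rw [le_div_iff₀ hs0]; nlinarith
  set E := ballErr h (b / s) X (4 * η) a b c q with hE
  set K : ℝ := 8 * ((labelMod D a : ℝ) ^ 2 * q.divisors.card) * nearElts.card *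
          (20 * (2 * a * X / s) * volume.real siegel +
          16 * (2 * a * X / s) *
            ∑ k ∈ (Finset.Icc 1 ⌊2 * a * X / s⌋₊).filter (a * q ∣ ·), klNorm (-h) k / k) / η ^ 2
    with hK
  have hθX : X * (1 + 4 * η) * (2 * a) / s = 2 * a * X / s * (1 + 4 * η) := by ring
  have h0 : ∀ Q : QForm D, 0 ≤ ∑ v ∈ (lowVecs (2 * a * X / s * (1 + 4 * η)) Q.point).filter
      (Good a b q Q), phaseErr h (b / s) (2 * a * X / s) (4 * η) (sec v • Q.point) :=
    fun Q => Finset.sum_nonneg fun v _ => phaseErr_nonneg (by positivity) _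
  have hErr : ∀ Q ∈ reduced D, ∑ v ∈ (lowVecs (2 * a * X / s * (1 + 4 * η)) Q.point).filter
      (Good a b q Q), phaseErr h (b / s) (2 * a * X / s) (4 * η) (sec v • Q.point) ≤
      nearElts.card * E := by
    intro Q hQ
    have h1 := sum_rootPairs_eq (a := a) (b := b) (c := c) (q := q) haz hD
      (X := X * (1 + 4 * η)) (by positivity)
      (periodic_phaseErr h (b / s) (2 * a * X / s) (4 * η)) (by
        intro w hw
        rw [phaseErr, if_neg]
        · simp
        · rw [not_le]
          refine lt_of_lt_of_eq hw ?_
          rw [← hs]; push_cast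
          congr 1; ring)
    have h2 := sum_phaseErr_le (b := b) (c := c) haz hD q h (b / s) hX0 (by positivity : 0 ≤ 4 * η)
    rw [← Complex.ofReal_sum] at h1
    simp only [← Complex.ofReal_sum, ← Complex.ofReal_mul] at h1
    rw [Complex.ofReal_inj] at h1
    have h3 : weight Q.point * ∑ v ∈ (lowVecs (2 * a * X / s * (1 + 4 * η)) Q.point).filter
      (Good a b q Q), phaseErr h (b / s) (2 * a * X / s) (4 * η) (sec v • Q.point) ≤ E := by
      refine le_trans ?_ h2
      push_cast at h1 ⊢
      rw [h1]
      have e : (2 * a * (X * (1 + 4 * η)) / s : ℝ) = 2 * a * X / s * (1 + 4 * η) := by ring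
      rw [← hDdef, ← hs, e]
      refine Finset.single_le_sum (f := fun Q : QForm D => weight Q.point *
        ∑ v ∈ (lowVecs (2 * a * X / s * (1 + 4 * η)) Q.point).filter
      (Good a b q Q), phaseErr h (b / s) (2 * a * X / s) (4 * η) (sec v • Q.point)) ?_ hQ
      intro Q' _
      exact mul_nonneg (weight_nonneg _) (Finset.sum_nonneg fun v _ =>
        phaseErr_nonneg (by positivity) _)
    have hN0 : (0 : ℝ) < nearElts.card := by
      have : (1 : SL(2, ℤ)) ∈ nearElts := mem_nearElts (mem_reduced.1 hQ)
        (by rw [one_smul]; exact mem_reduced.1 hQ)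
      exact_mod_cast Finset.card_pos.2 ⟨1, this⟩
    have h4 := mul_le_mul_of_nonneg_right (le_weight (mem_reduced.1 hQ))
      (h0 Q)
    have h5 := h4.trans h3
    rw [div_mul_eq_mul_div, one_mul, div_le_iff₀ hN0] at h5
    linarith
  have hform : ∀ Q ∈ reduced D, ‖∑ v ∈ (lowVecs (2 * a * X / s) Q.point).filter
      (Good a b q Q), cuspPhase h (b / s) (2 * a * X / s) (sec v • Q.point)‖ ^ 2 ≤
      2 * (nearElts.card * E) ^ 2 + K := by
    intro Q hQ
    refine (norm_sq_form_sum_le ha hq (mem_reduced.1 hQ) h (b / s) hY hη hη8 hηD).trans ?_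
    refine add_le_add ?_ le_rfl
    have := hErr Q hQ
    have h0' := h0 Q
    gcongr
  have hmain := sum_rootPairs_eq (a := a) (b := b) (c := c) (q := q) haz hD hX0
      (periodic_cuspPhase h (b / s) (2 * a * X / s)) (by
        intro w hw
        exact cuspPhase_eq_zero (by push_cast at hw ⊢; exact hw))
  rw [sum_rho_eq haz hD q h hX0]
  push_cast at hmain ⊢
  rw [hmain]
  set S : QForm D → ℂ := fun Q => ∑ v ∈ (lowVecs (2 * a * X / s) Q.point).filter
      (Good a b q Q), cuspPhase h (b / s) (2 * a * X / s) (sec v • Q.point) with hS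
  calc ‖∑ Q ∈ reduced D, (weight Q.point : ℂ) * S Q‖ ^ 2
      ≤ (∑ Q ∈ reduced D, ‖S Q‖) ^ 2 := by
        gcongr
        refine (norm_sum_le _ _).trans (Finset.sum_le_sum fun Q _ => ?_)
        rw [norm_mul, Complex.norm_real, Real.norm_of_nonneg (weight_nonneg _)]
        exact mul_le_of_le_one_left (norm_nonneg _) (weight_le_one _)
    _ ≤ (reduced D).card * ∑ Q ∈ reduced D, ‖S Q‖ ^ 2 := sq_sum_le_card_mul_sum_sq
    _ ≤ (reduced D).card * ∑ Q ∈ reduced D, (2 * (nearElts.card * E) ^ 2 + K) := by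
        gcongr with Q hQ
        exact hform Q hQ
    _ = _ := by rw [Finset.sum_const, nsmul_eq_mul]; ring

end LargeSieve
end QuadRoots

namespace QuadRoots

section RootCount

lemma dvd_mul_sub_of_roots {a b c : ℤ} {n : ℕ} (hn : 0 < n) {x y z : ℤ}
    (hx : (n : ℤ) ∣ a * x ^ 2 + b * x + c) (hy : (n : ℤ) ∣ a * y ^ 2 + b * y + c)
    (hz : (n : ℤ) ∣ a * z ^ 2 + b * z + c) (h : Int.gcd (y - x) n = Int.gcd (z - x) n) :
    (n : ℤ) ∣ (b ^ 2 - 4 * a * c) * a * (y - z) := by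
  set d := Int.gcd (y - x) n with hd
  have hd0 : 0 < d := Int.gcd_pos_of_ne_zero_right _ (by exact_mod_cast hn.ne')
  have key : ∀ w : ℤ, (n : ℤ) ∣ a * w ^ 2 + b * w + c → Int.gcd (w - x) n = d →
      (d : ℤ) ∣ w - x ∧ ((n / d : ℤ)) ∣ a * (w + x) + b := by
    intro w hw hwd
    refine ⟨hwd ▸ Int.gcd_dvd_left _ _, ?_⟩
    have h1 : (n : ℤ) ∣ (w - x) * (a * (w + x) + b) := by
      have := dvd_sub hw hx
      exact this.trans (dvd_of_eq (by ring))
    have h2 : (n / d : ℤ) ∣ ((w - x) / d) * (a * (w + x) + b) := by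
      have h3 : (d : ℤ) ∣ w - x := hwd ▸ Int.gcd_dvd_left _ _
      rw [← Int.mul_ediv_assoc' _ h3]
      exact Int.ediv_dvd_ediv (hwd ▸ Int.gcd_dvd_right _ _) h1
    refine Int.dvd_of_dvd_mul_right_of_gcd_one h2 ?_
    have := Int.gcd_ediv_gcd_ediv_gcd (i := w - x) (j := n) (hwd.symm ▸ hd0)
    rw [hwd] at this
    rw [Int.gcd_comm]; exact this
  obtain ⟨hy1, hy2⟩ := key y hy rfl
  obtain ⟨hz1, hz2⟩ := key z hz h.symm
  have hdn : (d : ℤ) ∣ n := Int.gcd_dvd_right _ _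
  obtain ⟨e, he⟩ := hdn
  have he' : (n / d : ℤ) = e := by
    rw [he, Int.mul_ediv_cancel_left _ (by exact_mod_cast hd0.ne')]
  rw [he'] at hy2 hz2
  have hg : ((Int.gcd d e : ℕ) : ℤ) ∣ b ^ 2 - 4 * a * c := by
    set g : ℤ := ((Int.gcd d e : ℕ) : ℤ) with hgdef
    have g1 : g ∣ d := Int.gcd_dvd_left _ _
    have g2 : g ∣ e := Int.gcd_dvd_right _ _
    have g3 : g ∣ 2 * a * x + b := by
      have := dvd_sub (g2.trans hy2) ((g1.trans hy1).mul_left a)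
      exact this.trans (dvd_of_eq (by ring))
    have g4 : g ∣ a * x ^ 2 + b * x + c := (g1.trans ⟨e, he⟩).trans hx
    have := dvd_sub ((g3.mul_left (2 * a * x + b))) (g4.mul_left (4 * a))
    exact this.trans (dvd_of_eq (by ring))
  have hl : ((Int.lcm d e : ℕ) : ℤ) ∣ a * (y - z) := by
    refine Int.coe_lcm_dvd ?_ ?_
    · have := (dvd_sub hy1 hz1).mul_left a
      exact this.trans (dvd_of_eq (by ring))
    · have := dvd_sub hy2 hz2
      exact this.trans (dvd_of_eq (by ring))
  have hprod : (n : ℤ) ∣ ((Int.gcd d e : ℕ) : ℤ) * ((Int.lcm d e : ℕ) : ℤ) := by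
    rw [he, ← Nat.cast_mul, Int.gcd_mul_lcm]
    rw [← Int.natAbs_mul]; exact Int.dvd_natAbs.2 (dvd_refl _)
  rw [mul_assoc]
  exact hprod.trans (mul_dvd_mul hg hl)

lemma card_filter_dvd_le {K y : ℤ} (hK : K ≠ 0) {n : ℕ} (hn : 0 < n) (hy : 0 ≤ y) (hyn : y < n) :
    ((Finset.range n).filter fun ν : ℕ => (n : ℤ) ∣ K * (ν - y)).card ≤ 2 * K.natAbs := by
  have hn' : (0 : ℤ) < n := by exact_mod_cast hn
  have h : ((Finset.range n).filter fun ν : ℕ => (n : ℤ) ∣ K * (ν - y)).card ≤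
      (Finset.Ioc (-|K|) |K|).card := by
    refine Finset.card_le_card_of_injOn (fun ν => K * (ν - y) / n) ?_ ?_
    · intro ν hν
      simp only [Finset.coe_filter, Finset.mem_range, Set.mem_ofPred_eq] at hν
      obtain ⟨k, hk⟩ := hν.2
      have e : K * (ν - y) / n = k := by rw [hk, Int.mul_ediv_cancel_left _ hn'.ne']
      simp only [Finset.coe_Ioc, Set.mem_Ioc, e]
      have h1 : |((ν : ℤ) - y)| < n := by
        have := hν.1
        rw [abs_lt]; omega
      have h2 : (n : ℤ) * |k| < n * |K| := by
        rw [← abs_of_pos hn', ← abs_mul, ← hk, abs_mul, abs_of_pos hn', mul_comm]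
        exact mul_lt_mul_of_pos_right h1 (abs_pos.2 hK)
      have h3 := abs_lt.1 (lt_of_mul_lt_mul_left h2 hn'.le)
      exact ⟨h3.1, h3.2.le⟩
    · intro ν hν μ hμ hνμ
      simp only [Finset.coe_filter, Finset.mem_range, Set.mem_ofPred_eq] at hν hμ
      have := (Int.ediv_left_inj hν.2 hμ.2).1 hνμ
      have := mul_left_cancel₀ hK this
      omega
  refine h.trans ?_
  rw [Int.card_Ioc, Int.abs_eq_natAbs]
  omega

lemma card_roots_le {a b c : ℤ} (ha : a ≠ 0) (hD : b ^ 2 - 4 * a * c ≠ 0) {n : ℕ} (hn : 0 < n) :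
    (roots a b c n).card ≤ 2 * ((b ^ 2 - 4 * a * c) * a).natAbs * n.divisors.card := by
  rcases (roots a b c n).eq_empty_or_nonempty with h0 | ⟨x, hx⟩
  · rw [h0]; simp
  have hmem : ∀ {ν : ℕ}, ν ∈ roots a b c n → ν < n ∧
      (n : ℤ) ∣ a * (ν : ℤ) ^ 2 + b * (ν : ℤ) + c := fun h => by
    simpa [roots] using h
  refine Finset.card_le_mul_card_image_of_maps_to (f := fun ν : ℕ => Int.gcd ((ν : ℤ) - x) n)
    (fun ν _ => ?_) _ fun d _ => ?_
  · rw [Nat.mem_divisors]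
    exact ⟨by exact_mod_cast Int.gcd_dvd_right ((ν : ℤ) - x) n, hn.ne'⟩
  · rcases ((roots a b c n).filter fun ν : ℕ => Int.gcd ((ν : ℤ) - x) n = d).eq_empty_or_nonempty
      with h0 | ⟨y, hy⟩
    · rw [h0]; simp
    rw [Finset.mem_filter] at hy
    refine le_trans (Finset.card_le_card ?_) (card_filter_dvd_le (y := y)
      (mul_ne_zero hD ha) hn (by positivity) (by exact_mod_cast (hmem hy.1).1))
    intro ν hν
    rw [Finset.mem_filter] at hν
    rw [Finset.mem_filter, Finset.mem_range]
    exact ⟨(hmem hν.1).1, dvd_mul_sub_of_roots hn (hmem hx).2 (hmem hν.1).2 (hmem hy.1).2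
      (hν.2.trans hy.2.symm)⟩

end RootCount

section DivisorBound
open Finset

lemma card_divisors_mul_le (m n : ℕ) :
    (m * n).divisors.card ≤ m.divisors.card * n.divisors.card := by
  rw [Nat.divisors_mul]; exact Finset.card_mul_le

lemma exists_succ_le_two_pow {ε : ℝ} (hε : 0 < ε) :
    ∃ C : ℝ, 1 ≤ C ∧ ∀ k : ℕ, (k + 1 : ℝ) ≤ C * ((2 : ℝ) ^ ε) ^ k := by
  have h2 : 0 < (2 : ℝ) ^ ε - 1 := by
    have := Real.one_lt_rpow (x := 2) (by norm_num) hε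
    linarith
  refine ⟨1 + 1 / ((2 : ℝ) ^ ε - 1), by simp [h2.le], fun k => ?_⟩
  set t := (2 : ℝ) ^ ε - 1 with ht
  have hb : 1 + (k : ℝ) * t ≤ ((2 : ℝ) ^ ε) ^ k := by
    have := one_add_mul_le_pow (a := t) (by linarith) k
    rwa [show 1 + t = (2 : ℝ) ^ ε by rw [ht]; ring] at this
  have h1 : (1 : ℝ) ≤ ((2 : ℝ) ^ ε) ^ k := by
    nlinarith [mul_nonneg (Nat.cast_nonneg (α := ℝ) k) h2.le]
  have h3 : (k : ℝ) ≤ 1 / t * ((2 : ℝ) ^ ε) ^ k := by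
    rw [one_div, ← div_eq_inv_mul, le_div_iff₀ h2]; linarith
  rw [add_mul, one_mul]; linarith

lemma exists_card_divisors_le {ε : ℝ} (hε : 0 < ε) :
    ∃ C : ℝ, 1 ≤ C ∧ ∀ n : ℕ, 0 < n → (n.divisors.card : ℝ) ≤ C * (n : ℝ) ^ ε := by
  obtain ⟨C, hC, hCk⟩ := exists_succ_le_two_pow hε
  set P := ⌈(2 : ℝ) ^ (1 / ε)⌉₊ with hP
  refine ⟨C ^ P, one_le_pow₀ hC, fun n hn => ?_⟩
  have hterm : ∀ p ∈ n.primeFactors, ((n.factorization p + 1 : ℕ) : ℝ) ≤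
      (if p < P then C else 1) * ((p : ℝ) ^ n.factorization p) ^ ε := by
    intro p hp
    have hp2 : (2 : ℝ) ≤ p := by exact_mod_cast (Nat.prime_of_mem_primeFactors hp).two_le
    have e : ((p : ℝ) ^ n.factorization p) ^ ε = ((p : ℝ) ^ ε) ^ n.factorization p := by
      rw [← Real.rpow_natCast, ← Real.rpow_mul (by positivity), mul_comm,
        Real.rpow_mul (by positivity), Real.rpow_natCast]
    rw [e]; push_cast
    split_ifs with h
    · refine (hCk _).trans ?_
      gcongr
    · rw [one_mul]
      have h1 : (2 : ℝ) ≤ (p : ℝ) ^ ε := by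
        have h2 : (2 : ℝ) ^ (1 / ε) ≤ p := (Nat.le_ceil _).trans (by exact_mod_cast not_lt.1 h)
        calc (2 : ℝ) = ((2 : ℝ) ^ (1 / ε)) ^ ε := by
              rw [← Real.rpow_mul (by norm_num), one_div_mul_cancel hε.ne', Real.rpow_one]
          _ ≤ _ := by gcongr
      calc ((n.factorization p : ℝ) + 1) ≤ (2 : ℝ) ^ n.factorization p := by
            exact_mod_cast Nat.lt_two_pow_self
        _ ≤ _ := by gcongr
  rw [Nat.card_divisors hn.ne', Nat.cast_prod]
  refine (Finset.prod_le_prod (fun _ _ => by positivity) hterm).trans ?_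
  rw [Finset.prod_mul_distrib, Real.finsetProd_rpow _ _ fun p _ => by positivity]
  have hn' : ∏ p ∈ n.primeFactors, (p : ℝ) ^ n.factorization p = n := by
    exact_mod_cast Nat.prod_factorization_pow_eq_self hn.ne'
  rw [hn']
  gcongr
  rw [← Finset.prod_filter, Finset.prod_const]
  refine pow_le_pow_right₀ hC ?_
  calc _ ≤ (range P).card := card_le_card fun p hp => by
        simp only [mem_filter, mem_range] at hp ⊢; exact hp.2
    _ = P := card_range P

lemma sum_card_divisors_le (X : ℕ) :
    ∑ n ∈ Icc 1 X, (n.divisors.card : ℝ) ≤ X * (1 + Real.log X) := by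
  have h : ∀ n ∈ Icc 1 X, (n.divisors.card : ℝ) = ∑ d ∈ Icc 1 X, if d ∣ n then (1 : ℝ) else 0 := by
    intro n hn
    rw [mem_Icc] at hn
    rw [← Finset.sum_filter, Finset.sum_const, nsmul_eq_mul, mul_one]
    congr 2
    ext d
    simp only [Nat.mem_divisors, mem_filter, mem_Icc]
    constructor
    · rintro ⟨hd, h0⟩
      exact ⟨⟨Nat.pos_of_dvd_of_pos hd (by omega), (Nat.le_of_dvd (by omega) hd).trans hn.2⟩, hd⟩
    · rintro ⟨-, hd⟩; exact ⟨hd, by omega⟩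
  rw [Finset.sum_congr rfl h, Finset.sum_comm]
  calc ∑ d ∈ Icc 1 X, ∑ n ∈ Icc 1 X, (if d ∣ n then (1 : ℝ) else 0)
      ≤ ∑ d ∈ Icc 1 X, (X : ℝ) * (1 / d) := by
        refine Finset.sum_le_sum fun d hd => ?_
        rw [mem_Icc] at hd
        rw [← Finset.sum_filter, sum_multiples_eq X d (by omega) fun _ => 1]
        simp only [Finset.sum_const, Nat.card_Icc, add_tsub_cancel_right, nsmul_eq_mul, mul_one]
        rw [mul_one_div]
        exact Nat.cast_div_le
    _ = X * ∑ d ∈ Icc 1 X, (1 : ℝ) / d := by rw [Finset.mul_sum]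
    _ ≤ _ := by gcongr; exact sum_Icc_inv_le X

end DivisorBound

end QuadRoots

namespace QuadRoots

section LevelOfDistribution
open Finset
open QForm (rt reduced)
open scoped Real

lemma sum_short_interval_le {X θ : ℝ} (hX : 0 < X) (hθ : 0 ≤ θ) {q : ℕ} (hq : 0 < q) :
    ∑ n ∈ (Icc 1 ⌊X * (1 + θ)⌋₊).filter (q ∣ ·), (if X < n * (1 + 2 * θ) then (1 : ℝ) else 0) ≤
      3 * θ * X / q + 1 := by
  have hq' : (0 : ℝ) < q := by exact_mod_cast hq
  rw [sum_multiples_eq _ q hq fun n => if X < n * (1 + 2 * θ) then (1 : ℝ) else 0,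
    ← Finset.sum_filter, Finset.sum_const, nsmul_eq_mul, mul_one]
  set A := X / (q * (1 + 2 * θ)) with hA
  set B := X * (1 + θ) / q with hB
  have hB0 : 0 ≤ B := by positivity
  have hA0 : 0 ≤ A := by positivity
  have hsub : (Icc 1 (⌊X * (1 + θ)⌋₊ / q)).filter (fun j : ℕ => X < ((q * j : ℕ) : ℝ) * (1 + 2 * θ)) ⊆
      Ioc ⌊A⌋₊ ⌊B⌋₊ := by
    intro j hj
    rw [mem_filter, mem_Icc] at hj
    rw [mem_Ioc, Nat.floor_lt hA0, Nat.le_floor_iff hB0]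
    constructor
    · rw [hA, div_lt_iff₀ (by positivity)]
      have := hj.2
      push_cast at this
      linarith
    · rw [hB, le_div_iff₀ hq']
      have := (Nat.le_div_iff_mul_le hq).1 hj.1.2
      rw [Nat.le_floor_iff (by positivity)] at this
      exact_mod_cast this
  have hAB : A ≤ B := by
    rw [hA, hB, div_le_div_iff₀ (by positivity) hq']
    nlinarith [mul_pos hX hq', mul_nonneg (mul_pos hX hq').le hθ,
      mul_nonneg (mul_nonneg (mul_pos hX hq').le hθ) hθ]
  have hBA : B - A ≤ 3 * θ * X / q := by
    have : A = X / q * (1 / (1 + 2 * θ)) := by rw [hA]; field_simp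
    have h2 : 1 - 2 * θ ≤ 1 / (1 + 2 * θ) := by
      rw [le_div_iff₀ (by positivity)]; nlinarith
    have h3 := mul_le_mul_of_nonneg_left h2 (by positivity : 0 ≤ X / q)
    have h4 : B = X / q * (1 + θ) := by rw [hB]; ring
    have h5 : 3 * θ * X / q = X / q * (3 * θ) := by ring
    rw [this, h4, h5]; linarith
  have hcard := card_le_card hsub
  rw [Nat.card_Ioc] at hcard
  have h1 : ((⌊B⌋₊ - ⌊A⌋₊ : ℕ) : ℝ) ≤ B - A + 1 := by
    rw [Nat.cast_sub (Nat.floor_mono hAB)]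
    linarith [Nat.floor_le hB0, Nat.lt_floor_add_one A]
  calc _ ≤ ((⌊B⌋₊ - ⌊A⌋₊ : ℕ) : ℝ) := by exact_mod_cast hcard
    _ ≤ _ := by linarith

lemma ballErr_le {a b c : ℤ} (ha : 0 < a) (h : ℤ) (κ : ℝ) {X θ R : ℝ} (hX : 1 ≤ X) (hθ : 0 ≤ θ)
    (hθ1 : θ ≤ 1) {q : ℕ} (hq : 0 < q)
    (hR : ∀ n : ℕ, 0 < n → (n : ℝ) ≤ 2 * X → ((roots a b c n).card : ℝ) ≤ R) :
    ballErr h κ X θ a b c q ≤ R * (3 * θ * X / q + 1 +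
      2 * π * |(h : ℝ)| * (1 + |κ|) * θ * rt (b ^ 2 - 4 * a * c) * ((1 + Real.log (2 * X)) / q)) := by
  have hR0 : 0 ≤ R := (Nat.cast_nonneg _).trans (hR 1 one_pos (by push_cast; linarith))
  have haR : (1 : ℝ) ≤ a := by exact_mod_cast ha
  have hq' : (0 : ℝ) < q := by exact_mod_cast hq
  set s := rt (b ^ 2 - 4 * a * c) with hs
  have hs0 : 0 ≤ s := Real.sqrt_nonneg _
  have h1 : ∀ n ∈ (Icc 1 ⌊X * (1 + θ)⌋₊).filter (q ∣ ·), ((roots a b c n).card : ℝ) *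
    ((if X < n * (1 + 2 * θ) then 1 else 0) +
      2 * π * |(h : ℝ)| * (1 + |κ|) * θ * (s / (2 * a * n))) ≤
      R * ((if X < n * (1 + 2 * θ) then 1 else 0) +
      2 * π * |(h : ℝ)| * (1 + |κ|) * θ * s * (1 / n)) := by
    intro n hn
    rw [mem_filter, mem_Icc, Nat.le_floor_iff (by positivity)] at hn
    have hn0 : (0 : ℝ) < n := by exact_mod_cast hn.1.1
    have e : s / (2 * a * n) ≤ s * (1 / n) := by
      rw [mul_one_div]
      refine div_le_div_of_nonneg_left hs0 hn0 ?_
      nlinarith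
    rw [mul_assoc _ s]
    refine mul_le_mul (hR n hn.1.1 (hn.1.2.trans (by nlinarith))) ?_ (by positivity) hR0
    gcongr
  refine (Finset.sum_le_sum h1).trans ?_
  rw [← Finset.mul_sum, Finset.sum_add_distrib, ← Finset.mul_sum]
  refine mul_le_mul_of_nonneg_left (add_le_add (sum_short_interval_le (by linarith) hθ hq) ?_) hR0
  refine mul_le_mul_of_nonneg_left ((sum_multiples_inv_le _ q hq).trans ?_) (by positivity)
  have h3 : (⌊X * (1 + θ)⌋₊ : ℝ) ≤ 2 * X := (Nat.floor_le (by positivity)).trans (by nlinarith)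
  have h4 : Real.log (⌊X * (1 + θ)⌋₊ : ℝ) ≤ Real.log (2 * X) := by
    refine Real.log_le_log ?_ h3
    have : 0 < ⌊X * (1 + θ)⌋₊ := Nat.floor_pos.2 (by nlinarith)
    exact_mod_cast this
  gcongr

end LevelOfDistribution

end QuadRoots

namespace QuadRoots

section LevelOfDistributionTwo
open Finset MeasureTheory
open QForm (rt reduced)
open scoped Real

lemma exists_small_bounds {a b c : ℤ} (ha : a ≠ 0) (hD : b ^ 2 - 4 * a * c ≠ 0) {ε l : ℝ}
    (hε : 0 < ε) (hl : 1 ≤ l) : ∃ C : ℝ, 1 ≤ C ∧ ∀ X : ℝ, 1 ≤ X →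
      (∀ n : ℕ, 0 < n → (n : ℝ) ≤ l * X → ((roots a b c n).card : ℝ) ≤ C * X ^ ε) ∧
      (∀ n : ℕ, 0 < n → (n : ℝ) ≤ l * X → (n.divisors.card : ℝ) ≤ C * X ^ ε) ∧
      1 + Real.log (l * X) ≤ C * X ^ ε := by
  obtain ⟨C₁, hC₁, hτ⟩ := exists_card_divisors_le hε
  set k : ℝ := 1 + 2 * ((b ^ 2 - 4 * a * c) * a).natAbs with hk
  have hk1 : 1 ≤ k := by rw [hk]; linarith [Nat.cast_nonneg (α := ℝ) ((b ^ 2 - 4 * a * c) * a).natAbs]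
  have hlε : 1 ≤ l ^ ε := Real.one_le_rpow hl hε.le
  have hP : 1 ≤ C₁ * l ^ ε := by nlinarith
  refine ⟨k * (C₁ * l ^ ε) * (1 + 1 / ε), ?_, fun X hX => ?_⟩
  · have : 1 ≤ 1 + 1 / ε := by simp [hε.le]
    have : 1 ≤ k * (C₁ * l ^ ε) := by nlinarith
    nlinarith
  have hε1 : 1 ≤ 1 + 1 / ε := by simp [hε.le]
  have hXε : 1 ≤ X ^ ε := Real.one_le_rpow hX hε.le
  have hdiv : ∀ n : ℕ, 0 < n → (n : ℝ) ≤ l * X → (n.divisors.card : ℝ) ≤ C₁ * l ^ ε * X ^ ε := by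
    intro n hn hnX
    refine (hτ n hn).trans ?_
    rw [mul_assoc, ← Real.mul_rpow (by linarith) (by linarith)]
    gcongr
  have hA : C₁ * l ^ ε * X ^ ε ≤ k * (C₁ * l ^ ε) * X ^ ε := by
    rw [mul_assoc k]; exact le_mul_of_one_le_left (by positivity) hk1
  have hB : k * (C₁ * l ^ ε) * X ^ ε ≤ k * (C₁ * l ^ ε) * (1 + 1 / ε) * X ^ ε := by
    exact mul_le_mul_of_nonneg_right (le_mul_of_one_le_right (by positivity) hε1) (by positivity)
  refine ⟨fun n hn hnX => ?_, fun n hn hnX => (hdiv n hn hnX).trans (hA.trans hB), ?_⟩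
  · refine le_trans ?_ hB
    have h1 := card_roots_le ha hD hn
    calc ((roots a b c n).card : ℝ) ≤ (2 * ((b ^ 2 - 4 * a * c) * a).natAbs) * n.divisors.card := by
          exact_mod_cast h1
      _ ≤ k * (C₁ * l ^ ε * X ^ ε) := by
          gcongr
          · rw [hk]; linarith
          · exact hdiv n hn hnX
      _ = _ := by ring
  · have h1 : Real.log (l * X) ≤ (l * X) ^ ε / ε := Real.log_le_rpow_div (by positivity) hε
    rw [Real.mul_rpow (by linarith) (by linarith)] at h1
    have h2 : 1 + Real.log (l * X) ≤ l ^ ε * X ^ ε * (1 + 1 / ε) := by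
      have : 1 ≤ l ^ ε * X ^ ε := by nlinarith
      rw [mul_add, mul_one, mul_one_div]; linarith
    refine h2.trans ?_
    have h3 : l ^ ε ≤ k * (C₁ * l ^ ε) := by
      have : 1 ≤ k * C₁ := by nlinarith
      rw [← mul_assoc]; exact le_mul_of_one_le_left (by positivity) this
    calc _ ≤ k * (C₁ * l ^ ε) * X ^ ε * (1 + 1 / ε) := by gcongr
      _ = _ := by ring

lemma klNorm_nonneg (c : ℤ) (k : ℕ) : 0 ≤ klNorm c k := by
  rw [klNorm]; split_ifs
  · exact le_rfl
  · exact norm_nonneg _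

lemma ballErr_nonneg {a : ℕ} (b c h : ℤ) (κ X : ℝ) {θ : ℝ} (hθ : 0 ≤ θ) (q : ℕ) :
    0 ≤ ballErr h κ X θ a b c q := by
  refine Finset.sum_nonneg fun n _ => mul_nonneg (Nat.cast_nonneg _) (add_nonneg ?_ ?_)
  · split_ifs <;> norm_num
  · have := Real.sqrt_nonneg (-((b ^ 2 - 4 * a * c : ℤ) : ℝ))
    rw [← rt] at this
    push_cast
    positivity

lemma sum_klNorm_le_of_bounds {a q H : ℕ} (ha : 0 < a) (hq : Squarefree q) {c : ℤ} (hc : c ≠ 0)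
    (hqc : q.gcd c.natAbs ≤ H) {Y B : ℝ} (hY : 1 ≤ Y) (hYτ : ∀ k : ℕ, 0 < k → (k : ℝ) ≤ Y →
    (k.divisors.card : ℝ) ≤ B) (hqτ : (q.divisors.card : ℝ) ≤ B)
    (hcτ : (c.natAbs.divisors.card : ℝ) ≤ B) (hlog : 1 + Real.log Y ≤ B) :
    ∑ k ∈ (Icc 1 ⌊Y⌋₊).filter (a * q ∣ ·), klNorm c k / k ≤ 2 * H * √Y * B ^ 6 / q := by
  have hY0 : 0 ≤ Y := by linarith
  have hB0 : 0 ≤ B := (Nat.cast_nonneg _).trans hqτ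
  have hfl : 0 < ⌊Y⌋₊ := Nat.floor_pos.2 hY
  have h1 := sum_klNorm_div_le (X := ⌊Y⌋₊) (T := ⌊B⌋₊) ha hq hc fun k hk hkY =>
    Nat.le_floor (hYτ k hk ((Nat.le_floor_iff hY0).1 hkY))
  refine h1.trans ?_
  have hlog' : 1 + Real.log (⌊Y⌋₊ : ℝ) ≤ B := by
    refine le_trans ?_ hlog
    gcongr
    exact Nat.floor_le hY0
  have hlog0 : 0 ≤ 1 + Real.log (⌊Y⌋₊ : ℝ) := by
    have := Real.log_natCast_nonneg ⌊Y⌋₊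
    linarith
  have hgH : (q.gcd c.natAbs : ℝ) ≤ H := by exact_mod_cast hqc
  calc 2 * (⌊B⌋₊ : ℝ) * √(⌊Y⌋₊ : ℝ) / q * (q.gcd c.natAbs) * c.natAbs.divisors.card *
        (q.divisors.card * (1 + Real.log (⌊Y⌋₊ : ℝ))) ^ 2
      ≤ 2 * B * √Y / q * H * B * (B * B) ^ 2 := by
        gcongr
        · exact Nat.floor_le hB0
        · exact Nat.floor_le hY0
    _ = _ := by ring

lemma sq_bound_assembly {R N l C₁ y V c₁ η₀ t w q E S B₀ H : ℝ} (hN : 0 ≤ N)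
    (hC₁ : 1 ≤ C₁) (hy : 0 ≤ y) (hV : 0 ≤ V) (hc₁ : 0 ≤ c₁) (hη₀ : 0 < η₀) (hη₁ : η₀ ≤ 1 / 8)
    (ht : 1 ≤ t) (hq : 1 ≤ q) (hw : 0 ≤ w) (hqw : q * t ^ 40 ≤ w) (hH : 0 ≤ H)
    (hE : E ≤ C₁ * t * (3 * (4 * (η₀ / t ^ 10)) * w ^ 2 / q + 1 +
      c₁ * w ^ 2 * (4 * (η₀ / t ^ 10)) * (C₁ * t / q))) (hE0 : 0 ≤ E)
    (hS : S ≤ H * w * (C₁ * t) ^ 6 / q) (hB₀ : B₀ ≤ C₁ * t) (hS0 : 0 ≤ S) :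
    R ^ 2 * (2 * (N * E) ^ 2 + 8 * (l ^ 2 * B₀) * N * (20 * (y * w ^ 2) * V +
      16 * (y * w ^ 2) * S) / (η₀ / t ^ 10) ^ 2) ≤
    R ^ 2 * (2 * (N * (C₁ * (4 + c₁ * C₁))) ^ 2 + 8 * l ^ 2 * C₁ * N * y *
      (20 * V + 16 * (H * C₁ ^ 6)) / η₀ ^ 2) * (w ^ 2 / (q * t ^ 5)) ^ 2 := by
  have ht0 : 0 < t := by linarith
  have hq0 : 0 < q := by linarith
  set G := w ^ 2 / (q * t ^ 5) with hG
  have hG0 : 0 ≤ G := by positivity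
  have htp : ∀ k : ℕ, 1 ≤ t ^ k := fun k => one_le_pow₀ ht
  have hwt : t ^ 40 ≤ w := le_trans (le_mul_of_one_le_left (by positivity) hq) hqw
  have hqw' : q ≤ w := le_trans (le_mul_of_one_le_right hq0.le (htp 40)) hqw
  have hE' : E ≤ C₁ * (4 + c₁ * C₁) * G := by
    refine hE.trans ?_
    have e1 : 4 * (η₀ / t ^ 10) ≤ 1 / t ^ 10 := by
      rw [← mul_div_assoc]; gcongr; linarith
    have e2 : 1 ≤ w ^ 2 / (q * t ^ 10) := by
      rw [le_div_iff₀ (by positivity), one_mul]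
      calc q * t ^ 10 ≤ w * t ^ 40 := by
            gcongr
            norm_num
        _ ≤ w * w := by gcongr
        _ = w ^ 2 := by ring
    calc C₁ * t * (3 * (4 * (η₀ / t ^ 10)) * w ^ 2 / q + 1 +
          c₁ * w ^ 2 * (4 * (η₀ / t ^ 10)) * (C₁ * t / q))
        ≤ C₁ * t * (3 * (1 / t ^ 10) * w ^ 2 / q + w ^ 2 / (q * t ^ 10) +
          c₁ * w ^ 2 * (1 / t ^ 10) * (C₁ * t / q)) := by gcongr
      _ = C₁ * (4 * (w ^ 2 / (q * t ^ 9)) + c₁ * C₁ * (w ^ 2 / (q * t ^ 8))) := by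
          field_simp; ring
      _ ≤ C₁ * (4 * G + c₁ * C₁ * G) := by
          rw [hG]
          gcongr <;> first | exact ht | norm_num
      _ = _ := by ring
  have f1 : w ^ 2 * t ^ 21 ≤ G ^ 2 := by
    rw [hG, div_pow, le_div_iff₀ (by positivity)]
    have : (q * t ^ 40) ^ 2 ≤ w ^ 2 := by gcongr
    calc w ^ 2 * t ^ 21 * (q * t ^ 5) ^ 2 = w ^ 2 * (q ^ 2 * t ^ 31) := by ring
      _ ≤ w ^ 2 * (q ^ 2 * t ^ 80) := by
          gcongr
          norm_num
      _ = w ^ 2 * (q * t ^ 40) ^ 2 := by ring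
      _ ≤ w ^ 2 * w ^ 2 := by gcongr
      _ = (w ^ 2) ^ 2 := by ring
  have f2 : w ^ 3 * t ^ 27 / q ≤ G ^ 2 := by
    rw [hG, div_pow, div_le_div_iff₀ (by positivity) (by positivity)]
    calc w ^ 3 * t ^ 27 * (q * t ^ 5) ^ 2 = w ^ 3 * q * (q * t ^ 37) := by ring
      _ ≤ w ^ 3 * q * (q * t ^ 40) := by
          gcongr
          norm_num
      _ ≤ w ^ 3 * q * w := by gcongr
      _ = (w ^ 2) ^ 2 * q := by ring
  have hK0 : 0 ≤ 8 * l ^ 2 * C₁ * N * y / η₀ ^ 2 := by positivity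
  have hsec : 8 * (l ^ 2 * B₀) * N * (20 * (y * w ^ 2) * V +
      16 * (y * w ^ 2) * S) / (η₀ / t ^ 10) ^ 2 ≤ 8 * l ^ 2 * C₁ * N * y *
      (20 * V + 16 * (H * C₁ ^ 6)) / η₀ ^ 2 * G ^ 2 := by
    calc _ ≤ 8 * (l ^ 2 * (C₁ * t)) * N * (20 * (y * w ^ 2) * V +
      16 * (y * w ^ 2) * (H * w * (C₁ * t) ^ 6 / q)) / (η₀ / t ^ 10) ^ 2 := by gcongr
      _ = 8 * l ^ 2 * C₁ * N * y / η₀ ^ 2 * (20 * V * (w ^ 2 * t ^ 21) +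
          16 * (H * C₁ ^ 6) * (w ^ 3 * t ^ 27 / q)) := by field_simp
      _ ≤ 8 * l ^ 2 * C₁ * N * y / η₀ ^ 2 * (20 * V * G ^ 2 + 16 * (H * C₁ ^ 6) * G ^ 2) := by
          gcongr
      _ = _ := by ring
  calc _ ≤ R ^ 2 * (2 * (N * (C₁ * (4 + c₁ * C₁) * G)) ^ 2 + 8 * l ^ 2 * C₁ * N * y *
      (20 * V + 16 * (H * C₁ ^ 6)) / η₀ ^ 2 * G ^ 2) := by gcongr
    _ = _ := by ring

set_option maxHeartbeats 1000000 in
/-- The roots of a quadratic congruence have level of distribution `1 / 2`. -/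
theorem exists_norm_sum_rho_le {a : ℕ} {b c : ℤ} (ha : 0 < a) (hD : b ^ 2 - 4 * a * c < 0) {δ : ℝ}
    (hδ : 0 < δ) (H : ℕ) : ∃ C X₀ : ℝ, 0 ≤ C ∧ ∀ X : ℝ, X₀ ≤ X → ∀ q : ℕ, Squarefree q →
      q * X ^ (4 * δ) ≤ √X → ∀ h : ℤ, h ≠ 0 → |(h : ℝ)| ≤ X → q.gcd h.natAbs ≤ H →
      ‖∑ n ∈ (Icc 1 ⌊X⌋₊).filter (q ∣ ·), rho a b c h n‖ ≤ C * X ^ (1 - δ / 2) / q := by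
  have haz : (a : ℤ) ≠ 0 := by exact_mod_cast ha.ne'
  have haR : (1 : ℝ) ≤ a := by exact_mod_cast ha
  set s := rt (b ^ 2 - 4 * a * c) with hs
  have hs0 : 0 < s := QForm.rt_pos hD
  set y : ℝ := 2 * a / s with hy
  have hy0 : 0 ≤ y := by positivity
  obtain ⟨C₁, hC₁, hsmall⟩ := exists_small_bounds (b := b) (c := c) (l := 2 + y) haz hD.ne
    (by positivity : 0 < δ / 10) (by linarith)
  set η₀ : ℝ := 1 / (8 * (1 + s)) with hη₀
  have hη₀0 : 0 < η₀ := by positivity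
  have hη₀1 : η₀ ≤ 1 / 8 := by
    rw [hη₀]; gcongr; linarith
  have hη₀s : η₀ * s ≤ 1 := by
    rw [hη₀, div_mul_eq_mul_div, one_mul, div_le_one (by positivity)]; linarith
  set c₁ : ℝ := 2 * π * (1 + |b / s|) * s with hc₁
  have hc₁0 : 0 ≤ c₁ := by positivity
  set K : ℝ := ((reduced (b ^ 2 - 4 * a * c)).card : ℝ) ^ 2 *
    (2 * (nearElts.card * (C₁ * (4 + c₁ * C₁))) ^ 2 + 8 * (labelMod (b ^ 2 - 4 * a * c) a : ℝ) ^ 2 *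
      C₁ * nearElts.card * y *
      (20 * volume.real siegel + 16 * (2 * H * √y * C₁ ^ 6)) / η₀ ^ 2) with hK
  refine ⟨√K, max 1 (max s (1 / y)), Real.sqrt_nonneg _, fun X hX q hq hqX h hh hhX hgcd => ?_⟩
  simp only [max_le_iff] at hX
  obtain ⟨hX1, hXs, hXy⟩ := hX
  have hyX : 1 ≤ y * X := by
    rw [div_le_iff₀ (by positivity)] at hXy; linarith
  obtain ⟨hroots, htau, hlog⟩ := hsmall X hX1
  have hX0 : 0 < X := by linarith
  have hq1 : 1 ≤ (q : ℝ) := by exact_mod_cast Nat.pos_of_ne_zero hq.ne_zero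
  set t := X ^ (δ / 10) with ht
  have ht1 : 1 ≤ t := Real.one_le_rpow hX1 (by positivity)
  have htpow : ∀ k : ℕ, t ^ k = X ^ (δ / 10 * k) := fun k => by
    rw [ht, ← Real.rpow_natCast, ← Real.rpow_mul hX0.le]
  have ht40 : X ^ (4 * δ) = t ^ 40 := by
    rw [htpow]; congr 1; push_cast; ring
  rw [ht40] at hqX
  have hwX : √X ^ 2 = X := Real.sq_sqrt hX0.le
  have hwX' : √X ≤ X := by
    rw [Real.sqrt_le_left hX0.le]; nlinarith
  have hqX' : (q : ℝ) ≤ X := by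
    refine le_trans ?_ hwX'
    exact (le_mul_of_one_le_right (by positivity) (one_le_pow₀ ht1)).trans hqX
  have hη0 : 0 < η₀ / t ^ 10 := by positivity
  have hηle : η₀ / t ^ 10 ≤ η₀ := div_le_self hη₀0.le (one_le_pow₀ ht1)
  have hXl : ∀ {u : ℝ}, u ≤ X → u ≤ (2 + y) * X := fun hu => by nlinarith
  have hroots2 : ∀ n : ℕ, 0 < n → (n : ℝ) ≤ 2 * X → ((roots a b c n).card : ℝ) ≤ C₁ * t :=
    fun n hn hnX => hroots n hn (by nlinarith)
  have hmain := norm_sq_sum_rho_le ha hD hq h hXs hη0 (hηle.trans hη₀1)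
    ((mul_le_mul_of_nonneg_right hηle hs0.le).trans hη₀s)
  have hE := ballErr_le (b := b) (c := c) (by exact_mod_cast ha : (0 : ℤ) < a) h (b / s) hX1
    (mul_nonneg (by norm_num) hη0.le : 0 ≤ 4 * (η₀ / t ^ 10)) (by linarith) (Nat.pos_of_ne_zero hq.ne_zero) hroots2
  have hE' : ballErr h (b / s) X (4 * (η₀ / t ^ 10)) a b c q ≤
      C₁ * t * (3 * (4 * (η₀ / t ^ 10)) * √X ^ 2 / q + 1 +
        c₁ * √X ^ 2 * (4 * (η₀ / t ^ 10)) * (C₁ * t / q)) := by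
    refine hE.trans ?_
    rw [hwX]
    have hl2 : 1 + Real.log (2 * X) ≤ C₁ * t := by
      refine le_trans ?_ hlog
      gcongr; linarith
    have e : c₁ * X * (4 * (η₀ / t ^ 10)) * (C₁ * t / q) =
      2 * π * X * (1 + |b / s|) * (4 * (η₀ / t ^ 10)) * s * (C₁ * t / q) := by rw [hc₁]; ring
    have hl0 : 0 ≤ (1 + Real.log (2 * X)) / q :=
      div_nonneg (by linarith [Real.log_nonneg (by linarith : 1 ≤ 2 * X)]) (by linarith)
    rw [e]
    gcongr
  have hyX' : 2 * a * X / s = y * X := by rw [hy]; ring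
  rw [← hs, hyX'] at hmain
  have hS := sum_klNorm_le_of_bounds (c := -h) (H := H) (Y := y * X) (B := C₁ * t) ha hq
    (neg_ne_zero.2 hh) (by rwa [Int.natAbs_neg]) hyX
    (fun k hk hkY => htau k hk (by linarith)) (htau q (Nat.pos_of_ne_zero hq.ne_zero) (hXl hqX'))
    (by
      rw [Int.natAbs_neg]
      refine htau _ (Int.natAbs_pos.2 hh) (hXl ?_)
      rwa [Nat.cast_natAbs, Int.cast_abs])
    (le_trans (by gcongr; linarith) hlog)
  rw [Real.sqrt_mul hy0] at hS
  have hS' := hS.trans (le_of_eq (by ring : 2 * H * (√y * √X) * (C₁ * t) ^ 6 / q =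
    2 * H * √y * √X * (C₁ * t) ^ 6 / q))
  have hass := sq_bound_assembly (R := (reduced (b ^ 2 - 4 * a * c)).card) (N := nearElts.card)
    (l := labelMod (b ^ 2 - 4 * a * c) a) (V := volume.real siegel) (t := t) (w := √X) (q := q)
    (H := 2 * H * √y) (B₀ := q.divisors.card) (Nat.cast_nonneg _) hC₁ hy0 measureReal_nonneg
    hc₁0 hη₀0 hη₀1 ht1 hq1 (Real.sqrt_nonneg _) hqX (by positivity) hE'
    (ballErr_nonneg b c h _ X (mul_nonneg (by norm_num) hη0.le) q) hS'
    (htau q (Nat.pos_of_ne_zero hq.ne_zero) (hXl hqX'))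
    (Finset.sum_nonneg fun n _ => div_nonneg (klNorm_nonneg _ _) (Nat.cast_nonneg _))
  rw [hwX] at hass
  have h2 := hmain.trans hass
  rw [← hK] at h2
  have hK0 : 0 ≤ K := by positivity
  have hG : X ^ (1 - δ / 2) / q = X / (q * t ^ 5) := by
    rw [htpow, Real.rpow_sub hX0, Real.rpow_one, div_div, mul_comm]
    congr 3; push_cast; ring
  rw [mul_div_assoc, hG]
  refine le_of_sq_le_sq (h2.trans (le_of_eq ?_)) (by positivity)
  rw [mul_pow, Real.sq_sqrt hK0]

end LevelOfDistributionTwo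

end QuadRoots

namespace QuadRoots

section RootBounds
open Finset

variable {a b c : ℤ}

lemma mem_roots {n ν : ℕ} : ν ∈ roots a b c n ↔
    ν < n ∧ (n : ℤ) ∣ a * (ν : ℤ) ^ 2 + b * (ν : ℤ) + c := by
  simp [roots]

/-- A constant bounding the number of roots modulo `n` in terms of the divisor function. -/
def rootConst (a b c : ℤ) : ℕ := 2 * ((b ^ 2 - 4 * a * c) * a).natAbs

lemma norm_rho_le_card (h : ℤ) (n : ℕ) : ‖rho a b c h n‖ ≤ (roots a b c n).card := by
  refine (norm_sum_le _ _).trans ?_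
  simp [norm_ft]

lemma card_roots_le_rootConst (ha : a ≠ 0) (hD : b ^ 2 - 4 * a * c ≠ 0) {n : ℕ} (hn : 0 < n) :
    ((roots a b c n).card : ℝ) ≤ rootConst a b c * n.divisors.card := by
  exact_mod_cast card_roots_le ha hD hn

lemma norm_rho_le (ha : a ≠ 0) (hD : b ^ 2 - 4 * a * c ≠ 0) (h : ℤ) {n : ℕ} (hn : 0 < n) :
    ‖rho a b c h n‖ ≤ rootConst a b c * n.divisors.card :=
  (norm_rho_le_card h n).trans (card_roots_le_rootConst ha hD hn)

lemma card_divisors_prime {p : ℕ} (hp : p.Prime) : p.divisors.card = 2 := by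
  rw [hp.divisors, card_pair hp.one_lt.ne]

lemma sum_card_divisors_mul_le (q M : ℕ) :
    ∑ m ∈ Icc 1 M, ((q * m).divisors.card : ℝ) ≤ q.divisors.card * (M * (1 + Real.log M)) := by
  refine le_trans ?_ (mul_le_mul_of_nonneg_left (sum_card_divisors_le M) (Nat.cast_nonneg _))
  rw [Finset.mul_sum]
  exact Finset.sum_le_sum fun m _ => by exact_mod_cast card_divisors_mul_le q m

lemma sum_card_divisors_mul_div_le (q d N : ℕ) (hd : 0 < d) :
    ∑ m ∈ Icc 1 (N / d), ((q * m).divisors.card : ℝ) ≤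
      q.divisors.card * (N / d * (1 + Real.log N)) := by
  refine (sum_card_divisors_mul_le q _).trans ?_
  have h1 : ((N / d : ℕ) : ℝ) ≤ N / d := Nat.cast_div_le
  rcases Nat.eq_zero_or_pos (N / d) with h0 | h0
  · rw [h0]; simp only [Nat.cast_zero, zero_mul, mul_zero]
    have := Real.log_natCast_nonneg N
    positivity
  · have h2 : Real.log (N / d : ℕ) ≤ Real.log N := by
      refine Real.log_le_log (by exact_mod_cast h0) ?_
      exact_mod_cast Nat.div_le_self N d
    have := Real.log_natCast_nonneg (N / d)
    gcongr

end RootBounds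

section Dispersion
open Finset

variable {a b c : ℤ}

lemma dvd_quadratic_iff {n x y : ℤ} (h : n ∣ x - y) :
    n ∣ a * x ^ 2 + b * x + c ↔ n ∣ a * y ^ 2 + b * y + c := by
  have e : a * x ^ 2 + b * x + c = (x - y) * (a * (x + y) + b) + (a * y ^ 2 + b * y + c) := by ring
  rw [e]
  exact dvd_add_right (h.mul_right _)

lemma dvd_sub_emod (Ω m : ℕ) : (m : ℤ) ∣ (Ω : ℤ) - ((Ω % m : ℕ) : ℤ) := by
  push_cast
  exact Int.dvd_self_sub_emod

lemma mod_mem_roots {m n Ω : ℕ} (hm : 0 < m) (hmn : m ∣ n)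
    (h : (n : ℤ) ∣ a * (Ω : ℤ) ^ 2 + b * (Ω : ℤ) + c) : Ω % m ∈ roots a b c m := by
  rw [mem_roots]
  refine ⟨Nat.mod_lt _ hm, ?_⟩
  rw [← dvd_quadratic_iff (dvd_sub_emod Ω m)]
  exact (Int.natCast_dvd_natCast.2 hmn).trans h

lemma ft_mod (h : ℤ) (Ω n : ℕ) : ft (h * (Ω % n : ℕ) / n) = ft (h * Ω / n) := by
  rcases Nat.eq_zero_or_pos n with rfl | hn
  · simp
  have hn' : (n : ℝ) ≠ 0 := by exact_mod_cast hn.ne'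
  have e : (h * Ω / n : ℝ) = h * (Ω % n : ℕ) / n + ((h * ((Ω / n : ℕ) : ℤ) : ℤ) : ℝ) := by
    have h1 : (Ω : ℝ) = n * (Ω / n : ℕ) + (Ω % n : ℕ) := by
      exact_mod_cast (Nat.div_add_mod Ω n).symm
    rw [Int.cast_mul, Int.cast_natCast]
    nth_rewrite 1 [h1]
    field_simp
    ring
  rw [e, ft_add, ft_int, mul_one]

/-- The sum over the lifts of a root modulo `m` to roots modulo `q * m`. -/
noncomputable def liftSum (a b c h : ℤ) (q m μ : ℕ) : ℂ :=
  ∑ Ω ∈ (roots a b c (q * m)).filter (· % m = μ), ft (h * Ω / (q * m : ℕ))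

lemma sum_liftSum (h : ℤ) (q : ℕ) {m : ℕ} (hm : 0 < m) :
    ∑ μ ∈ roots a b c m, liftSum a b c h q m μ = rho a b c h (q * m) := by
  rw [rho]
  exact Finset.sum_fiberwise_of_maps_to
    (fun Ω hΩ => mod_mem_roots hm (dvd_mul_left m q) (mem_roots.1 hΩ).2) _

lemma lcm_mul_mul {q₁ q₂ m : ℕ} (h : q₁.Coprime q₂) : (q₁ * m).lcm (q₂ * m) = q₁ * q₂ * m := by
  rw [Nat.lcm_mul_right, h.lcm_eq_mul]

lemma sum_liftSum_mul_conj (h : ℤ) {q₁ q₂ m : ℕ} (hm : 0 < m) (hq₁ : 0 < q₁) (hq₂ : 0 < q₂)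
    (hq : q₁.Coprime q₂) :
    ∑ μ ∈ roots a b c m, liftSum a b c h q₁ m μ * (starRingEnd ℂ) (liftSum a b c h q₂ m μ) =
      rho a b c (h * (q₂ - q₁)) (q₁ * q₂ * m) := by
  have hm' : (m : ℝ) ≠ 0 := by exact_mod_cast hm.ne'
  have hq₁' : (q₁ : ℝ) ≠ 0 := by exact_mod_cast hq₁.ne'
  have hq₂' : (q₂ : ℝ) ≠ 0 := by exact_mod_cast hq₂.ne'
  have hl := lcm_mul_mul (m := m) hq
  rw [rho, ← Finset.sum_fiberwise_of_maps_to (g := (· % m)) (t := roots a b c m)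
    (fun Ω hΩ => mod_mem_roots hm (dvd_mul_left m (q₁ * q₂)) (mem_roots.1 hΩ).2)]
  refine Finset.sum_congr rfl fun μ hμ => ?_
  rw [liftSum, liftSum, map_sum, Finset.sum_mul_sum, ← Finset.sum_product']
  symm
  have hd1 : q₁ * m ∣ q₁ * q₂ * m := ⟨q₂, by ring⟩
  have hd2 : q₂ * m ∣ q₁ * q₂ * m := ⟨q₁, by ring⟩
  refine Finset.sum_nbij (fun Ω => (Ω % (q₁ * m), Ω % (q₂ * m))) ?_ ?_ ?_ ?_
  · intro Ω hΩ
    rw [mem_filter] at hΩ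
    have hr := (mem_roots.1 hΩ.1).2
    simp only [mem_product, mem_filter, Nat.mod_mul_left_mod]
    exact ⟨⟨mod_mem_roots (by positivity) hd1 hr, hΩ.2⟩,
      mod_mem_roots (by positivity) hd2 hr, hΩ.2⟩
  · intro Ω hΩ Ω' hΩ' he
    simp only [coe_filter, Set.mem_ofPred_eq, mem_roots] at hΩ hΩ'
    simp only [Prod.mk.injEq] at he
    have : Ω ≡ Ω' [MOD (q₁ * m).lcm (q₂ * m)] := Nat.mod_lcm he.1 he.2
    rw [hl] at this
    exact Nat.ModEq.eq_of_lt_of_lt this hΩ.1.1 hΩ'.1.1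
  · rintro ⟨Ω₁, Ω₂⟩ hΩ
    simp only [coe_product, coe_filter, Set.mem_prod, Set.mem_ofPred_eq, mem_roots] at hΩ
    obtain ⟨⟨⟨hlt1, hr1⟩, hm1⟩, ⟨hlt2, hr2⟩, hm2⟩ := hΩ
    have hg : (q₁ * m).gcd (q₂ * m) = m := by
      rw [Nat.gcd_mul_right, hq.gcd_eq_one, one_mul]
    have hcomp : Ω₁ ≡ Ω₂ [MOD (q₁ * m).gcd (q₂ * m)] := by
      rw [hg]; exact hm1.trans hm2.symm
    obtain ⟨k, hk1, hk2⟩ := Nat.chineseRemainder' hcomp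
    have e1 : k % (q₁ * q₂ * m) % (q₁ * m) = Ω₁ := by
      rw [Nat.mod_mod_of_dvd _ hd1, hk1, Nat.mod_eq_of_lt hlt1]
    have e2 : k % (q₁ * q₂ * m) % (q₂ * m) = Ω₂ := by
      rw [Nat.mod_mod_of_dvd _ hd2, hk2, Nat.mod_eq_of_lt hlt2]
    refine ⟨k % (q₁ * q₂ * m), ?_, by rw [Prod.mk.injEq]; exact ⟨e1, e2⟩⟩
    simp only [coe_filter, Set.mem_ofPred_eq, mem_roots]
    refine ⟨⟨Nat.mod_lt _ (by positivity), ?_⟩, ?_⟩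
    · set K := k % (q₁ * q₂ * m)
      have f1 : ((q₁ * m : ℕ) : ℤ) ∣ a * (K : ℤ) ^ 2 + b * (K : ℤ) + c := by
        have := dvd_sub_emod K (q₁ * m)
        rw [e1] at this
        exact (dvd_quadratic_iff this).2 hr1
      have f2 : ((q₂ * m : ℕ) : ℤ) ∣ a * (K : ℤ) ^ 2 + b * (K : ℤ) + c := by
        have := dvd_sub_emod K (q₂ * m)
        rw [e2] at this
        exact (dvd_quadratic_iff this).2 hr2
      rw [← hl, Int.natCast_dvd]
      exact Nat.lcm_dvd (Int.natCast_dvd.1 f1) (Int.natCast_dvd.1 f2)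
    · have : k % (q₁ * q₂ * m) % m = Ω₁ % m := by
        conv_rhs => rw [← e1]
        simp only [Nat.mod_mul_left_mod]
      exact this.trans hm1
  · intro Ω hΩ
    simp only
    rw [ft_mod, ft_mod, conj_ft, ← ft_add]
    congr 1
    push_cast
    field_simp
    ring

lemma card_lift_le (q : ℕ) {m μ : ℕ} (hq : 0 < q) (hqm : q.Coprime m) :
    ((roots a b c (q * m)).filter (· % m = μ)).card ≤ (roots a b c q).card := by
  refine Finset.card_le_card_of_injOn (· % q) ?_ ?_
  · intro Ω hΩ
    simp only [coe_filter, Set.mem_ofPred_eq, mem_roots] at hΩ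
    exact mod_mem_roots hq (dvd_mul_right q m) hΩ.1.2
  · intro Ω hΩ Ω' hΩ' he
    simp only [coe_filter, Set.mem_ofPred_eq, mem_roots] at hΩ hΩ'
    have : Ω ≡ Ω' [MOD q * m] :=
      (Nat.modEq_and_modEq_iff_modEq_mul hqm).1 ⟨he, hΩ.2.trans hΩ'.2.symm⟩
    exact Nat.ModEq.eq_of_lt_of_lt this hΩ.1.1 hΩ'.1.1

lemma sum_norm_liftSum_sq_le (h : ℤ) {q m : ℕ} (hq : 0 < q) (hm : 0 < m) (hqm : q.Coprime m) :
    ∑ μ ∈ roots a b c m, ‖liftSum a b c h q m μ‖ ^ 2 ≤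
      ((roots a b c q).card : ℝ) * (roots a b c (q * m)).card := by
  have h1 : ∀ μ, ‖liftSum a b c h q m μ‖ ≤ ((roots a b c (q * m)).filter (· % m = μ)).card := by
    intro μ
    refine (norm_sum_le _ _).trans ?_
    simp [norm_ft]
  have h2 : ∀ μ ∈ roots a b c m, ‖liftSum a b c h q m μ‖ ^ 2 ≤ ((roots a b c q).card : ℝ) *
      ((roots a b c (q * m)).filter (· % m = μ)).card := by
    intro μ _
    have h3 : ‖liftSum a b c h q m μ‖ ≤ (roots a b c q).card :=
      (h1 μ).trans (by exact_mod_cast card_lift_le q hq hqm)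
    rw [sq]
    exact mul_le_mul h3 (h1 μ) (norm_nonneg _) (Nat.cast_nonneg _)
  refine (Finset.sum_le_sum h2).trans (le_of_eq ?_)
  rw [← Finset.mul_sum, ← Nat.cast_sum, ← Finset.card_eq_sum_card_fiberwise
    (fun Ω hΩ => mod_mem_roots hm (dvd_mul_left m q) (mem_roots.1 hΩ).2)]

end Dispersion

end QuadRoots

namespace QuadRoots

section TypeTwo
open Finset

variable {a b c : ℤ}

/-- The sums of `rho` over the multiples of `q` up to `X` exhibit cancellation, uniformly for
squarefree `q` up to a power of `X` slightly smaller than `X ^ (1 / 2)`. -/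
def HasLevel (a b c : ℤ) (δ C X₀ : ℝ) (H : ℕ) : Prop :=
  ∀ X : ℝ, X₀ ≤ X → ∀ q : ℕ, Squarefree q → q * X ^ (4 * δ) ≤ √X → ∀ h : ℤ, h ≠ 0 →
    |(h : ℝ)| ≤ X → q.gcd h.natAbs ≤ H →
      ‖∑ n ∈ (Icc 1 ⌊X⌋₊).filter (q ∣ ·), rho a b c h n‖ ≤ C * X ^ (1 - δ / 2) / q

lemma sum_multiples {E : Type*} [AddCommMonoid E] (X L : ℕ) (hL : 0 < L) (f : ℕ → E) :
    ∑ k ∈ (Icc 1 X).filter (L ∣ ·), f k = ∑ j ∈ Icc 1 (X / L), f (L * j) := by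
  symm
  refine Finset.sum_nbij (L * ·) ?_ ?_ ?_ ?_
  · intro j hj
    rw [mem_Icc] at hj
    simp only [mem_filter, mem_Icc, dvd_mul_right, and_true]
    exact ⟨Nat.mul_pos hL hj.1, by rw [mul_comm]; exact (Nat.le_div_iff_mul_le hL).1 hj.2⟩
  · intro j _ j' _ h
    exact Nat.eq_of_mul_eq_mul_left hL h
  · rintro k hk
    simp only [coe_filter, Set.mem_ofPred_eq, mem_Icc] at hk
    obtain ⟨⟨h1, h2⟩, j, rfl⟩ := hk
    refine ⟨j, ?_, rfl⟩
    simp only [coe_Icc, Set.mem_Icc]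
    exact ⟨Nat.pos_of_mul_pos_left h1, (Nat.le_div_iff_mul_le hL).2 (by rwa [mul_comm])⟩
  · intro j _; rfl

/-- The pairing between the lifts to level `p₁ * m` and to level `p₂ * m`. -/
noncomputable def liftPairing (a b c h : ℤ) (N Y p₁ p₂ : ℕ) : ℂ :=
  ∑ m ∈ (Icc 1 Y).filter (fun m => (¬ p₁ ∣ m ∧ p₁ * m ≤ N) ∧ ¬ p₂ ∣ m ∧ p₂ * m ≤ N),
    ∑ μ ∈ roots a b c m, liftSum a b c h p₁ m μ * (starRingEnd ℂ) (liftSum a b c h p₂ m μ)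

lemma sum_norm_sq_eq_sum_liftPairing (h : ℤ) (N Y : ℕ) (P : Finset ℕ) :
    ((∑ m ∈ Icc 1 Y, ∑ μ ∈ roots a b c m,
      ‖∑ p ∈ P.filter (fun p => ¬ p ∣ m ∧ p * m ≤ N), liftSum a b c h p m μ‖ ^ 2 : ℝ) : ℂ) =
    ∑ p₁ ∈ P, ∑ p₂ ∈ P, liftPairing a b c h N Y p₁ p₂ := by
  have e1 : ∀ m μ : ℕ,
      ((‖∑ p ∈ P.filter (fun p => ¬ p ∣ m ∧ p * m ≤ N), liftSum a b c h p m μ‖ ^ 2 : ℝ) : ℂ) =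
      ∑ p₁ ∈ P, ∑ p₂ ∈ P, if (¬ p₁ ∣ m ∧ p₁ * m ≤ N) ∧ ¬ p₂ ∣ m ∧ p₂ * m ≤ N then
        liftSum a b c h p₁ m μ * (starRingEnd ℂ) (liftSum a b c h p₂ m μ) else 0 := by
    intro m μ
    push_cast
    rw [← Complex.mul_conj', map_sum, Finset.sum_mul_sum, Finset.sum_filter]
    refine Finset.sum_congr rfl fun p₁ _ => ?_
    split_ifs with h1
    · rw [Finset.sum_filter]
      refine Finset.sum_congr rfl fun p₂ _ => ?_
      simp only [h1, not_false_eq_true, and_self, true_and]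
    · simp [h1]
  push_cast
  push_cast at e1
  simp_rw [e1, liftPairing, Finset.sum_filter]
  have e2 : ∀ m : ℕ, (∑ μ ∈ roots a b c m, ∑ p₁ ∈ P, ∑ p₂ ∈ P,
      if (¬ p₁ ∣ m ∧ p₁ * m ≤ N) ∧ ¬ p₂ ∣ m ∧ p₂ * m ≤ N then
        liftSum a b c h p₁ m μ * (starRingEnd ℂ) (liftSum a b c h p₂ m μ) else 0) =
      ∑ p₁ ∈ P, ∑ p₂ ∈ P, if (¬ p₁ ∣ m ∧ p₁ * m ≤ N) ∧ ¬ p₂ ∣ m ∧ p₂ * m ≤ N then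
        ∑ μ ∈ roots a b c m,
          liftSum a b c h p₁ m μ * (starRingEnd ℂ) (liftSum a b c h p₂ m μ) else 0 := by
    intro m
    rw [Finset.sum_comm]
    refine Finset.sum_congr rfl fun p₁ _ => ?_
    rw [Finset.sum_comm]
    refine Finset.sum_congr rfl fun p₂ _ => ?_
    split_ifs <;> simp
  simp_rw [e2]
  rw [Finset.sum_comm]
  refine Finset.sum_congr rfl fun p₁ _ => ?_
  rw [Finset.sum_comm]

lemma norm_liftPairing_self_le (ha : a ≠ 0) (hD : b ^ 2 - 4 * a * c ≠ 0) (h : ℤ) (N Y : ℕ)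
    {p : ℕ} (hp : p.Prime) :
    ‖liftPairing a b c h N Y p p‖ ≤
      4 * (rootConst a b c : ℝ) ^ 2 * (N / p * (1 + Real.log N)) := by
  set Cf : ℝ := (rootConst a b c : ℝ)
  have hCf : 0 ≤ Cf := Nat.cast_nonneg _
  have h1 : ∀ m ∈ (Icc 1 Y).filter (fun m => (¬ p ∣ m ∧ p * m ≤ N) ∧ ¬ p ∣ m ∧ p * m ≤ N),
      ‖∑ μ ∈ roots a b c m, liftSum a b c h p m μ * (starRingEnd ℂ) (liftSum a b c h p m μ)‖ ≤
        2 * Cf ^ 2 * ((p * m).divisors.card : ℝ) := by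
    intro m hm
    simp only [mem_filter, mem_Icc] at hm
    refine (norm_sum_le _ _).trans ?_
    have e : ∀ μ, ‖liftSum a b c h p m μ * (starRingEnd ℂ) (liftSum a b c h p m μ)‖ =
        ‖liftSum a b c h p m μ‖ ^ 2 := by
      intro μ; rw [norm_mul, RCLike.norm_conj, sq]
    simp_rw [e]
    have hm0 : 0 < m := hm.1.1
    refine (sum_norm_liftSum_sq_le h hp.pos hm0
      ((Nat.Prime.coprime_iff_not_dvd hp).2 hm.2.1.1)).trans ?_
    have r1 := card_roots_le_rootConst (a := a) (b := b) (c := c) ha hD hp.pos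
    rw [card_divisors_prime hp] at r1
    have r2 := card_roots_le_rootConst (a := a) (b := b) (c := c) ha hD
      (Nat.mul_pos hp.pos hm0)
    calc _ ≤ (Cf * (2 : ℕ)) * (Cf * ((p * m).divisors.card : ℝ)) := by gcongr
      _ = _ := by push_cast; ring
  refine (norm_sum_le _ _).trans ((Finset.sum_le_sum h1).trans ?_)
  rw [← Finset.mul_sum]
  have h2 : ∑ m ∈ (Icc 1 Y).filter (fun m => (¬ p ∣ m ∧ p * m ≤ N) ∧ ¬ p ∣ m ∧ p * m ≤ N),
      ((p * m).divisors.card : ℝ) ≤ ∑ m ∈ Icc 1 (N / p), ((p * m).divisors.card : ℝ) := by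
    refine Finset.sum_le_sum_of_subset_of_nonneg ?_ fun _ _ _ => Nat.cast_nonneg _
    intro m hm
    simp only [mem_filter, mem_Icc] at hm ⊢
    exact ⟨hm.1.1, (Nat.le_div_iff_mul_le hp.pos).2 (by rw [mul_comm]; exact hm.2.1.2)⟩
  have h3 := h2.trans (sum_card_divisors_mul_div_le p p N hp.pos)
  rw [card_divisors_prime hp] at h3
  calc _ ≤ 2 * Cf ^ 2 * ((2 : ℕ) * (N / p * (1 + Real.log N))) := by gcongr
    _ = _ := by push_cast; ring

lemma gcd_mul_sub_le {p₁ p₂ : ℕ} (hp₁ : p₁.Prime) (hp₂ : p₂.Prime) (hne : p₁ ≠ p₂) {h : ℤ}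
    (hh : h ≠ 0) : (p₁ * p₂).gcd (h * (p₂ - p₁)).natAbs ≤ h.natAbs := by
  have hc : (p₁ * p₂).Coprime ((p₂ : ℤ) - p₁).natAbs := by
    have h12 := (Nat.coprime_primes hp₁ hp₂).2 hne
    have h12' : IsCoprime (p₁ : ℤ) p₂ := Nat.isCoprime_iff_coprime.2 h12
    rw [Nat.coprime_mul_iff_left]
    constructor
    · have : IsCoprime (p₁ : ℤ) ((p₂ : ℤ) - p₁) := by
        have := h12'.add_mul_left_right (-1)
        rwa [show (p₂ : ℤ) + p₁ * -1 = p₂ - p₁ by ring] at this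
      exact Int.isCoprime_iff_gcd_eq_one.1 this
    · have : IsCoprime (p₂ : ℤ) ((p₂ : ℤ) - p₁) := by
        have := h12'.symm.neg_right.add_mul_left_right 1
        rwa [show -(p₁ : ℤ) + p₂ * 1 = p₂ - p₁ by ring] at this
      exact Int.isCoprime_iff_gcd_eq_one.1 this
  rw [Int.natAbs_mul, Nat.Coprime.gcd_mul_right_cancel_right _ hc.symm]
  exact Nat.le_of_dvd (Int.natAbs_pos.2 hh) (Nat.gcd_dvd_right _ _)

lemma sum_norm_rho_multiples_le (ha : a ≠ 0) (hD : b ^ 2 - 4 * a * c ≠ 0) (h : ℤ) (q d k N : ℕ)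
    (hq : 0 < q) (hd : 0 < d) (hk : k ≤ N) (hq8 : (q * d).divisors.card ≤ 8) :
    ∑ m ∈ (Icc 1 k).filter (d ∣ ·), ‖rho a b c h (q * m)‖ ≤
      8 * (rootConst a b c : ℝ) * (k / d * (1 + Real.log N)) := by
  have hCf : (0 : ℝ) ≤ rootConst a b c := Nat.cast_nonneg _
  rw [sum_multiples k d hd]
  have h1 : ∀ j ∈ Icc 1 (k / d), ‖rho a b c h (q * (d * j))‖ ≤
      rootConst a b c * ((q * d * j).divisors.card : ℝ) := by
    intro j hj
    rw [mem_Icc] at hj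
    have hj0 : 0 < j := hj.1
    rw [mul_assoc q d j]
    exact norm_rho_le ha hD h (by positivity)
  refine (Finset.sum_le_sum h1).trans ?_
  rw [← Finset.mul_sum]
  have h2 := sum_card_divisors_mul_div_le (q * d) d k hd
  have h3 : Real.log k ≤ Real.log N := by
    rcases Nat.eq_zero_or_pos k with rfl | hk0
    · simpa using Real.log_natCast_nonneg N
    · exact Real.log_le_log (by exact_mod_cast hk0) (by exact_mod_cast hk)
  have h4 := Real.log_natCast_nonneg k
  have h5 : ((q * d).divisors.card : ℝ) ≤ 8 := by exact_mod_cast hq8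
  calc _ ≤ (rootConst a b c : ℝ) * (8 * (k / d * (1 + Real.log N))) := by
        refine mul_le_mul_of_nonneg_left (h2.trans ?_) hCf
        gcongr
    _ = _ := by ring

lemma norm_liftPairing_le {δ C X₀ : ℝ} (hδ : 0 < δ) (hC : 0 ≤ C) (ha : a ≠ 0)
    (hD : b ^ 2 - 4 * a * c ≠ 0) {h : ℤ} (hh : h ≠ 0) (hK : HasLevel a b c δ C X₀ h.natAbs)
    {N M p₁ p₂ : ℕ} (hM : 2 ≤ M) (hMN : 4 * M ≤ N) (hN : X₀ ≤ N) (hhN : |(h : ℝ)| * M ≤ N)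
    (hsize : 4 * (M : ℝ) ^ 2 * (2 * M * N) ^ (4 * δ) ≤ √(M * N / 2))
    (hp₁ : p₁.Prime) (hp₂ : p₂.Prime) (hne : p₁ ≠ p₂) (h₁ : M ≤ p₁) (h₁' : p₁ < 2 * M)
    (h₂ : M ≤ p₂) (h₂' : p₂ < 2 * M) :
    ‖liftPairing a b c h N (N / M) p₁ p₂‖ ≤ C * (N / M) * (N : ℝ) ^ (-(δ / 2)) +
      16 * (rootConst a b c : ℝ) * (N / M / M * (1 + Real.log N)) := by
  have hM0 : 0 < M := by omega
  have hN0 : 0 < N := by omega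
  have hMr : (0 : ℝ) < M := by exact_mod_cast hM0
  have hNr : (0 : ℝ) < N := by exact_mod_cast hN0
  have hcop : p₁.Coprime p₂ := (Nat.coprime_primes hp₁ hp₂).2 hne
  set mx := max p₁ p₂ with hmx
  set mn := min p₁ p₂ with hmn
  have hmx0 : 0 < mx := lt_of_lt_of_le hM0 (h₁.trans (le_max_left _ _))
  have hprod : p₁ * p₂ = mn * mx := (min_mul_max p₁ p₂).symm
  have hmxM : M ≤ mx := h₁.trans (le_max_left _ _)
  have hmx2 : mx < 2 * M := max_lt h₁' h₂'
  have hmnM : M ≤ mn := le_min h₁ h₂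
  have hmn2 : mn < 2 * M := (min_le_left _ _).trans_lt h₁'
  set k := N / mx with hk
  have hkN : k * mx ≤ N := Nat.div_mul_le_self N mx
  have hkN' : N < k * mx + mx := by
    have := Nat.lt_div_mul_add hmx0 (a := N)
    simpa [hk] using this
  have hkle : k ≤ N := Nat.div_le_self _ _
  have hkM : (k : ℝ) ≤ N / M := by
    rw [le_div_iff₀ hMr]
    have : k * M ≤ N := (Nat.mul_le_mul_left k hmxM).trans hkN
    exact_mod_cast this
  have e : liftPairing a b c h N (N / M) p₁ p₂ =
      ∑ m ∈ (Icc 1 k).filter (fun m => ¬ p₁ ∣ m ∧ ¬ p₂ ∣ m),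
        rho a b c (h * (p₂ - p₁)) (p₁ * p₂ * m) := by
    rw [liftPairing]
    refine Finset.sum_congr ?_ ?_
    · ext m
      simp only [mem_filter, mem_Icc]
      rw [hk, Nat.le_div_iff_mul_le hmx0, Nat.le_div_iff_mul_le hM0]
      constructor
      · rintro ⟨⟨h1, h2⟩, ⟨h3, h4⟩, h5, h6⟩
        refine ⟨⟨h1, ?_⟩, h3, h5⟩
        rcases max_choice p₁ p₂ with hx | hx <;> rw [hmx, hx, mul_comm] <;> assumption
      · rintro ⟨⟨h1, h2⟩, h3, h5⟩
        refine ⟨⟨h1, (Nat.mul_le_mul_left m hmxM).trans h2⟩, ⟨h3, ?_⟩, h5, ?_⟩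
        · rw [mul_comm]; exact (Nat.mul_le_mul_left m (le_max_left _ _)).trans h2
        · rw [mul_comm]; exact (Nat.mul_le_mul_left m (le_max_right _ _)).trans h2
    · intro m hm
      simp only [mem_filter, mem_Icc] at hm
      exact sum_liftSum_mul_conj h hm.1.1 hp₁.pos hp₂.pos hcop
  set r : ℕ → ℂ := fun m => rho a b c (h * (p₂ - p₁)) (p₁ * p₂ * m) with hr
  have split : ‖∑ m ∈ (Icc 1 k).filter (fun m => ¬ p₁ ∣ m ∧ ¬ p₂ ∣ m), r m‖ ≤
      ‖∑ m ∈ Icc 1 k, r m‖ + (∑ m ∈ (Icc 1 k).filter (p₁ ∣ ·), ‖r m‖ +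
        ∑ m ∈ (Icc 1 k).filter (p₂ ∣ ·), ‖r m‖) := by
    have h1 := Finset.sum_filter_add_sum_filter_not (Icc 1 k)
      (fun m => ¬ p₁ ∣ m ∧ ¬ p₂ ∣ m) r
    rw [← eq_sub_iff_add_eq] at h1
    rw [h1]
    refine (norm_sub_le _ _).trans (add_le_add_right ((norm_sum_le _ _).trans ?_) _)
    refine le_trans ?_ (Finset.sum_union_inter (s₁ := (Icc 1 k).filter (p₁ ∣ ·))
      (s₂ := (Icc 1 k).filter (p₂ ∣ ·)) (f := fun m => ‖r m‖)).le
    refine le_trans (Finset.sum_le_sum_of_subset_of_nonneg ?_ fun _ _ _ => norm_nonneg _)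
      (le_add_of_nonneg_right (Finset.sum_nonneg fun _ _ => norm_nonneg _))
    intro m hm
    simp only [mem_filter, mem_union, not_and_or, not_not] at hm ⊢
    tauto
  have hXle : p₁ * p₂ * k ≤ 2 * M * N := by
    rw [hprod, mul_assoc, mul_comm mx k]
    exact Nat.mul_le_mul hmn2.le hkN
  have hXge : M * N ≤ 2 * (p₁ * p₂ * k) := by
    rw [hprod, mul_assoc, mul_comm mx k]
    have : N ≤ 2 * (k * mx) := by omega
    calc M * N ≤ mn * (2 * (k * mx)) := Nat.mul_le_mul hmnM this
      _ = _ := by ring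
  have hXN : N ≤ p₁ * p₂ * k := by
    have : 2 * N ≤ M * N := Nat.mul_le_mul_right N hM
    omega
  have hq0 : 0 < p₁ * p₂ := Nat.mul_pos hp₁.pos hp₂.pos
  have hXNr : (N : ℝ) ≤ ((p₁ * p₂ * k : ℕ) : ℝ) := by exact_mod_cast hXN
  have hXle' : ((p₁ * p₂ * k : ℕ) : ℝ) ≤ 2 * M * N := by exact_mod_cast hXle
  have hXge' : (M * N / 2 : ℝ) ≤ ((p₁ * p₂ * k : ℕ) : ℝ) := by
    rw [div_le_iff₀ two_pos, mul_comm _ (2 : ℝ)]; exact_mod_cast hXge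
  have hX0 : (0 : ℝ) < ((p₁ * p₂ * k : ℕ) : ℝ) := hNr.trans_le hXNr
  have main : ‖∑ m ∈ Icc 1 k, r m‖ ≤ C * (N / M) * (N : ℝ) ^ (-(δ / 2)) := by
    have hsq : Squarefree (p₁ * p₂) :=
      (Nat.squarefree_mul hcop).2 ⟨hp₁.squarefree, hp₂.squarefree⟩
    have hq4 : ((p₁ * p₂ : ℕ) : ℝ) ≤ 4 * (M : ℝ) ^ 2 := by
      have : p₁ * p₂ ≤ 4 * M ^ 2 := by
        calc p₁ * p₂ ≤ (2 * M) * (2 * M) := Nat.mul_le_mul h₁'.le h₂'.le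
          _ = _ := by ring
      exact_mod_cast this
    have hdiff : |((p₂ : ℝ) - p₁)| ≤ M := by
      have a1 : (M : ℝ) ≤ p₁ := by exact_mod_cast h₁
      have a2 : (p₁ : ℝ) ≤ 2 * M := by exact_mod_cast h₁'.le
      have a3 : (M : ℝ) ≤ p₂ := by exact_mod_cast h₂
      have a4 : (p₂ : ℝ) ≤ 2 * M := by exact_mod_cast h₂'.le
      rw [abs_le]; constructor <;> linarith
    have := hK ((p₁ * p₂ * k : ℕ) : ℝ) (hN.trans hXNr) (p₁ * p₂) hsq ?_ (h * (p₂ - p₁))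
      (mul_ne_zero hh (sub_ne_zero.2 (by exact_mod_cast hne.symm))) ?_
      (gcd_mul_sub_le hp₁ hp₂ hne hh)
    · rw [Nat.floor_natCast, sum_multiples _ _ hq0, Nat.mul_div_cancel_left k hq0] at this
      refine this.trans ?_
      have e1 : ((p₁ * p₂ * k : ℕ) : ℝ) ^ (1 - δ / 2) / ((p₁ * p₂ : ℕ) : ℝ) =
          k * ((p₁ * p₂ * k : ℕ) : ℝ) ^ (-(δ / 2)) := by
        rw [sub_eq_add_neg, Real.rpow_add hX0, Real.rpow_one]
        have : ((p₁ * p₂ : ℕ) : ℝ) ≠ 0 := by exact_mod_cast hq0.ne'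
        rw [Nat.cast_mul (p₁ * p₂) k]
        field_simp
      rw [mul_div_assoc, e1, mul_assoc C (N / M : ℝ)]
      refine mul_le_mul_of_nonneg_left ?_ hC
      refine mul_le_mul hkM ?_ (Real.rpow_nonneg hX0.le _) (by positivity)
      exact Real.rpow_le_rpow_of_nonpos hNr hXNr (by linarith)
    · calc ((p₁ * p₂ : ℕ) : ℝ) * ((p₁ * p₂ * k : ℕ) : ℝ) ^ (4 * δ)
          ≤ 4 * (M : ℝ) ^ 2 * (2 * M * N) ^ (4 * δ) := by
            refine mul_le_mul hq4 (Real.rpow_le_rpow hX0.le hXle' (by linarith))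
              (Real.rpow_nonneg hX0.le _) (by positivity)
        _ ≤ √(M * N / 2) := hsize
        _ ≤ _ := Real.sqrt_le_sqrt hXge'
    · push_cast
      rw [abs_mul]
      have := (mul_le_mul_of_nonneg_left hdiff (abs_nonneg (h : ℝ))).trans hhN
      have h3 := this.trans hXNr
      push_cast at h3
      exact h3
  have tau8 : ∀ p, p.Prime → (p₁ * p₂ * p).divisors.card ≤ 8 := by
    intro p hp
    have t1 := card_divisors_mul_le (p₁ * p₂) p
    have t2 := card_divisors_mul_le p₁ p₂
    rw [card_divisors_prime hp₁, card_divisors_prime hp₂] at t2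
    rw [card_divisors_prime hp] at t1
    omega
  have hlog := Real.log_natCast_nonneg N
  have side : ∀ p, p.Prime → M ≤ p → ∑ m ∈ (Icc 1 k).filter (p ∣ ·), ‖r m‖ ≤
      8 * (rootConst a b c : ℝ) * (N / M / M * (1 + Real.log N)) := by
    intro p hp hpM
    refine (sum_norm_rho_multiples_le ha hD _ (p₁ * p₂) p k N hq0 hp.pos hkle (tau8 p hp)).trans ?_
    have : (M : ℝ) ≤ p := by exact_mod_cast hpM
    gcongr
  rw [e]
  have s1 := side p₁ hp₁ h₁
  have s2 := side p₂ hp₂ h₂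
  calc _ ≤ _ := split
    _ ≤ _ := add_le_add main (add_le_add s1 s2)
    _ = _ := by ring

end TypeTwo

end QuadRoots

namespace QuadRoots

section TypeTwoBlock
open Finset

variable {a b c : ℤ}

lemma sum_card_roots_le (ha : a ≠ 0) (hD : b ^ 2 - 4 * a * c ≠ 0) (N M : ℕ) (hM : 0 < M) :
    ∑ m ∈ Icc 1 (N / M), ((roots a b c m).card : ℝ) ≤
      (rootConst a b c : ℝ) * (N / M * (1 + Real.log N)) := by
  have h1 : ∀ m ∈ Icc 1 (N / M), ((roots a b c m).card : ℝ) ≤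
      rootConst a b c * ((1 * m).divisors.card : ℝ) := by
    intro m hm
    rw [mem_Icc] at hm
    rw [one_mul]
    exact card_roots_le_rootConst ha hD hm.1
  refine (Finset.sum_le_sum h1).trans ?_
  rw [← Finset.mul_sum]
  have := sum_card_divisors_mul_div_le 1 M N hM
  rw [Nat.divisors_one, card_singleton, Nat.cast_one, one_mul] at this
  exact mul_le_mul_of_nonneg_left this (Nat.cast_nonneg _)

lemma bilinear_cauchy_schwarz (h : ℤ) {N M : ℕ} (hM : 0 < M) {P : Finset ℕ}
    (hP : ∀ p ∈ P, p.Prime ∧ M ≤ p) {α : ℕ → ℂ} {G : ℝ} (hα : ∀ m, ‖α m‖ ≤ G) :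
    ‖∑ p ∈ P, ∑ m ∈ (Icc 1 (N / p)).filter (¬ p ∣ ·), α m * rho a b c h (p * m)‖ ^ 2 ≤
      (G ^ 2 * ∑ m ∈ Icc 1 (N / M), ((roots a b c m).card : ℝ)) *
        ∑ m ∈ Icc 1 (N / M), ∑ μ ∈ roots a b c m,
          ‖∑ p ∈ P.filter (fun p => ¬ p ∣ m ∧ p * m ≤ N), liftSum a b c h p m μ‖ ^ 2 := by
  have e : ∑ p ∈ P, ∑ m ∈ (Icc 1 (N / p)).filter (¬ p ∣ ·), α m * rho a b c h (p * m) =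
      ∑ m ∈ Icc 1 (N / M), ∑ μ ∈ roots a b c m,
        α m * ∑ p ∈ P.filter (fun p => ¬ p ∣ m ∧ p * m ≤ N), liftSum a b c h p m μ := by
    have e1 : ∀ m ∈ Icc 1 (N / M), ∑ μ ∈ roots a b c m,
        α m * ∑ p ∈ P.filter (fun p => ¬ p ∣ m ∧ p * m ≤ N), liftSum a b c h p m μ =
        ∑ p ∈ P.filter (fun p => ¬ p ∣ m ∧ p * m ≤ N), α m * rho a b c h (p * m) := by
      intro m hm
      rw [mem_Icc] at hm
      rw [← Finset.mul_sum, Finset.sum_comm, ← Finset.mul_sum]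
      congr 1
      exact Finset.sum_congr rfl fun p _ => sum_liftSum h p hm.1
    rw [Finset.sum_congr rfl e1]
    refine Finset.sum_comm' ?_
    intro p m
    simp only [mem_filter, mem_Icc]
    constructor
    · rintro ⟨hp, ⟨h1, h2⟩, h3⟩
      have hp0 := (hP p hp).1.pos
      have h4 : m * p ≤ N := (Nat.le_div_iff_mul_le hp0).1 h2
      exact ⟨⟨hp, h3, by rwa [mul_comm]⟩, h1, (Nat.le_div_iff_mul_le hM).2
        ((Nat.mul_le_mul_left m (hP p hp).2).trans h4)⟩
    · rintro ⟨⟨hp, h3, h4⟩, h1, _⟩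
      exact ⟨hp, ⟨h1, (Nat.le_div_iff_mul_le (hP p hp).1.pos).2 (by rwa [mul_comm])⟩, h3⟩
  rw [e, Finset.sum_sigma' (Icc 1 (N / M)) (roots a b c ·)]
  refine (pow_le_pow_left₀ (norm_nonneg _) (norm_sum_le _ _) 2).trans ?_
  simp_rw [norm_mul]
  refine (Finset.sum_mul_sq_le_sq_mul_sq _ _ _).trans ?_
  rw [Finset.sum_sigma' (Icc 1 (N / M)) (roots a b c ·)]
  refine mul_le_mul_of_nonneg_right ?_ (Finset.sum_nonneg fun _ _ => sq_nonneg _)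
  rw [Finset.sum_sigma, Finset.mul_sum]
  refine Finset.sum_le_sum fun m _ => ?_
  change ∑ _s ∈ roots a b c m, ‖α m‖ ^ 2 ≤ _
  rw [Finset.sum_const, nsmul_eq_mul, mul_comm]
  exact mul_le_mul_of_nonneg_right (pow_le_pow_left₀ (norm_nonneg _) (hα m) 2) (Nat.cast_nonneg _)

lemma norm_bilinear_block_sq_le {δ C X₀ : ℝ} (hδ : 0 < δ) (hC : 0 ≤ C) (ha : a ≠ 0)
    (hD : b ^ 2 - 4 * a * c ≠ 0) {h : ℤ} (hh : h ≠ 0) (hK : HasLevel a b c δ C X₀ h.natAbs)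
    {N M : ℕ} (hM : 2 ≤ M) (hMN : 4 * M ≤ N) (hN : X₀ ≤ N) (hhN : |(h : ℝ)| * M ≤ N)
    (hsize : 4 * (M : ℝ) ^ 2 * (2 * M * N) ^ (4 * δ) ≤ √(M * N / 2))
    {P : Finset ℕ} (hP : ∀ p ∈ P, p.Prime ∧ M ≤ p ∧ p < 2 * M)
    {α : ℕ → ℂ} {G : ℝ} (hα : ∀ m, ‖α m‖ ≤ G) :
    ‖∑ p ∈ P, ∑ m ∈ (Icc 1 (N / p)).filter (¬ p ∣ ·), α m * rho a b c h (p * m)‖ ^ 2 ≤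
      G ^ 2 * rootConst a b c * (N : ℝ) ^ 2 * (1 + Real.log N) *
        (C * (N : ℝ) ^ (-(δ / 2)) +
          (16 * rootConst a b c + 4 * (rootConst a b c : ℝ) ^ 2) * (1 + Real.log N) / M) := by
  set Cf : ℝ := (rootConst a b c : ℝ) with hCfd
  have hCf : 0 ≤ Cf := Nat.cast_nonneg _
  have hM0 : 0 < M := by omega
  have hMr : (0 : ℝ) < M := by exact_mod_cast hM0
  have hlog := Real.log_natCast_nonneg N
  set L := Real.log N
  have hG : 0 ≤ G := (norm_nonneg _).trans (hα 0)
  refine (bilinear_cauchy_schwarz h hM0 (fun p hp => ⟨(hP p hp).1, (hP p hp).2.1⟩) hα).trans ?_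
  have f1 := sum_card_roots_le (c := c) ha hD N M hM0
  set E := C * (N / M) * (N : ℝ) ^ (-(δ / 2)) + 16 * Cf * (N / M / M * (1 + L)) with hE
  have hE0 : 0 ≤ E := by
    have := Real.rpow_nonneg (Nat.cast_nonneg N (α := ℝ)) (-(δ / 2))
    positivity
  set F := 4 * Cf ^ 2 * (N / M * (1 + L)) with hF
  have hF0 : 0 ≤ F := by positivity
  have hcard : (P.card : ℝ) ≤ M := by
    have : P ⊆ Ico M (2 * M) := fun p hp => mem_Ico.2 (hP p hp).2
    have := Finset.card_le_card this
    rw [Nat.card_Ico] at this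
    exact_mod_cast this.trans (by omega)
  have f2 : ∑ m ∈ Icc 1 (N / M), ∑ μ ∈ roots a b c m,
      ‖∑ p ∈ P.filter (fun p => ¬ p ∣ m ∧ p * m ≤ N), liftSum a b c h p m μ‖ ^ 2 ≤
      M * (F + M * E) := by
    have e := sum_norm_sq_eq_sum_liftPairing (a := a) (b := b) (c := c) h N (N / M) P
    set S := ∑ m ∈ Icc 1 (N / M), ∑ μ ∈ roots a b c m,
      ‖∑ p ∈ P.filter (fun p => ¬ p ∣ m ∧ p * m ≤ N), liftSum a b c h p m μ‖ ^ 2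
    have hS : S ≤ ‖(S : ℂ)‖ := by
      rw [Complex.norm_real]; exact Real.le_norm_self S
    refine hS.trans ?_
    rw [e]
    refine (norm_sum_le _ _).trans ?_
    have g1 : ∀ p₁ ∈ P, ‖∑ p₂ ∈ P, liftPairing a b c h N (N / M) p₁ p₂‖ ≤ F + M * E := by
      intro p₁ hp₁
      obtain ⟨q1, q2, q3⟩ := hP p₁ hp₁
      have hd : ‖liftPairing a b c h N (N / M) p₁ p₁‖ ≤ F := by
        refine (norm_liftPairing_self_le ha hD h N (N / M) q1).trans ?_
        have : (M : ℝ) ≤ p₁ := by exact_mod_cast q2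
        rw [hF]; gcongr
      rw [← Finset.add_sum_erase P _ hp₁]
      refine (norm_add_le _ _).trans (add_le_add hd ((norm_sum_le _ _).trans ?_))
      have g2 : ∀ p₂ ∈ P.erase p₁, ‖liftPairing a b c h N (N / M) p₁ p₂‖ ≤ E := by
        intro p₂ hp₂
        rw [mem_erase] at hp₂
        obtain ⟨r1, r2, r3⟩ := hP p₂ hp₂.2
        exact norm_liftPairing_le hδ hC ha hD hh hK hM hMN hN hhN hsize q1 r1 hp₂.1.symm q2 q3 r2 r3
      refine (Finset.sum_le_card_nsmul _ _ _ g2).trans ?_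
      rw [nsmul_eq_mul]
      refine mul_le_mul_of_nonneg_right (le_trans ?_ hcard) hE0
      exact_mod_cast Finset.card_le_card (Finset.erase_subset _ _)
    refine (Finset.sum_le_card_nsmul _ _ _ g1).trans ?_
    rw [nsmul_eq_mul]
    exact mul_le_mul_of_nonneg_right hcard (by positivity)
  calc _ ≤ (G ^ 2 * (Cf * (N / M * (1 + L)))) * (M * (F + M * E)) := by gcongr
    _ = _ := by
      rw [hF, hE]; field_simp; ring

lemma natLog_two_le {n N : ℕ} (hn : n ≤ N) : (Nat.log 2 n : ℝ) + 1 ≤ 2 * (1 + Real.log N) := by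
  have hlog := Real.log_natCast_nonneg N
  rcases Nat.eq_zero_or_pos N with rfl | hN
  · obtain rfl : n = 0 := by omega
    simp
  have h1 : Nat.log 2 n ≤ Nat.log 2 N := Nat.log_mono_right hn
  have h2 : 2 ^ Nat.log 2 N ≤ N := Nat.pow_log_le_self 2 hN.ne'
  have h3 : (Nat.log 2 N : ℝ) * Real.log 2 ≤ Real.log N := by
    rw [← Real.log_pow]
    exact Real.log_le_log (by positivity) (by exact_mod_cast h2)
  have h4 : (Nat.log 2 n : ℝ) ≤ Nat.log 2 N := by exact_mod_cast h1
  have h5 := Real.log_two_gt_d9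
  have h6 : (0 : ℝ) ≤ Nat.log 2 N := Nat.cast_nonneg _
  nlinarith

lemma norm_bilinear_le {δ C X₀ : ℝ} (hδ : 0 < δ) (hC : 0 ≤ C) (ha : a ≠ 0)
    (hD : b ^ 2 - 4 * a * c ≠ 0) {h : ℤ} (hh : h ≠ 0) (hK : HasLevel a b c δ C X₀ h.natAbs)
    {N : ℕ} {z₀ z : ℝ} (hz₀ : 4 ≤ z₀) (hzN : 4 * z ≤ N) (hN : X₀ ≤ N) (hhN : |(h : ℝ)| * z ≤ N)
    (hsize : 4 * z * √z * (2 * z * N) ^ (4 * δ) ≤ √(N / 2))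
    {P : Finset ℕ} (hP : ∀ p ∈ P, p.Prime ∧ z₀ ≤ p ∧ p ≤ z)
    {α : ℕ → ℂ} {G : ℝ} (hα : ∀ m, ‖α m‖ ≤ G) :
    ‖∑ p ∈ P, ∑ m ∈ (Icc 1 (N / p)).filter (¬ p ∣ ·), α m * rho a b c h (p * m)‖ ≤
      2 * √(rootConst a b c * (C + 32 * rootConst a b c + 8 * (rootConst a b c : ℝ) ^ 2)) * G *
        (N * (1 + Real.log N) ^ 2) * √((N : ℝ) ^ (-(δ / 2)) + 1 / z₀) := by
  set Cf : ℝ := (rootConst a b c : ℝ) with hCfd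
  have hCf : 0 ≤ Cf := Nat.cast_nonneg _
  have hlog := Real.log_natCast_nonneg N
  set L := Real.log N
  have hG : 0 ≤ G := (norm_nonneg _).trans (hα 0)
  have hNδ := Real.rpow_nonneg (Nat.cast_nonneg N (α := ℝ)) (-(δ / 2))
  set T := √(Cf * (C + 32 * Cf + 8 * Cf ^ 2)) * G * (N * (1 + L)) *
    √((N : ℝ) ^ (-(δ / 2)) + 1 / z₀) with hT
  have hT0 : 0 ≤ T := by positivity
  have hmaps : ∀ p ∈ P, Nat.log 2 p ∈ range (Nat.log 2 N + 1) := by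
    intro p hp
    obtain ⟨q1, q2, q3⟩ := hP p hp
    rw [mem_range, Nat.lt_succ_iff]
    refine Nat.log_mono_right ?_
    have : (p : ℝ) ≤ N := by linarith
    exact_mod_cast this
  rw [← Finset.sum_fiberwise_of_maps_to hmaps]
  refine (norm_sum_le _ _).trans ?_
  have key : ∀ j ∈ range (Nat.log 2 N + 1), ‖∑ p ∈ P.filter (Nat.log 2 · = j),
      ∑ m ∈ (Icc 1 (N / p)).filter (¬ p ∣ ·), α m * rho a b c h (p * m)‖ ≤ T := by
    intro j _
    rcases (P.filter (Nat.log 2 · = j)).eq_empty_or_nonempty with he | ⟨p₀, hp₀⟩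
    · rw [he, Finset.sum_empty, norm_zero]; exact hT0
    have hrange : ∀ p ∈ P.filter (Nat.log 2 · = j), 2 ^ j ≤ p ∧ p < 2 * 2 ^ j := by
      intro p hp
      rw [mem_filter] at hp
      have hp0 := (hP p hp.1).1.pos
      rw [← hp.2]
      refine ⟨Nat.pow_log_le_self 2 hp0.ne', ?_⟩
      rw [mul_comm, ← pow_succ]
      exact Nat.lt_pow_succ_log_self (by norm_num) p
    set M := 2 ^ j with hM
    obtain ⟨q1, q2, q3⟩ := hP p₀ (mem_filter.1 hp₀).1
    obtain ⟨r1, r2⟩ := hrange p₀ hp₀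
    have r1' : (M : ℝ) ≤ p₀ := by exact_mod_cast r1
    have r2' : (p₀ : ℝ) < 2 * M := by exact_mod_cast r2
    have hMz : (M : ℝ) ≤ z := r1'.trans q3
    have hM2 : 2 < (M : ℝ) := by linarith
    have hMr : 0 < (M : ℝ) := by linarith
    have hz0 : 0 < z := by linarith
    have hNr : 0 < (N : ℝ) := by linarith
    have hblock := norm_bilinear_block_sq_le hδ hC ha hD hh hK (N := N) (M := M)
      (by exact_mod_cast hM2.le) (by
        have : 4 * (M : ℝ) ≤ N := by linarith
        exact_mod_cast this) hN
      ((mul_le_mul_of_nonneg_left hMz (abs_nonneg _)).trans hhN) (by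
        have e : √(M * N / 2) = √M * √(N / 2) := by
          rw [mul_div_assoc, Real.sqrt_mul hMr.le]
        rw [e]
        have e2 : 4 * (M : ℝ) ^ 2 * (2 * M * N) ^ (4 * δ) =
            √M * (4 * M * √M * (2 * M * N) ^ (4 * δ)) := by
          have := Real.mul_self_sqrt hMr.le
          calc 4 * (M : ℝ) ^ 2 * (2 * M * N) ^ (4 * δ) =
              4 * M * (M : ℝ) * (2 * M * N) ^ (4 * δ) := by ring
            _ = 4 * M * (√M * √M) * (2 * M * N) ^ (4 * δ) := by rw [this]
            _ = _ := by ring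
        rw [e2]
        refine mul_le_mul_of_nonneg_left (le_trans ?_ hsize) (Real.sqrt_nonneg _)
        gcongr)
      (P := P.filter (Nat.log 2 · = j))
      (fun p hp => ⟨(hP p (mem_filter.1 hp).1).1, hrange p hp⟩) hα
    refine le_of_sq_le_sq (hblock.trans ?_) hT0
    rw [hT, mul_pow, mul_pow, mul_pow, Real.sq_sqrt (by positivity), Real.sq_sqrt (by positivity)]
    have hinv : 1 / (M : ℝ) ≤ 2 * (1 / z₀) := by
      rw [mul_one_div, div_le_div_iff₀ hMr (by linarith)]
      linarith
    set x := (N : ℝ) ^ (-(δ / 2))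
    have g1 : C * x + (16 * Cf + 4 * Cf ^ 2) * (1 + L) / M ≤
        (1 + L) * ((C + 32 * Cf + 8 * Cf ^ 2) * (x + 1 / z₀)) := by
      have hz1 : 0 ≤ 1 / z₀ := by positivity
      calc C * x + (16 * Cf + 4 * Cf ^ 2) * (1 + L) / M
          = 1 * (C * x) + (1 + L) * ((16 * Cf + 4 * Cf ^ 2) * (1 / M)) := by ring
        _ ≤ (1 + L) * (C * x) + (1 + L) * ((16 * Cf + 4 * Cf ^ 2) * (2 * (1 / z₀))) := by
            gcongr; linarith
        _ ≤ (1 + L) * (C * x) + (1 + L) * ((16 * Cf + 4 * Cf ^ 2) * (2 * (1 / z₀))) +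
            (1 + L) * ((32 * Cf + 8 * Cf ^ 2) * x + C * (1 / z₀)) :=
            le_add_of_nonneg_right (by positivity)
        _ = _ := by ring
    calc _ ≤ G ^ 2 * Cf * N ^ 2 * (1 + L) *
        ((1 + L) * ((C + 32 * Cf + 8 * Cf ^ 2) * (x + 1 / z₀))) := by gcongr
      _ = _ := by ring
  refine (Finset.sum_le_card_nsmul _ _ _ key).trans ?_
  rw [nsmul_eq_mul, card_range]
  have hl := natLog_two_le (le_refl N)
  push_cast
  calc _ ≤ 2 * (1 + L) * T := by gcongr
    _ = _ := by rw [hT]; ring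

end TypeTwoBlock

end QuadRoots

namespace QuadRoots

section TypeOne
open Finset

variable {a b c : ℤ}

lemma sum_powerset_filter_prod_dvd {P : Finset ℕ} (hP : ∀ p ∈ P, p.Prime) (n : ℕ) :
    ∑ t ∈ P.powerset.filter (fun t => ∏ p ∈ t, p ∣ n), (-1 : ℂ) ^ t.card =
      if ∀ p ∈ P, ¬ p ∣ n then 1 else 0 := by
  have e : P.powerset.filter (fun t => ∏ p ∈ t, p ∣ n) = (P.filter (· ∣ n)).powerset := by
    ext t
    simp only [mem_filter, mem_powerset]
    constructor
    · rintro ⟨h1, h2⟩ p hp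
      exact mem_filter.2 ⟨h1 hp, (Finset.dvd_prod_of_mem _ hp).trans h2⟩
    · intro h
      refine ⟨h.trans (filter_subset _ _), Finset.prod_primes_dvd n ?_ ?_⟩
      · intro p hp
        exact (hP p (mem_filter.1 (h hp)).1).prime
      · intro p hp
        exact (mem_filter.1 (h hp)).2
  rw [e]
  have := Finset.sum_powerset_neg_one_pow_card (x := P.filter (· ∣ n))
  have h2 : ∑ t ∈ (P.filter (· ∣ n)).powerset, (-1 : ℂ) ^ t.card =
      ((∑ t ∈ (P.filter (· ∣ n)).powerset, (-1 : ℤ) ^ t.card : ℤ) : ℂ) := by push_cast; rfl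
  rw [h2, this]
  simp only [Finset.filter_eq_empty_iff]
  split_ifs <;> simp

lemma sum_inv_le_one_add_log {P : Finset ℕ} {z : ℝ} (hz : 1 ≤ z)
    (hP : ∀ p ∈ P, p.Prime ∧ (p : ℝ) ≤ z) : ∑ p ∈ P, (1 : ℝ) / p ≤ 1 + Real.log z := by
  have hz0 : 0 ≤ z := by linarith
  have h1 : P ⊆ Icc 1 ⌊z⌋₊ := fun p hp =>
    mem_Icc.2 ⟨(hP p hp).1.pos, Nat.le_floor (hP p hp).2⟩
  have hf : 0 < ⌊z⌋₊ := Nat.floor_pos.2 hz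
  calc ∑ p ∈ P, (1 : ℝ) / p ≤ ∑ p ∈ Icc 1 ⌊z⌋₊, (1 : ℝ) / p :=
        Finset.sum_le_sum_of_subset_of_nonneg h1 fun _ _ _ => by positivity
    _ ≤ 1 + Real.log ⌊z⌋₊ := sum_Icc_inv_le _
    _ ≤ _ := by
      gcongr
      exact Nat.floor_le hz0

lemma sum_powerset_pow_div_prod_le {P : Finset ℕ} {z : ℝ} (hz : 1 ≤ z)
    (hP : ∀ p ∈ P, p.Prime ∧ (p : ℝ) ≤ z) (k : ℕ) :
    ∑ t ∈ P.powerset, (k : ℝ) ^ t.card / ((∏ p ∈ t, p : ℕ) : ℝ) ≤ (Real.exp 1 * z) ^ k := by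
  have e : ∑ t ∈ P.powerset, (k : ℝ) ^ t.card / ((∏ p ∈ t, p : ℕ) : ℝ) =
      ∏ p ∈ P, (1 + (k : ℝ) / p) := by
    rw [Finset.prod_one_add]
    refine Finset.sum_congr rfl fun t _ => ?_
    rw [Finset.prod_div_distrib, Finset.prod_const, Nat.cast_prod]
  rw [e]
  have hz0 : 0 < z := by linarith
  calc ∏ p ∈ P, (1 + (k : ℝ) / p) ≤ ∏ p ∈ P, Real.exp ((k : ℝ) / p) := by
        refine Finset.prod_le_prod (fun _ _ => by positivity) fun p _ => ?_
        rw [add_comm]; exact Real.add_one_le_exp _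
    _ = Real.exp (k * ∑ p ∈ P, (1 : ℝ) / p) := by
        rw [← Real.exp_sum, Finset.mul_sum]
        congr 1
        exact Finset.sum_congr rfl fun p _ => by ring
    _ ≤ Real.exp (k * (1 + Real.log z)) := by
        gcongr
        exact sum_inv_le_one_add_log hz hP
    _ = _ := by
        rw [Real.exp_nat_mul, Real.exp_add, Real.exp_log hz0]

lemma card_divisors_prod_le {t : Finset ℕ} (ht : ∀ p ∈ t, p.Prime) :
    (∏ p ∈ t, p).divisors.card ≤ 2 ^ t.card := by
  induction t using Finset.induction_on with
  | empty => simp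
  | insert p s hps ih =>
    rw [Finset.prod_insert hps, Finset.card_insert_of_notMem hps, pow_succ, mul_comm (2 ^ _)]
    refine (card_divisors_mul_le _ _).trans (Nat.mul_le_mul ?_ ?_)
    · rw [card_divisors_prime (ht p (mem_insert_self _ _))]
    · exact ih fun q hq => ht q (mem_insert_of_mem hq)

lemma squarefree_prod_of_primes {t : Finset ℕ} (ht : ∀ p ∈ t, p.Prime) :
    Squarefree (∏ p ∈ t, p) := by
  induction t using Finset.induction_on with
  | empty => simp
  | insert p s hps ih =>
    have hs : ∀ q ∈ s, q.Prime := fun q hq => ht q (mem_insert_of_mem hq)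
    have hp := ht p (mem_insert_self _ _)
    rw [Finset.prod_insert hps, Nat.squarefree_mul]
    · exact ⟨hp.squarefree, ih hs⟩
    · refine Nat.Coprime.prod_right fun q hq => (Nat.coprime_primes hp (hs q hq)).2 ?_
      rintro rfl
      exact hps hq

lemma sum_norm_rho_multiples_le' (ha : a ≠ 0) (hD : b ^ 2 - 4 * a * c ≠ 0) (h : ℤ) (N : ℕ) {q : ℕ}
    (hq : 0 < q) : ‖∑ n ∈ (Icc 1 N).filter (q ∣ ·), rho a b c h n‖ ≤
      rootConst a b c * (q.divisors.card * (N / q * (1 + Real.log N))) := by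
  rw [sum_multiples N q hq]
  refine (norm_sum_le _ _).trans ?_
  have h1 : ∀ j ∈ Icc 1 (N / q), ‖rho a b c h (q * j)‖ ≤
      rootConst a b c * ((q * j).divisors.card : ℝ) := by
    intro j hj
    rw [mem_Icc] at hj
    exact norm_rho_le ha hD h (Nat.mul_pos hq hj.1)
  refine (Finset.sum_le_sum h1).trans ?_
  rw [← Finset.mul_sum]
  exact mul_le_mul_of_nonneg_left (sum_card_divisors_mul_div_le q q N hq) (Nat.cast_nonneg _)

lemma norm_sum_sifted_multiples_le {δ C X₀ : ℝ} (hC : 0 ≤ C) (ha : a ≠ 0)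
    (hD : b ^ 2 - 4 * a * c ≠ 0) {h : ℤ} (hh : h ≠ 0) (hK : HasLevel a b c δ C X₀ h.natAbs)
    {N : ℕ} {z : ℝ} (hz : 1 ≤ z) (hN0 : 0 < N) (hN : X₀ ≤ N) (hhN : |(h : ℝ)| ≤ N)
    {P : Finset ℕ} (hP : ∀ p ∈ P, p.Prime ∧ (p : ℝ) ≤ z) {q k : ℕ} (hq : Squarefree q)
    (hqP : ∀ p ∈ P, ¬ p ∣ q) (hsize : q * z ^ k * (N : ℝ) ^ (4 * δ) ≤ √N) :
    ‖∑ n ∈ (Icc 1 N).filter (fun n => q ∣ n ∧ ∀ p ∈ P, ¬ p ∣ n), rho a b c h n‖ ≤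
      N / q * (C * (N : ℝ) ^ (-(δ / 2)) * (Real.exp 1 * z) +
        rootConst a b c * q.divisors.card * (1 + Real.log N) *
          ((1 / 2 : ℝ) ^ k * (Real.exp 1 * z) ^ 4)) := by
  have hlog := Real.log_natCast_nonneg N
  set L := Real.log N
  have hNr : (0 : ℝ) < N := by exact_mod_cast hN0
  have hq0 : 0 < q := Nat.pos_of_ne_zero hq.ne_zero
  have hqr : (0 : ℝ) < q := by exact_mod_cast hq0
  set Cf : ℝ := (rootConst a b c : ℝ) with hCfd
  have hCf : 0 ≤ Cf := Nat.cast_nonneg _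
  have hcop : ∀ t ∈ P.powerset, q.Coprime (∏ p ∈ t, p) := by
    intro t ht
    rw [mem_powerset] at ht
    refine Nat.Coprime.prod_right fun p hp => ?_
    exact ((hP p (ht hp)).1.coprime_iff_not_dvd.2 (hqP p (ht hp))).symm
  have e : ∑ n ∈ (Icc 1 N).filter (fun n => q ∣ n ∧ ∀ p ∈ P, ¬ p ∣ n), rho a b c h n =
      ∑ t ∈ P.powerset, (-1 : ℂ) ^ t.card *
        ∑ n ∈ (Icc 1 N).filter ((q * ∏ p ∈ t, p) ∣ ·), rho a b c h n := by
    have e1 : ∀ n, (if ∀ p ∈ P, ¬ p ∣ n then rho a b c h n else 0) =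
        ∑ t ∈ P.powerset, if ∏ p ∈ t, p ∣ n then (-1 : ℂ) ^ t.card * rho a b c h n else 0 := by
      intro n
      have := sum_powerset_filter_prod_dvd (fun p hp => (hP p hp).1) n
      rw [← Finset.sum_filter, ← Finset.sum_mul, this]
      split_ifs <;> simp
    rw [← Finset.filter_filter, Finset.sum_filter, Finset.sum_congr rfl fun n _ => e1 n,
      Finset.sum_comm]
    refine Finset.sum_congr rfl fun t ht => ?_
    rw [← Finset.sum_filter, Finset.filter_filter, Finset.mul_sum]
    refine Finset.sum_congr (Finset.filter_congr fun n _ => ?_) fun _ _ => rfl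
    exact ⟨fun h => (hcop t ht).mul_dvd_of_dvd_of_dvd h.1 h.2,
      fun h => ⟨(dvd_mul_right _ _).trans h, (dvd_mul_left _ _).trans h⟩⟩
  rw [e]
  refine (norm_sum_le _ _).trans ?_
  set x := (N : ℝ) ^ (-(δ / 2)) with hx
  have hx0 : 0 ≤ x := Real.rpow_nonneg hNr.le _
  have key : ∀ t ∈ P.powerset, ‖(-1 : ℂ) ^ t.card *
      ∑ n ∈ (Icc 1 N).filter ((q * ∏ p ∈ t, p) ∣ ·), rho a b c h n‖ ≤
      N / q * C * x * (((1 : ℕ) : ℝ) ^ t.card / ((∏ p ∈ t, p : ℕ) : ℝ)) +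
      N / q * (Cf * q.divisors.card * (1 + L)) * (1 / 2 : ℝ) ^ k *
        (((4 : ℕ) : ℝ) ^ t.card / ((∏ p ∈ t, p : ℕ) : ℝ)) := by
    intro t ht
    have htP : ∀ p ∈ t, p.Prime ∧ (p : ℝ) ≤ z := fun p hp => hP p (mem_powerset.1 ht hp)
    set D := ∏ p ∈ t, p with hDt
    have hD0 : 0 < D := Finset.prod_pos fun p hp => (htP p hp).1.pos
    have hDr : (0 : ℝ) < D := by exact_mod_cast hD0
    rw [norm_mul, norm_pow, norm_neg, norm_one, one_pow, one_mul]
    rcases le_or_gt t.card k with hcard | hcard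
    · refine le_trans ?_ (le_add_of_nonneg_right (by positivity))
      have hDz : (D : ℝ) ≤ z ^ k := by
        rw [hDt, Nat.cast_prod]
        calc ∏ p ∈ t, (p : ℝ) ≤ ∏ p ∈ t, z :=
              Finset.prod_le_prod (fun _ _ => Nat.cast_nonneg _) fun p hp => (htP p hp).2
          _ = z ^ t.card := by rw [Finset.prod_const]
          _ ≤ z ^ k := pow_le_pow_right₀ hz hcard
      have hsq : Squarefree (q * D) :=
        (Nat.squarefree_mul (hcop t ht)).2 ⟨hq, squarefree_prod_of_primes fun p hp => (htP p hp).1⟩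
      have := hK N hN (q * D) hsq (by
        refine le_trans ?_ hsize
        push_cast
        gcongr) h hh hhN (Nat.le_of_dvd (Int.natAbs_pos.2 hh) (Nat.gcd_dvd_right _ _))
      rw [Nat.floor_natCast] at this
      refine this.trans (le_of_eq ?_)
      rw [sub_eq_add_neg, Real.rpow_add hNr, Real.rpow_one, hx]
      push_cast
      field_simp
      simp
    · refine le_trans ?_ (le_add_of_nonneg_left (by positivity))
      refine (sum_norm_rho_multiples_le' ha hD h N (Nat.mul_pos hq0 hD0)).trans ?_
      have t1 : ((q * D).divisors.card : ℝ) ≤ q.divisors.card * 2 ^ t.card := by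
        have := (card_divisors_mul_le q D).trans (Nat.mul_le_mul_left _
          (card_divisors_prod_le fun p hp => (htP p hp).1))
        exact_mod_cast this
      have t2 : (2 : ℝ) ^ t.card ≤ (1 / 2 : ℝ) ^ k * (4 : ℕ) ^ t.card := by
        have : (2 : ℝ) ^ k ≤ 2 ^ t.card := pow_le_pow_right₀ (by norm_num) hcard.le
        have e4 : (((4 : ℕ) : ℝ)) ^ t.card = 2 ^ t.card * 2 ^ t.card := by
          rw [← mul_pow]; norm_num
        rw [e4, one_div, inv_pow, ← div_eq_inv_mul, le_div_iff₀ (by positivity)]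
        gcongr
      calc Cf * (((q * D).divisors.card : ℝ) * (N / (q * D : ℕ) * (1 + L)))
          ≤ Cf * ((q.divisors.card * ((1 / 2 : ℝ) ^ k * (4 : ℕ) ^ t.card)) *
            (N / (q * D : ℕ) * (1 + L))) := by
            gcongr
            exact t1.trans (by gcongr)
        _ = _ := by push_cast; field_simp
  refine (Finset.sum_le_sum key).trans ?_
  rw [Finset.sum_add_distrib, ← Finset.mul_sum, ← Finset.mul_sum]
  have s1 := sum_powerset_pow_div_prod_le hz hP 1
  have s4 := sum_powerset_pow_div_prod_le hz hP 4
  rw [pow_one] at s1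
  calc _ ≤ N / q * C * x * (Real.exp 1 * z) + N / q * (Cf * q.divisors.card * (1 + L)) *
        (1 / 2 : ℝ) ^ k * (Real.exp 1 * z) ^ 4 := by gcongr
    _ = _ := by ring

end TypeOne

end QuadRoots

namespace QuadRoots

section SieveIdentity
open Finset

variable {a b c : ℤ}

/-- The number of elements of `P` dividing `n`. -/
def numDvd (P : Finset ℕ) (n : ℕ) : ℕ := (P.filter (· ∣ n)).card

lemma pow_numDvd_le {P : Finset ℕ} {z : ℝ} (hz : 0 ≤ z) (hP : ∀ p ∈ P, p.Prime ∧ z ≤ p) {n : ℕ}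
    (hn : 0 < n) : z ^ numDvd P n ≤ n := by
  have h1 : ∏ p ∈ P.filter (· ∣ n), p ∣ n := by
    refine Finset.prod_primes_dvd n ?_ ?_
    · intro p hp
      exact (hP p (mem_filter.1 hp).1).1.prime
    · intro p hp
      exact (mem_filter.1 hp).2
  have h2 : ((∏ p ∈ P.filter (· ∣ n), p : ℕ) : ℝ) ≤ n := by exact_mod_cast Nat.le_of_dvd hn h1
  refine le_trans ?_ h2
  rw [numDvd, Nat.cast_prod, ← Finset.prod_const]
  exact Finset.prod_le_prod (fun _ _ => hz) fun p hp => (hP p (mem_filter.1 hp).1).2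

lemma numDvd_le_three {P : Finset ℕ} {z : ℝ} (hz : 1 ≤ z) (hP : ∀ p ∈ P, p.Prime ∧ z ≤ p) {n N : ℕ}
    (hn : 0 < n) (hnN : n ≤ N) (hzN : (N : ℝ) < z ^ 4) : numDvd P n ≤ 3 := by
  by_contra! h
  have h1 := pow_numDvd_le (by linarith) hP hn
  have h2 : z ^ 4 ≤ z ^ numDvd P n := pow_le_pow_right₀ hz h
  have h3 : (n : ℝ) ≤ N := by exact_mod_cast hnN
  linarith

lemma abs_one_sub_le_two {g : ℕ} (hg : g ≤ 3) : ‖(1 : ℂ) - g‖ ≤ 2 := by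
  interval_cases g <;> norm_num

lemma numDvd_prime_mul {P : Finset ℕ} (hP : ∀ q ∈ P, q.Prime) {p m : ℕ} (hp : p.Prime)
    (hpP : p ∉ P) : numDvd P (p * m) = numDvd P m := by
  rw [numDvd, numDvd]
  congr 1
  refine Finset.filter_congr fun q hq => ?_
  rw [(hP q hq).dvd_mul, Nat.prime_dvd_prime_iff_eq (hP q hq) hp]
  constructor
  · rintro (rfl | h)
    · exact absurd hq hpP
    · exact h
  · exact Or.inr

lemma numDvd_mem_mul {P : Finset ℕ} (hP : ∀ q ∈ P, q.Prime) {p m : ℕ}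
    (hpP : p ∈ P) (hpm : ¬ p ∣ m) : numDvd P (p * m) = 1 + numDvd P m := by
  rw [numDvd, numDvd, add_comm]
  have : P.filter (· ∣ p * m) = insert p (P.filter (· ∣ m)) := by
    ext q
    simp only [mem_filter, mem_insert]
    constructor
    · rintro ⟨hq, hd⟩
      rcases (hP q hq).dvd_mul.1 hd with h | h
      · exact Or.inl ((Nat.prime_dvd_prime_iff_eq (hP q hq) (hP p hpP)).1 h)
      · exact Or.inr ⟨hq, h⟩
    · rintro (rfl | ⟨hq, hd⟩)
      · exact ⟨hpP, dvd_mul_right _ _⟩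
      · exact ⟨hq, hd.mul_left _⟩
  rw [this, Finset.card_insert_of_notMem (by simp [hpm])]

lemma numDvd_pos_of_dvd {P : Finset ℕ} {p n : ℕ} (hp : p ∈ P) (h : p ∣ n) : 0 < numDvd P n :=
  Finset.card_pos.2 ⟨p, mem_filter.2 ⟨hp, h⟩⟩

/-- Buchstab-type identity: removing the multiples of the primes in `P₁` from a sum. -/
lemma sum_eq_sum_sub_sum_numDvd (N : ℕ) {P₁ : Finset ℕ} (hP : ∀ p ∈ P₁, 0 < p) (F : ℕ → ℂ) :
    ∑ n ∈ (Icc 1 N).filter (fun n => numDvd P₁ n = 0), F n =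
      ∑ n ∈ Icc 1 N, F n -
        ∑ p ∈ P₁, ∑ m ∈ Icc 1 (N / p), F (p * m) / numDvd P₁ (p * m) := by
  have e1 : ∑ p ∈ P₁, ∑ m ∈ Icc 1 (N / p), F (p * m) / numDvd P₁ (p * m) =
      ∑ n ∈ Icc 1 N, if numDvd P₁ n = 0 then 0 else F n := by
    have : ∀ p ∈ P₁, ∑ m ∈ Icc 1 (N / p), F (p * m) / numDvd P₁ (p * m) =
        ∑ n ∈ Icc 1 N, if p ∣ n then F n / numDvd P₁ n else 0 := by
      intro p hp
      rw [← Finset.sum_filter, sum_multiples N p (hP p hp) (fun n => F n / numDvd P₁ n)]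
    rw [Finset.sum_congr rfl this, Finset.sum_comm]
    refine Finset.sum_congr rfl fun n _ => ?_
    rw [← Finset.sum_filter, Finset.sum_const, nsmul_eq_mul]
    change (numDvd P₁ n : ℂ) * _ = _
    split_ifs with h
    · simp [h]
    · have : (numDvd P₁ n : ℂ) ≠ 0 := by exact_mod_cast h
      field_simp
  rw [e1, ← Finset.sum_sub_distrib, Finset.sum_filter]
  refine Finset.sum_congr rfl fun n _ => ?_
  split_ifs <;> simp

open Classical in
/-- The weighted summand: `rho` restricted to integers free of the primes in `P₀`, with the
weight `1 - #{p ∈ P₂ | p ∣ n}`. -/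
noncomputable def sieveTerm (a b c h : ℤ) (P₀ P₂ : Finset ℕ) (n : ℕ) : ℂ :=
  if ∀ p ∈ P₀, ¬ p ∣ n then (1 - (numDvd P₂ n : ℂ)) * rho a b c h n else 0

lemma norm_sieveTerm_le {h : ℤ} {P₀ P₂ : Finset ℕ} {n : ℕ} (hg : numDvd P₂ n ≤ 3) :
    ‖sieveTerm a b c h P₀ P₂ n‖ ≤ 2 * ‖rho a b c h n‖ := by
  rw [sieveTerm]
  split_ifs
  · rw [norm_mul]
    exact mul_le_mul_of_nonneg_right (abs_one_sub_le_two hg) (norm_nonneg _)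
  · rw [norm_zero]; positivity

lemma sum_sieveTerm_eq (h : ℤ) (N : ℕ) (P₀ P₂ : Finset ℕ) :
    ∑ n ∈ Icc 1 N, sieveTerm a b c h P₀ P₂ n =
      ∑ n ∈ (Icc 1 N).filter (fun n => 1 ∣ n ∧ ∀ p ∈ P₀, ¬ p ∣ n), rho a b c h n -
      ∑ q ∈ P₂, ∑ n ∈ (Icc 1 N).filter (fun n => q ∣ n ∧ ∀ p ∈ P₀, ¬ p ∣ n), rho a b c h n := by
  have e1 : ∀ q, ∑ n ∈ (Icc 1 N).filter (fun n => q ∣ n ∧ ∀ p ∈ P₀, ¬ p ∣ n), rho a b c h n =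
      ∑ n ∈ (Icc 1 N).filter (fun n => ∀ p ∈ P₀, ¬ p ∣ n), if q ∣ n then rho a b c h n else 0 := by
    intro q
    rw [← Finset.sum_filter, Finset.filter_filter]
    refine Finset.sum_congr (Finset.filter_congr fun n _ => and_comm) fun _ _ => rfl
  simp_rw [e1]
  rw [Finset.sum_comm, ← Finset.sum_sub_distrib, Finset.sum_filter]
  refine Finset.sum_congr rfl fun n _ => ?_
  rw [sieveTerm]
  split_ifs with h1 h2
  · rw [← Finset.sum_filter, Finset.sum_const, nsmul_eq_mul, sub_mul, one_mul]
    rfl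
  · exact absurd (one_dvd n) h2
  · rfl

lemma norm_sum_sieveTerm_le {δ C X₀ : ℝ} (hC : 0 ≤ C) (ha : a ≠ 0)
    (hD : b ^ 2 - 4 * a * c ≠ 0) {h : ℤ} (hh : h ≠ 0) (hK : HasLevel a b c δ C X₀ h.natAbs)
    {N : ℕ} {z₀ z y : ℝ} (hz₀ : 1 ≤ z₀) (hzz : z₀ ≤ z) (hy1 : 1 ≤ y) (hyN : y ≤ N) (hN0 : 0 < N)
    (hN : X₀ ≤ N) (hhN : |(h : ℝ)| ≤ N) {P₀ P₂ : Finset ℕ}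
    (hP₀ : ∀ p ∈ P₀, p.Prime ∧ (p : ℝ) < z₀) (hP₂ : ∀ p ∈ P₂, p.Prime ∧ z ≤ p ∧ (p : ℝ) ≤ y)
    {k : ℕ} (hsize : y * z₀ ^ k * (N : ℝ) ^ (4 * δ) ≤ √N) :
    ‖∑ n ∈ Icc 1 N, sieveTerm a b c h P₀ P₂ n‖ ≤
      N * (2 + Real.log N) * (C * (N : ℝ) ^ (-(δ / 2)) * (Real.exp 1 * z₀) +
        2 * rootConst a b c * (1 + Real.log N) * ((1 / 2 : ℝ) ^ k * (Real.exp 1 * z₀) ^ 4)) := by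
  have hlog := Real.log_natCast_nonneg N
  set L := Real.log N
  have hNr : (0 : ℝ) < N := by exact_mod_cast hN0
  set Cf : ℝ := (rootConst a b c : ℝ) with hCfd
  have hCf : 0 ≤ Cf := Nat.cast_nonneg _
  set x := (N : ℝ) ^ (-(δ / 2)) with hx
  have hx0 : 0 ≤ x := Real.rpow_nonneg hNr.le _
  set B := (1 / 2 : ℝ) ^ k * (Real.exp 1 * z₀) ^ 4 with hB
  have hB0 : 0 ≤ B := by positivity
  set T := C * x * (Real.exp 1 * z₀) + 2 * Cf * (1 + L) * B with hT
  have hT0 : 0 ≤ T := by positivity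
  have hP₀' : ∀ p ∈ P₀, p.Prime ∧ (p : ℝ) ≤ z₀ := fun p hp => ⟨(hP₀ p hp).1, (hP₀ p hp).2.le⟩
  have hNδ : 0 ≤ (N : ℝ) ^ (4 * δ) := Real.rpow_nonneg hNr.le _
  rw [sum_sieveTerm_eq]
  have b1 := norm_sum_sifted_multiples_le hC ha hD hh hK hz₀ hN0 hN hhN hP₀' (q := 1) (k := k)
    squarefree_one (fun p hp => (hP₀ p hp).1.not_dvd_one) (by
      refine le_trans ?_ hsize
      rw [Nat.cast_one]; gcongr)
  have b1' : ‖∑ n ∈ (Icc 1 N).filter (fun n => 1 ∣ n ∧ ∀ p ∈ P₀, ¬ p ∣ n), rho a b c h n‖ ≤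
      N * T := by
    refine b1.trans ?_
    rw [Nat.cast_one, div_one, Nat.divisors_one, card_singleton, Nat.cast_one]
    refine mul_le_mul_of_nonneg_left (add_le_add_right ?_ _) hNr.le
    change Cf * 1 * (1 + L) * B ≤ 2 * Cf * (1 + L) * B
    gcongr ?_ * _ * _
    linarith
  have b2 : ∀ q ∈ P₂, ‖∑ n ∈ (Icc 1 N).filter (fun n => q ∣ n ∧ ∀ p ∈ P₀, ¬ p ∣ n),
      rho a b c h n‖ ≤ N * T * (1 / q) := by
    intro q hq
    obtain ⟨q1, q2, q3⟩ := hP₂ q hq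
    refine (norm_sum_sifted_multiples_le hC ha hD hh hK hz₀ hN0 hN hhN hP₀' (q := q) (k := k)
      q1.squarefree (fun p hp hd => ?_) ?_).trans (le_of_eq ?_)
    · rw [Nat.prime_dvd_prime_iff_eq (hP₀ p hp).1 q1] at hd
      have := (hP₀ p hp).2
      rw [hd] at this
      linarith
    · refine le_trans ?_ hsize
      gcongr
    · rw [card_divisors_prime q1, hT]
      push_cast
      ring
  have s2 : ∑ q ∈ P₂, (1 : ℝ) / q ≤ 1 + L := by
    refine (sum_inv_le_one_add_log hy1 fun p hp => ⟨(hP₂ p hp).1, (hP₂ p hp).2.2⟩).trans ?_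
    exact add_le_add_right (Real.log_le_log (by linarith) hyN) 1
  refine (norm_sub_le _ _).trans ?_
  have b3 := (norm_sum_le _ _).trans (Finset.sum_le_sum b2)
  rw [← Finset.mul_sum] at b3
  calc _ ≤ N * T + N * T * (1 + L) := add_le_add b1' (b3.trans (by gcongr))
    _ = _ := by ring

lemma norm_sum_sieveTerm_numDvd_le {δ C X₀ : ℝ} (hδ : 0 < δ) (hC : 0 ≤ C) (ha : a ≠ 0)
    (hD : b ^ 2 - 4 * a * c ≠ 0) {h : ℤ} (hh : h ≠ 0) (hK : HasLevel a b c δ C X₀ h.natAbs)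
    {N : ℕ} {z₀ z y : ℝ} (hz₀ : 4 ≤ z₀) (hzz : z₀ ≤ z) (hy1 : 1 ≤ y) (hyN : y ≤ N)
    (hN : X₀ ≤ N) (hzN : 4 * z ≤ N) (hhN : |(h : ℝ)| * z ≤ N) (hz4 : (N : ℝ) < z ^ 4)
    {P₀ P₁ P₂ : Finset ℕ} (hP₀ : ∀ p ∈ P₀, p.Prime ∧ (p : ℝ) < z₀)
    (hP₁ : ∀ p ∈ P₁, p.Prime ∧ z₀ ≤ p ∧ (p : ℝ) < z)
    (hP₂ : ∀ p ∈ P₂, p.Prime ∧ z ≤ p ∧ (p : ℝ) ≤ y)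
    {k : ℕ} (hsize₁ : y * z₀ ^ k * (N : ℝ) ^ (4 * δ) ≤ √N)
    (hsize₂ : 4 * z * √z * (2 * z * N) ^ (4 * δ) ≤ √(N / 2)) :
    ‖∑ n ∈ (Icc 1 N).filter (fun n => numDvd P₁ n = 0), sieveTerm a b c h P₀ P₂ n‖ ≤
      N * (2 + Real.log N) * (C * (N : ℝ) ^ (-(δ / 2)) * (Real.exp 1 * z₀) +
        2 * rootConst a b c * (1 + Real.log N) * ((1 / 2 : ℝ) ^ k * (Real.exp 1 * z₀) ^ 4)) +
      2 * √(rootConst a b c * (C + 32 * rootConst a b c + 8 * (rootConst a b c : ℝ) ^ 2)) * 2 *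
        (N * (1 + Real.log N) ^ 2) * √((N : ℝ) ^ (-(δ / 2)) + 1 / z₀) +
      8 * rootConst a b c * (N * (1 + Real.log N) ^ 2) * (1 / z₀) := by
  have hlog := Real.log_natCast_nonneg N
  have hz0 : 0 < z := by linarith
  have hNr : (0 : ℝ) < N := by linarith
  have hN0 : 0 < N := by exact_mod_cast hNr
  have hCf : (0 : ℝ) ≤ rootConst a b c := Nat.cast_nonneg _
  set F := sieveTerm a b c h P₀ P₂ with hF
  have hg3 : ∀ n, 0 < n → n ≤ N → numDvd P₂ n ≤ 3 := fun n hn hnN =>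
    numDvd_le_three (by linarith) (fun p hp => ⟨(hP₂ p hp).1, (hP₂ p hp).2.1⟩) hn hnN hz4
  have hA := norm_sum_sieveTerm_le hC ha hD hh hK (by linarith) hzz hy1 hyN hN0 hN
    (le_trans (le_mul_of_one_le_right (abs_nonneg _) (by linarith)) hhN) hP₀ hP₂ hsize₁
  rw [sum_eq_sum_sub_sum_numDvd N (fun p hp => (hP₁ p hp).1.pos)]
  set α : ℕ → ℂ := fun m => if m ∈ Icc 1 N then
    (if ∀ p ∈ P₀, ¬ p ∣ m then (1 - (numDvd P₂ m : ℂ)) / (1 + numDvd P₁ m : ℕ) else 0) else 0 with hα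
  have hαle : ∀ m, ‖α m‖ ≤ 2 := by
    intro m
    rw [hα]
    dsimp only
    split_ifs with h1 h2
    · rw [mem_Icc] at h1
      rw [norm_div, Complex.norm_natCast]
      have h3 := abs_one_sub_le_two (hg3 m h1.1 h1.2)
      refine (div_le_self (norm_nonneg _) ?_).trans h3
      push_cast
      have : (0 : ℝ) ≤ numDvd P₁ m := Nat.cast_nonneg _
      linarith
    all_goals rw [norm_zero]; norm_num
  have hbil := norm_bilinear_le hδ hC ha hD hh hK hz₀ hzN hN hhN hsize₂ (P := P₁)
    (fun p hp => ⟨(hP₁ p hp).1, (hP₁ p hp).2.1, (hP₁ p hp).2.2.le⟩) hαle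
  have split : ∑ p ∈ P₁, ∑ m ∈ Icc 1 (N / p), F (p * m) / numDvd P₁ (p * m) =
      ∑ p ∈ P₁, ∑ m ∈ (Icc 1 (N / p)).filter (¬ p ∣ ·), α m * rho a b c h (p * m) +
      ∑ p ∈ P₁, ∑ m ∈ (Icc 1 (N / p)).filter (p ∣ ·), F (p * m) / numDvd P₁ (p * m) := by
    rw [← Finset.sum_add_distrib]
    refine Finset.sum_congr rfl fun p hp => ?_
    obtain ⟨q1, q2, q3⟩ := hP₁ p hp
    rw [← Finset.sum_filter_add_sum_filter_not (Icc 1 (N / p)) (p ∣ ·), add_comm]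
    congr 1
    refine Finset.sum_congr rfl fun m hm => ?_
    rw [mem_filter, mem_Icc] at hm
    have hp0 : p ∉ P₀ := fun hmem => by have := (hP₀ p hmem).2; linarith
    have hp2 : p ∉ P₂ := fun hmem => by have := (hP₂ p hmem).2.1; linarith
    have hmN : m ∈ Icc 1 N := mem_Icc.2 ⟨hm.1.1, hm.1.2.trans (Nat.div_le_self _ _)⟩
    have hiff : (∀ q ∈ P₀, ¬ q ∣ p * m) ↔ ∀ q ∈ P₀, ¬ q ∣ m := by
      refine forall₂_congr fun q hq => not_congr ?_
      rw [(hP₀ q hq).1.dvd_mul, Nat.prime_dvd_prime_iff_eq (hP₀ q hq).1 q1]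
      refine ⟨fun h => h.resolve_left ?_, Or.inr⟩
      rintro rfl
      exact hp0 hq
    rw [hF, hα]
    dsimp only
    rw [if_pos hmN, sieveTerm, numDvd_mem_mul (fun q hq => (hP₁ q hq).1) hp hm.2,
      numDvd_prime_mul (fun q hq => (hP₂ q hq).1) q1 hp2]
    by_cases h1 : ∀ q ∈ P₀, ¬ q ∣ m
    · rw [if_pos (hiff.2 h1), if_pos h1]; ring
    · rw [if_neg (fun h => h1 (hiff.1 h)), if_neg h1]; simp
  have herr : ‖∑ p ∈ P₁, ∑ m ∈ (Icc 1 (N / p)).filter (p ∣ ·), F (p * m) / numDvd P₁ (p * m)‖ ≤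
      8 * rootConst a b c * (N * (1 + Real.log N) ^ 2) * (1 / z₀) := by
    have g1 : ∀ p ∈ P₁, ‖∑ m ∈ (Icc 1 (N / p)).filter (p ∣ ·),
        F (p * m) / numDvd P₁ (p * m)‖ ≤
        8 * rootConst a b c * (N * (1 + Real.log N)) * (1 / z₀) * (1 / p) := by
      intro p hp
      obtain ⟨q1, q2, q3⟩ := hP₁ p hp
      have hpr : (0 : ℝ) < p := by exact_mod_cast q1.pos
      have g2 : ∀ m ∈ (Icc 1 (N / p)).filter (p ∣ ·),
          ‖F (p * m) / numDvd P₁ (p * m)‖ ≤ 2 * ‖rho a b c h (p * m)‖ := by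
        intro m hm
        rw [mem_filter, mem_Icc, Nat.le_div_iff_mul_le q1.pos, mul_comm m p] at hm
        have hpm : 0 < p * m := Nat.mul_pos q1.pos hm.1.1
        rw [norm_div, Complex.norm_natCast]
        have h1 : (1 : ℝ) ≤ numDvd P₁ (p * m) := by
          exact_mod_cast numDvd_pos_of_dvd hp (dvd_mul_right p m)
        exact (div_le_self (norm_nonneg _) h1).trans (norm_sieveTerm_le (hg3 _ hpm hm.1.2))
      refine (norm_sum_le _ _).trans ((Finset.sum_le_sum g2).trans ?_)
      rw [← Finset.mul_sum]
      have g3 : ∀ m ∈ (Icc 1 (N / p)).filter (p ∣ ·), ‖rho a b c h (p * m)‖ ≤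
          rootConst a b c * ((p * m).divisors.card : ℝ) := by
        intro m hm
        rw [mem_filter, mem_Icc] at hm
        exact norm_rho_le ha hD h (Nat.mul_pos q1.pos hm.1.1)
      have g4 : ∑ m ∈ (Icc 1 (N / p)).filter (p ∣ ·), ((p * m).divisors.card : ℝ) ≤
          4 * (N / p / p * (1 + Real.log N)) := by
        rw [sum_multiples _ p q1.pos (fun m => ((p * m).divisors.card : ℝ))]
        simp_rw [← mul_assoc]
        rw [Nat.div_div_eq_div_mul]
        refine (sum_card_divisors_mul_div_le (p * p) (p * p) N (Nat.mul_pos q1.pos q1.pos)).trans ?_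
        have h4 : ((p * p).divisors.card : ℝ) ≤ 4 := by
          have := card_divisors_mul_le p p
          rw [card_divisors_prime q1] at this
          exact_mod_cast this
        rw [Nat.cast_mul, ← div_div, mul_assoc (4 : ℝ)]
        exact mul_le_mul_of_nonneg_right h4 (by positivity)
      have g5 : ∑ m ∈ (Icc 1 (N / p)).filter (p ∣ ·), ‖rho a b c h (p * m)‖ ≤
          rootConst a b c * (4 * (N / p / p * (1 + Real.log N))) := by
        refine (Finset.sum_le_sum g3).trans ?_
        rw [← Finset.mul_sum]
        exact mul_le_mul_of_nonneg_left g4 hCf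
      calc _ ≤ 2 * (rootConst a b c * (4 * (N / p / p * (1 + Real.log N)))) := by gcongr
        _ = 8 * rootConst a b c * (N * (1 + Real.log N)) * (1 / p) * (1 / p) := by ring
        _ ≤ _ := by
          have : 1 / (p : ℝ) ≤ 1 / z₀ := one_div_le_one_div_of_le (by linarith) q2
          gcongr
    refine (norm_sum_le _ _).trans ((Finset.sum_le_sum g1).trans ?_)
    rw [← Finset.mul_sum]
    have s1 : ∑ p ∈ P₁, (1 : ℝ) / p ≤ 1 + Real.log N :=
      sum_inv_le_one_add_log (by linarith) fun p hp => ⟨(hP₁ p hp).1, by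
        have := (hP₁ p hp).2.2; linarith⟩
    have hz0' : 0 ≤ 1 / z₀ := by positivity
    calc _ ≤ 8 * rootConst a b c * (N * (1 + Real.log N)) * (1 / z₀) * (1 + Real.log N) := by
          gcongr
      _ = _ := by ring
  rw [split, ← sub_sub]
  exact (norm_sub_le _ _).trans (add_le_add ((norm_sub_le _ _).trans (add_le_add hA hbil)) herr)

end SieveIdentity

end QuadRoots

namespace QuadRoots

section PrimeSums
open Finset

lemma primeCounting_floor_le {x : ℝ} (hx : 1 < x) :
    (Nat.primeCounting ⌊x⌋₊ : ℝ) ≤ 4 * x / Real.log x := by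
  have hx0 : 0 < x := by linarith
  have hl : 0 < Real.log x := Real.log_pos hx
  have h1 := Chebyshev.pi_le_log4_mul_div hx
  rw [Real.log_sqrt hx0.le] at h1
  have hs : 0 < √x := Real.sqrt_pos.2 hx0
  have h2 : Real.log x ≤ √x := by
    have h3 : Real.log √x ≤ √x / Real.exp 1 := by
      have := Real.add_one_le_exp (Real.log √x - 1)
      rw [Real.exp_sub, Real.exp_log hs] at this
      linarith
    rw [Real.log_sqrt hx0.le] at h3
    have h4 : √x / Real.exp 1 ≤ √x / 2 :=
      div_le_div_of_nonneg_left hs.le two_pos (by have := Real.exp_one_gt_d9; linarith)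
    linarith
  have h5 : √x ≤ x / Real.log x := by
    rw [le_div_iff₀ hl]
    calc √x * Real.log x ≤ √x * √x := by gcongr
      _ = x := Real.mul_self_sqrt hx0.le
  have h6 : Real.log 4 ≤ 3 / 2 := by
    have : (4 : ℝ) = 2 ^ 2 := by norm_num
    rw [this, Real.log_pow]
    have := Real.log_two_lt_d9
    push_cast
    linarith
  have h7 : Real.log 4 * x / (Real.log x / 2) ≤ 3 * (x / Real.log x) := by
    have : Real.log 4 * x / (Real.log x / 2) = 2 * Real.log 4 * (x / Real.log x) := by
      field_simp
    rw [this]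
    have : 0 ≤ x / Real.log x := by positivity
    gcongr
    linarith
  rw [mul_div_assoc]
  linarith

lemma sum_inv_primes_le {A B : ℝ} (hA : 1 < A) (hAB : A ≤ B) {P : Finset ℕ}
    (hP : ∀ p ∈ P, p.Prime ∧ A ≤ p ∧ (p : ℝ) ≤ B) :
    ∑ p ∈ P, (1 : ℝ) / p ≤ 16 * (Real.log (B / A) + 1) / Real.log A := by
  have hA0 : 0 < A := by linarith
  have hB0 : 0 < B := by linarith
  have hlA : 0 < Real.log A := Real.log_pos hA
  have hl2 := Real.log_two_gt_d9
  set i₀ := Nat.log 2 ⌊A⌋₊ with hi₀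
  set i₁ := Nat.log 2 ⌊B⌋₊ with hi₁
  have hfB : ⌊B⌋₊ ≠ 0 := (Nat.floor_pos.2 (by linarith)).ne'
  have hi₀A : Real.log A ≤ (i₀ + 1) * Real.log 2 := by
    have : ⌊A⌋₊ < 2 ^ (i₀ + 1) := Nat.lt_pow_succ_log_self (by norm_num) _
    have h2 : A < ((2 ^ (i₀ + 1) : ℕ) : ℝ) := (Nat.floor_lt hA0.le).1 this
    have h3 := Real.log_le_log hA0 h2.le
    push_cast at h3
    rw [Real.log_pow] at h3
    push_cast at h3
    exact h3
  have hi₁B : i₁ * Real.log 2 ≤ Real.log B := by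
    have : 2 ^ i₁ ≤ ⌊B⌋₊ := Nat.pow_log_le_self 2 hfB
    have h2 : ((2 ^ i₁ : ℕ) : ℝ) ≤ B := (Nat.le_floor_iff hB0.le).1 this
    push_cast at h2
    rw [← Real.log_pow]
    exact Real.log_le_log (by positivity) h2
  have hmaps : ∀ p ∈ P, Nat.log 2 p ∈ Icc i₀ i₁ := by
    intro p hp
    obtain ⟨q1, q2, q3⟩ := hP p hp
    rw [mem_Icc]
    exact ⟨Nat.log_mono_right (Nat.floor_le_of_le q2), Nat.log_mono_right (Nat.le_floor q3)⟩
  have key : ∀ j ∈ Icc i₀ i₁, ∑ p ∈ P.filter (Nat.log 2 · = j), (1 : ℝ) / p ≤ 8 / Real.log A := by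
    intro j hj
    rw [mem_Icc] at hj
    have h1 : ∀ p ∈ P.filter (Nat.log 2 · = j), (1 : ℝ) / p ≤ 1 / 2 ^ j := by
      intro p hp
      rw [mem_filter] at hp
      have hp0 := (hP p hp.1).1.pos
      have : 2 ^ j ≤ p := by rw [← hp.2]; exact Nat.pow_log_le_self 2 hp0.ne'
      have : (2 : ℝ) ^ j ≤ p := by exact_mod_cast this
      exact one_div_le_one_div_of_le (by positivity) this
    refine (Finset.sum_le_card_nsmul _ _ _ h1).trans ?_
    rw [nsmul_eq_mul]
    have h2 : (P.filter (Nat.log 2 · = j)).card ≤ Nat.primeCounting (2 ^ (j + 1)) := by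
      rw [Nat.primeCounting, Nat.primeCounting', Nat.count_eq_card_filter_range]
      refine Finset.card_le_card fun p hp => ?_
      rw [mem_filter] at hp
      rw [mem_filter, mem_range]
      refine ⟨?_, (hP p hp.1).1⟩
      have := Nat.lt_pow_succ_log_self (b := 2) (by norm_num) p
      rw [hp.2] at this
      exact this.trans (Nat.lt_succ_self _)
    have h3 := primeCounting_floor_le (x := ((2 ^ (j + 1) : ℕ) : ℝ)) (by
      exact_mod_cast Nat.one_lt_two_pow (Nat.succ_ne_zero j))
    rw [Nat.floor_natCast] at h3
    have h4 : ((P.filter (Nat.log 2 · = j)).card : ℝ) ≤ 8 * 2 ^ j / Real.log A := by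
      refine (Nat.cast_le.2 h2).trans (h3.trans ?_)
      push_cast
      rw [Real.log_pow]
      have : Real.log A ≤ ((j + 1 : ℕ) : ℝ) * Real.log 2 := by
        refine hi₀A.trans ?_
        push_cast
        have : (i₀ : ℝ) ≤ j := by exact_mod_cast hj.1
        gcongr
      calc 4 * 2 ^ (j + 1) / (((j + 1 : ℕ) : ℝ) * Real.log 2) ≤ 4 * 2 ^ (j + 1) / Real.log A := by
            gcongr
        _ = _ := by rw [pow_succ]; ring
    calc _ ≤ 8 * 2 ^ j / Real.log A * (1 / 2 ^ j) := by gcongr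
      _ = _ := by field_simp
  rw [← Finset.sum_fiberwise_of_maps_to hmaps]
  refine (Finset.sum_le_card_nsmul _ _ _ key).trans ?_
  rw [nsmul_eq_mul, Nat.card_Icc]
  have hcount : ((i₁ + 1 - i₀ : ℕ) : ℝ) ≤ 2 * (Real.log (B / A) + 1) := by
    rw [Real.log_div hB0.ne' hA0.ne']
    have hBA : Real.log A ≤ Real.log B := Real.log_le_log hA0 hAB
    rcases le_total i₀ (i₁ + 1) with hle | hle
    · rw [Nat.cast_sub hle]
      push_cast
      have h8 : ((i₁ : ℝ) - i₀ - 1) * Real.log 2 ≤ Real.log B - Real.log A := by nlinarith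
      by_cases hneg : (i₁ : ℝ) - i₀ - 1 ≤ 0
      · linarith
      · push Not at hneg
        nlinarith
    · rw [Nat.sub_eq_zero_of_le hle]
      push_cast
      linarith
  calc _ ≤ 2 * (Real.log (B / A) + 1) * (8 / Real.log A) := by gcongr
    _ = _ := by ring

end PrimeSums

end QuadRoots

namespace QuadRoots

section AlmostPrimes
open Finset

/-- The primes `p ≤ N` in the real interval `[A, B]`. -/
noncomputable def primesIn (N : ℕ) (A B : ℝ) : Finset ℕ :=
  (range (N + 1)).filter fun p => p.Prime ∧ A ≤ p ∧ (p : ℝ) ≤ B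

lemma mem_primesIn {N p : ℕ} {A B : ℝ} :
    p ∈ primesIn N A B ↔ p ≤ N ∧ p.Prime ∧ A ≤ p ∧ (p : ℝ) ≤ B := by
  rw [primesIn, mem_filter, mem_range, Nat.lt_succ_iff]

lemma almostPrime_classification {N n : ℕ} {z y : ℝ} (hz : 1 < z) (hzy : z ≤ y)
    (hz4 : (N : ℝ) < z ^ 4) (hy3 : (N : ℝ) < y ^ 3) (hn : 0 < n) (hnN : n ≤ N)
    (hnz : ∀ p, p.Prime → p ∣ n → z ≤ p) (hnp : ¬ n.Prime)
    (hg : numDvd (primesIn N z y) n ≠ 1) :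
    (n : ℝ) ≤ y ^ 2 ∨
      (∃ p ∈ primesIn N y √N, ∃ q, q.Prime ∧ n = p * q) ∨
      ∃ p₁ ∈ primesIn N z (N / z ^ 2), ∃ p₂ ∈ primesIn N z (N / z ^ 2),
        ∃ q, q.Prime ∧ n = p₁ * p₂ * q := by
  have hz0 : 0 < z := by linarith
  have hy0 : 0 < y := by linarith
  have hnNr : (n : ℝ) ≤ N := by exact_mod_cast hnN
  rcases eq_or_ne n 1 with rfl | hn1
  · left
    rw [Nat.cast_one]
    nlinarith
  rcases Nat.eq_zero_or_pos (numDvd (primesIn N z y) n) with h0 | hpos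
  · right; left
    have hno : ∀ p, p.Prime → p ∣ n → y < p := by
      intro p hp hpn
      by_contra! hle
      have := numDvd_pos_of_dvd (mem_primesIn.2
        ⟨(Nat.le_of_dvd hn hpn).trans hnN, hp, hnz p hp hpn, hle⟩) hpn
      omega
    set p := n.minFac with hpdef
    have hp : p.Prime := Nat.minFac_prime hn1
    have hpn : p ∣ n := Nat.minFac_dvd n
    have hpsq : p ^ 2 ≤ n := Nat.minFac_sq_le_self hn hnp
    have hyp := hno p hp hpn
    obtain ⟨q, hq⟩ := hpn
    refine ⟨p, mem_primesIn.2 ⟨(Nat.minFac_le hn).trans hnN, hp, hyp.le, ?_⟩, q, ?_, hq⟩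
    · refine Real.le_sqrt_of_sq_le (le_trans ?_ hnNr)
      exact_mod_cast hpsq
    · by_contra hqp
      have hq1 : q ≠ 1 := by
        rintro rfl
        rw [mul_one] at hq
        exact hnp (hq ▸ hp)
      have hq0 : 0 < q := Nat.pos_of_ne_zero (by rintro rfl; omega)
      have hr := Nat.minFac_prime hq1
      have hrq := Nat.minFac_sq_le_self hq0 hqp
      have hyr := hno _ hr ((Nat.minFac_dvd q).trans (hq ▸ dvd_mul_left q p))
      have hrq' : ((q.minFac : ℝ)) ^ 2 ≤ q := by exact_mod_cast hrq
      have e : (n : ℝ) = p * q := by exact_mod_cast hq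
      have h2 : y ^ 2 ≤ q := (pow_le_pow_left₀ hy0.le hyr.le 2).trans hrq'
      have : y ^ 3 ≤ n := by
        rw [e]
        calc y ^ 3 = y * y ^ 2 := by ring
          _ ≤ (p : ℝ) * q := mul_le_mul hyp.le h2 (by positivity) (by positivity)
      linarith
  · have h2 : 1 < numDvd (primesIn N z y) n := by omega
    obtain ⟨p₁, hp₁, p₂, hp₂, hne⟩ := Finset.one_lt_card.1 h2
    rw [mem_filter, mem_primesIn] at hp₁ hp₂
    obtain ⟨⟨hp₁N, hp₁', hz₁, hy₁⟩, hd₁⟩ := hp₁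
    obtain ⟨⟨hp₂N, hp₂', hz₂, hy₂⟩, hd₂⟩ := hp₂
    obtain ⟨q, hq⟩ := ((Nat.coprime_primes hp₁' hp₂').2 hne).mul_dvd_of_dvd_of_dvd hd₁ hd₂
    have e : (n : ℝ) = p₁ * p₂ * q := by exact_mod_cast hq
    have hq0 : 0 < q := Nat.pos_of_ne_zero (by rintro rfl; omega)
    rcases eq_or_ne q 1 with rfl | hq1
    · left
      rw [e, Nat.cast_one, mul_one, sq]
      gcongr
    right; right
    have hqd : q ∣ n := hq ▸ dvd_mul_left q _
    have hzz : z ^ 2 ≤ p₁ * p₂ := by rw [sq]; gcongr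
    have hqprime : q.Prime := by
      by_contra hqp
      have hr := Nat.minFac_prime hq1
      have hrq := Nat.minFac_sq_le_self hq0 hqp
      have hzr := hnz _ hr ((Nat.minFac_dvd q).trans hqd)
      have hrq' : ((q.minFac : ℝ)) ^ 2 ≤ q := by exact_mod_cast hrq
      have h3 : z ^ 2 ≤ q := (pow_le_pow_left₀ hz0.le hzr 2).trans hrq'
      have : z ^ 4 ≤ n := by
        rw [e]
        calc z ^ 4 = z ^ 2 * z ^ 2 := by ring
          _ ≤ (p₁ : ℝ) * p₂ * q := mul_le_mul hzz h3 (by positivity) (by positivity)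
      linarith
    have hzq := hnz q hqprime hqd
    refine ⟨p₁, mem_primesIn.2 ⟨hp₁N, hp₁', hz₁, ?_⟩, p₂, mem_primesIn.2 ⟨hp₂N, hp₂', hz₂, ?_⟩,
      q, hqprime, hq⟩
    · rw [le_div_iff₀ (by positivity)]
      refine le_trans ?_ hnNr
      rw [e, mul_assoc, sq]
      gcongr
    · rw [le_div_iff₀ (by positivity)]
      refine le_trans ?_ hnNr
      rw [e, mul_comm (p₁ : ℝ), mul_assoc, sq]
      gcongr

open Classical in
/-- The composite `n ≤ N` without prime factors below `z` for which the number of prime factors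
in `[z, y]` differs from one. -/
noncomputable def badSet (N : ℕ) (z y : ℝ) : Finset ℕ :=
  (Icc 1 N).filter fun n => (∀ p, p.Prime → p ∣ n → z ≤ p) ∧ ¬ n.Prime ∧
    numDvd (primesIn N z y) n ≠ 1

lemma card_image_primes_le (d M : ℕ) :
    (((range (M + 1)).filter Nat.Prime).image (d * ·)).card ≤ Nat.primeCounting M := by
  refine Finset.card_image_le.trans ?_
  rw [Nat.primeCounting, Nat.primeCounting', Nat.count_eq_card_filter_range]

lemma card_badSet_le {N : ℕ} {z y : ℝ} (hz : 1 < z) (hzy : z ≤ y)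
    (hz4 : (N : ℝ) < z ^ 4) (hy3 : (N : ℝ) < y ^ 3) :
    ((badSet N z y).card : ℝ) ≤ y ^ 2 + ∑ p ∈ primesIn N y √N, (Nat.primeCounting (N / p) : ℝ) +
      ∑ p₁ ∈ primesIn N z (N / z ^ 2), ∑ p₂ ∈ primesIn N z (N / z ^ 2),
        (Nat.primeCounting (N / (p₁ * p₂)) : ℝ) := by
  classical
  have hsub : badSet N z y ⊆ (Icc 1 ⌊y ^ 2⌋₊ ∪ (primesIn N y √N).biUnion
      (fun p => ((range (N / p + 1)).filter Nat.Prime).image (p * ·))) ∪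
      (primesIn N z (N / z ^ 2)).biUnion fun p₁ => (primesIn N z (N / z ^ 2)).biUnion fun p₂ =>
        ((range (N / (p₁ * p₂) + 1)).filter Nat.Prime).image (p₁ * p₂ * ·) := by
    intro n hn
    rw [badSet, mem_filter, mem_Icc] at hn
    obtain ⟨⟨hn1, hnN⟩, h1, h2, h3⟩ := hn
    simp only [mem_union, mem_biUnion, mem_image, mem_filter, mem_range, Nat.lt_succ_iff, mem_Icc]
    rcases almostPrime_classification hz hzy hz4 hy3 hn1 hnN h1 h2 h3 with
      h | ⟨p, hp, q, hq, rfl⟩ | ⟨p₁, hp₁, p₂, hp₂, q, hq, rfl⟩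
    · exact Or.inl (Or.inl ⟨hn1, Nat.le_floor h⟩)
    · refine Or.inl (Or.inr ⟨p, hp, q, ⟨?_, hq⟩, rfl⟩)
      rw [Nat.le_div_iff_mul_le (mem_primesIn.1 hp).2.1.pos, mul_comm]
      exact hnN
    · refine Or.inr ⟨p₁, hp₁, p₂, hp₂, q, ⟨?_, hq⟩, rfl⟩
      rw [Nat.le_div_iff_mul_le (Nat.mul_pos (mem_primesIn.1 hp₁).2.1.pos
        (mem_primesIn.1 hp₂).2.1.pos), mul_comm]
      exact hnN
  have h1 := (Finset.card_le_card hsub).trans ((card_union_le _ _).trans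
    (add_le_add (card_union_le _ _) le_rfl))
  have h2 : (Icc 1 ⌊y ^ 2⌋₊).card ≤ ⌊y ^ 2⌋₊ := by rw [Nat.card_Icc]; omega
  have h3 : (((primesIn N y √N).biUnion
      (fun p => ((range (N / p + 1)).filter Nat.Prime).image (p * ·))).card) ≤
      ∑ p ∈ primesIn N y √N, Nat.primeCounting (N / p) :=
    Finset.card_biUnion_le.trans (Finset.sum_le_sum fun p _ => card_image_primes_le p _)
  have h4 : (((primesIn N z (N / z ^ 2)).biUnion fun p₁ => (primesIn N z (N / z ^ 2)).biUnion
      fun p₂ => ((range (N / (p₁ * p₂) + 1)).filter Nat.Prime).image (p₁ * p₂ * ·)).card) ≤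
      ∑ p₁ ∈ primesIn N z (N / z ^ 2), ∑ p₂ ∈ primesIn N z (N / z ^ 2),
        Nat.primeCounting (N / (p₁ * p₂)) :=
    Finset.card_biUnion_le.trans (Finset.sum_le_sum fun p₁ _ =>
      Finset.card_biUnion_le.trans (Finset.sum_le_sum fun p₂ _ => card_image_primes_le _ _))
  have h5 := h1.trans (add_le_add (add_le_add h2 h3) h4)
  have h6 : (⌊y ^ 2⌋₊ : ℝ) ≤ y ^ 2 := Nat.floor_le (by positivity)
  have h7 : ((badSet N z y).card : ℝ) ≤ ((⌊y ^ 2⌋₊ + ∑ p ∈ primesIn N y √N,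
      Nat.primeCounting (N / p) + ∑ p₁ ∈ primesIn N z (N / z ^ 2),
        ∑ p₂ ∈ primesIn N z (N / z ^ 2), Nat.primeCounting (N / (p₁ * p₂)) : ℕ) : ℝ) := by
    exact_mod_cast h5
  push_cast at h7
  linarith

lemma primeCounting_div_le {N d : ℕ} (hN : 1 < N) {κ : ℝ} (hκ : 0 < κ)
    (hd : (N : ℝ) ^ (1 / κ) ≤ (N : ℝ) / d) :
    (Nat.primeCounting (N / d) : ℝ) ≤ 4 * κ * (N / Real.log N) * (1 / d) := by
  have hN1 : (1 : ℝ) < N := by exact_mod_cast hN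
  have hl : 0 < Real.log N := Real.log_pos hN1
  have h1 : (1 : ℝ) < (N : ℝ) / d := lt_of_lt_of_le (Real.one_lt_rpow hN1 (by positivity)) hd
  have h2 := primeCounting_floor_le h1
  rw [Nat.floor_div_natCast, Nat.floor_natCast] at h2
  refine h2.trans ?_
  have h3 : Real.log N / κ ≤ Real.log ((N : ℝ) / d) := by
    have := Real.log_le_log (by positivity) hd
    rw [Real.log_rpow (by linarith)] at this
    rw [div_eq_mul_one_div, mul_comm]
    exact this
  calc 4 * ((N : ℝ) / d) / Real.log ((N : ℝ) / d) ≤ 4 * ((N : ℝ) / d) / (Real.log N / κ) := by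
        gcongr
    _ = _ := by field_simp

lemma card_badSet_le_sum_inv {N : ℕ} {z y : ℝ} (hN : 1 < N) (hz : 1 < z) (hzy : z ≤ y)
    (hz4 : (N : ℝ) < z ^ 4) (hy3 : (N : ℝ) < y ^ 3)
    (hz6 : (N : ℝ) ^ (1 / 6 : ℝ) * N ≤ z ^ 4) :
    ((badSet N z y).card : ℝ) ≤ y ^ 2 +
      8 * (N / Real.log N) * (∑ p ∈ primesIn N y √N, (1 : ℝ) / p) +
      24 * (N / Real.log N) * (∑ p ∈ primesIn N z (N / z ^ 2), (1 : ℝ) / p) ^ 2 := by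
  have hN1 : (1 : ℝ) < N := by exact_mod_cast hN
  have hN0 : (0 : ℝ) < N := by linarith
  have hz0 : 0 < z := by linarith
  refine (card_badSet_le hz hzy hz4 hy3).trans (add_le_add (add_le_add le_rfl ?_) ?_)
  · rw [Finset.mul_sum]
    refine Finset.sum_le_sum fun p hp => ?_
    obtain ⟨_, hp, _, hps⟩ := mem_primesIn.1 hp
    have hp0 : (0 : ℝ) < p := by exact_mod_cast hp.pos
    refine (primeCounting_div_le (κ := 2) hN two_pos ?_).trans (le_of_eq (by ring))
    rw [← Real.sqrt_eq_rpow, le_div_iff₀ hp0]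
    calc √(N : ℝ) * p ≤ √(N : ℝ) * √(N : ℝ) := by gcongr
      _ = N := Real.mul_self_sqrt hN0.le
  · rw [sq (∑ p ∈ primesIn N z (N / z ^ 2), (1 : ℝ) / p), Finset.sum_mul_sum, Finset.mul_sum]
    refine Finset.sum_le_sum fun p₁ hp₁ => ?_
    rw [Finset.mul_sum]
    refine Finset.sum_le_sum fun p₂ hp₂ => ?_
    obtain ⟨_, hp₁, _, hw₁⟩ := mem_primesIn.1 hp₁
    obtain ⟨_, hp₂, _, hw₂⟩ := mem_primesIn.1 hp₂
    have h1 : (0 : ℝ) < p₁ := by exact_mod_cast hp₁.pos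
    have h2 : (0 : ℝ) < p₂ := by exact_mod_cast hp₂.pos
    refine (primeCounting_div_le (κ := 6) hN (by norm_num) ?_).trans (le_of_eq ?_)
    · push_cast
      rw [le_div_iff₀ (by positivity)]
      calc (N : ℝ) ^ (1 / 6 : ℝ) * ((p₁ : ℝ) * p₂)
          ≤ (N : ℝ) ^ (1 / 6 : ℝ) * ((N / z ^ 2) * (N / z ^ 2)) := by gcongr
        _ = ((N : ℝ) ^ (1 / 6 : ℝ) * N) * N / z ^ 4 := by field_simp
        _ ≤ z ^ 4 * N / z ^ 4 := by gcongr
        _ = N := by field_simp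
    · push_cast
      field_simp
      ring

end AlmostPrimes

end QuadRoots

namespace QuadRoots

section Combine
open Finset

variable {a b c : ℤ}

lemma card_badSet_rpow_le {N : ℕ} {ε : ℝ} (hN : 1 < N) (hε : 0 < ε) (hε1 : ε ≤ 1 / 100)
    (hεL : 1 ≤ ε * Real.log N) :
    ((badSet N ((N : ℝ) ^ (1 / 3 - ε)) ((N : ℝ) ^ (1 / 2 - ε))).card : ℝ) ≤
      (N : ℝ) ^ (1 - 2 * ε) + 13000 * ε * (N / Real.log N) := by
  have hN1 : (1 : ℝ) < N := by exact_mod_cast hN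
  have hN0 : (0 : ℝ) < N := by linarith
  set L := Real.log N with hL
  have hL0 : 0 < L := Real.log_pos hN1
  set z := (N : ℝ) ^ (1 / 3 - ε) with hz
  set y := (N : ℝ) ^ (1 / 2 - ε) with hy
  have hz1 : 1 < z := Real.one_lt_rpow hN1 (by linarith)
  have hy1 : 1 < y := Real.one_lt_rpow hN1 (by linarith)
  have hzpow : ∀ k : ℕ, z ^ k = (N : ℝ) ^ ((1 / 3 - ε) * k) := fun k => by
    rw [hz, ← Real.rpow_natCast, ← Real.rpow_mul hN0.le]
  have hypow : ∀ k : ℕ, y ^ k = (N : ℝ) ^ ((1 / 2 - ε) * k) := fun k => by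
    rw [hy, ← Real.rpow_natCast, ← Real.rpow_mul hN0.le]
  have hlt : ∀ s : ℝ, 1 < s → (N : ℝ) < (N : ℝ) ^ s := fun s hs => by
    conv_lhs => rw [← Real.rpow_one (N : ℝ)]
    exact Real.rpow_lt_rpow_of_exponent_lt hN1 hs
  have hmain := card_badSet_le_sum_inv (N := N) (z := z) (y := y) hN hz1
    (Real.rpow_le_rpow_of_exponent_le hN1.le (by linarith))
    (by rw [hzpow]; exact hlt _ (by push_cast; linarith))
    (by rw [hypow]; exact hlt _ (by push_cast; linarith))
    (by
      rw [hzpow]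
      conv_lhs => rw [← Real.rpow_one (N : ℝ), ← Real.rpow_mul hN0.le, ← Real.rpow_add hN0]
      exact Real.rpow_le_rpow_of_exponent_le hN1.le (by push_cast; linarith))
  have hlz : Real.log z = (1 / 3 - ε) * L := Real.log_rpow hN0 _
  have hly : Real.log y = (1 / 2 - ε) * L := Real.log_rpow hN0 _
  have hs : √(N : ℝ) = (N : ℝ) ^ (1 / 2 : ℝ) := Real.sqrt_eq_rpow _
  have e1 : √(N : ℝ) / y = (N : ℝ) ^ ε := by
    rw [hs, hy, ← Real.rpow_sub hN0]; congr 1; ring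
  have e2 : (N : ℝ) / z ^ 2 / z = (N : ℝ) ^ (3 * ε) := by
    rw [div_div, ← pow_succ, hzpow]
    conv_lhs => rw [← Real.rpow_one (N : ℝ), ← Real.rpow_mul hN0.le, ← Real.rpow_sub hN0]
    congr 1
    push_cast
    ring
  have b1 : ∑ p ∈ primesIn N y √N, (1 : ℝ) / p ≤ 70 * ε := by
    refine (sum_inv_primes_le hy1 ?_ fun p hp => (mem_primesIn.1 hp).2).trans ?_
    · rw [hs]; exact Real.rpow_le_rpow_of_exponent_le hN1.le (by linarith)
    · rw [e1, Real.log_rpow hN0, hly, div_le_iff₀ (by nlinarith)]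
      nlinarith [mul_pos hε hL0]
  have b2 : ∑ p ∈ primesIn N z (N / z ^ 2), (1 : ℝ) / p ≤ 220 * ε := by
    refine (sum_inv_primes_le hz1 ?_ fun p hp => (mem_primesIn.1 hp).2).trans ?_
    · have : (1 : ℝ) ≤ (N : ℝ) / z ^ 2 / z := by
        rw [e2]; exact Real.one_le_rpow hN1.le (by linarith)
      rwa [le_div_iff₀ (by linarith), one_mul] at this
    · rw [e2, Real.log_rpow hN0, hlz, div_le_iff₀ (by nlinarith)]
      nlinarith [mul_pos hε hL0]
  have b2' : (∑ p ∈ primesIn N z (N / z ^ 2), (1 : ℝ) / p) ^ 2 ≤ 484 * ε := by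
    have h0 : 0 ≤ ∑ p ∈ primesIn N z (N / z ^ 2), (1 : ℝ) / p :=
      Finset.sum_nonneg fun p _ => by positivity
    calc _ ≤ (220 * ε) ^ 2 := pow_le_pow_left₀ h0 b2 2
      _ ≤ _ := by nlinarith
  have hNL : 0 < (N : ℝ) / L := by positivity
  refine hmain.trans ?_
  have e3 : y ^ 2 = (N : ℝ) ^ (1 - 2 * ε) := by
    rw [hypow]; congr 1; push_cast; ring
  rw [e3]
  have c1 : 8 * ((N : ℝ) / L) * (∑ p ∈ primesIn N y √N, (1 : ℝ) / p) ≤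
      8 * ((N : ℝ) / L) * (70 * ε) := by gcongr
  have c2 : 24 * ((N : ℝ) / L) * (∑ p ∈ primesIn N z (N / z ^ 2), (1 : ℝ) / p) ^ 2 ≤
      24 * ((N : ℝ) / L) * (484 * ε) := by gcongr
  rw [← hL]
  nlinarith [mul_pos hNL hε]

lemma exists_card_divisors_le_two_pow {z : ℝ} (hz : 0 ≤ z) (n : ℕ) :
    0 < n → (∀ p, p.Prime → p ∣ n → z ≤ p) → ∃ k : ℕ, z ^ k ≤ n ∧ n.divisors.card ≤ 2 ^ k := by
  induction n using Nat.recOnMul with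
  | zero => intro h; omega
  | one => exact fun _ _ => ⟨0, by simp, by simp⟩
  | prime p hp =>
    exact fun _ h => ⟨1, by simpa using h p hp dvd_rfl, by rw [card_divisors_prime hp, pow_one]⟩
  | mul m n hm hn =>
    intro h0 h
    obtain ⟨k, hk, hk'⟩ := hm (Nat.pos_of_mul_pos_right h0)
      fun p hp hd => h p hp (hd.mul_right n)
    obtain ⟨l, hl, hl'⟩ := hn (Nat.pos_of_mul_pos_left h0)
      fun p hp hd => h p hp (hd.mul_left m)
    refine ⟨k + l, ?_, ?_⟩
    · rw [pow_add, Nat.cast_mul]; gcongr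
    · rw [pow_add]
      exact (card_divisors_mul_le m n).trans (Nat.mul_le_mul hk' hl')

lemma card_divisors_le_eight {z : ℝ} (hz : 1 ≤ z) {n N : ℕ} (hn : 0 < n) (hnN : n ≤ N)
    (hz4 : (N : ℝ) < z ^ 4) (h : ∀ p, p.Prime → p ∣ n → z ≤ p) : n.divisors.card ≤ 8 := by
  obtain ⟨k, hk, hk'⟩ := exists_card_divisors_le_two_pow (by linarith) n hn h
  have hk3 : k ≤ 3 := by
    by_contra! hlt
    have h1 : z ^ 4 ≤ z ^ k := pow_le_pow_right₀ hz hlt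
    have h2 : (n : ℝ) ≤ N := by exact_mod_cast hnN
    linarith
  exact hk'.trans (Nat.pow_le_pow_right two_pos hk3)

/-- The primes `p ≤ N` in the half-open real interval `[A, B)`. -/
noncomputable def primesIco (N : ℕ) (A B : ℝ) : Finset ℕ :=
  (range (N + 1)).filter fun p => p.Prime ∧ A ≤ p ∧ (p : ℝ) < B

lemma mem_primesIco {N p : ℕ} {A B : ℝ} :
    p ∈ primesIco N A B ↔ p ≤ N ∧ p.Prime ∧ A ≤ p ∧ (p : ℝ) < B := by
  rw [primesIco, mem_filter, mem_range, Nat.lt_succ_iff]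

lemma forall_prime_dvd_iff {N n : ℕ} {z₀ z : ℝ} (hzz : z₀ ≤ z) (hn : 0 < n) (hnN : n ≤ N) :
    (numDvd (primesIco N z₀ z) n = 0 ∧ ∀ p ∈ primesIco N 0 z₀, ¬ p ∣ n) ↔
      ∀ p, p.Prime → p ∣ n → z ≤ p := by
  constructor
  · rintro ⟨h1, h2⟩ p hp hd
    by_contra! hlt
    have hpN := (Nat.le_of_dvd hn hd).trans hnN
    rcases lt_or_ge (p : ℝ) z₀ with h | h
    · exact h2 p (mem_primesIco.2 ⟨hpN, hp, Nat.cast_nonneg _, h⟩) hd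
    · have := numDvd_pos_of_dvd (mem_primesIco.2 ⟨hpN, hp, h, hlt⟩) hd
      omega
  · intro h
    constructor
    · rw [numDvd, Finset.card_eq_zero, Finset.filter_eq_empty_iff]
      intro p hp hd
      obtain ⟨_, hp, _, hlt⟩ := mem_primesIco.1 hp
      exact absurd (h p hp hd) (not_le.2 hlt)
    · intro p hp hd
      obtain ⟨_, hp, _, hlt⟩ := mem_primesIco.1 hp
      exact absurd (h p hp hd) (not_le.2 (hlt.trans_le hzz))

lemma numDvd_prime_eq {P : Finset ℕ} {p : ℕ} (hp : p.Prime) (hP : ∀ q ∈ P, q.Prime) :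
    numDvd P p = if p ∈ P then 1 else 0 := by
  rw [numDvd, Finset.filter_congr fun q hq => Nat.prime_dvd_prime_iff_eq (hP q hq) hp]
  split_ifs with h
  · rw [Finset.filter_eq', if_pos h, Finset.card_singleton]
  · rw [Finset.filter_eq', if_neg h, Finset.card_empty]

lemma norm_prime_sub_sieveTerm_le (ha : a ≠ 0) (hD : b ^ 2 - 4 * a * c ≠ 0) (h : ℤ) {N n : ℕ}
    {z₀ z y : ℝ} (hz : 1 < z) (hzz : z₀ ≤ z) (hzy : z ≤ y) (hz4 : (N : ℝ) < z ^ 4)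
    (hn : 0 < n) (hnN : n ≤ N) :
    ‖(if n.Prime then rho a b c h n else 0) -
      (if numDvd (primesIco N z₀ z) n = 0 then
        sieveTerm a b c h (primesIco N 0 z₀) (primesIn N z y) n else 0)‖ ≤
      (if n ≤ ⌊y⌋₊ then 2 * (rootConst a b c : ℝ) else 0) +
        (if n ∈ badSet N z y then 16 * (rootConst a b c : ℝ) else 0) := by
  have hiff := forall_prime_dvd_iff hzz hn hnN
  have hrho := norm_rho_le ha hD h hn
  have hp₂ : ∀ q ∈ primesIn N z y, q.Prime := fun q hq => (mem_primesIn.1 hq).2.1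
  have hb0 : (0 : ℝ) ≤ if n ∈ badSet N z y then 16 * (rootConst a b c : ℝ) else 0 := by
    split_ifs <;> positivity
  have hc0 : (0 : ℝ) ≤ if n ≤ ⌊y⌋₊ then 2 * (rootConst a b c : ℝ) else 0 := by
    split_ifs <;> positivity
  have hs : (if numDvd (primesIco N z₀ z) n = 0 then
        sieveTerm a b c h (primesIco N 0 z₀) (primesIn N z y) n else 0) =
      if numDvd (primesIco N z₀ z) n = 0 ∧ ∀ p ∈ primesIco N 0 z₀, ¬ p ∣ n then
        (1 - (numDvd (primesIn N z y) n : ℂ)) * rho a b c h n else 0 := by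
    rw [sieveTerm, ite_and]
  rw [hs]
  by_cases hA : ∀ p, p.Prime → p ∣ n → z ≤ p
  · rw [if_pos (hiff.2 hA)]
    by_cases hp : n.Prime
    · rw [if_pos hp]
      by_cases hny : n ≤ ⌊y⌋₊
      · have hmem : n ∈ primesIn N z y := mem_primesIn.2
          ⟨hnN, hp, hA n hp dvd_rfl, (Nat.le_floor_iff (by linarith)).1 hny⟩
        rw [numDvd_prime_eq hp hp₂, if_pos hmem, if_pos hny, Nat.cast_one, sub_self, zero_mul,
          sub_zero]
        rw [card_divisors_prime hp] at hrho
        push_cast at hrho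
        linarith
      · have hmem : n ∉ primesIn N z y := fun hmem => hny (Nat.le_floor (mem_primesIn.1 hmem).2.2.2)
        rw [numDvd_prime_eq hp hp₂, if_neg hmem, Nat.cast_zero, sub_zero, one_mul, sub_self,
          norm_zero]
        linarith
    · rw [if_neg hp, zero_sub, norm_neg]
      by_cases hg : numDvd (primesIn N z y) n = 1
      · rw [hg, Nat.cast_one, sub_self, zero_mul, norm_zero]
        linarith
      · have hbad : n ∈ badSet N z y := by
          simp only [badSet, mem_filter, mem_Icc]
          exact ⟨⟨hn, hnN⟩, hA, hp, hg⟩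
        rw [if_pos hbad]
        have hg3 := numDvd_le_three (P := primesIn N z y) hz.le
          (fun p hp => ⟨(mem_primesIn.1 hp).2.1, (mem_primesIn.1 hp).2.2.1⟩) hn hnN hz4
        have h8 := card_divisors_le_eight hz.le hn hnN hz4 hA
        have h8' : (n.divisors.card : ℝ) ≤ 8 := by exact_mod_cast h8
        rw [norm_mul]
        have h9 : ‖rho a b c h n‖ ≤ rootConst a b c * 8 :=
          hrho.trans (mul_le_mul_of_nonneg_left h8' (Nat.cast_nonneg _))
        have := mul_le_mul (abs_one_sub_le_two hg3) h9 (norm_nonneg _) zero_le_two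
        linarith
  · rw [if_neg (fun h => hA (hiff.1 h)), sub_zero]
    by_cases hp : n.Prime
    · have hny : n ≤ ⌊y⌋₊ := by
        by_contra! hny
        rw [Nat.floor_lt (by linarith)] at hny
        refine hA fun p hp' hd => ?_
        rw [(Nat.prime_dvd_prime_iff_eq hp' hp).1 hd]
        linarith
      rw [card_divisors_prime hp] at hrho
      rw [if_pos hp, if_pos hny]
      push_cast at hrho
      linarith
    · rw [if_neg hp, norm_zero]
      linarith

lemma norm_sum_primes_le (ha : a ≠ 0) (hD : b ^ 2 - 4 * a * c ≠ 0) (h : ℤ) {N : ℕ}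
    {z₀ z y : ℝ} (hz : 1 < z) (hzz : z₀ ≤ z) (hzy : z ≤ y) (hz4 : (N : ℝ) < z ^ 4) :
    ‖∑ p ∈ (range (N + 1)).filter Nat.Prime, rho a b c h p‖ ≤
      ‖∑ n ∈ (Icc 1 N).filter (fun n => numDvd (primesIco N z₀ z) n = 0),
        sieveTerm a b c h (primesIco N 0 z₀) (primesIn N z y) n‖ +
      (2 * rootConst a b c * y + 16 * rootConst a b c * (badSet N z y).card) := by
  have e1 : ∑ p ∈ (range (N + 1)).filter Nat.Prime, rho a b c h p =
      ∑ n ∈ Icc 1 N, if n.Prime then rho a b c h n else 0 := by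
    rw [← Finset.sum_filter]
    refine Finset.sum_congr ?_ fun _ _ => rfl
    ext p
    simp only [mem_filter, mem_range, mem_Icc, Nat.lt_succ_iff]
    exact ⟨fun h => ⟨⟨h.2.one_lt.le, h.1⟩, h.2⟩, fun h => ⟨h.1.2, h.2⟩⟩
  rw [e1, Finset.sum_filter]
  rw [← sub_le_iff_le_add']
  refine (norm_sub_norm_le _ _).trans ?_
  rw [← Finset.sum_sub_distrib]
  refine (norm_sum_le_of_le _ fun n hn =>
    norm_prime_sub_sieveTerm_le ha hD h hz hzz hzy hz4 (mem_Icc.1 hn).1 (mem_Icc.1 hn).2).trans ?_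
  rw [Finset.sum_add_distrib, ← Finset.sum_filter, ← Finset.sum_filter, Finset.sum_const,
    Finset.sum_const, nsmul_eq_mul, nsmul_eq_mul]
  have h1 : ((Icc 1 N).filter (fun n => n ≤ ⌊y⌋₊)).card ≤ ⌊y⌋₊ := by
    refine (Finset.card_le_card (t := Icc 1 ⌊y⌋₊) fun n hn => ?_).trans (by simp)
    rw [mem_filter, mem_Icc] at hn
    exact mem_Icc.2 ⟨hn.1.1, hn.2⟩
  have h2 : (((Icc 1 N).filter (fun n => n ≤ ⌊y⌋₊)).card : ℝ) ≤ y :=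
    (Nat.cast_le.2 h1).trans (Nat.floor_le (by linarith))
  have h3 : (((Icc 1 N).filter (fun n => n ∈ badSet N z y)).card : ℝ) ≤ (badSet N z y).card := by
    exact_mod_cast Finset.card_le_card fun n hn => (mem_filter.1 hn).2
  have h4 : (0 : ℝ) ≤ rootConst a b c := Nat.cast_nonneg _
  nlinarith

end Combine

end QuadRoots

namespace QuadRoots

section Parameters
open Finset

variable {a b c : ℤ}

lemma sieve_error_le {N u ε C R S : ℝ} {k : ℕ} (hN : N = Real.exp (u ^ 3)) (hε : 0 < ε)
    (hε1 : ε ≤ 1 / 100) (hu : 80 ≤ ε * u) (hk : ε * u ^ 2 / 8 ≤ k + 1) (hC : 0 ≤ C) (hR : 0 ≤ R)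
    (hS : 0 ≤ S) :
    N * (2 + u ^ 3) * (C * N ^ (-(ε / 8 / 2)) * (Real.exp 1 * Real.exp u) +
        2 * R * (1 + u ^ 3) * ((1 / 2 : ℝ) ^ k * (Real.exp 1 * Real.exp u) ^ 4)) +
      2 * S * 2 * (N * (1 + u ^ 3) ^ 2) * √(N ^ (-(ε / 8 / 2)) + 1 / Real.exp u) +
      8 * R * (N * (1 + u ^ 3) ^ 2) * (1 / Real.exp u) ≤
    N * (2 + u ^ 3) ^ 2 * Real.exp (-(u / 2)) *
      (Real.exp 1 * C + 4 * Real.exp 4 * R + 8 * S + 8 * R) := by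
  have hN0 : 0 < N := hN ▸ Real.exp_pos _
  have hu0 : 8000 ≤ u := by nlinarith
  have hu3 : 0 < u ^ 3 := by positivity
  have hu2 : 0 < u ^ 2 := by positivity
  have p1 : N ^ (-(ε / 8 / 2)) ≤ Real.exp (-(5 * u)) := by
    rw [hN, ← Real.exp_mul, Real.exp_le_exp]
    have : 80 * u ^ 2 ≤ (ε * u) * u ^ 2 := by gcongr
    nlinarith
  have p2 : (1 / 2 : ℝ) ^ k ≤ 2 * Real.exp (-(5 * u)) := by
    have e1 : (1 / 2 : ℝ) ^ k = 2 * Real.exp (-((k + 1) * Real.log 2)) := by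
      rw [Real.exp_neg]
      have : ((k : ℝ) + 1) * Real.log 2 = ((k + 1 : ℕ) : ℝ) * Real.log 2 := by push_cast; ring
      rw [this, Real.exp_nat_mul, Real.exp_log two_pos, pow_succ, one_div, inv_pow]
      field_simp
    rw [e1]
    refine mul_le_mul_of_nonneg_left (Real.exp_le_exp.2 (neg_le_neg ?_)) zero_le_two
    have hl2 := Real.log_two_gt_d9
    have h2 : 10 * u ≤ k + 1 := by nlinarith
    nlinarith
  have hk0 : 0 ≤ (1 / 2 : ℝ) ^ k := by positivity
  have hM0 : 0 ≤ N ^ (-(ε / 8 / 2)) := by positivity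
  set E := Real.exp (-(u / 2)) with hE
  have hE0 : 0 < E := Real.exp_pos _
  have p3 : N ^ (-(ε / 8 / 2)) * (Real.exp 1 * Real.exp u) ≤ Real.exp 1 * E := by
    calc N ^ (-(ε / 8 / 2)) * (Real.exp 1 * Real.exp u)
        ≤ Real.exp (-(5 * u)) * (Real.exp 1 * Real.exp u) := by gcongr
      _ = Real.exp 1 * Real.exp (-(4 * u)) := by
        rw [← Real.exp_add, ← Real.exp_add, ← Real.exp_add]; congr 1; ring
      _ ≤ Real.exp 1 * E := by rw [hE]; gcongr; linarith
  have p4 : (1 / 2 : ℝ) ^ k * (Real.exp 1 * Real.exp u) ^ 4 ≤ 2 * Real.exp 4 * E := by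
    calc (1 / 2 : ℝ) ^ k * (Real.exp 1 * Real.exp u) ^ 4
        ≤ 2 * Real.exp (-(5 * u)) * (Real.exp 1 * Real.exp u) ^ 4 := by gcongr
      _ = 2 * Real.exp 4 * Real.exp (-u) := by
        rw [mul_assoc, mul_assoc, ← Real.exp_add, ← Real.exp_nat_mul, ← Real.exp_add,
          ← Real.exp_add]
        congr 2; push_cast; ring
      _ ≤ 2 * Real.exp 4 * E := by rw [hE]; gcongr; linarith
  have p5 : 1 / Real.exp u ≤ E := by
    rw [one_div, ← Real.exp_neg, hE, Real.exp_le_exp]; linarith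
  have p6 : √(N ^ (-(ε / 8 / 2)) + 1 / Real.exp u) ≤ 2 * E := by
    refine Real.sqrt_le_iff.2 ⟨by positivity, ?_⟩
    have e1 : (2 * E) ^ 2 = 4 * Real.exp (-u) := by
      rw [mul_pow, hE, ← Real.exp_nat_mul]; congr 1
      · norm_num
      · congr 1; push_cast; ring
    have e2 : Real.exp (-(5 * u)) ≤ Real.exp (-u) := Real.exp_le_exp.2 (by linarith)
    rw [e1, one_div, ← Real.exp_neg]
    have := Real.exp_pos (-u)
    linarith
  have hw : 0 < 2 + u ^ 3 := by positivity
  have q1 : N * (2 + u ^ 3) * (C * N ^ (-(ε / 8 / 2)) * (Real.exp 1 * Real.exp u) +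
        2 * R * (1 + u ^ 3) * ((1 / 2 : ℝ) ^ k * (Real.exp 1 * Real.exp u) ^ 4)) ≤
      N * (2 + u ^ 3) * (C * (Real.exp 1 * E) * (2 + u ^ 3) +
        2 * R * (2 + u ^ 3) * (2 * Real.exp 4 * E)) := by
    gcongr ?_ * (?_ + ?_)
    · rw [mul_assoc]
      calc _ ≤ C * (Real.exp 1 * E) * 1 := by rw [mul_one]; gcongr
        _ ≤ _ := by gcongr; linarith
    · gcongr
      norm_num
  have q2 : 2 * S * 2 * (N * (1 + u ^ 3) ^ 2) * √(N ^ (-(ε / 8 / 2)) + 1 / Real.exp u) ≤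
      2 * S * 2 * (N * (2 + u ^ 3) ^ 2) * (2 * E) := by
    gcongr
    norm_num
  have q3 : 8 * R * (N * (1 + u ^ 3) ^ 2) * (1 / Real.exp u) ≤
      8 * R * (N * (2 + u ^ 3) ^ 2) * E := by
    gcongr
    norm_num
  refine (add_le_add (add_le_add q1 q2) q3).trans (le_of_eq ?_)
  ring

lemma sieve_level_le {N u ε : ℝ} {k : ℕ} (hN : N = Real.exp (u ^ 3)) (hε : 0 < ε)
    (hu0 : 0 ≤ u) (hk : (k : ℝ) ≤ ε * u ^ 2 / 8) :
    N ^ (1 / 2 - ε) * Real.exp u ^ k * N ^ (4 * (ε / 8)) ≤ √N := by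
  rw [Real.sqrt_eq_rpow, hN, ← Real.exp_mul, ← Real.exp_mul, ← Real.exp_mul, ← Real.exp_nat_mul,
    ← Real.exp_add, ← Real.exp_add, Real.exp_le_exp]
  have h1 : k * u ≤ ε * u ^ 2 / 8 * u := by gcongr
  have h2 : 0 ≤ ε * u ^ 3 := by positivity
  nlinarith

lemma bilinear_level_le {N ε : ℝ} (hN : 1 < N) (hε : 0 < ε) (hε1 : ε ≤ 1 / 100)
    (hεL : 4 ≤ ε * Real.log N) :
    4 * N ^ (1 / 3 - ε) * √(N ^ (1 / 3 - ε)) * (2 * N ^ (1 / 3 - ε) * N) ^ (4 * (ε / 8)) ≤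
      √(N / 2) := by
  have hN0 : 0 < N := by linarith
  set z := N ^ (1 / 3 - ε) with hz
  have hz0 : 0 < z := Real.rpow_pos_of_pos hN0 _
  have hlz : Real.log z = (1 / 3 - ε) * Real.log N := Real.log_rpow hN0 _
  clear_value z
  rw [← Real.log_le_log_iff (by positivity) (by positivity), Real.log_mul (by positivity)
    (by positivity), Real.log_mul (by positivity) (by positivity), Real.log_mul (by positivity)
    (by positivity), Real.log_sqrt hz0.le, Real.log_rpow (by positivity), Real.log_mul
    (by positivity) (by positivity), Real.log_mul (by positivity) (by positivity),
    Real.log_sqrt (by positivity), Real.log_div (by positivity) (by positivity), hlz]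
  have h4 : Real.log 4 = 2 * Real.log 2 := by
    rw [show (4 : ℝ) = 2 ^ 2 by norm_num, Real.log_pow]; push_cast; ring
  have hl2 := Real.log_two_lt_d9
  have hl2' := Real.log_two_gt_d9
  rw [h4]
  nlinarith [mul_pos hε hε]

end Parameters

end QuadRoots

namespace QuadRoots

section Equidistribution
open Finset Filter Topology

variable {a b c : ℤ}

set_option maxHeartbeats 800000 in
lemma norm_sum_primes_le_of_hasLevel {ε C X₀ u : ℝ} (hε : 0 < ε) (hε1 : ε ≤ 1 / 100)
    (hC : 0 ≤ C) (ha : a ≠ 0) (hD : b ^ 2 - 4 * a * c ≠ 0) {h : ℤ} (hh : h ≠ 0)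
    (hK : HasLevel a b c (ε / 8) C X₀ h.natAbs) {N : ℕ} (hN : (N : ℝ) = Real.exp (u ^ 3))
    (hu : 80 ≤ ε * u) (hX : X₀ ≤ N) (hhN : |(h : ℝ)| ≤ √N) :
    ‖∑ p ∈ (range (N + 1)).filter Nat.Prime, rho a b c h p‖ ≤
      N / u ^ 3 * ((Real.exp 1 * C + 4 * Real.exp 4 * rootConst a b c +
        8 * √(rootConst a b c * (C + 32 * rootConst a b c + 8 * (rootConst a b c : ℝ) ^ 2)) +
        8 * rootConst a b c + 18 * rootConst a b c) *
          (u ^ 3 * (2 + u ^ 3) ^ 2 * Real.exp (-(u / 2))) +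
        208000 * rootConst a b c * ε) := by
  set R : ℝ := (rootConst a b c : ℝ) with hR
  set S := √(R * (C + 32 * R + 8 * R ^ 2)) with hS
  have hR0 : 0 ≤ R := Nat.cast_nonneg _
  have hS0 : 0 ≤ S := Real.sqrt_nonneg _
  have hu0 : 8000 ≤ u := by nlinarith
  have hu2 : 0 < u ^ 2 := by positivity
  have hu3 : 0 < u ^ 3 := by positivity
  have hεu : 80 * u ^ 2 ≤ ε * u * u ^ 2 := by gcongr
  have hεu3 : u / 2 ≤ 2 * ε * u ^ 3 := by nlinarith
  have hlog : Real.log N = u ^ 3 := by rw [hN, Real.log_exp]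
  have hN1 : (1 : ℝ) < N := by rw [hN]; exact Real.one_lt_exp_iff.2 hu3
  have hN1' : 1 < N := by exact_mod_cast hN1
  have hN0 : (0 : ℝ) < N := by linarith
  have hN16 : (16 : ℝ) ≤ N := by
    have := Real.add_one_le_exp (u ^ 3)
    rw [hN]
    nlinarith
  have h4s : 4 ≤ √(N : ℝ) := Real.le_sqrt_of_sq_le (by linarith)
  have hpow : ∀ s : ℝ, (N : ℝ) ^ s = Real.exp (u ^ 3 * s) := fun s => by rw [hN, Real.exp_mul]
  set z := (N : ℝ) ^ (1 / 3 - ε) with hz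
  set y := (N : ℝ) ^ (1 / 2 - ε) with hy
  have hz1 : 1 < z := Real.one_lt_rpow hN1 (by linarith)
  have hy1 : 1 < y := Real.one_lt_rpow hN1 (by linarith)
  have hzs : √(N : ℝ) * z ≤ N := by
    rw [Real.sqrt_eq_rpow, hz, ← Real.rpow_add hN0]
    conv_rhs => rw [← Real.rpow_one (N : ℝ)]
    exact Real.rpow_le_rpow_of_exponent_le hN1.le (by linarith)
  have hzy : z ≤ y := Real.rpow_le_rpow_of_exponent_le hN1.le (by linarith)
  have hyN : y ≤ N := by
    conv_rhs => rw [← Real.rpow_one (N : ℝ)]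
    exact Real.rpow_le_rpow_of_exponent_le hN1.le (by linarith)
  have hz4 : (N : ℝ) < z ^ 4 := by
    rw [hz, ← Real.rpow_natCast, ← Real.rpow_mul hN0.le]
    conv_lhs => rw [← Real.rpow_one (N : ℝ)]
    exact Real.rpow_lt_rpow_of_exponent_lt hN1 (by push_cast; linarith)
  have hz₀z : Real.exp u ≤ z := by
    rw [hz, hpow, Real.exp_le_exp]
    have : 8000 * u ≤ u * u := by gcongr
    nlinarith
  have hz₀ : 4 ≤ Real.exp u := by
    have := Real.add_one_le_exp u
    linarith
  set k := ⌊ε * u ^ 2 / 8⌋₊ with hk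
  have hk1 : (k : ℝ) ≤ ε * u ^ 2 / 8 := Nat.floor_le (by positivity)
  have hk2 : ε * u ^ 2 / 8 ≤ k + 1 := (Nat.lt_floor_add_one _).le
  have hM := norm_sum_sieveTerm_numDvd_le (by positivity) hC ha hD hh hK hz₀ hz₀z hy1.le hyN hX
    (le_trans (by gcongr) hzs) (le_trans (by gcongr) hzs) hz4
    (P₀ := primesIco N 0 (Real.exp u)) (P₁ := primesIco N (Real.exp u) z)
    (P₂ := primesIn N z y)
    (fun p hp => ⟨(mem_primesIco.1 hp).2.1, (mem_primesIco.1 hp).2.2.2⟩)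
    (fun p hp => (mem_primesIco.1 hp).2) (fun p hp => (mem_primesIn.1 hp).2)
    (sieve_level_le hN hε (by linarith) hk1)
    (bilinear_level_le hN1 hε hε1 (by rw [hlog]; nlinarith))
  rw [hlog, ← hR, ← hS] at hM
  have hM' := hM.trans (sieve_error_le hN hε hε1 hu hk2 hC hR0 hS0)
  have hB := card_badSet_rpow_le hN1' hε hε1 (by rw [hlog]; nlinarith)
  rw [hlog] at hB
  have hT := norm_sum_primes_le ha hD h hz1 hz₀z hzy hz4
  rw [← hR] at hT
  set E := Real.exp (-(u / 2)) with hE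
  have hE0 : 0 < E := Real.exp_pos _
  have hsmall : (N : ℝ) ^ (1 - 2 * ε) ≤ N * (2 + u ^ 3) ^ 2 * E := by
    have h1 : (N : ℝ) ^ (1 - 2 * ε) ≤ N * E := by
      rw [hpow, hN, hE, ← Real.exp_add, Real.exp_le_exp]
      linarith
    have h2 : (1 : ℝ) ≤ (2 + u ^ 3) ^ 2 := by nlinarith
    calc _ ≤ N * E := h1
      _ ≤ N * E * (2 + u ^ 3) ^ 2 := le_mul_of_one_le_right (by positivity) h2
      _ = _ := by ring
  have hysmall : y ≤ N * (2 + u ^ 3) ^ 2 * E :=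
    (Real.rpow_le_rpow_of_exponent_le hN1.le (by linarith)).trans hsmall
  set W := (N : ℝ) * (2 + u ^ 3) ^ 2 * E with hW
  have t1 : 2 * R * y ≤ 2 * R * W := by gcongr
  have t2 : 16 * R * (badSet N z y).card ≤ 16 * R * (W + 13000 * ε * (N / u ^ 3)) := by
    gcongr
    exact hB.trans (by gcongr)
  refine (hT.trans (add_le_add hM' (add_le_add t1 t2))).trans (le_of_eq ?_)
  rw [hW]
  field_simp
  ring

lemma tendsto_param :
    Tendsto (fun u : ℝ => u ^ 3 * (2 + u ^ 3) ^ 2 * Real.exp (-(u / 2))) atTop (𝓝 0) := by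
  have h1 := (Real.tendsto_pow_mul_exp_neg_atTop_nhds_zero 9).comp
    (tendsto_id.atTop_div_const (r := (2 : ℝ)) two_pos)
  have h2 := h1.const_mul (9 * 2 ^ 9)
  rw [mul_zero] at h2
  refine squeeze_zero' ?_ ?_ h2
  · filter_upwards [eventually_ge_atTop 0] with u hu
    positivity
  · filter_upwards [eventually_ge_atTop 1] with u hu
    have h3 : (1 : ℝ) ≤ u ^ 3 := one_le_pow₀ hu
    have h4 : (2 + u ^ 3) ^ 2 ≤ (3 * u ^ 3) ^ 2 := by gcongr; linarith
    calc u ^ 3 * (2 + u ^ 3) ^ 2 * Real.exp (-(u / 2))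
        ≤ u ^ 3 * (3 * u ^ 3) ^ 2 * Real.exp (-(u / 2)) := by gcongr
      _ = _ := by
        simp only [Function.comp, id]
        ring

lemma exists_norm_sum_primes_le {a : ℕ} {b c : ℤ} (ha : 0 < a) (hD : b ^ 2 - 4 * a * c < 0)
    {h : ℤ} (hh : h ≠ 0) {η : ℝ} (hη : 0 < η) :
    ∀ᶠ N : ℕ in atTop, ‖∑ p ∈ (range (N + 1)).filter Nat.Prime, rho a b c h p‖ ≤
      η * (N / Real.log N) := by
  set R : ℝ := (rootConst a b c : ℝ) with hR
  have hR0 : 0 ≤ R := Nat.cast_nonneg _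
  obtain ⟨ε, hε, hε1, hεη⟩ : ∃ ε : ℝ, 0 < ε ∧ ε ≤ 1 / 100 ∧ 208000 * R * ε ≤ η / 2 := by
    refine ⟨min (1 / 100) (η / 2 / (208000 * R + 1)), by positivity, min_le_left _ _, ?_⟩
    have h1 := min_le_right (1 / 100) (η / 2 / (208000 * R + 1))
    calc _ ≤ 208000 * R * (η / 2 / (208000 * R + 1)) := by gcongr
      _ = η / 2 * (208000 * R / (208000 * R + 1)) := by ring
      _ ≤ η / 2 * 1 := by
        gcongr
        rw [div_le_one (by positivity)]
        linarith
      _ = _ := mul_one _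
  obtain ⟨C, X₀, hC, hK⟩ := exists_norm_sum_rho_le (c := c) ha hD (δ := ε / 8) (by positivity)
    h.natAbs
  have hK' : HasLevel a b c (ε / 8) C X₀ h.natAbs := hK
  have hcast : Tendsto (fun N : ℕ => (N : ℝ)) atTop atTop := tendsto_natCast_atTop_atTop
  have hu : Tendsto (fun N : ℕ => (Real.log N) ^ (1 / 3 : ℝ)) atTop atTop :=
    (tendsto_rpow_atTop (by norm_num)).comp (Real.tendsto_log_atTop.comp hcast)
  set K := Real.exp 1 * C + 4 * Real.exp 4 * R + 8 * √(R * (C + 32 * R + 8 * R ^ 2)) +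
    8 * R + 18 * R with hKdef
  have hlim : Tendsto (fun u : ℝ => K * (u ^ 3 * (2 + u ^ 3) ^ 2 * Real.exp (-(u / 2)))) atTop
      (𝓝 0) := by simpa using tendsto_param.const_mul K
  filter_upwards [hu.eventually (hlim.eventually_le_const (half_pos hη)),
    hu.eventually_ge_atTop (80 / ε), hcast.eventually_ge_atTop X₀,
    hcast.eventually_ge_atTop (|(h : ℝ)| ^ 2), eventually_gt_atTop 1] with N h1 h2 h3 h4 h5
  have hN1 : (1 : ℝ) < N := by exact_mod_cast h5
  have hL : 0 < Real.log N := Real.log_pos hN1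
  set u := (Real.log N) ^ (1 / 3 : ℝ) with hudef
  have hu3 : u ^ 3 = Real.log N := by
    rw [hudef, ← Real.rpow_natCast, ← Real.rpow_mul hL.le]
    norm_num
  have hN : (N : ℝ) = Real.exp (u ^ 3) := by rw [hu3, Real.exp_log (by linarith)]
  have := norm_sum_primes_le_of_hasLevel hε hε1 hC (by exact_mod_cast ha.ne') hD.ne hh hK' hN
    (by rwa [div_le_iff₀' hε] at h2) h3 (Real.le_sqrt_of_sq_le h4)
  refine this.trans ?_
  rw [mul_comm η, hu3]
  rw [hu3] at h1
  gcongr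
  linarith

lemma div_log_le_primeCounting :
    ∀ᶠ N : ℕ in atTop, (N : ℝ) / Real.log N ≤ 2 * Nat.primeCounting N := by
  have h1 : Tendsto (fun N : ℕ => (N : ℝ) + 2) atTop atTop :=
    tendsto_atTop_add_const_right _ _ tendsto_natCast_atTop_atTop
  have h2 := h1.eventually (Real.isLittleO_log_id_atTop.bound (c := 1 / 10) (by norm_num))
  filter_upwards [h2, eventually_ge_atTop 10] with N h3 h4
  have h5 : (10 : ℝ) ≤ N := by exact_mod_cast h4
  have hL : 0 < Real.log N := Real.log_pos (by linarith)
  have h6 := Chebyshev.pi_ge' (x := N) (by linarith)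
  rw [Nat.floor_natCast] at h6
  have h7 : Real.log ((N : ℝ) + 2) ≤ 1 / 10 * (N + 2) := by
    have h8 := (le_abs_self _).trans h3
    simp only [id, Real.norm_eq_abs] at h8
    rwa [abs_of_nonneg (by linarith : (0 : ℝ) ≤ N + 2)] at h8
  have hl2 := Real.log_two_gt_d9
  have h9 : (N : ℝ) / 2 / Real.log N ≤
      (((N : ℝ) - 1) * Real.log 2 - Real.log ((N : ℝ) + 2)) / Real.log N := by
    gcongr
    nlinarith
  have h10 := h9.trans h6
  rw [div_right_comm] at h10
  linarith

lemma rho_eq_sum_exp (h : ℤ) (p : ℕ) :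
    rho a b c h p = ∑ ν ∈ (Finset.range p).filter
      (fun ν : ℕ => (p : ℤ) ∣ a * (ν : ℤ) ^ 2 + b * (ν : ℤ) + c),
        Complex.exp (2 * Real.pi * Complex.I * (((h * ν : ℤ) : ℂ) / (p : ℂ))) := by
  refine Finset.sum_congr rfl fun ν _ => ?_
  rw [ft]
  push_cast
  rfl

lemma rho_neg (h : ℤ) (p : ℕ) : rho (-a) (-b) (-c) h p = rho a b c h p := by
  refine Finset.sum_congr (Finset.filter_congr fun ν _ => ?_) fun _ _ => rfl
  rw [← dvd_neg]
  ring_nf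

lemma eventually_norm_sum_primes_le (ha : a ≠ 0) (hD : b ^ 2 - 4 * a * c < 0) {h : ℤ}
    (hh : h ≠ 0) {η : ℝ} (hη : 0 < η) :
    ∀ᶠ N : ℕ in atTop, ‖∑ p ∈ (range (N + 1)).filter Nat.Prime, rho a b c h p‖ ≤
      η * Nat.primeCounting N := by
  have key : ∀ᶠ N : ℕ in atTop, ‖∑ p ∈ (range (N + 1)).filter Nat.Prime, rho a b c h p‖ ≤
      η / 2 * (N / Real.log N) := by
    rcases ha.lt_or_gt with hneg | hpos
    · obtain ⟨m, hm⟩ := Int.eq_ofNat_of_zero_le (by omega : 0 ≤ -a)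
      have := exists_norm_sum_primes_le (a := m) (b := -b) (c := -c) (by omega)
        (by rw [← hm]; linarith [neg_sq b]) hh (half_pos hη)
      simpa only [← hm, rho_neg] using this
    · obtain ⟨m, rfl⟩ := Int.eq_ofNat_of_zero_le hpos.le
      exact exists_norm_sum_primes_le (by exact_mod_cast hpos) hD hh (half_pos hη)
  filter_upwards [key, div_log_le_primeCounting] with N h1 h2
  nlinarith

end Equidistribution

end QuadRoots

open scoped Real

/-- The Duke–Friedlander–Iwaniec theorem on equidistribution of roots of quadratic
congruences to prime moduli: for a quadratic polynomial `f(X) = aX² + bX + c` with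
integer coefficients, `a ≠ 0`, negative discriminant, and a nonzero integer `h`,
`∑_{p ≤ x} ∑_{ν mod p, p ∣ f(ν)} e(hν/p) = o(π(x))` as `x → ∞`. -/
theorem equidistribution_of_roots_of_quadratic_congruences
    (a b c : ℤ) (ha : a ≠ 0) (hdisc : b ^ 2 - 4 * a * c < 0) (h : ℤ) (hh : h ≠ 0) :
    ∀ ε : ℝ, 0 < ε → ∃ x₀ : ℝ, ∀ x : ℝ, x₀ ≤ x →
      ‖∑ p ∈ (Finset.range (⌊x⌋₊ + 1)).filter Nat.Prime,
          ∑ ν ∈ (Finset.range p).filter (fun ν : ℕ => (p : ℤ) ∣ a * (ν : ℤ) ^ 2 + b * (ν : ℤ) + c),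
            Complex.exp (2 * π * Complex.I * (((h * ν : ℤ) : ℂ) / (p : ℂ)))‖
        ≤ ε * (Nat.primeCounting ⌊x⌋₊ : ℝ) := by
  intro ε hε
  obtain ⟨x₀, hx₀⟩ := Filter.eventually_atTop.1 ((tendsto_nat_floor_atTop (α := ℝ)).eventually
    (QuadRoots.eventually_norm_sum_primes_le ha hdisc hh hε))
  refine ⟨x₀, fun x hx => ?_⟩
  simpa only [QuadRoots.rho_eq_sum_exp] using hx₀ x hx
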